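/- For every completely multiplicative function f : 𝓜 → S^1, and for every choice of lexicographic ordering ⟨·⟩ on 𝔽_q[t] with ⟨0⟩ = 0, the lexicographic discrepancy ℒ_f is infinite; in particular sup_{N ≥ 1} |Σ_{G ∈ 𝓜, ⟨G⟩ ≤ N} f(G)| = ∞. -/

import Mathlib

open Polynomial Complex Filter
open scoped ENNReal ComplexConjugate

noncomputable section

namespace FFEDP

variable {F : Type} [Field F] [Fintype F] [DecidableEq F]

/-- `f : 𝓜 → ℂ` is completely multiplicative (on monic polynomials). -/
def CompMultOnMonic (f : F[X] → ℂ) : Prop :=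
  f 1 = 1 ∧ ∀ G H : F[X], G.Monic → H.Monic → f (G * H) = f G * f H

/-- `f` takes values in `S¹` on monic polynomials. -/
def UnimodularOnMonic (f : F[X] → ℂ) : Prop :=
  ∀ G : F[X], G.Monic → ‖f G‖ = 1

/-- A Dirichlet character modulo `Q`. -/
structure IsDirichletCharacter (Q : F[X]) (χ : F[X] → ℂ) : Prop where
  map_mul : ∀ A B : F[X], χ (A * B) = χ A * χ B
  exists_ne_zero : ∃ M : F[X], χ M ≠ 0
  periodic : ∀ M : F[X], χ (M + Q) = χ M
  eq_zero_of_not_coprime : ∀ M : F[X], ¬ IsCoprime M Q → χ M = 0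

/-- A primitive Dirichlet character modulo `Q`: not induced by a character of
smaller modulus. -/
def IsPrimitiveDirichletCharacter (Q : F[X]) (χ : F[X] → ℂ) : Prop :=
  IsDirichletCharacter Q χ ∧
    ¬ ∃ (Q' : F[X]) (χ' : F[X] → ℂ), Q' ∣ Q ∧ Q'.natDegree < Q.natDegree ∧
        IsDirichletCharacter Q' χ' ∧ ∀ M : F[X], IsCoprime M Q → χ M = χ' M

def IsPrincipalDirichletCharacter (Q : F[X]) (χ : F[X] → ℂ) : Prop :=
  IsDirichletCharacter Q χ ∧ ∀ M : F[X], IsCoprime M Q → χ M = 1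

/-- the `i`-th highest-degree coefficient of `A` (zero if `i` exceeds the degree). -/
def topCoeff (A : F[X]) (i : ℕ) : F :=
  if i ≤ A.natDegree then A.coeff (A.natDegree - i) else 0

/-- A short interval character whose value depends only on the `ν + 1`
highest-degree coefficients (so its length is at most `ν`). -/
def IsShortIntervalCharacterOfLength (ν : ℕ) (ξ : F[X] → ℂ) : Prop :=
  (∀ A B : F[X], A.Monic → B.Monic → ξ (A * B) = ξ A * ξ B) ∧
    (∃ A : F[X], A.Monic ∧ ξ A ≠ 0) ∧
    ∀ A B : F[X], A.Monic → B.Monic →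
      (∀ i : ℕ, i ≤ ν → topCoeff A i = topCoeff B i) → ξ A = ξ B

def IsShortIntervalCharacter (ξ : F[X] → ℂ) : Prop :=
  ∃ ν : ℕ, IsShortIntervalCharacterOfLength ν ξ

/-- the Archimedean character `e_θ(G) = e(θ · deg G)`. -/
def eTheta (θ : ℝ) (G : F[X]) : ℂ :=
  Complex.exp (2 * (Real.pi : ℂ) * Complex.I * (θ : ℂ) * (G.natDegree : ℂ))

/-- `∑_{G ∈ 𝓜, deg G ≤ N} f(G)`. -/
def longSum (f : F[X] → ℂ) (N : ℕ) : ℂ :=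
  ∑ᶠ G ∈ {G : F[X] | G.Monic ∧ G.natDegree ≤ N}, f G

/-- `∑_{G ∈ 𝓜, deg G < H} f(G)`. -/
def longSumLt (f : F[X] → ℂ) (H : ℕ) : ℂ :=
  ∑ᶠ G ∈ {G : F[X] | G.Monic ∧ G.natDegree < H}, f G

/-- `∑_{G ∈ I_H(G₀)} f(G)` where `I_H(G₀) = {G ∈ 𝓜 : deg (G - G₀) < H}`. -/
def shortIntervalSum (f : F[X] → ℂ) (H : ℕ) (G₀ : F[X]) : ℂ :=
  ∑ᶠ G ∈ {G : F[X] | G.Monic ∧ (G - G₀).degree < (H : WithBot ℕ)}, f G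

/-- the short sum discrepancy
`𝒮_f = limsup_{H → ∞} limsup_{N → ∞} max_{G₀ ∈ 𝓜_N} |∑_{G ∈ I_H(G₀)} f(G)|`,
as an extended nonnegative real. -/
def shortSumDisc (f : F[X] → ℂ) : ℝ≥0∞ :=
  Filter.limsup (fun H : ℕ =>
    Filter.limsup (fun N : ℕ =>
      ⨆ G₀ ∈ {G₀ : F[X] | G₀.Monic ∧ G₀.natDegree = N},
        (‖shortIntervalSum f H G₀‖₊ : ℝ≥0∞)) Filter.atTop) Filter.atTop

/-- the pretentious distance `𝔻(f, g; N)`. -/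
def pretDist (f g : F[X] → ℂ) (N : ℕ) : ℝ :=
  Real.sqrt (∑ᶠ P ∈ {P : F[X] | P.Monic ∧ Irreducible P ∧ P.natDegree ≤ N},
    ((Fintype.card F : ℝ) ^ P.natDegree)⁻¹ * (1 - (f P * conj (g P)).re))

/-- `ω(Q)`: the number of distinct monic irreducible divisors of `Q`. -/
def omegaPoly (Q : F[X]) : ℕ :=
  Set.ncard {P : F[X] | P.Monic ∧ Irreducible P ∧ P ∣ Q}

/-- `f` is a modified character associated with the character `χ` of modulus `Q`:
it is completely multiplicative, takes values in `S¹` on monics, and agrees with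
`χ` at every monic irreducible not dividing `Q`. -/
def IsModifiedCharacter (Q : F[X]) (χ f : F[X] → ℂ) : Prop :=
  CompMultOnMonic f ∧ UnimodularOnMonic f ∧ IsDirichletCharacter Q χ ∧
    ∀ P : F[X], P.Monic → Irreducible P → ¬ P ∣ Q → f P = χ P

/-- the lexicographic ordering `⟨·⟩` associated with `ι : 𝔽_q → {0,…,q-1}`:
`⟨Σ bᵢ tⁱ⟩ = Σ ι(bᵢ) qⁱ`. -/
def lexNum (ι : F → ℕ) (G : F[X]) : ℕ :=
  ∑ i ∈ Finset.range (G.natDegree + 1), ι (G.coeff i) * (Fintype.card F) ^ i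

set_option linter.unusedSectionVars false

/-- A generalized limit: a linear functional on all real sequences that respects eventual upper
bounds of bounded sequences. -/
lemma exists_generalized_limit : ∃ Λ : (ℕ → ℝ) →ₗ[ℝ] ℝ, ∀ (x : ℕ → ℝ) (b : ℝ),
    (∃ C, ∀ n, |x n| ≤ C) → (∀ᶠ n in atTop, x n ≤ b) → Λ x ≤ b := by
  have hlim : ∀ x : ℕ → ℝ, (∃ C, ∀ n, |x n| ≤ C) →
      ∃ a, Tendsto x (hyperfilter ℕ : Filter ℕ) (nhds a) := by
    rintro x ⟨C, hC⟩
    have h := (isCompact_Icc (a := -C) (b := C)).ultrafilter_le_nhds'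
      ((hyperfilter ℕ).map x) (by
        rw [Ultrafilter.mem_map]
        exact Filter.univ_mem' fun n => abs_le.mp (hC n))
    obtain ⟨a, _, ha⟩ := h
    exact ⟨a, ha⟩
  let B : Submodule ℝ (ℕ → ℝ) :=
    { carrier := {x | ∃ C, ∀ n, |x n| ≤ C}
      add_mem' := by
        rintro x y ⟨C, hC⟩ ⟨D, hD⟩
        exact ⟨C + D, fun n => (abs_add_le _ _).trans (add_le_add (hC n) (hD n))⟩
      zero_mem' := ⟨0, by simp⟩
      smul_mem' := by
        rintro c x ⟨C, hC⟩
        refine ⟨|c| * C, fun n => ?_⟩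
        simp only [Pi.smul_apply, smul_eq_mul, abs_mul]
        exact mul_le_mul_of_nonneg_left (hC n) (abs_nonneg c) }
  choose l hl using hlim
  let l0 : B →ₗ[ℝ] ℝ :=
    { toFun := fun x => l x.1 x.2
      map_add' := fun x y => tendsto_nhds_unique (hl _ (x + y).2)
        ((hl _ x.2).add (hl _ y.2))
      map_smul' := fun c x => tendsto_nhds_unique (hl _ (c • x).2)
        ((hl _ x.2).const_mul c) }
  obtain ⟨Λ, hΛ⟩ := l0.exists_extend
  refine ⟨Λ, fun x b hx hb => ?_⟩
  have : Λ x = l x hx := by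
    exact congrArg (fun g => g ⟨x, hx⟩) hΛ
  rw [this]
  exact le_of_tendsto (hl x hx) (Nat.hyperfilter_le_atTop hb)

/-- A fixed generalized limit. -/
def genLim : (ℕ → ℝ) →ₗ[ℝ] ℝ := exists_generalized_limit.choose

lemma genLim_le {x : ℕ → ℝ} {b : ℝ} (hx : ∃ C, ∀ n, |x n| ≤ C)
    (hb : ∀ᶠ n in atTop, x n ≤ b) : genLim x ≤ b :=
  exists_generalized_limit.choose_spec x b hx hb

lemma le_genLim {x : ℕ → ℝ} {b : ℝ} (hx : ∃ C, ∀ n, |x n| ≤ C)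
    (hb : ∀ᶠ n in atTop, b ≤ x n) : b ≤ genLim x := by
  have : genLim (-x) ≤ -b := genLim_le (by simpa using hx) (hb.mono fun n h => by simpa using h)
  simpa using this

lemma genLim_eq_of_tendsto {x : ℕ → ℝ} {a : ℝ} (hx : ∃ C, ∀ n, |x n| ≤ C)
    (h : Tendsto x atTop (nhds a)) : genLim x = a := by
  refine le_antisymm (le_of_forall_pos_le_add fun ε hε => genLim_le hx ?_)
    (le_of_forall_sub_le fun ε hε => le_genLim hx ?_)
  · exact (h.eventually (gt_mem_nhds (lt_add_of_pos_right a hε))).mono fun n hn => le_of_lt hn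
  · exact (h.eventually (lt_mem_nhds (sub_lt_self a hε))).mono fun n hn => le_of_lt hn

/-- The number of elements of the finite field, as a real number. -/
abbrev qr (F : Type) [Fintype F] : ℝ := (Fintype.card F : ℝ)

lemma one_lt_qr : 1 < qr F := by
  have := Fintype.one_lt_card (α := F)
  exact_mod_cast this

lemma two_le_qr : 2 ≤ qr F := by
  have := Fintype.one_lt_card (α := F)
  exact_mod_cast this

lemma qr_pos : 0 < qr F := lt_trans one_pos one_lt_qr

lemma finite_degreeLT (n : ℕ) : {G : F[X] | G ∈ degreeLT F n}.Finite :=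
  Set.finite_coe_iff.1 (Finite.of_equiv _ (degreeLTEquiv F n).toEquiv.symm)

/-- The set of polynomials of degree `< n`. -/
def V (F : Type) [Field F] [Fintype F] [DecidableEq F] (n : ℕ) : Finset F[X] :=
  (finite_degreeLT n).toFinset

lemma mem_V {n : ℕ} {G : F[X]} : G ∈ V F n ↔ G.degree < n := by
  simp [V, mem_degreeLT]

lemma zero_mem_V (n : ℕ) : (0 : F[X]) ∈ V F n := by simp [mem_V]

lemma card_V (n : ℕ) : (V F n).card = Fintype.card F ^ n := by
  classical
  have h : Nat.card (degreeLT F n) = Nat.card (Fin n → F) :=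
    Nat.card_congr (degreeLTEquiv F n).toEquiv
  rw [V, ← Set.ncard_eq_toFinset_card _ (finite_degreeLT n), ← Nat.card_coe_set_eq]
  simpa using h

lemma card_V_real (n : ℕ) : ((V F n).card : ℝ) = qr F ^ n := by
  rw [card_V]; push_cast; rfl

lemma V_mono {m n : ℕ} (h : m ≤ n) : V F m ⊆ V F n := fun G hG => by
  rw [mem_V] at *
  exact hG.trans_le (by exact_mod_cast h)

lemma add_mem_V {n : ℕ} {G H : F[X]} (hG : G ∈ V F n) (hH : H ∈ V F n) : G + H ∈ V F n := by
  rw [mem_V] at *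
  exact (degree_add_le _ _).trans_lt (max_lt hG hH)

lemma neg_mem_V {n : ℕ} {G : F[X]} (hG : G ∈ V F n) : -G ∈ V F n := by
  rw [mem_V] at *; rwa [degree_neg]

lemma sub_mem_V {n : ℕ} {G H : F[X]} (hG : G ∈ V F n) (hH : H ∈ V F n) : G - H ∈ V F n := by
  rw [sub_eq_add_neg]; exact add_mem_V hG (neg_mem_V hH)

lemma mul_mem_V {m n : ℕ} {S M : F[X]} (hS : S.Monic) (hS' : S.natDegree = m) (hM : M ∈ V F n) :
    S * M ∈ V F (m + n) := by
  rw [mem_V] at *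
  rcases eq_or_ne M 0 with rfl | h0
  · simp
  · rw [degree_eq_natDegree h0] at hM
    rw [degree_eq_natDegree (mul_ne_zero hS.ne_zero h0), natDegree_mul hS.ne_zero h0, hS']
    norm_cast at *
    omega

lemma exists_mem_V (G : F[X]) : ∃ n, G ∈ V F n :=
  ⟨G.natDegree + 1, mem_V.2 (degree_le_natDegree.trans_lt (by exact_mod_cast Nat.lt_succ_self _))⟩

lemma mem_V_iff_coeff {n : ℕ} {G : F[X]} : G ∈ V F n ↔ ∀ i, n ≤ i → G.coeff i = 0 := by
  rw [mem_V, degree_lt_iff_coeff_zero]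

lemma sum_V_add {A : Type*} [AddCommMonoid A] {n : ℕ} {L : F[X]} (hL : L ∈ V F n)
    (g : F[X] → A) : ∑ M ∈ V F n, g (M + L) = ∑ M ∈ V F n, g M :=
  Finset.sum_nbij' (· + L) (· - L) (fun _ h => add_mem_V h hL) (fun _ h => sub_mem_V h hL)
    (by simp) (by simp) (by simp)

lemma modByMonic_mem_V {k : ℕ} {S : F[X]} (hS : S.Monic) (hk : S.natDegree = k) (G : F[X]) :
    G %ₘ S ∈ V F k := by
  rw [mem_V, ← hk, ← degree_eq_natDegree hS.ne_zero]
  exact degree_modByMonic_lt G hS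

lemma divByMonic_mem_V {k m : ℕ} {S G : F[X]} (hS : S.Monic) (hk : S.natDegree = k)
    (hG : G ∈ V F (k + m)) : G /ₘ S ∈ V F m := by
  rw [mem_V] at *
  rcases eq_or_ne (G /ₘ S) 0 with h0 | h0
  · simp [h0]
  have hG0 : G ≠ 0 := fun h => h0 (by rw [h, zero_divByMonic])
  have hle : S.natDegree ≤ G.natDegree := by
    by_contra hlt
    exact h0 ((divByMonic_eq_zero_iff hS).2 (degree_lt_degree (not_le.1 hlt)))
  rw [degree_eq_natDegree hG0] at hG
  rw [degree_eq_natDegree h0, natDegree_divByMonic G hS, hk]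
  norm_cast at *
  omega

/-- Division by a monic polynomial parametrizes `V (k + m)`. -/
lemma sum_V_division {A : Type*} [AddCommMonoid A] {k m : ℕ} {S : F[X]} (hS : S.Monic)
    (hk : S.natDegree = k) (g : F[X] → A) :
    ∑ G ∈ V F (k + m), g G = ∑ M ∈ V F k, ∑ N ∈ V F m, g (M + S * N) := by
  rw [← Finset.sum_product']
  refine (Finset.sum_nbij' (fun p : F[X] × F[X] => p.1 + S * p.2)
    (fun G => (G %ₘ S, G /ₘ S)) ?_ ?_ ?_ ?_ ?_).symm
  · rintro ⟨M, N⟩ h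
    rw [Finset.mem_product] at h
    exact add_mem_V (V_mono (Nat.le_add_right _ _) h.1) (mul_mem_V hS hk h.2)
  · intro G hG
    exact Finset.mem_product.2 ⟨modByMonic_mem_V hS hk G, divByMonic_mem_V hS hk hG⟩
  · rintro ⟨M, N⟩ h
    rw [Finset.mem_product] at h
    have hM : M.degree < S.degree := by
      rw [degree_eq_natDegree hS.ne_zero, hk]; exact mem_V.1 h.1
    have := div_modByMonic_unique (f := M + S * N) N M hS ⟨rfl, hM⟩
    exact Prod.ext this.2 this.1
  · intro G _
    exact modByMonic_add_div G S
  · intro _ _; rfl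

/-- The Cesàro generalized limit. -/
def cesLim : (ℕ → ℝ) →ₗ[ℝ] ℝ :=
  genLim ∘ₗ (
    { toFun := fun a N => (N : ℝ)⁻¹ * ∑ n ∈ Finset.range N, a n
      map_add' := fun a b => by
        funext N; simp [Finset.sum_add_distrib, mul_add]
      map_smul' := fun c a => by
        funext N; simp [← Finset.mul_sum]; ring } : (ℕ → ℝ) →ₗ[ℝ] (ℕ → ℝ))

lemma cesLim_apply (a : ℕ → ℝ) :
    cesLim a = genLim fun N => (N : ℝ)⁻¹ * ∑ n ∈ Finset.range N, a n := rfl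

lemma abs_cesaro_le {a : ℕ → ℝ} {C : ℝ} (hC : ∀ n, |a n| ≤ C) (N : ℕ) :
    |(N : ℝ)⁻¹ * ∑ n ∈ Finset.range N, a n| ≤ C := by
  have h0 : 0 ≤ C := (abs_nonneg _).trans (hC 0)
  rw [abs_mul, abs_of_nonneg (by positivity : (0 : ℝ) ≤ (N : ℝ)⁻¹)]
  have h1 : |∑ n ∈ Finset.range N, a n| ≤ N * C :=
    (Finset.abs_sum_le_sum_abs _ _).trans
      ((Finset.sum_le_sum fun n _ => hC n).trans (by simp))
  rcases Nat.eq_zero_or_pos N with rfl | hN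
  · simpa using h0
  · calc (N : ℝ)⁻¹ * |∑ n ∈ Finset.range N, a n| ≤ (N : ℝ)⁻¹ * (N * C) := by gcongr
      _ = C := by field_simp

lemma cesLim_eq_of_tendsto {a : ℕ → ℝ} {b : ℝ} (ha : ∃ C, ∀ n, |a n| ≤ C)
    (h : Tendsto a atTop (nhds b)) : cesLim a = b := by
  obtain ⟨C, hC⟩ := ha
  exact genLim_eq_of_tendsto ⟨C, abs_cesaro_le hC⟩ h.cesaro

lemma cesLim_nonneg {a : ℕ → ℝ} (ha : ∃ C, ∀ n, |a n| ≤ C) (h : ∀ n, 0 ≤ a n) :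
    0 ≤ cesLim a := by
  obtain ⟨C, hC⟩ := ha
  refine le_genLim ⟨C, abs_cesaro_le hC⟩ (Eventually.of_forall fun N => ?_)
  exact mul_nonneg (by positivity) (Finset.sum_nonneg fun n _ => h n)

lemma cesLim_congr {a b : ℕ → ℝ} (ha : ∃ C, ∀ n, |a n| ≤ C) (hb : ∃ C, ∀ n, |b n| ≤ C)
    (h : ∀ᶠ n in atTop, a n = b n) : cesLim a = cesLim b := by
  obtain ⟨C, hC⟩ := ha
  obtain ⟨D, hD⟩ := hb
  rw [← sub_eq_zero, ← map_sub]
  refine cesLim_eq_of_tendsto ⟨C + D, fun n => ?_⟩ ?_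
  · exact (abs_sub _ _).trans (add_le_add (hC n) (hD n))
  · exact tendsto_const_nhds.congr' (h.mono fun n hn => by simp [hn])

lemma cesLim_mono {a b : ℕ → ℝ} (ha : ∃ C, ∀ n, |a n| ≤ C) (hb : ∃ C, ∀ n, |b n| ≤ C)
    (h : ∀ᶠ n in atTop, a n ≤ b n) : cesLim a ≤ cesLim b := by
  obtain ⟨C, hC⟩ := ha
  obtain ⟨D, hD⟩ := hb
  have hba : ∀ n, |b n - a n| ≤ D + C := fun n =>
    (abs_sub _ _).trans (add_le_add (hD n) (hC n))
  have h1 : cesLim (b - a) = cesLim fun n => |b n - a n| :=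
    cesLim_congr ⟨D + C, hba⟩ ⟨D + C, fun n => by simpa using hba n⟩
      (h.mono fun n hn => (abs_of_nonneg (sub_nonneg.2 hn)).symm)
  have h2 : 0 ≤ cesLim (b - a) := by
    rw [h1]; exact cesLim_nonneg ⟨D + C, fun n => by simpa using hba n⟩ fun n => abs_nonneg _
  rw [map_sub] at h2
  linarith

lemma cesLim_shift {a : ℕ → ℝ} (ha : ∃ C, ∀ n, |a n| ≤ C) (k : ℕ) :
    cesLim (fun n => a (n + k)) = cesLim a := by
  obtain ⟨C, hC⟩ := ha
  induction k with
  | zero => rfl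
  | succ k ih =>
    rw [← ih, ← sub_eq_zero, ← map_sub, cesLim_apply]
    have h0 : 0 ≤ C := (abs_nonneg _).trans (hC 0)
    refine genLim_eq_of_tendsto ⟨2 * C, abs_cesaro_le fun n => ?_⟩ ?_
    · exact (abs_sub _ _).trans (by linarith [hC (n + (k + 1)), hC (n + k)])
    · have : ∀ N : ℕ, (N : ℝ)⁻¹ * ∑ n ∈ Finset.range N,
          ((fun n => a (n + (k + 1))) - fun n => a (n + k)) n = (N : ℝ)⁻¹ * (a (N + k) - a k) := by
        intro N
        have := Finset.sum_range_sub (fun n => a (n + k)) N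
        simp only [Pi.sub_apply]
        simp only [Nat.add_right_comm _ 1 k, add_assoc, zero_add] at this ⊢
        rw [this]
      simp only [this]
      refine squeeze_zero_norm (a := fun N : ℕ => (N : ℝ)⁻¹ * (2 * C)) (fun N => ?_) ?_
      · rw [norm_mul, Real.norm_of_nonneg (by positivity : (0 : ℝ) ≤ (N : ℝ)⁻¹)]
        gcongr
        exact (abs_sub _ _).trans (by linarith [hC (N + k), hC k])
      · simpa using (tendsto_inv_atTop_nhds_zero_nat (𝕜 := ℝ)).mul_const (2 * C)

/-- Monic polynomials of degree `n`. -/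
def Mon (F : Type) [Field F] [Fintype F] [DecidableEq F] (n : ℕ) : Finset F[X] :=
  (V F n).image fun L => X ^ n + L

lemma mem_Mon {n : ℕ} {G : F[X]} : G ∈ Mon F n ↔ G.Monic ∧ G.natDegree = n := by
  simp only [Mon, Finset.mem_image, mem_V]
  constructor
  · rintro ⟨L, hL, rfl⟩
    exact ⟨monic_X_pow_add hL, by
      rw [natDegree_add_eq_left_of_degree_lt (by rwa [degree_X_pow]), natDegree_X_pow]⟩
  · rintro ⟨hG, rfl⟩
    refine ⟨G - X ^ G.natDegree, ?_, by ring⟩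
    have := degree_sub_lt_left (p := G) (q := X ^ G.natDegree)
      (by rw [degree_X_pow, degree_eq_natDegree hG.ne_zero]) hG.ne_zero
      (by rw [hG.leadingCoeff, leadingCoeff_X_pow])
    rwa [degree_eq_natDegree hG.ne_zero] at this

lemma sum_Mon {A : Type*} [AddCommMonoid A] (n : ℕ) (h : F[X] → A) :
    ∑ G ∈ Mon F n, h G = ∑ L ∈ V F n, h (X ^ n + L) :=
  Finset.sum_image fun _ _ _ _ h => add_left_cancel h

lemma card_Mon (n : ℕ) : (Mon F n).card = Fintype.card F ^ n := by
  rw [Mon, Finset.card_image_of_injective _ (add_right_injective _), card_V]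

lemma monic_add_of_mem_V {n : ℕ} {G L : F[X]} (hG : G.Monic) (hn : n ≤ G.natDegree)
    (hL : L ∈ V F n) : (G + L).Monic ∧ (G + L).natDegree = G.natDegree := by
  have hd : L.degree < G.degree := by
    rw [degree_eq_natDegree hG.ne_zero]
    exact (mem_V.1 hL).trans_le (by exact_mod_cast hn)
  exact ⟨hG.add_of_left hd, natDegree_add_eq_left_of_degree_lt hd⟩

lemma sum_Mon_add {A : Type*} [AddCommMonoid A] {n : ℕ} {L : F[X]} (hL : L ∈ V F n)
    (h : F[X] → A) : ∑ G ∈ Mon F n, h (G + L) = ∑ G ∈ Mon F n, h G := by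
  rw [sum_Mon, sum_Mon, ← sum_V_add hL fun M => h (X ^ n + M)]
  simp [add_assoc]

lemma sum_Mon_dvd {A : Type*} [AddCommMonoid A] {n : ℕ} {D : F[X]} (hD : D.Monic)
    (h : F[X] → A) [DecidablePred fun G => D ∣ G] :
    ∑ G ∈ (Mon F (n + D.natDegree)).filter (fun G => D ∣ G), h G = ∑ G ∈ Mon F n, h (D * G) := by
  refine (Finset.sum_bij (fun G _ => D * G) ?_ ?_ ?_ ?_).symm
  · intro G hG
    rw [mem_Mon] at hG
    rw [Finset.mem_filter, mem_Mon]
    exact ⟨⟨hD.mul hG.1, by rw [hD.natDegree_mul hG.1, hG.2, add_comm]⟩, dvd_mul_right _ _⟩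
  · intro G _ H _ h
    exact mul_left_cancel₀ hD.ne_zero h
  · intro G hG
    rw [Finset.mem_filter, mem_Mon] at hG
    obtain ⟨⟨hG, hn⟩, H, rfl⟩ := hG
    have hH : H.Monic := hD.of_mul_monic_left hG
    rw [hD.natDegree_mul hH] at hn
    exact ⟨H, mem_Mon.2 ⟨hH, by omega⟩, rfl⟩
  · intro _ _; rfl

/-- The filter of monic polynomials of large degree. -/
def big (F : Type) [Field F] : Filter F[X] := comap natDegree atTop ⊓ 𝓟 {G | G.Monic}

lemma eventually_big {p : F[X] → Prop} :
    (∀ᶠ G in big F, p G) ↔ ∃ n, ∀ G : F[X], G.Monic → n ≤ G.natDegree → p G := by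
  simp only [big, eventually_inf_principal, eventually_comap, eventually_atTop]
  constructor
  · rintro ⟨n, h⟩
    exact ⟨n, fun G hG hn => h _ hn G rfl hG⟩
  · rintro ⟨n, h⟩
    exact ⟨n, fun b hb G hG hm => h G hm (hG ▸ hb)⟩

lemma eventually_big_degree (n : ℕ) : ∀ᶠ G in big F, G.Monic ∧ n ≤ G.natDegree :=
  eventually_big.2 ⟨n, fun _ hm hd => ⟨hm, hd⟩⟩

/-- The average over monic polynomials of degree `n`. -/
def monAvg (n : ℕ) (h : F[X] → ℝ) : ℝ := (qr F ^ n)⁻¹ * ∑ G ∈ Mon F n, h G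

lemma monAvg_le {n : ℕ} {h g : F[X] → ℝ} (hg : ∀ G ∈ Mon F n, h G ≤ g G) :
    monAvg n h ≤ monAvg n g := by
  have := qr_pos (F := F)
  exact mul_le_mul_of_nonneg_left (Finset.sum_le_sum hg) (by positivity)

lemma monAvg_const (n : ℕ) (c : ℝ) : monAvg (F := F) n (fun _ => c) = c := by
  have := qr_pos (F := F)
  simp only [monAvg, Finset.sum_const, card_Mon, nsmul_eq_mul]
  push_cast
  field_simp

lemma abs_monAvg_le {n : ℕ} {h : F[X] → ℝ} {C : ℝ} (hC : ∀ G, |h G| ≤ C) : |monAvg n h| ≤ C := by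
  rw [abs_le]
  constructor
  · rw [← monAvg_const (F := F) n (-C)]
    exact monAvg_le fun G _ => (abs_le.1 (hC G)).1
  · rw [← monAvg_const (F := F) n C]
    exact monAvg_le fun G _ => (abs_le.1 (hC G)).2

/-- Bounded real functions on polynomials. -/
def Bdd (h : F[X] → ℝ) : Prop := ∃ C, ∀ G, |h G| ≤ C

lemma Bdd.monAvg {h : F[X] → ℝ} (hh : Bdd h) : ∃ C, ∀ n, |monAvg n h| ≤ C :=
  hh.imp fun _ hC _ => abs_monAvg_le hC

/-- The mean of a function over monic polynomials. -/
def mean : (F[X] → ℝ) →ₗ[ℝ] ℝ :=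
  cesLim ∘ₗ (
    { toFun := fun h n => monAvg n h
      map_add' := fun a b => by
        funext N; simp [monAvg, Finset.sum_add_distrib, mul_add]
      map_smul' := fun c a => by
        funext N; simp [monAvg, ← Finset.mul_sum]; ring } : (F[X] → ℝ) →ₗ[ℝ] (ℕ → ℝ))

lemma mean_apply (h : F[X] → ℝ) : mean h = cesLim fun n => monAvg n h := rfl

lemma mean_mono {g h : F[X] → ℝ} (hg : Bdd g) (hh : Bdd h) (H : ∀ᶠ G in big F, g G ≤ h G) :
    mean g ≤ mean h := by
  obtain ⟨n, hn⟩ := eventually_big.1 H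
  refine cesLim_mono hg.monAvg hh.monAvg (eventually_atTop.2 ⟨n, fun k hk => monAvg_le ?_⟩)
  intro G hG
  rw [mem_Mon] at hG
  exact hn G hG.1 (hG.2 ▸ hk)

lemma mean_congr {g h : F[X] → ℝ} (hg : Bdd g) (hh : Bdd h) (H : ∀ᶠ G in big F, g G = h G) :
    mean g = mean h :=
  le_antisymm (mean_mono hg hh (H.mono fun _ h => h.le)) (mean_mono hh hg (H.mono fun _ h => h.ge))

lemma mean_const (c : ℝ) : mean (F := F) (fun _ => c) = c := by
  rw [mean_apply]
  refine cesLim_eq_of_tendsto ⟨|c|, fun n => ?_⟩ ?_ <;> simp only [monAvg_const]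
  · exact le_rfl
  · exact tendsto_const_nhds

lemma mean_translate {h : F[X] → ℝ} (hh : Bdd h) (L : F[X]) :
    mean (fun G => h (G + L)) = mean h := by
  obtain ⟨n, hn⟩ := exists_mem_V L
  have hh' : Bdd fun G => h (G + L) := hh.imp fun C hC G => hC _
  refine cesLim_congr hh'.monAvg hh.monAvg (eventually_atTop.2 ⟨n, fun k hk => ?_⟩)
  simp only [LinearMap.coe_mk, AddHom.coe_mk, monAvg]
  rw [sum_Mon_add (V_mono hk hn)]

open Classical in
lemma mean_dilate {h : F[X] → ℝ} (hh : Bdd h) {D : F[X]} (hD : D.Monic) :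
    mean (fun G => if D ∣ G then h G else 0) =
      (qr F ^ D.natDegree)⁻¹ * mean (fun G => h (D * G)) := by
  have hh1 : Bdd fun G => h (D * G) := hh.imp fun C hC G => hC _
  have hh2 : Bdd fun G => if D ∣ G then h G else 0 := by
    obtain ⟨C, hC⟩ := hh
    refine ⟨C, fun G => ?_⟩
    dsimp only
    split_ifs
    · exact hC G
    · simpa using (abs_nonneg _).trans (hC 0)
  rw [mean_apply, mean_apply, ← cesLim_shift hh2.monAvg D.natDegree, ← smul_eq_mul, ← map_smul]
  congr 1
  funext n
  simp only [monAvg, Pi.smul_apply, smul_eq_mul]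
  rw [← Finset.sum_filter, sum_Mon_dvd hD, pow_add]
  have := qr_pos (F := F)
  field_simp

section Sieve

variable {α β : Type*} [DecidableEq α]

/-- If divisibility events are independent on `Z` with total mass `c`, so are affine functions of
their indicators. -/
lemma sum_prod_affine (Z : Finset β) (ind : α → β → ℝ) (w : α → ℝ) (c : ℝ) (s : Finset α)
    (h : ∀ t ⊆ s, ∑ M ∈ Z, ∏ p ∈ t, ind p M = c * ∏ p ∈ t, (w p)⁻¹) (a b : α → ℝ) :
    ∑ M ∈ Z, ∏ p ∈ s, (a p + b p * ind p M) = c * ∏ p ∈ s, (a p + b p * (w p)⁻¹) := by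
  simp only [add_comm (a _), Finset.prod_add, Finset.prod_mul_distrib]
  rw [Finset.sum_comm, Finset.mul_sum]
  refine Finset.sum_congr rfl fun t ht => ?_
  have := h t (Finset.mem_powerset.1 ht)
  rw [← Finset.sum_mul, ← Finset.mul_sum, this]
  ring

/-- The large sieve type upper bound: if divisibility by the elements of `s₁ ∪ s₂` is independent
for `s₁, s₂ ∈ 𝒮`, then few elements of `Z` are divisible by no element. -/
lemma card_sifted_mul_le (Z : Finset β) (ind : α → β → ℝ) (w : α → ℝ) (c : ℝ) (hc : 0 ≤ c)
    (𝒮 : Finset (Finset α)) (hind : ∀ p M, ind p M * ind p M = ind p M)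
    (hw : ∀ s ∈ 𝒮, ∀ p ∈ s, 1 < w p)
    (h : ∀ s₁ ∈ 𝒮, ∀ s₂ ∈ 𝒮, ∀ t ⊆ s₁ ∪ s₂,
      ∑ M ∈ Z, ∏ p ∈ t, ind p M = c * ∏ p ∈ t, (w p)⁻¹)
    (Y : Finset β) (hY : Y ⊆ Z) (hY0 : ∀ M ∈ Y, ∀ s ∈ 𝒮, ∀ p ∈ s, ind p M = 0) :
    (Y.card : ℝ) * ∑ s ∈ 𝒮, ∏ p ∈ s, (w p - 1)⁻¹ ≤ c := by
  set J : ℝ := ∑ s ∈ 𝒮, ∏ p ∈ s, (w p - 1)⁻¹ with hJ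
  set g : α → β → ℝ := fun p M => (w p - 1)⁻¹ + -(w p * (w p - 1)⁻¹) * ind p M with hg
  set R : β → ℝ := fun M => ∑ s ∈ 𝒮, ∏ p ∈ s, g p M with hR
  have hRY : ∀ M ∈ Y, R M = J := by
    intro M hM
    refine Finset.sum_congr rfl fun s hs => Finset.prod_congr rfl fun p hp => ?_
    simp [hg, hY0 M hM s hs p hp]
  have key : ∀ s₁ ∈ 𝒮, ∀ s₂ ∈ 𝒮, ∑ M ∈ Z, (∏ p ∈ s₁, g p M) * ∏ p ∈ s₂, g p M =
      if s₁ = s₂ then c * ∏ p ∈ s₁, (w p - 1)⁻¹ else 0 := by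
    intro s₁ h₁ s₂ h₂
    have hw' : ∀ p ∈ s₁ ∪ s₂, 1 < w p := fun p hp =>
      (Finset.mem_union.1 hp).elim (hw s₁ h₁ p) (hw s₂ h₂ p)
    let a : α → ℝ := fun p => if p ∈ s₁ ∧ p ∈ s₂ then ((w p - 1)⁻¹) ^ 2 else (w p - 1)⁻¹
    let b : α → ℝ := fun p => if p ∈ s₁ ∧ p ∈ s₂ then 1 - ((w p - 1)⁻¹) ^ 2
      else -(w p * (w p - 1)⁻¹)
    have e : ∀ M, (∏ p ∈ s₁, g p M) * ∏ p ∈ s₂, g p M =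
        ∏ p ∈ s₁ ∪ s₂, (a p + b p * ind p M) := by
      intro M
      have e1 : ∏ p ∈ s₁, g p M = ∏ p ∈ s₁ ∪ s₂, if p ∈ s₁ then g p M else 1 := by
        rw [Finset.prod_ite_mem, Finset.union_inter_cancel_left]
      have e2 : ∏ p ∈ s₂, g p M = ∏ p ∈ s₁ ∪ s₂, if p ∈ s₂ then g p M else 1 := by
        rw [Finset.prod_ite_mem, Finset.union_inter_cancel_right]
      rw [e1, e2, ← Finset.prod_mul_distrib]
      refine Finset.prod_congr rfl fun p hp => ?_
      have hp1 : w p - 1 ≠ 0 := by linarith [hw' p hp]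
      have hi := hind p M
      by_cases m1 : p ∈ s₁ <;> by_cases m2 : p ∈ s₂
      · simp only [m1, m2, and_self, if_true, a, b, hg]
        field_simp
        linear_combination (w p) ^ 2 * hi
      · simp [m1, m2, a, b, hg]
      · simp [m1, m2, a, b, hg]
      · simp [m1, m2] at hp
    simp only [e]
    rw [sum_prod_affine Z ind w c _ (h s₁ h₁ s₂ h₂)]
    have v1 : ∀ p ∈ s₁ ∪ s₂, ¬ (p ∈ s₁ ∧ p ∈ s₂) → a p + b p * (w p)⁻¹ = 0 := by
      intro p hp hn
      have : w p ≠ 0 := by linarith [hw' p hp]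
      simp only [a, b, if_neg hn]
      field_simp
      ring
    split_ifs with hs
    · subst hs
      congr 1
      rw [Finset.union_self]
      refine Finset.prod_congr rfl fun p hp => ?_
      have h1 := hw s₁ h₁ p hp
      have h2 : w p ≠ 0 := by linarith
      have h3 : w p - 1 ≠ 0 := by linarith
      simp only [a, b, hp, and_self, if_true]
      field_simp
      ring
    · have : ∃ p ∈ s₁ ∪ s₂, ¬ (p ∈ s₁ ∧ p ∈ s₂) := by
        by_contra hcon
        push Not at hcon
        exact hs (Finset.ext fun p =>
          ⟨fun hp => (hcon p (Finset.mem_union_left _ hp)).2,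
            fun hp => (hcon p (Finset.mem_union_right _ hp)).1⟩)
      obtain ⟨p, hp, hn⟩ := this
      rw [Finset.prod_eq_zero hp (v1 p hp hn), mul_zero]
  have hsq : ∑ M ∈ Z, R M ^ 2 = c * J := by
    have : ∀ M, R M ^ 2 = ∑ s₁ ∈ 𝒮, ∑ s₂ ∈ 𝒮, (∏ p ∈ s₁, g p M) * ∏ p ∈ s₂, g p M := by
      intro M; rw [sq, hR, Finset.sum_mul_sum]
    simp only [this]
    rw [Finset.sum_comm, hJ, Finset.mul_sum]
    refine Finset.sum_congr rfl fun s₁ h₁ => ?_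
    rw [Finset.sum_comm, Finset.sum_congr rfl (key s₁ h₁)]
    simp [h₁]
  have hle : (Y.card : ℝ) * J ^ 2 ≤ c * J := by
    rw [← hsq, ← nsmul_eq_mul, ← Finset.sum_const]
    rw [Finset.sum_congr rfl fun M hM => show J ^ 2 = R M ^ 2 by rw [hRY M hM]]
    exact Finset.sum_le_sum_of_subset_of_nonneg hY fun _ _ _ => sq_nonneg _
  have hJ0 : 0 ≤ J := Finset.sum_nonneg fun s hs => Finset.prod_nonneg fun p hp =>
    inv_nonneg.2 (by linarith [hw s hs p hp])
  rcases hJ0.eq_or_lt with h0 | h0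
  · rw [← h0, mul_zero]; exact hc
  · nlinarith

end Sieve

open Classical in
lemma sum_char_V (χ : AddChar F[X] ℂ) (n : ℕ) :
    ∑ L ∈ V F n, χ L = if ∀ L ∈ V F n, χ L = 1 then (qr F : ℂ) ^ n else 0 := by
  split_ifs with h
  · rw [Finset.sum_congr rfl h]
    simp [card_V]
  · push Not at h
    obtain ⟨L, hL, h1⟩ := h
    have := sum_V_add hL fun M => χ M
    simp only [AddChar.map_add_eq_mul, ← Finset.sum_mul] at this
    have h2 : (∑ L ∈ V F n, χ L) * (χ L - 1) = 0 := by rw [mul_sub, this]; ring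
    exact (mul_eq_zero.1 h2).resolve_right (sub_ne_zero.2 h1)

/-- The norm of a polynomial. -/
def nm (G : F[X]) : ℝ := qr F ^ G.natDegree

lemma nm_pos (G : F[X]) : 0 < nm G := pow_pos qr_pos _

lemma one_le_nm (G : F[X]) : 1 ≤ nm G := one_le_pow₀ one_lt_qr.le

lemma nm_mul {G H : F[X]} (hG : G.Monic) (hH : H.Monic) : nm (G * H) = nm G * nm H := by
  rw [nm, hG.natDegree_mul hH, pow_add, nm, nm]

lemma nm_one : nm (1 : F[X]) = 1 := by simp [nm]

lemma nm_prod {ι : Type*} (s : Finset ι) (g : ι → F[X]) (h : ∀ i ∈ s, (g i).Monic) :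
    nm (∏ i ∈ s, g i) = ∏ i ∈ s, nm (g i) := by
  rw [nm, natDegree_prod_of_monic _ _ h, ← Finset.prod_pow_eq_pow_sum]
  rfl

lemma one_lt_nm {p : F[X]} (hp : Irreducible p) : 1 < nm p :=
  one_lt_pow₀ one_lt_qr hp.natDegree_pos.ne'

open Classical in
/-- Monic irreducible polynomials of degree `d`. -/
def Irr (F : Type) [Field F] [Fintype F] [DecidableEq F] (d : ℕ) : Finset F[X] :=
  (Mon F d).filter Irreducible

lemma mem_Irr {d : ℕ} {P : F[X]} : P ∈ Irr F d ↔ P.Monic ∧ P.natDegree = d ∧ Irreducible P := by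
  simp [Irr, mem_Mon, and_assoc]

lemma sum_Mon_inv_nm (k : ℕ) : ∑ M ∈ Mon F k, (nm M)⁻¹ = 1 := by
  have : ∀ M ∈ Mon F k, (nm M)⁻¹ = (qr F ^ k)⁻¹ := fun M hM => by rw [nm, (mem_Mon.1 hM).2]
  rw [Finset.sum_congr rfl this, Finset.sum_const, card_Mon, nsmul_eq_mul]
  have := qr_pos (F := F)
  push_cast
  field_simp

/-- Monic polynomials of degree at most `z`. -/
def MonLE (F : Type) [Field F] [Fintype F] [DecidableEq F] (z : ℕ) : Finset F[X] :=
  (Finset.range (z + 1)).biUnion (Mon F)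

lemma mem_MonLE {z : ℕ} {G : F[X]} : G ∈ MonLE F z ↔ G.Monic ∧ G.natDegree ≤ z := by
  simp only [MonLE, Finset.mem_biUnion, Finset.mem_range, mem_Mon]
  constructor
  · rintro ⟨a, ha, h, rfl⟩; exact ⟨h, by omega⟩
  · rintro ⟨h, h'⟩; exact ⟨_, by omega, h, rfl⟩

lemma sum_MonLE {A : Type*} [AddCommMonoid A] (z : ℕ) (g : F[X] → A) :
    ∑ M ∈ MonLE F z, g M = ∑ k ∈ Finset.range (z + 1), ∑ M ∈ Mon F k, g M := by
  refine Finset.sum_biUnion ?_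
  intro i _ j _ hij
  rw [Function.onFun, Finset.disjoint_left]
  intro G h1 h2
  exact hij ((mem_Mon.1 h1).2.symm.trans (mem_Mon.1 h2).2)

lemma exists_prod_mul_sq (M : F[X]) (hM : M.Monic) : ∃ (s : Finset F[X]) (B : F[X]),
    (∀ p ∈ s, p.Monic ∧ Irreducible p) ∧ B.Monic ∧ M = (∏ p ∈ s, p) * B ^ 2 := by
  induction hn : M.natDegree using Nat.strong_induction_on generalizing M with
  | _ n ih =>
    by_cases h1 : M = 1
    · exact ⟨∅, 1, by simp, monic_one, by simp [h1]⟩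
    have hu : ¬ IsUnit M := fun h => h1 (hM.eq_one_of_isUnit h)
    obtain ⟨p, hpm, hp, M', rfl⟩ := exists_monic_irreducible_factor M hu
    have hM' : M'.Monic := hpm.of_mul_monic_left hM
    have hd := hp.natDegree_pos
    rw [hpm.natDegree_mul hM'] at hn
    obtain ⟨s, B, hs, hB, rfl⟩ := ih M'.natDegree (by omega) M' hM' rfl
    by_cases hps : p ∈ s
    · refine ⟨s.erase p, p * B, fun x hx => hs x (Finset.mem_of_mem_erase hx), hpm.mul hB, ?_⟩
      rw [← Finset.mul_prod_erase s _ hps]; ring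
    · refine ⟨insert p s, B, ?_, hB, ?_⟩
      · intro x hx
        rcases Finset.mem_insert.1 hx with rfl | hx
        · exact ⟨hpm, hp⟩
        · exact hs x hx
      · rw [Finset.prod_insert hps]; ring

open Classical in
/-- Sets of monic irreducible polynomials, distinct from `p`, with product of degree at most
`z`. -/
def sieveSets (p : F[X]) (z : ℕ) : Finset (Finset F[X]) :=
  ((MonLE F z).filter fun r => Irreducible r ∧ r ≠ p).powerset.filter
    fun s => ∑ r ∈ s, r.natDegree ≤ z

lemma mem_sieveSets {p : F[X]} {z : ℕ} {s : Finset F[X]} :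
    s ∈ sieveSets p z ↔ (∀ r ∈ s, r.Monic ∧ Irreducible r ∧ r ≠ p) ∧
      ∑ r ∈ s, r.natDegree ≤ z := by
  simp only [sieveSets, Finset.mem_filter, Finset.mem_powerset, Finset.subset_iff, mem_MonLE]
  constructor
  · rintro ⟨h, h'⟩
    exact ⟨fun r hr => ⟨(h hr).1.1, (h hr).2⟩, h'⟩
  · rintro ⟨h, h'⟩
    exact ⟨fun r hr => ⟨⟨(h r hr).1, (Finset.single_le_sum (fun _ _ => Nat.zero_le _) hr).trans h'⟩,
      (h r hr).2⟩, h'⟩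

lemma sum_sieveSets_ge {p : F[X]} (hp : p.Monic) (z : ℕ) :
    ((z : ℝ) + 1) / 4 ≤ ∑ s ∈ sieveSets p z, ∏ r ∈ s, (nm r - 1)⁻¹ := by
  classical
  set 𝒮 := sieveSets p z
  let φ : Finset F[X] × F[X] × Bool → F[X] := fun x =>
    ((∏ r ∈ x.1, r) * x.2.1 ^ 2) * bif x.2.2 then p else 1
  let D := 𝒮 ×ˢ MonLE F z ×ˢ (Finset.univ : Finset Bool)
  have hsub : MonLE F z ⊆ D.image φ := by
    intro M hM
    rw [mem_MonLE] at hM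
    obtain ⟨s, B, hs, hB, hMe⟩ := exists_prod_mul_sq M hM.1
    have hmon : ∀ t ⊆ s, (∏ r ∈ t, r).Monic := fun t ht =>
      monic_prod_of_monic _ _ fun r hr => (hs r (ht hr)).1
    have hdeg : ∀ t ⊆ s, (∏ r ∈ t, r).natDegree = ∑ r ∈ t, r.natDegree := fun t ht =>
      natDegree_prod_of_monic _ _ fun r hr => (hs r (ht hr)).1
    have hdM : M.natDegree = (∑ r ∈ s, r.natDegree) + 2 * B.natDegree := by
      rw [hMe, (hmon s le_rfl).natDegree_mul (hB.pow 2), hdeg s le_rfl, hB.natDegree_pow]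
    rw [Finset.mem_image]
    by_cases hps : p ∈ s
    · refine ⟨(s.erase p, B, true), ?_, ?_⟩
      · simp only [D, Finset.mem_product, Finset.mem_univ, and_true, 𝒮, mem_sieveSets, mem_MonLE]
        refine ⟨⟨fun r hr => ?_, ?_⟩, hB, by omega⟩
        · have := hs r (Finset.mem_of_mem_erase hr)
          exact ⟨this.1, this.2, Finset.ne_of_mem_erase hr⟩
        · have := Finset.sum_le_sum_of_subset (f := natDegree) (Finset.erase_subset p s)
          omega
      · simp only [φ, cond_true]
        rw [hMe, ← Finset.mul_prod_erase s _ hps]; ring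
    · refine ⟨(s, B, false), ?_, ?_⟩
      · simp only [D, Finset.mem_product, Finset.mem_univ, and_true, 𝒮, mem_sieveSets, mem_MonLE]
        refine ⟨⟨fun r hr => ⟨(hs r hr).1, (hs r hr).2, fun h => hps (h ▸ hr)⟩, by omega⟩, hB,
          by omega⟩
      · simp [φ, hMe]
  have h1 : ((z : ℝ) + 1) = ∑ M ∈ MonLE F z, (nm M)⁻¹ := by
    rw [sum_MonLE]; simp [sum_Mon_inv_nm]
  have h2 : ∑ M ∈ MonLE F z, (nm M)⁻¹ ≤ ∑ x ∈ D, (nm (φ x))⁻¹ :=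
    (Finset.sum_le_sum_of_subset_of_nonneg hsub fun M _ _ => (inv_pos.2 (nm_pos M)).le).trans
      (Finset.sum_image_le_of_nonneg fun x _ => (inv_pos.2 (nm_pos _)).le)
  have h3 : ∑ x ∈ D, (nm (φ x))⁻¹ = (∑ s ∈ 𝒮, ∏ r ∈ s, (nm r)⁻¹) *
      ((∑ B ∈ MonLE F z, (nm B)⁻¹ ^ 2) * ((nm p)⁻¹ + 1)) := by
    have e : ((nm p)⁻¹ + 1) = ∑ b : Bool, (nm (bif b then p else 1))⁻¹ := by
      simp [nm_one]
    rw [e, Finset.sum_mul_sum, ← Finset.sum_product', Finset.sum_mul_sum, ← Finset.sum_product']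
    refine Finset.sum_congr rfl fun x hx => ?_
    simp only [Finset.mem_product, 𝒮, mem_sieveSets, mem_MonLE] at hx
    have hs : (∏ r ∈ x.1, r).Monic := monic_prod_of_monic _ _ fun r hr => (hx.1.1 r hr).1
    have hb : (bif x.2.2 then p else 1 : F[X]).Monic := by
      cases x.2.2 <;> simp [hp]
    simp only [φ]
    rw [nm_mul (hs.mul (hx.2.1.1.pow 2)) hb, nm_mul hs (hx.2.1.1.pow 2),
      nm_prod _ _ fun r hr => (hx.1.1 r hr).1, sq, nm_mul hx.2.1.1 hx.2.1.1]
    simp only [Finset.prod_inv_distrib]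
    have := nm_pos x.2.1
    field_simp
  have h4 : ∑ s ∈ 𝒮, ∏ r ∈ s, (nm r)⁻¹ ≤ ∑ s ∈ 𝒮, ∏ r ∈ s, (nm r - 1)⁻¹ := by
    refine Finset.sum_le_sum fun s hs => Finset.prod_le_prod
      (fun r _ => (inv_pos.2 (nm_pos r)).le) fun r hr => ?_
    have := one_lt_nm ((mem_sieveSets.1 hs).1 r hr).2.1
    exact inv_anti₀ (by linarith) (by linarith)
  have h5 : ∑ B ∈ MonLE F z, (nm B)⁻¹ ^ 2 ≤ 2 := by
    rw [sum_MonLE]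
    have : ∀ k, ∑ M ∈ Mon F k, (nm M)⁻¹ ^ 2 ≤ (1 / 2 : ℝ) ^ k := by
      intro k
      have e : ∀ M ∈ Mon F k, (nm M)⁻¹ ^ 2 = (qr F ^ k)⁻¹ * (nm M)⁻¹ := fun M hM => by
        rw [nm, (mem_Mon.1 hM).2]; ring
      rw [Finset.sum_congr rfl e, ← Finset.mul_sum, sum_Mon_inv_nm, mul_one, one_div, inv_pow]
      exact inv_anti₀ (by positivity) (pow_le_pow_left₀ (by norm_num) two_le_qr k)
    refine (Finset.sum_le_sum fun k _ => this k).trans ?_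
    exact sum_geometric_two_le _
  have h6 : (nm p)⁻¹ ≤ 1 := inv_le_one_of_one_le₀ (one_le_nm p)
  have h7 : 0 ≤ ∑ s ∈ 𝒮, ∏ r ∈ s, (nm r)⁻¹ :=
    Finset.sum_nonneg fun s _ => Finset.prod_nonneg fun r _ => (inv_pos.2 (nm_pos r)).le
  have h8 : (∑ B ∈ MonLE F z, (nm B)⁻¹ ^ 2) * ((nm p)⁻¹ + 1) ≤ 2 * 2 :=
    mul_le_mul h5 (by linarith) (by have := inv_pos.2 (nm_pos p); linarith) (by norm_num)
  have h9 := mul_le_mul_of_nonneg_left h8 h7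
  linarith

lemma mul_mem_V_of_natDegree_le {a s : ℕ} {U M : F[X]} (hU : U.natDegree ≤ a) (hM : M ∈ V F s) :
    U * M ∈ V F (a + s) := by
  rw [mem_V] at *
  rcases eq_or_ne (U * M) 0 with h | h
  · simp [h]
  have hU0 := left_ne_zero_of_mul h
  have hM0 := right_ne_zero_of_mul h
  rw [degree_eq_natDegree hM0] at hM
  rw [degree_eq_natDegree h, natDegree_mul hU0 hM0]
  norm_cast at *
  omega

lemma smul_mem_V {n : ℕ} (a : F) {M : F[X]} (hM : M ∈ V F n) : C a * M ∈ V F n := by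
  have := mul_mem_V_of_natDegree_le (U := C a) (a := 0) (by simp) hM
  rwa [zero_add] at this

/-- The product of all nonzero polynomials of degree `< n`. -/
def prodV (F : Type) [Field F] [Fintype F] [DecidableEq F] (n : ℕ) : F[X] :=
  ∏ M ∈ (V F n).erase 0, M

lemma prodV_ne_zero (n : ℕ) : prodV F n ≠ 0 :=
  Finset.prod_ne_zero_iff.2 fun _ h => Finset.ne_of_mem_erase h

/-- Either an additive character is trivial on multiples of a polynomial of bounded degree, or
there is a prime such that the character is equidistributed along multiples of polynomials coprime
to that prime. -/
lemma rational_or_prime (χ : AddChar F[X] ℂ) (n d z : ℕ) (hd : 4 * z + 2 * n ≤ d) :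
    (∃ Q : F[X], Q.Monic ∧ Q.natDegree ≤ (prodV F n).natDegree ∧
      ∀ M ∈ V F (d - (prodV F n).natDegree), χ (Q * M) = 1) ∨
    ∃ p : F[X], p.Monic ∧ Irreducible p ∧ ∀ E : F[X], E.Monic → E.natDegree ≤ 2 * z → ¬ p ∣ E →
      ∀ L ∈ V F n, L ≠ 0 → ∃ M ∈ V F (d - E.natDegree), χ (E * L * M) ≠ 1 := by
  classical
  rw [or_iff_not_imp_right]
  intro hbad
  push Not at hbad
  set s := 2 * z + n with hs
  have hscale : ∀ (m : ℕ) (B : F[X]), B ≠ 0 → (∀ M ∈ V F m, χ (B * M) = 1) →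
      ∀ M ∈ V F m, χ (B * C B.leadingCoeff⁻¹ * M) = 1 := by
    intro m B _ h M hM
    rw [mul_assoc]
    exact h _ (smul_mem_V _ hM)
  let Pd : ℕ → Prop := fun k => ∃ Q : F[X], Q.Monic ∧ Q.natDegree = k ∧ ∀ M ∈ V F s, χ (Q * M) = 1
  -- a monic multiple attached to a failure of equidistribution
  have hB : ∀ (E L : F[X]), E.Monic → E.natDegree ≤ 2 * z → L ∈ V F n → L ≠ 0 →
      (∀ M ∈ V F (d - E.natDegree), χ (E * L * M) = 1) →
      ∃ B : F[X], B.Monic ∧ B.natDegree < s ∧ E.natDegree ≤ B.natDegree ∧ B ∣ E * L ∧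
        ∀ M ∈ V F (d - E.natDegree), χ (B * M) = 1 := by
    intro E L hE hEz hL hL0 h
    have h0 : E * L ≠ 0 := mul_ne_zero hE.ne_zero hL0
    have hu : IsUnit (C (E * L).leadingCoeff⁻¹) :=
      isUnit_C.2 (isUnit_iff_ne_zero.2 (inv_ne_zero (leadingCoeff_ne_zero.2 h0)))
    refine ⟨E * L * C (E * L).leadingCoeff⁻¹, monic_mul_leadingCoeff_inv h0, ?_, ?_, ?_,
      hscale _ _ h0 h⟩
    · rw [natDegree_mul_leadingCoeff_inv _ h0, natDegree_mul hE.ne_zero hL0]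
      rw [mem_V, degree_eq_natDegree hL0] at hL
      norm_cast at hL
      omega
    · rw [natDegree_mul_leadingCoeff_inv _ h0, natDegree_mul hE.ne_zero hL0]
      omega
    · exact (hu.mul_right_dvd).2 dvd_rfl
  obtain ⟨E₀, hE₀, hE₀z, _, L₀, hL₀, hL₀0, h₀⟩ := hbad X monic_X irreducible_X
  obtain ⟨B₀, hB₀, hB₀s, hEB₀, _, hχ₀⟩ := hB E₀ L₀ hE₀ hE₀z hL₀ hL₀0 h₀
  have hex : ∃ k, Pd k := ⟨_, B₀, hB₀, rfl, fun M hM => hχ₀ M (V_mono (by omega) hM)⟩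
  obtain ⟨Q, hQ, hQk, hQs⟩ := Nat.find_spec hex
  set k := Nat.find hex with hk
  have hmin : ∀ r : F[X], r ≠ 0 → r.natDegree < k → ¬ ∀ M ∈ V F s, χ (r * M) = 1 := by
    intro r hr hrk h
    refine Nat.find_min hex hrk ⟨_, monic_mul_leadingCoeff_inv hr, ?_, hscale _ _ hr h⟩
    exact natDegree_mul_leadingCoeff_inv _ hr
  have hks : k ≤ B₀.natDegree :=
    Nat.find_min' hex ⟨B₀, hB₀, rfl, fun M hM => hχ₀ M (V_mono (by omega) hM)⟩
  have hext : ∀ M ∈ V F (d - k), χ (Q * M) = 1 := by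
    intro M hM
    rw [← modByMonic_add_div M B₀, mul_add, AddChar.map_add_eq_mul]
    have h1 : χ (Q * (M %ₘ B₀)) = 1 :=
      hQs _ (V_mono hB₀s.le (modByMonic_mem_V hB₀ rfl M))
    have h2 : χ (B₀ * (Q * (M /ₘ B₀))) = 1 := by
      have h3 : M /ₘ B₀ ∈ V F (d - E₀.natDegree - k) :=
        divByMonic_mem_V hB₀ rfl (V_mono (by omega) hM)
      refine hχ₀ _ (V_mono ?_ (mul_mem_V hQ hQk h3))
      omega
    rw [h1, one_mul, ← h2]
    ring_nf
  have hdvd : ∀ B : F[X], B.Monic → B.natDegree < s → (∀ M ∈ V F s, χ (B * M) = 1) → Q ∣ B := by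
    intro B hBm hBs h
    by_contra hcon
    have hr0 : B %ₘ Q ≠ 0 := fun h => hcon ((modByMonic_eq_zero_iff_dvd hQ).1 h)
    refine hmin _ hr0 ?_ fun M hM => ?_
    · have := mem_V.1 (modByMonic_mem_V hQ hQk B)
      rw [degree_eq_natDegree hr0] at this
      exact_mod_cast this
    · have e : B %ₘ Q * M = B * M + Q * (-(B /ₘ Q) * M) := by
        linear_combination M * modByMonic_add_div B Q
      have hkB : k ≤ B.natDegree := Nat.find_min' hex ⟨B, hBm, rfl, h⟩
      have hU : (-(B /ₘ Q)).natDegree ≤ B.natDegree - k := by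
        rw [natDegree_neg, natDegree_divByMonic B hQ, hQk]
      rw [e, AddChar.map_add_eq_mul, h M hM, one_mul]
      refine hext _ (V_mono ?_ (mul_mem_V_of_natDegree_le hU hM))
      omega
  have hkK : k ≤ (prodV F n).natDegree := by
    by_contra hcon
    push Not at hcon
    have hQd : ¬ Q ∣ prodV F n := fun h => by
      have := natDegree_le_of_dvd h (prodV_ne_zero n)
      omega
    have hpa : ∃ (p : F[X]) (a : ℕ), Irreducible p ∧ p ^ a ∣ Q ∧ ¬ p ^ a ∣ prodV F n := by
      by_contra hno
      push Not at hno
      refine hQd ((UniqueFactorizationMonoid.dvd_iff_emultiplicity_le hQ.ne_zero).2 fun p hp => ?_)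
      exact emultiplicity_le_emultiplicity_iff.2 fun a h => hno p a hp.irreducible h
    obtain ⟨p, a, hp, hpQ, hpn⟩ := hpa
    have hu : IsUnit (C p.leadingCoeff⁻¹) :=
      isUnit_C.2 (isUnit_iff_ne_zero.2 (inv_ne_zero (leadingCoeff_ne_zero.2 hp.ne_zero)))
    have hass : Associated p (p * C p.leadingCoeff⁻¹) := ⟨hu.unit, rfl⟩
    obtain ⟨E, hE, hEz, hpE, L, hL, hL0, h⟩ := hbad _ (monic_mul_leadingCoeff_inv hp.ne_zero)
      (hass.irreducible hp)
    obtain ⟨B, hBm, hBs, hEB, hBE, hχB⟩ := hB E L hE hEz hL hL0 h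
    have h1 : Q ∣ E * L :=
      (hdvd B hBm hBs fun M hM => hχB M (V_mono (by omega) hM)).trans hBE
    have hpE' : ¬ p ∣ E := fun h => hpE (hass.symm.dvd.trans h)
    have hcop : IsCoprime (p ^ a) E := ((hp.coprime_iff_not_dvd).2 hpE').pow_left
    have h2 : p ^ a ∣ L := hcop.dvd_of_dvd_mul_left (hpQ.trans h1)
    refine hpn (h2.trans (Finset.dvd_prod_of_mem (fun M => M) (Finset.mem_erase.2 ⟨hL0, hL⟩)))
  exact ⟨Q, hQ, hQk ▸ hkK, fun M hM => hext M (V_mono (by omega) hM)⟩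

/-- The additive character `L ↦ χ (M * L)`. -/
def mulChar (χ : AddChar F[X] ℂ) (M : F[X]) : AddChar F[X] ℂ :=
  χ.compAddMonoidHom (AddMonoidHom.mulLeft M)

lemma mulChar_apply (χ : AddChar F[X] ℂ) (M L : F[X]) : mulChar χ M L = χ (M * L) := rfl

open Classical in
lemma card_char_eq (χ ψ : AddChar F[X] ℂ) (n d : ℕ) {E : F[X]} (hE : E.Monic)
    (hEd : E.natDegree ≤ d)
    (h : ∀ L ∈ V F n, L ≠ 0 → ∃ M ∈ V F (d - E.natDegree), χ (E * L * M) ≠ 1) :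
    (((Mon F d).filter fun M => (∀ L ∈ V F n, χ (M * L) = ψ L) ∧ E ∣ M).card : ℝ) =
      qr F ^ d / qr F ^ n * (nm E)⁻¹ := by
  have hq := qr_pos (F := F)
  have key : ((((Mon F d).filter fun M => (∀ L ∈ V F n, χ (M * L) = ψ L) ∧ E ∣ M).card : ℝ) : ℂ) *
      (qr F : ℂ) ^ n = (qr F : ℂ) ^ (d - E.natDegree) := by
    calc _ = ∑ M ∈ (Mon F d).filter (fun M => E ∣ M),
            if ∀ L ∈ V F n, χ (M * L) = ψ L then (qr F : ℂ) ^ n else 0 := by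
          rw [← Finset.sum_filter, Finset.filter_filter, Finset.sum_const, nsmul_eq_mul]
          simp [and_comm]
      _ = ∑ M ∈ (Mon F d).filter (fun M => E ∣ M), ∑ L ∈ V F n, χ (M * L) * ψ⁻¹ L := by
          refine Finset.sum_congr rfl fun M _ => ?_
          have := sum_char_V (mulChar χ M * ψ⁻¹) n
          simp only [AddChar.mul_apply, mulChar_apply] at this
          rw [this]
          congr 1
          refine propext (forall₂_congr fun L _ => ?_)
          rw [AddChar.inv_apply', mul_inv_eq_one₀]
          exact (AddChar.val_isUnit ψ L).ne_zero
      _ = ∑ L ∈ V F n, ∑ M ∈ (Mon F d).filter (fun M => E ∣ M), χ (M * L) * ψ⁻¹ L :=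
          Finset.sum_comm
      _ = ∑ L ∈ V F n, if L = 0 then (qr F : ℂ) ^ (d - E.natDegree) else 0 := by
          refine Finset.sum_congr rfl fun L hL => ?_
          have hd : d = d - E.natDegree + E.natDegree := by omega
          rw [← Finset.sum_mul]
          conv_lhs => rw [hd]
          rw [sum_Mon_dvd hE fun M => χ (M * L), sum_Mon]
          have h1 : ∀ N ∈ V F (d - E.natDegree), χ (E * (X ^ (d - E.natDegree) + N) * L) =
              χ (E * X ^ (d - E.natDegree) * L) * mulChar χ (E * L) N := by
            intro N _
            rw [mulChar_apply, ← AddChar.map_add_eq_mul]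
            ring_nf
          rw [Finset.sum_congr rfl h1, ← Finset.mul_sum, sum_char_V]
          by_cases h3 : L = 0
          · subst h3; simp [mulChar_apply]
          · obtain ⟨M, hM, hM'⟩ := h L hL h3
            rw [if_neg h3, if_neg (fun h2 => hM' (h2 M hM)), mul_zero, zero_mul]
      _ = _ := by
          rw [Finset.sum_ite_eq' (V F n) 0, if_pos (zero_mem_V n)]
  have key' : (((Mon F d).filter fun M => (∀ L ∈ V F n, χ (M * L) = ψ L) ∧ E ∣ M).card : ℝ) *
      qr F ^ n = qr F ^ (d - E.natDegree) := by exact_mod_cast key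
  rw [nm, div_mul_eq_mul_div, eq_div_iff (by positivity), key', pow_sub₀ _ hq.ne' hEd]

open Classical in
/-- Either an additive character is trivial on multiples of a fixed polynomial of bounded degree,
or the primes of degree `d` do not concentrate in any joint level set of the character. -/
theorem card_Irr_char_le (χ ψ : AddChar F[X] ℂ) (n d : ℕ) (hd : 4 * n + 16 ≤ d) :
    (∃ Q : F[X], Q.Monic ∧ Q.natDegree ≤ (prodV F n).natDegree ∧
      ∀ M ∈ V F (d - (prodV F n).natDegree), χ (Q * M) = 1) ∨
    (((Irr F d).filter fun P => ∀ L ∈ V F n, χ (P * L) = ψ L).card : ℝ) * d ≤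
      64 * (qr F ^ d / qr F ^ n) := by
  have hq := qr_pos (F := F)
  set z := d / 16 with hz
  rcases rational_or_prime χ n d z (by omega) with h | ⟨p, hpm, hpi, hp⟩
  · exact Or.inl h
  right
  have hdvd : ∀ s : Finset F[X], (∀ r ∈ s, r.Monic ∧ Irreducible r) → ∀ M : F[X],
      ((∏ r ∈ s, r) ∣ M ↔ ∀ r ∈ s, r ∣ M) := by
    intro s hs M
    refine ⟨fun h r hr => (Finset.dvd_prod_of_mem (fun r => r) hr).trans h, fun h => ?_⟩
    refine Finset.prod_dvd_of_coprime ?_ h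
    intro a ha b hb hab
    have ha' := hs a ha
    have hb' := hs b hb
    refine (ha'.2.coprime_iff_not_dvd).2 fun hd => hab ?_
    exact eq_of_monic_of_associated ha'.1 hb'.1 (ha'.2.associated_of_dvd hb'.2 hd)
  have key := card_sifted_mul_le (α := F[X]) (β := F[X])
    ((Mon F d).filter fun M => ∀ L ∈ V F n, χ (M * L) = ψ L)
    (fun r M => if r ∣ M then 1 else 0) nm (qr F ^ d / qr F ^ n) (by positivity)
    (sieveSets p z) (fun r M => by simp)
    (fun s hs r hr => one_lt_nm ((mem_sieveSets.1 hs).1 r hr).2.1) ?_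
    ((Irr F d).filter fun P => ∀ L ∈ V F n, χ (P * L) = ψ L) ?_ ?_
  · have h1 := sum_sieveSets_ge hpm z
    have h2 : (d : ℝ) / 16 ≤ z + 1 := by
      rw [div_le_iff₀ (by norm_num)]
      have : d ≤ (z + 1) * 16 := by omega
      exact_mod_cast this
    have h3 := mul_le_mul_of_nonneg_left (((div_le_div_of_nonneg_right h2
      (by norm_num : (0 : ℝ) ≤ 4)).trans h1))
      (Nat.cast_nonneg ((Irr F d).filter fun P => ∀ L ∈ V F n, χ (P * L) = ψ L).card : (0 : ℝ) ≤ _)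
    have := h3.trans key
    linarith
  · intro s₁ hs₁ s₂ hs₂ t ht
    rw [mem_sieveSets] at hs₁ hs₂
    have htr : ∀ r ∈ t, r.Monic ∧ Irreducible r ∧ r ≠ p := fun r hr => by
      rcases Finset.mem_union.1 (ht hr) with h | h
      exacts [hs₁.1 r h, hs₂.1 r h]
    have hE : (∏ r ∈ t, r).Monic := monic_prod_of_monic _ _ fun r hr => (htr r hr).1
    have hdeg : (∏ r ∈ t, r).natDegree ≤ 2 * z := by
      rw [natDegree_prod_of_monic _ _ fun r hr => (htr r hr).1]
      calc _ ≤ ∑ r ∈ s₁ ∪ s₂, r.natDegree := Finset.sum_le_sum_of_subset ht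
        _ ≤ ∑ r ∈ s₁, r.natDegree + ∑ r ∈ s₂, r.natDegree := by
            rw [← Finset.sum_union_inter]; exact Nat.le_add_right _ _
        _ ≤ 2 * z := by omega
    have hpE : ¬ p ∣ ∏ r ∈ t, r := by
      intro h
      obtain ⟨r, hr, hpr⟩ := (hpi.prime.dvd_finsetProd_iff _).1 h
      exact (htr r hr).2.2 (eq_of_monic_of_associated (htr r hr).1 hpm
        (hpi.associated_of_dvd (htr r hr).2.1 hpr).symm)
    have h1 := card_char_eq χ ψ n d hE (by omega) (hp _ hE hdeg hpE)
    rw [nm_prod _ _ fun r hr => (htr r hr).1, ← Finset.prod_inv_distrib] at h1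
    rw [← h1, ← Finset.filter_filter, Finset.card_filter]
    push_cast
    refine Finset.sum_congr rfl fun M _ => ?_
    rw [Finset.prod_ite_zero]
    simp [hdvd t fun r hr => ⟨(htr r hr).1, (htr r hr).2.1⟩]
  · exact Finset.filter_subset_filter _ (Finset.filter_subset _ _)
  · intro M hM s hs r hr
    have hM' := mem_Irr.1 (Finset.mem_filter.1 hM).1
    rw [mem_sieveSets] at hs
    have hr' := hs.1 r hr
    refine if_neg fun h => ?_
    have h1 := eq_of_monic_of_associated hr'.1 hM'.1 (hr'.2.1.associated_of_dvd hM'.2.2 h)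
    have h2 : r.natDegree ≤ z :=
      (Finset.single_le_sum (fun _ _ => Nat.zero_le _) hr).trans hs.2
    rw [h1, hM'.2.1] at h2
    omega

lemma pow_le_card_Irr (d : ℕ) (hd : 2 ≤ d) :
    Fintype.card F ^ d ≤ d * (Irr F d).card + d ^ 2 * Fintype.card F ^ (d / 2) := by
  classical
  have hq0 : 0 < Fintype.card F := Fintype.card_pos
  obtain ⟨p, hp⟩ := CharP.exists F
  have : Fact p.Prime := ⟨CharP.char_is_prime F p⟩
  have : NeZero d := ⟨by omega⟩
  let K := FiniteField.Extension F p d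
  have : Fintype K := Fintype.ofFinite K
  have hcard : Fintype.card K = Fintype.card F ^ d := by
    rw [← Nat.card_eq_fintype_card, ← Nat.card_eq_fintype_card]
    exact FiniteField.natCard_extension F p d
  have hIntegral : ∀ a : K, IsIntegral F a := fun a => Algebra.IsIntegral.isIntegral a
  let T : Finset F[X] := Irr F d ∪ (Finset.range (d / 2 + 1)).biUnion (Mon F)
  have hmem : ∀ a ∈ (Finset.univ : Finset K), minpoly F a ∈ T := by
    intro a _
    have hdvd : (minpoly F a).natDegree ∣ d := by
      have h1 := minpoly.degree_dvd (hIntegral a)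
      rwa [FiniteField.finrank_extension F p d] at h1
    rw [Finset.mem_union]
    by_cases he : (minpoly F a).natDegree = d
    · exact Or.inl (mem_Irr.2 ⟨minpoly.monic (hIntegral a), he, minpoly.irreducible (hIntegral a)⟩)
    · right
      rw [Finset.mem_biUnion]
      refine ⟨_, Finset.mem_range.2 ?_, mem_Mon.2 ⟨minpoly.monic (hIntegral a), rfl⟩⟩
      obtain ⟨c, hc⟩ := hdvd
      have hc1 : 2 ≤ c := by
        rcases c with _ | _ | c
        · omega
        · omega
        · omega
      have : (minpoly F a).natDegree ≤ d / 2 := by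
        rw [Nat.le_div_iff_mul_le (by norm_num)]
        nlinarith
      omega
  have hfib : ∀ g ∈ T, ((Finset.univ : Finset K).filter fun a => minpoly F a = g).card ≤
      g.natDegree := by
    intro g hg
    by_cases hg0 : g = 0
    · subst hg0
      simp [minpoly.ne_zero (hIntegral _)]
    have hsub : ((Finset.univ : Finset K).filter fun a => minpoly F a = g) ⊆
        (g.map (algebraMap F K)).roots.toFinset := by
      intro a ha
      have ha' := (Finset.mem_filter.1 ha).2
      rw [Multiset.mem_toFinset, mem_roots (Polynomial.map_ne_zero hg0), IsRoot.def, eval_map_algebraMap,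
        ← ha']
      exact minpoly.aeval F a
    calc _ ≤ _ := Finset.card_le_card hsub
      _ ≤ _ := Multiset.toFinset_card_le _
      _ ≤ _ := card_roots' _
      _ ≤ _ := natDegree_map_le
  calc Fintype.card F ^ d = ∑ g ∈ T, ((Finset.univ : Finset K).filter fun a => minpoly F a = g).card := by
        rw [← hcard, ← Finset.card_univ]
        exact Finset.card_eq_sum_card_fiberwise hmem
    _ ≤ ∑ g ∈ T, g.natDegree := Finset.sum_le_sum hfib
    _ ≤ ∑ g ∈ Irr F d, g.natDegree +
        ∑ g ∈ (Finset.range (d / 2 + 1)).biUnion (Mon F), g.natDegree := by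
        rw [← Finset.sum_union_inter]
        exact Nat.le_add_right _ _
    _ ≤ d * (Irr F d).card + d ^ 2 * Fintype.card F ^ (d / 2) := by
        gcongr ?_ + ?_
        · rw [Finset.sum_congr rfl fun g hg => (mem_Irr.1 hg).2.1]
          simp [mul_comm]
        · have hM := sum_MonLE (F := F) (d / 2) natDegree
          rw [MonLE] at hM
          rw [hM]
          calc _ ≤ ∑ k ∈ Finset.range (d / 2 + 1), d * Fintype.card F ^ (d / 2) := by
                refine Finset.sum_le_sum fun k hk => ?_
                have hk' := Finset.mem_range.1 hk
                rw [Finset.sum_congr rfl fun g hg => (mem_Mon.1 hg).2, Finset.sum_const, card_Mon,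
                  smul_eq_mul, mul_comm]
                exact Nat.mul_le_mul (by omega) (Nat.pow_le_pow_right hq0 (by omega))
            _ ≤ _ := by
                rw [Finset.sum_const, Finset.card_range, smul_eq_mul, ← mul_assoc, sq]
                gcongr
                omega

lemma eight_sq_le_two_pow (m : ℕ) (hm : 10 ≤ m) : 8 * m ^ 2 ≤ 2 ^ m := by
  induction m, hm using Nat.le_induction with
  | base => norm_num
  | succ k hk ih => rw [pow_succ 2 k]; nlinarith

lemma qr_pow_le_card_Irr (d : ℕ) (hd : 20 ≤ d) : qr F ^ d ≤ 2 * d * ((Irr F d).card : ℝ) := by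
  have h := pow_le_card_Irr (F := F) d (by omega)
  have hq : 2 ≤ Fintype.card F := Fintype.one_lt_card
  have h1 : 2 * d ^ 2 ≤ Fintype.card F ^ (d - d / 2) := by
    have := eight_sq_le_two_pow (d - d / 2) (by omega)
    calc 2 * d ^ 2 ≤ 2 * (2 * (d - d / 2)) ^ 2 := by gcongr; omega
      _ = 8 * (d - d / 2) ^ 2 := by ring
      _ ≤ _ := this.trans (Nat.pow_le_pow_left hq _)
  have h2 : 2 * (d ^ 2 * Fintype.card F ^ (d / 2)) ≤ Fintype.card F ^ d := by
    calc _ = 2 * d ^ 2 * Fintype.card F ^ (d / 2) := by ring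
      _ ≤ Fintype.card F ^ (d - d / 2) * Fintype.card F ^ (d / 2) := Nat.mul_le_mul_right _ h1
      _ = _ := by rw [← pow_add]; congr 1; omega
  have h3 : Fintype.card F ^ d ≤ 2 * d * (Irr F d).card := by nlinarith
  simp only [qr]
  exact_mod_cast h3

section Entropy

open Real (negMulLog)

variable {α β γ : Type} [Fintype α] [Fintype β] [Fintype γ]
  [DecidableEq α] [DecidableEq β] [DecidableEq γ]

/-- The Gibbs inequality for finite distributions. -/
lemma gibbs {κ : Type} [Fintype κ] (p r : κ → ℝ) (hp : ∀ k, 0 ≤ p k) (hr : ∀ k, 0 ≤ r k)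
    (hpr : ∀ k, r k = 0 → p k = 0) (hs : ∑ k, r k ≤ ∑ k, p k) :
    ∑ k, p k * Real.log (r k) ≤ ∑ k, p k * Real.log (p k) := by
  have h : ∀ k, p k * Real.log (r k) - p k * Real.log (p k) ≤ r k - p k := by
    intro k
    rcases (hp k).eq_or_lt with h0 | h0
    · simp [← h0, hr k]
    · have hrk : 0 < r k := (hr k).lt_of_ne fun h => h0.ne' (hpr k h.symm)
      have h1 := Real.log_le_sub_one_of_pos (div_pos hrk h0)
      rw [Real.log_div hrk.ne' h0.ne'] at h1
      have h2 := mul_le_mul_of_nonneg_left h1 h0.le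
      have h3 : p k * (r k / p k - 1) = r k - p k := by field_simp
      linarith
  have := Finset.sum_le_sum fun k (_ : k ∈ Finset.univ) => h k
  simp only [Finset.sum_sub_distrib] at this
  linarith

/-- The density of the level set `{X = a}`. -/
def pr (X : F[X] → α) (a : α) : ℝ := mean fun G => if X G = a then (1 : ℝ) else 0

lemma Bdd.of_fintype (X : F[X] → α) (φ : α → ℝ) : Bdd fun G => φ (X G) :=
  ⟨∑ a, |φ a|, fun G => Finset.single_le_sum (f := fun a => |φ a|) (fun _ _ => abs_nonneg _)
    (Finset.mem_univ (X G))⟩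

lemma mean_nonneg {h : F[X] → ℝ} (hh : Bdd h) (h0 : ∀ G, 0 ≤ h G) : 0 ≤ mean h := by
  rw [← mean_const (F := F) 0]
  exact mean_mono ⟨0, by simp⟩ hh (Eventually.of_forall h0)

lemma mean_sum {ι : Type*} (s : Finset ι) (h : ι → F[X] → ℝ) :
    mean (fun G => ∑ i ∈ s, h i G) = ∑ i ∈ s, mean (h i) := by
  rw [← map_sum]
  congr 1
  ext G
  simp

lemma mean_const_mul (c : ℝ) (h : F[X] → ℝ) : mean (fun G => c * h G) = c * mean h :=
  map_smul mean c h

lemma mean_add (g h : F[X] → ℝ) : mean (fun G => g G + h G) = mean g + mean h :=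
  map_add mean g h

lemma mean_sub (g h : F[X] → ℝ) : mean (fun G => g G - h G) = mean g - mean h :=
  map_sub mean g h

lemma pr_nonneg (X : F[X] → α) (a : α) : 0 ≤ pr X a :=
  mean_nonneg (Bdd.of_fintype X fun b => if b = a then 1 else 0) fun G => by split_ifs <;> simp

lemma sum_pr_mul (X : F[X] → α) (φ : α → ℝ) : ∑ a, pr X a * φ a = mean fun G => φ (X G) := by
  have : (fun G => φ (X G)) = fun G => ∑ a, φ a * if X G = a then (1 : ℝ) else 0 := by
    ext G; simp
  rw [this, mean_sum]
  refine Finset.sum_congr rfl fun a _ => ?_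
  rw [mean_const_mul, mul_comm, pr]

lemma sum_pr (X : F[X] → α) : ∑ a, pr X a = 1 := by
  have := sum_pr_mul X fun _ => 1
  simpa [mean_const] using this

lemma pr_comp (X : F[X] → α) (g : α → β) (b : β) :
    pr (fun G => g (X G)) b = ∑ a, if g a = b then pr X a else 0 := by
  have := sum_pr_mul X fun a => if g a = b then (1 : ℝ) else 0
  rw [pr, ← this]
  simp

lemma pr_le_comp (X : F[X] → α) (g : α → β) (a : α) : pr X a ≤ pr (fun G => g (X G)) (g a) := by
  rw [pr_comp X g]
  have := Finset.single_le_sum (f := fun a' => if g a' = g a then pr X a' else 0)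
    (fun a' _ => by split_ifs; exacts [pr_nonneg X a', le_rfl]) (Finset.mem_univ a)
  simpa using this

/-- The Shannon entropy of a finitely valued function. -/
def ent (X : F[X] → α) : ℝ := ∑ a, negMulLog (pr X a)

lemma pr_le_one (X : F[X] → α) (a : α) : pr X a ≤ 1 := by
  rw [← sum_pr X]
  exact Finset.single_le_sum (fun a _ => pr_nonneg X a) (Finset.mem_univ a)

lemma ent_nonneg (X : F[X] → α) : 0 ≤ ent X :=
  Finset.sum_nonneg fun a _ => Real.negMulLog_nonneg (pr_nonneg X a) (pr_le_one X a)

lemma sum_pr_mul_log_comp (X : F[X] → α) (g : α → β) :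
    ∑ a, pr X a * Real.log (pr (fun G => g (X G)) (g a)) = -ent (fun G => g (X G)) := by
  rw [sum_pr_mul X fun a => Real.log (pr (fun G => g (X G)) (g a)),
    ← sum_pr_mul (fun G => g (X G)) fun b => Real.log (pr (fun G => g (X G)) b), ent,
    ← Finset.sum_neg_distrib]
  simp [negMulLog]

lemma sum_pr_mul_log (X : F[X] → α) : ∑ a, pr X a * Real.log (pr X a) = -ent X :=
  sum_pr_mul_log_comp X id

lemma ent_comp_le (X : F[X] → α) (g : α → β) : ent (fun G => g (X G)) ≤ ent X := by
  have h1 := sum_pr_mul_log_comp X g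
  have h2 := sum_pr_mul_log X
  have : ∑ a, pr X a * Real.log (pr X a) ≤ ∑ a, pr X a * Real.log (pr (fun G => g (X G)) (g a)) := by
    refine Finset.sum_le_sum fun a _ => ?_
    rcases (pr_nonneg X a).eq_or_lt with h | h
    · simp [← h]
    · exact mul_le_mul_of_nonneg_left (Real.log_le_log h (pr_le_comp X g a)) h.le
  linarith

lemma ent_le_of_determines (X : F[X] → α) (Z : F[X] → β) (h : ∀ G G', X G = X G' → Z G = Z G') :
    ent Z ≤ ent X := by
  have : Nonempty β := ⟨Z 0⟩
  obtain ⟨g, hg⟩ := (Function.factorsThrough_iff (f := X) Z).1 fun G G' h' => h G G' h'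
  have := ent_comp_le X g
  rwa [show (fun G => g (X G)) = Z from hg.symm] at this

lemma ent_le_log_card (X : F[X] → α) : ent X ≤ Real.log (Fintype.card α) := by
  have hne : Nonempty α := ⟨X 0⟩
  have hc : (0 : ℝ) < Fintype.card α := by exact_mod_cast Fintype.card_pos
  have h := gibbs (pr X) (fun _ => (Fintype.card α : ℝ)⁻¹) (pr_nonneg X) (fun _ => by positivity)
    (fun _ h => absurd h (by positivity)) (by rw [sum_pr]; simp)
  rw [sum_pr_mul_log, ← Finset.sum_mul, sum_pr, Real.log_inv] at h
  linarith

lemma ent_submodular (X : F[X] → α) (Y : F[X] → β) (Z : F[X] → γ) :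
    ent (fun G => (X G, Y G, Z G)) + ent Z ≤ ent (fun G => (X G, Z G)) +
      ent (fun G => (Y G, Z G)) := by
  let W : F[X] → α × β × γ := fun G => (X G, Y G, Z G)
  let gx : α × β × γ → α × γ := fun w => (w.1, w.2.2)
  let gy : α × β × γ → β × γ := fun w => (w.2.1, w.2.2)
  let gz : α × β × γ → γ := fun w => w.2.2
  let r : α × β × γ → ℝ := fun w => pr (fun G => gx (W G)) (gx w) * pr (fun G => gy (W G)) (gy w) /
    pr (fun G => gz (W G)) (gz w)
  have hz0 : ∀ w, 0 < pr W w → 0 < pr (fun G => gz (W G)) (gz w) :=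
    fun w h => h.trans_le (pr_le_comp W gz w)
  have hx0 : ∀ w, 0 < pr W w → 0 < pr (fun G => gx (W G)) (gx w) :=
    fun w h => h.trans_le (pr_le_comp W gx w)
  have hy0 : ∀ w, 0 < pr W w → 0 < pr (fun G => gy (W G)) (gy w) :=
    fun w h => h.trans_le (pr_le_comp W gy w)
  have hmx : ∀ c, ∑ a, pr (fun G => (X G, Z G)) (a, c) = pr Z c := by
    intro c
    have := pr_comp (fun G => (X G, Z G)) Prod.snd c
    rw [show pr Z c = _ from this, Fintype.sum_prod_type]
    simp
  have hmy : ∀ c, ∑ a, pr (fun G => (Y G, Z G)) (a, c) = pr Z c := by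
    intro c
    have := pr_comp (fun G => (Y G, Z G)) Prod.snd c
    rw [show pr Z c = _ from this, Fintype.sum_prod_type]
    simp
  have h := gibbs (pr W) r (pr_nonneg W)
    (fun w => div_nonneg (mul_nonneg (pr_nonneg _ _) (pr_nonneg _ _)) (pr_nonneg _ _)) ?_ ?_
  · have e : ∑ w, pr W w * Real.log (r w) = ∑ w, pr W w * Real.log (pr (fun G => gx (W G)) (gx w)) +
        ∑ w, pr W w * Real.log (pr (fun G => gy (W G)) (gy w)) -
        ∑ w, pr W w * Real.log (pr (fun G => gz (W G)) (gz w)) := by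
      rw [← Finset.sum_add_distrib, ← Finset.sum_sub_distrib]
      refine Finset.sum_congr rfl fun w _ => ?_
      rcases (pr_nonneg W w).eq_or_lt with h | h
      · simp [← h]
      · rw [Real.log_div (mul_pos (hx0 w h) (hy0 w h)).ne' (hz0 w h).ne',
          Real.log_mul (hx0 w h).ne' (hy0 w h).ne']
        ring
    rw [e, sum_pr_mul_log_comp, sum_pr_mul_log_comp, sum_pr_mul_log_comp, sum_pr_mul_log] at h
    change ent W + ent (fun G => gz (W G)) ≤ ent (fun G => gx (W G)) + ent (fun G => gy (W G))
    linarith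
  · intro w hw
    by_contra hne
    have hpos := (pr_nonneg W w).lt_of_ne (Ne.symm hne)
    exact (div_pos (mul_pos (hx0 w hpos) (hy0 w hpos)) (hz0 w hpos)).ne' hw
  · rw [sum_pr]
    calc ∑ w, r w = ∑ c, ∑ a, ∑ b, pr (fun G => (X G, Z G)) (a, c) *
          pr (fun G => (Y G, Z G)) (b, c) / pr Z c := by
          rw [Fintype.sum_prod_type]
          simp_rw [Fintype.sum_prod_type]
          rw [Finset.sum_comm]
          refine (Finset.sum_congr rfl fun b _ => Finset.sum_comm).trans ?_
          rw [Finset.sum_comm]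
          refine Finset.sum_congr rfl fun c _ => ?_
          rw [Finset.sum_comm]
      _ = ∑ c, pr Z c * pr Z c / pr Z c := by
          refine Finset.sum_congr rfl fun c _ => ?_
          simp_rw [← Finset.sum_div, ← Finset.mul_sum, ← Finset.sum_mul, hmx, hmy]
      _ = ∑ c, pr Z c := Finset.sum_congr rfl fun c _ => mul_self_div_self _
      _ ≤ 1 := (sum_pr Z).le

lemma ent_translate (X : F[X] → α) (S : F[X]) : ent (fun G => X (G + S)) = ent X := by
  have : ∀ a, pr (fun G => X (G + S)) a = pr X a := fun a =>
    mean_translate (h := fun G => if X G = a then (1 : ℝ) else 0)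
      (Bdd.of_fintype X fun b => if b = a then 1 else 0) S
  simp only [ent, this]

/-- The variational inequality for the mutual information. -/
lemma donsker_varadhan (X : F[X] → α) (Y : F[X] → β) (φ : α → β → ℝ) (K : ℝ)
    (hK : ∀ a, ∑ b, pr Y b * Real.exp (φ a b) ≤ Real.exp K) :
    mean (fun G => φ (X G) (Y G)) ≤ ent X + ent Y - ent (fun G => (X G, Y G)) + K := by
  let W : F[X] → α × β := fun G => (X G, Y G)
  let r : α × β → ℝ := fun w => pr (fun G => (W G).1) w.1 * pr (fun G => (W G).2) w.2 *
    Real.exp (φ w.1 w.2 - K)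
  have hx0 : ∀ w, 0 < pr W w → 0 < pr (fun G => (W G).1) w.1 :=
    fun w h => h.trans_le (pr_le_comp W Prod.fst w)
  have hy0 : ∀ w, 0 < pr W w → 0 < pr (fun G => (W G).2) w.2 :=
    fun w h => h.trans_le (pr_le_comp W Prod.snd w)
  have h := gibbs (pr W) r (pr_nonneg W)
    (fun w => mul_nonneg (mul_nonneg (pr_nonneg _ _) (pr_nonneg _ _)) (Real.exp_nonneg _)) ?_ ?_
  · have e : ∑ w, pr W w * Real.log (r w) = ∑ w, pr W w * Real.log (pr (fun G => (W G).1) w.1) +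
        ∑ w, pr W w * Real.log (pr (fun G => (W G).2) w.2) + ∑ w, pr W w * (φ w.1 w.2 - K) := by
      rw [← Finset.sum_add_distrib, ← Finset.sum_add_distrib]
      refine Finset.sum_congr rfl fun w _ => ?_
      rcases (pr_nonneg W w).eq_or_lt with h | h
      · simp [← h]
      · rw [Real.log_mul (mul_pos (hx0 w h) (hy0 w h)).ne' (Real.exp_ne_zero _),
          Real.log_mul (hx0 w h).ne' (hy0 w h).ne', Real.log_exp]
        ring
    have e1 := sum_pr_mul_log_comp W Prod.fst
    have e2 := sum_pr_mul_log_comp W Prod.snd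
    have e3 := sum_pr_mul W fun w => φ w.1 w.2 - K
    rw [e, e1, e2, e3, sum_pr_mul_log, mean_sub, mean_const] at h
    change mean (fun G => φ (W G).1 (W G).2) ≤
      ent (fun G => (W G).1) + ent (fun G => (W G).2) - ent W + K
    linarith
  · intro w hw
    by_contra hne
    have hpos := (pr_nonneg W w).lt_of_ne (Ne.symm hne)
    exact (mul_pos (mul_pos (hx0 w hpos) (hy0 w hpos)) (Real.exp_pos _)).ne' hw
  · rw [sum_pr, Fintype.sum_prod_type]
    calc _ = ∑ a, pr X a * ((∑ b, pr Y b * Real.exp (φ a b)) * Real.exp (-K)) := by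
          refine Finset.sum_congr rfl fun a _ => ?_
          rw [Finset.sum_mul, Finset.mul_sum]
          refine Finset.sum_congr rfl fun b _ => ?_
          simp only [r, sub_eq_add_neg, Real.exp_add]
          ring
      _ ≤ ∑ a, pr X a * 1 := by
          refine Finset.sum_le_sum fun a _ => mul_le_mul_of_nonneg_left ?_ (pr_nonneg X a)
          calc _ ≤ Real.exp K * Real.exp (-K) :=
                mul_le_mul_of_nonneg_right (hK a) (Real.exp_nonneg _)
            _ = 1 := by rw [← Real.exp_add]; simp
      _ = 1 := by simp [sum_pr]

end Entropy

section Words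

variable {A α β : Type} [Fintype A] [DecidableEq A] [Fintype α] [DecidableEq α]
  [Fintype β] [DecidableEq β]

/-- The values of `X` at the translates by the elements of `s`. -/
def shifts (X : F[X] → α) (s : Finset F[X]) (G : F[X]) : s → α := fun i => X (G + i)

lemma ent_shifts_le (W : F[X] → α) (Y : F[X] → β)
    (hY : ∀ S G G' : F[X], Y G = Y G' → Y (G + S) = Y (G' + S)) (s : Finset F[X]) :
    ent (fun G => (shifts W s G, Y G)) - ent Y ≤
      s.card * (ent (fun G => (W G, Y G)) - ent Y) := by
  induction s using Finset.induction_on with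
  | empty =>
    have : ent (fun G => (shifts W ∅ G, Y G)) ≤ ent Y :=
      ent_le_of_determines _ _ fun G G' h => Prod.ext (Subsingleton.elim _ _) h
    simpa using this
  | insert i s hi ih =>
    have h1 := ent_submodular (fun G => W (G + i)) (shifts W s) Y
    have h2 : ent (fun G => (shifts W (insert i s) G, Y G)) ≤
        ent (fun G => (W (G + i), shifts W s G, Y G)) := by
      refine ent_le_of_determines _ _ fun G G' h => ?_
      obtain ⟨h3, h4, h5⟩ := by simpa only [Prod.mk.injEq] using h
      refine Prod.ext (funext fun j => ?_) h5
      rcases Finset.mem_insert.1 j.2 with hj | hj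
      · simp only [shifts, hj, h3]
      · exact congrFun h4 ⟨j, hj⟩
    have h3 : ent (fun G => (W (G + i), Y G)) ≤ ent (fun G => (W G, Y G)) := by
      rw [← ent_translate (fun G => (W G, Y G)) i]
      refine ent_le_of_determines _ _ fun G G' h => ?_
      obtain ⟨h3, h4⟩ := by simpa only [Prod.mk.injEq] using h
      refine Prod.ext h3 ?_
      have := hY (-i) _ _ h4
      simpa using this
    rw [Finset.card_insert_of_notMem hi]
    push_cast
    linarith

/-- The word read off in the window `V n`. -/
abbrev word (code : F[X] → A) (n : ℕ) : F[X] → (V F n → A) := shifts code (V F n)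

lemma ent_word_le (code : F[X] → A) (Y : F[X] → β)
    (hY : ∀ S G G' : F[X], Y G = Y G' → Y (G + S) = Y (G' + S)) (n k : ℕ) :
    ent (word code (n + k)) ≤
      ent Y + qr F ^ k * (ent (fun G => (word code n G, Y G)) - ent Y) := by
  have h0 : 0 ≤ ent (fun G => (word code n G, Y G)) - ent Y :=
    sub_nonneg.2 (ent_le_of_determines _ _ fun G G' h => (Prod.ext_iff.1 h).2)
  set s : Finset F[X] := (V F k).image fun M => X ^ n * M
  have h1 := ent_shifts_le (word code n) Y hY s
  have h2 : ent (word code (n + k)) ≤ ent (fun G => (shifts (word code n) s G, Y G)) := by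
    refine ent_le_of_determines _ _ fun G G' h => ?_
    have h3 := (Prod.ext_iff.1 h).1
    have hm : (X ^ n : F[X]).Monic := monic_X_pow n
    have hd : (X ^ n : F[X]).natDegree = n := natDegree_X_pow n
    funext L
    have hdiv : (L : F[X]) /ₘ X ^ n ∈ V F k :=
      divByMonic_mem_V hm hd (V_mono (by omega) L.2)
    have hmem : X ^ n * ((L : F[X]) /ₘ X ^ n) ∈ s :=
      Finset.mem_image.2 ⟨_, hdiv, rfl⟩
    have h4 := congrFun (congrFun h3 ⟨_, hmem⟩) ⟨_, modByMonic_mem_V hm hd (L : F[X])⟩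
    have e : ∀ G : F[X], G + X ^ n * ((L : F[X]) /ₘ X ^ n) + (L : F[X]) %ₘ X ^ n = G + (L : F[X]) := by
      intro G
      linear_combination modByMonic_add_div (L : F[X]) (X ^ n)
    simp only [shifts, e] at h4 ⊢
    exact h4
  have h3 : (s.card : ℝ) ≤ qr F ^ k := by
    rw [← card_V_real]
    exact_mod_cast Finset.card_image_le
  nlinarith

lemma ent_word_mono (code : F[X] → A) (n k : ℕ) :
    ent (word code (n + k)) ≤ qr F ^ k * ent (word code n) := by
  have h := ent_word_le code (fun _ => ()) (fun _ _ _ _ => rfl) n k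
  have h1 : ent (fun _ : F[X] => ()) ≤ 0 := by
    have := ent_le_log_card (fun _ : F[X] => ())
    simpa using this
  have h2 := ent_nonneg (fun _ : F[X] => ())
  have h3 : ent (fun G => (word code n G, ())) ≤ ent (word code n) :=
    ent_le_of_determines _ _ fun G G' h => Prod.ext h rfl
  have h4 : ent (fun _ : F[X] => ()) = 0 := le_antisymm h1 h2
  have := qr_pos (F := F)
  rw [h4, zero_add, sub_zero] at h
  exact h.trans (by gcongr)

/-- The residues modulo the primes of degree `d`. -/
def residues (d : ℕ) (G : F[X]) : Irr F d → V F d := fun P =>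
  ⟨G %ₘ (P : F[X]), modByMonic_mem_V (mem_Irr.1 P.2).1 (mem_Irr.1 P.2).2.1 G⟩

lemma residues_eq_iff {d : ℕ} {G G' : F[X]} :
    residues d G = residues d G' ↔ ∀ P ∈ Irr F d, P ∣ G - G' := by
  constructor
  · intro h P hP
    have hm := (mem_Irr.1 hP).1
    have := congrArg Subtype.val (congrFun h ⟨P, hP⟩)
    simp only [residues] at this
    rw [← modByMonic_eq_zero_iff_dvd hm, sub_modByMonic, this, sub_self]
  · intro h
    funext P
    have hm := (mem_Irr.1 P.2).1
    have := h P P.2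
    rw [← modByMonic_eq_zero_iff_dvd hm, sub_modByMonic, sub_eq_zero] at this
    exact Subtype.ext this

lemma residues_add {d : ℕ} (S G G' : F[X]) (h : residues d G = residues d G') :
    residues d (G + S) = residues d (G' + S) := by
  rw [residues_eq_iff] at *
  intro P hP
  have := h P hP
  rwa [add_sub_add_right_eq_sub]

open Classical in
lemma mean_dvd_sub {D : F[X]} (hD : D.Monic) (y : F[X]) :
    mean (fun G => if D ∣ G - y then (1 : ℝ) else 0) = (nm D)⁻¹ := by
  have hb : Bdd fun G : F[X] => if D ∣ G then (1 : ℝ) else 0 :=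
    ⟨1, fun G => by dsimp only; split_ifs <;> simp⟩
  have h1 := mean_translate hb (-y)
  have h2 := mean_dilate (h := fun _ => (1 : ℝ)) ⟨1, by simp⟩ hD
  simp only [← sub_eq_add_neg] at h1
  rw [h1, h2, mean_const, mul_one, nm]

lemma irr_coprime {d e : ℕ} {P P' : F[X]} (hP : P ∈ Irr F d) (hP' : P' ∈ Irr F e) (h : P ≠ P') :
    IsCoprime P P' := by
  rw [mem_Irr] at hP hP'
  refine (hP.2.2.coprime_iff_not_dvd).2 fun hd => h ?_
  exact eq_of_monic_of_associated hP.1 hP'.1 (hP.2.2.associated_of_dvd hP'.2.2 hd)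

lemma pr_residues (d : ℕ) (y : Irr F d → V F d) :
    pr (residues d) y = ∏ _P : Irr F d, (qr F ^ d)⁻¹ := by
  classical
  obtain ⟨y₀, hy₀⟩ : ∃ y₀ : F[X], ∀ P : Irr F d, (P : F[X]) ∣ y₀ - y P := by
    have := Ideal.exists_forall_sub_mem_ideal
      (I := fun P : Irr F d => Ideal.span {(P : F[X])}) (fun P P' hne => (Ideal.isCoprime_span_singleton_iff _ _).2
        (irr_coprime P.2 P'.2 fun h => hne (Subtype.ext h)))
      (fun P => (y P : F[X]))
    obtain ⟨y₀, h⟩ := this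
    exact ⟨y₀, fun P => Ideal.mem_span_singleton.1 (h P)⟩
  have hres : residues d y₀ = y := by
    funext P
    have hm := (mem_Irr.1 P.2).1
    have h1 := hy₀ P
    rw [← modByMonic_eq_zero_iff_dvd hm, sub_modByMonic, sub_eq_zero] at h1
    refine Subtype.ext (h1.trans ?_)
    rw [(modByMonic_eq_self_iff hm)]
    rw [degree_eq_natDegree hm.ne_zero, (mem_Irr.1 P.2).2.1]
    exact mem_V.1 (y P).2
  have hN : (∏ P ∈ Irr F d, P).Monic := monic_prod_of_monic _ _ fun P hP => (mem_Irr.1 hP).1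
  have e : ∀ G, residues d G = y ↔ (∏ P ∈ Irr F d, P) ∣ G - y₀ := by
    intro G
    rw [← hres, residues_eq_iff]
    exact ⟨fun h => Finset.prod_dvd_of_coprime (fun P hP P' hP' hne => irr_coprime hP hP' hne) h,
      fun h P hP => (Finset.dvd_prod_of_mem (fun P => P) hP).trans h⟩
  have hpr : pr (residues d) y =
      mean fun G => if (∏ P ∈ Irr F d, P) ∣ G - y₀ then (1 : ℝ) else 0 := by
    rw [pr]
    congr 1
    funext G
    exact if_congr (e G) rfl rfl
  rw [hpr, mean_dvd_sub hN, nm_prod _ _ fun P hP => (mem_Irr.1 hP).1, ← Finset.prod_inv_distrib,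
    ← Finset.prod_coe_sort]
  exact Finset.prod_congr rfl fun P _ => by rw [nm, (mem_Irr.1 P.2).2.1]

lemma ent_residues_le (d : ℕ) :
    ent (residues (F := F) d) ≤ (Irr F d).card * (d * Real.log (qr F)) := by
  refine (ent_le_log_card _).trans (le_of_eq ?_)
  rw [Fintype.card_fun]
  push_cast
  rw [Real.log_pow, Fintype.card_coe, Fintype.card_coe, card_V]
  push_cast
  rw [Real.log_pow]

lemma card_Irr_le (d : ℕ) : ((Irr F d).card : ℝ) ≤ qr F ^ d := by
  have h : (Irr F d).card ≤ (Mon F d).card := Finset.card_le_card fun P hP =>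
    mem_Mon.2 ⟨(mem_Irr.1 hP).1, (mem_Irr.1 hP).2.1⟩
  rw [card_Mon] at h
  exact_mod_cast h

end Words

/-- A nonnegative nonincreasing sequence cannot satisfy a decrement inequality at every scale. -/
lemma no_decrement (v : ℕ → ℝ) (hv : ∀ m, 0 ≤ v m) (hanti : Antitone v) (m₀ : ℕ) (K c : ℝ)
    (hK : 0 < K) (hc : 0 < c)
    (h : ∀ m, m₀ ≤ m → ∀ s : ℕ, v (m + s) ≤ v m + K * m * (1 / 2) ^ s - c / m) : False := by
  obtain ⟨a, ha⟩ : ∃ a : ℕ, ((1 : ℝ) / 2) ^ a < c / (2 * K) :=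
    exists_pow_lt_of_lt_one (by positivity) (by norm_num)
  have hstep : ∀ k m : ℕ, m₀ ≤ m → 0 < m → m ≤ 2 ^ (k + 1) →
      v (m + (2 * k + 2 + a)) ≤ v m - c / 2 ^ (k + 2) := by
    intro k m hm hm0 hmk
    have h1 := h m hm (2 * k + 2 + a)
    have hmR : (0 : ℝ) < m := by exact_mod_cast hm0
    have hmk' : (m : ℝ) ≤ 2 ^ (k + 1) := by exact_mod_cast hmk
    have h2 : K * m * (1 / 2) ^ (2 * k + 2 + a) ≤ c / (2 * m) := by
      rw [le_div_iff₀ (by positivity)]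
      have h3 : (m : ℝ) ^ 2 ≤ (2 ^ (k + 1)) ^ 2 := by gcongr
      have h4 : ((1 : ℝ) / 2) ^ (2 * k + 2 + a) = ((2 ^ (k + 1)) ^ 2)⁻¹ * (1 / 2) ^ a := by
        rw [pow_add, ← pow_mul, one_div, inv_pow 2 (2 * k + 2), inv_pow]
        ring_nf
      have h5 : (m : ℝ) ^ 2 * ((2 ^ (k + 1)) ^ 2)⁻¹ ≤ 1 := by
        rw [← div_eq_mul_inv, div_le_one (by positivity)]
        exact h3
      calc _ = 2 * K * ((m : ℝ) ^ 2 * ((2 ^ (k + 1)) ^ 2)⁻¹) * (1 / 2) ^ a := by rw [h4]; ring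
        _ ≤ 2 * K * 1 * (c / (2 * K)) := by gcongr
        _ = c := by field_simp
    have h3 : c / 2 ^ (k + 2) ≤ c / (2 * m) := by
      gcongr
      calc (2 : ℝ) * m ≤ 2 * 2 ^ (k + 1) := by gcongr
        _ = 2 ^ (k + 2) := by ring
    have h4 : c / m = c / (2 * m) + c / (2 * m) := by field_simp; ring
    linarith
  have hiter : ∀ k : ℕ, m₀ ≤ 2 ^ k → ∀ j : ℕ, j * (2 * k + 2 + a) ≤ 2 ^ k →
      v (2 ^ k + j * (2 * k + 2 + a)) ≤ v (2 ^ k) - j * (c / 2 ^ (k + 2)) := by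
    intro k hk j
    induction j with
    | zero => simp
    | succ j ih =>
      intro hj
      have hj' : (j + 1) * (2 * k + 2 + a) = j * (2 * k + 2 + a) + (2 * k + 2 + a) := by ring
      have h1 := ih (by omega)
      have h2 := hstep k (2 ^ k + j * (2 * k + 2 + a)) (by omega) (by positivity)
        (by rw [pow_succ]; omega)
      rw [hj', ← add_assoc]
      push_cast
      linarith
  have hblock : ∀ k : ℕ, m₀ ≤ 2 ^ k → 2 * k + 2 + a ≤ 2 ^ k →
      v (2 ^ (k + 1)) ≤ v (2 ^ k) - c / (8 * (a + 2)) * (1 / (k + 1)) := by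
    intro k hk hs
    set s := 2 * k + 2 + a with hs_def
    set J := 2 ^ k / s with hJ
    have hJ1 : 1 ≤ J := (Nat.one_le_div_iff (by omega)).2 hs
    have hJ2 : J * s ≤ 2 ^ k := Nat.div_mul_le_self _ _
    have hJ3 : 2 ^ k < (J + 1) * s := by
      exact Nat.lt_mul_of_div_lt (Nat.lt_succ_self _) (by omega)
    have h1 := hiter k hk J hJ2
    have h2 : v (2 ^ (k + 1)) ≤ v (2 ^ k + J * s) := hanti (by rw [pow_succ]; omega)
    have h3 : (2 : ℝ) ^ k ≤ 2 * J * s := by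
      have : 2 ^ k ≤ 2 * J * s := by nlinarith
      exact_mod_cast this
    have h4 : (s : ℝ) ≤ (a + 2) * (k + 1) := by
      rw [hs_def]; push_cast; nlinarith [(Nat.cast_nonneg a : (0:ℝ) ≤ a), (Nat.cast_nonneg k : (0:ℝ) ≤ k)]
    have h5 : c / (8 * (a + 2)) * (1 / (k + 1)) ≤ J * (c / 2 ^ (k + 2)) := by
      have h6 : (2 : ℝ) ^ k ≤ 2 * J * ((a + 2) * (k + 1)) := h3.trans (by gcongr)
      have e : (2 : ℝ) ^ (k + 2) = 4 * 2 ^ k := by ring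
      rw [e, div_mul_div_comm, mul_one, ← mul_div_assoc, div_le_div_iff₀ (by positivity)
        (by positivity)]
      have := mul_le_mul_of_nonneg_left h6 hc.le
      nlinarith
    linarith
  obtain ⟨k₀, hk₀⟩ : ∃ k₀ : ℕ, ∀ k, k₀ ≤ k → m₀ ≤ 2 ^ k ∧ 2 * k + 2 + a ≤ 2 ^ k := by
    refine ⟨m₀ + a + 10, fun k hk => ?_⟩
    have h1 : k < 2 ^ k := Nat.lt_two_pow_self
    have h2 := eight_sq_le_two_pow k (by omega)
    constructor
    · omega
    · nlinarith
  have hsum : ∀ j : ℕ, v (2 ^ (k₀ + j)) ≤ v (2 ^ k₀) - c / (8 * (a + 2)) *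
      (∑ i ∈ Finset.range (k₀ + j), (1 / ((i : ℝ) + 1)) -
        ∑ i ∈ Finset.range k₀, (1 / ((i : ℝ) + 1))) := by
    intro j
    induction j with
    | zero => simp
    | succ j ih =>
      have h1 := hblock (k₀ + j) (hk₀ _ (by omega)).1 (hk₀ _ (by omega)).2
      rw [← add_assoc, Finset.sum_range_succ]
      linarith
  have htend := Real.tendsto_sum_range_one_div_nat_succ_atTop
  have hc' : 0 < c / (8 * ((a : ℝ) + 2)) := by positivity
  obtain ⟨N, hN⟩ := (tendsto_atTop.1 htend (∑ i ∈ Finset.range k₀, (1 / ((i : ℝ) + 1)) +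
    (v (2 ^ k₀) + 1) / (c / (8 * (a + 2))))).exists_forall_of_atTop
  have h1 := hN (k₀ + N) (by omega)
  have h2 := hsum N
  have h3 := hv (2 ^ (k₀ + N))
  have h4 : (v (2 ^ k₀) + 1) / (c / (8 * (a + 2))) ≤
      ∑ i ∈ Finset.range (k₀ + N), (1 / ((i : ℝ) + 1)) -
        ∑ i ∈ Finset.range k₀, (1 / ((i : ℝ) + 1)) := by linarith
  rw [div_le_iff₀ hc'] at h4
  linarith

section Words

variable {A : Type} [Fintype A] [DecidableEq A]

/-- At arbitrarily large scales the word has little mutual information with the residues. -/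
lemma exists_small_information (code : F[X] → A) (n D : ℕ) (δ : ℝ) (hδ : 0 < δ) :
    ∃ d, D ≤ d ∧ 20 ≤ d ∧ ent (word code (d + n)) + ent (residues (F := F) d) -
      ent (fun G => (word code (d + n) G, residues d G)) < δ * (Irr F d).card := by
  by_contra hcon
  push Not at hcon
  have hq := qr_pos (F := F)
  have hq1 := one_lt_qr (F := F)
  refine no_decrement (fun m => ent (word code m) / qr F ^ m)
    (fun m => div_nonneg (ent_nonneg _) (by positivity)) ?_ (D + 20 + n)
    (Real.log (qr F)) (δ / (2 * qr F ^ n)) (Real.log_pos hq1) (by positivity) ?_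
  · refine antitone_nat_of_succ_le fun m => ?_
    rw [div_le_div_iff₀ (by positivity) (by positivity)]
    have := ent_word_mono code m 1
    calc _ ≤ qr F ^ 1 * ent (word code m) * qr F ^ m := by gcongr
      _ = _ := by ring
  · intro m hm s
    obtain ⟨d, rfl⟩ : ∃ d, m = d + n := ⟨m - n, by omega⟩
    have h1 := hcon d (by omega) (by omega)
    have h2 := ent_word_le code (residues d) residues_add (d + n) s
    have h3 := ent_residues_le (F := F) d
    have h4 := qr_pow_le_card_Irr (F := F) d (by omega)
    have h5 := card_Irr_le (F := F) d
    have hd : (0 : ℝ) < d := by exact_mod_cast (by omega : 0 < d)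
    have hlog := Real.log_pos hq1
    have h6 : ent (word code (d + n + s)) ≤ qr F ^ d * (d * Real.log (qr F)) +
        qr F ^ s * (ent (word code (d + n)) - δ * (qr F ^ d / (2 * d))) := by
      have h7 : qr F ^ d / (2 * d) ≤ (Irr F d).card := by
        rw [div_le_iff₀ (by positivity)]; linarith
      have h8 : ent (residues (F := F) d) ≤ qr F ^ d * (d * Real.log (qr F)) :=
        h3.trans (by gcongr)
      refine h2.trans (add_le_add h8 ?_)
      have : δ * (qr F ^ d / (2 * d)) ≤ δ * (Irr F d).card := by gcongr
      refine mul_le_mul_of_nonneg_left ?_ (by positivity)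
      linarith
    have h7 : ent (word code (d + n + s)) / qr F ^ (d + n + s) ≤
        (qr F ^ d * (d * Real.log (qr F)) +
        qr F ^ s * (ent (word code (d + n)) - δ * (qr F ^ d / (2 * d)))) / qr F ^ (d + n + s) := by
      gcongr
    refine h7.trans ?_
    have e : (qr F ^ d * (d * Real.log (qr F)) +
        qr F ^ s * (ent (word code (d + n)) - δ * (qr F ^ d / (2 * d)))) / qr F ^ (d + n + s) =
        ent (word code (d + n)) / qr F ^ (d + n) + Real.log (qr F) * d * ((qr F ^ n)⁻¹ *
          (qr F ^ s)⁻¹) - δ / (2 * qr F ^ n) / d := by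
      rw [pow_add, pow_add]
      field_simp
      ring
    rw [e]
    push_cast
    have h8 : (qr F ^ n)⁻¹ * (qr F ^ s)⁻¹ ≤ (1 / 2) ^ s := by
      have h9 : (qr F ^ n)⁻¹ ≤ 1 := inv_le_one_of_one_le₀ (one_le_pow₀ hq1.le)
      have h10 : (qr F ^ s)⁻¹ ≤ (1 / 2) ^ s := by
        rw [one_div, inv_pow]
        gcongr
        exact two_le_qr
      calc (qr F ^ n)⁻¹ * (qr F ^ s)⁻¹ ≤ 1 * (1 / 2) ^ s := by gcongr
        _ = (1 / 2) ^ s := one_mul _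
    have h9 : Real.log (qr F) * d * ((qr F ^ n)⁻¹ * (qr F ^ s)⁻¹) ≤
        Real.log (qr F) * (d + n) * (1 / 2) ^ s := by
      gcongr
      linarith [(Nat.cast_nonneg n : (0 : ℝ) ≤ n)]
    have h10 : δ / (2 * qr F ^ n) / (d + n) ≤ δ / (2 * qr F ^ n) / d := by
      gcongr
      linarith [(Nat.cast_nonneg n : (0 : ℝ) ≤ n)]
    linarith

end Words

/-- Bounded complex-valued functions. -/
def CBdd (h : F[X] → ℂ) : Prop := ∃ C, ∀ G, ‖h G‖ ≤ C

lemma CBdd.re {h : F[X] → ℂ} (hh : CBdd h) : Bdd fun G => (h G).re :=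
  hh.imp fun _ hC G => (Complex.abs_re_le_norm _).trans (hC G)

lemma CBdd.im {h : F[X] → ℂ} (hh : CBdd h) : Bdd fun G => (h G).im :=
  hh.imp fun _ hC G => (Complex.abs_im_le_norm _).trans (hC G)

lemma CBdd.norm {h : F[X] → ℂ} (hh : CBdd h) : Bdd fun G => ‖h G‖ :=
  hh.imp fun _ hC G => by rw [abs_norm]; exact hC G

lemma CBdd.normSq {h : F[X] → ℂ} (hh : CBdd h) : Bdd fun G => ‖h G‖ ^ 2 := by
  obtain ⟨C, hC⟩ := hh
  exact ⟨C ^ 2, fun G => by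
    rw [abs_pow, abs_norm]; exact pow_le_pow_left₀ (norm_nonneg _) (hC G) 2⟩

lemma CBdd.comp {h : F[X] → ℂ} (hh : CBdd h) (g : F[X] → F[X]) : CBdd fun G => h (g G) :=
  hh.imp fun _ hC G => hC _

lemma CBdd.mul {g h : F[X] → ℂ} (hg : CBdd g) (hh : CBdd h) : CBdd fun G => g G * h G := by
  obtain ⟨C, hC⟩ := hg
  obtain ⟨D, hD⟩ := hh
  refine ⟨C * D, fun G => ?_⟩
  rw [norm_mul]
  exact mul_le_mul (hC G) (hD G) (norm_nonneg _) ((norm_nonneg _).trans (hC G))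

lemma CBdd.add {g h : F[X] → ℂ} (hg : CBdd g) (hh : CBdd h) : CBdd fun G => g G + h G := by
  obtain ⟨C, hC⟩ := hg
  obtain ⟨D, hD⟩ := hh
  exact ⟨C + D, fun G => (norm_add_le _ _).trans (add_le_add (hC G) (hD G))⟩

lemma CBdd.conj {h : F[X] → ℂ} (hh : CBdd h) : CBdd fun G => conj (h G) :=
  hh.imp fun _ hC G => by rw [RCLike.norm_conj]; exact hC G

lemma CBdd.const (c : ℂ) : CBdd (F := F) fun _ => c := ⟨‖c‖, fun _ => le_rfl⟩

lemma CBdd.sum {ι : Type*} (s : Finset ι) {h : ι → F[X] → ℂ} (hh : ∀ i ∈ s, CBdd (h i)) :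
    CBdd fun G => ∑ i ∈ s, h i G := by
  classical
  induction s using Finset.induction_on with
  | empty => simpa using CBdd.const 0
  | insert i s hi ih =>
    simp only [Finset.sum_insert hi]
    exact (hh i (Finset.mem_insert_self _ _)).add
      (ih fun j hj => hh j (Finset.mem_insert_of_mem hj))

/-- The mean of a complex-valued function over monic polynomials. -/
def cmean (h : F[X] → ℂ) : ℂ :=
  (mean fun G => (h G).re : ℝ) + (mean fun G => (h G).im : ℝ) * Complex.I

lemma cmean_re (h : F[X] → ℂ) : (cmean h).re = mean fun G => (h G).re := by simp [cmean]

lemma cmean_im (h : F[X] → ℂ) : (cmean h).im = mean fun G => (h G).im := by simp [cmean]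

lemma cmean_sub (g h : F[X] → ℂ) : cmean (fun G => g G - h G) = cmean g - cmean h := by
  apply Complex.ext <;> simp [cmean_re, cmean_im, mean_sub]

lemma cmean_const_mul (c : ℂ) (h : F[X] → ℂ) : cmean (fun G => c * h G) = c * cmean h := by
  apply Complex.ext <;>
    simp only [cmean_re, cmean_im, Complex.mul_re, Complex.mul_im, mean_sub, mean_add,
      mean_const_mul]

lemma cmean_ofReal (h : F[X] → ℝ) : cmean (fun G => (h G : ℂ)) = mean h := by
  have h0 : mean (fun _ : F[X] => (0 : ℝ)) = 0 := mean_const 0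
  apply Complex.ext <;> simp [cmean_re, cmean_im, h0]

lemma cmean_sum {ι : Type*} (s : Finset ι) (h : ι → F[X] → ℂ) :
    cmean (fun G => ∑ i ∈ s, h i G) = ∑ i ∈ s, cmean (h i) := by
  apply Complex.ext <;> simp [cmean_re, cmean_im, mean_sum]

lemma cmean_congr {g h : F[X] → ℂ} (hg : CBdd g) (hh : CBdd h) (H : ∀ᶠ G in big F, g G = h G) :
    cmean g = cmean h := by
  apply Complex.ext <;> simp only [cmean_re, cmean_im]
  · exact mean_congr hg.re hh.re (H.mono fun G h => by rw [h])
  · exact mean_congr hg.im hh.im (H.mono fun G h => by rw [h])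

lemma cmean_translate {h : F[X] → ℂ} (hh : CBdd h) (L : F[X]) :
    cmean (fun G => h (G + L)) = cmean h := by
  apply Complex.ext <;> simp only [cmean_re, cmean_im]
  · exact mean_translate hh.re L
  · exact mean_translate hh.im L

lemma exists_unit_re (z : ℂ) : ∃ θ : ℂ, ‖θ‖ = 1 ∧ (θ * z).re = ‖z‖ := by
  by_cases hz : z = 0
  · exact ⟨1, by simp, by simp [hz]⟩
  · have hz' : ‖z‖ ≠ 0 := norm_ne_zero_iff.2 hz
    refine ⟨conj z / ‖z‖, by simp [hz'], ?_⟩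
    rw [div_mul_eq_mul_div, mul_comm, Complex.mul_conj, Complex.normSq_eq_norm_sq, sq]
    push_cast
    rw [mul_self_div_self]
    simp

lemma norm_cmean_le {h : F[X] → ℂ} (hh : CBdd h) : ‖cmean h‖ ≤ mean fun G => ‖h G‖ := by
  obtain ⟨θ, hθ, h1⟩ := exists_unit_re (cmean h)
  rw [← h1, ← cmean_const_mul, cmean_re]
  refine mean_mono ((CBdd.const θ).mul hh).re hh.norm (Eventually.of_forall fun G => ?_)
  calc (θ * h G).re ≤ ‖θ * h G‖ := Complex.re_le_norm _
    _ = ‖h G‖ := by rw [norm_mul, hθ, one_mul]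

lemma norm_cmean_le_of_le {h : F[X] → ℂ} {C : ℝ} (hC : ∀ G, ‖h G‖ ≤ C) : ‖cmean h‖ ≤ C := by
  refine (norm_cmean_le ⟨C, hC⟩).trans ?_
  rw [← mean_const (F := F) C]
  exact mean_mono (CBdd.norm ⟨C, hC⟩) ⟨|C|, fun _ => le_rfl⟩ (Eventually.of_forall hC)

/-- A unimodular completely multiplicative function on monic polynomials, extended by zero. -/
structure UMul (f : F[X] → ℂ) : Prop where
  eq_zero : ∀ G, ¬ G.Monic → f G = 0
  norm_eq : ∀ G, G.Monic → ‖f G‖ = 1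
  map_mul : ∀ D G, D.Monic → f (D * G) = f D * f G

lemma UMul.norm_le {f : F[X] → ℂ} (hf : UMul f) (G : F[X]) : ‖f G‖ ≤ 1 := by
  by_cases h : G.Monic
  · exact (hf.norm_eq G h).le
  · rw [hf.eq_zero G h]; simp

lemma UMul.cbdd {f : F[X] → ℂ} (hf : UMul f) : CBdd f := ⟨1, hf.norm_le⟩

lemma UMul.mul_conj_self {f : F[X] → ℂ} (hf : UMul f) {D : F[X]} (hD : D.Monic) :
    f D * conj (f D) = 1 := by
  rw [Complex.mul_conj, Complex.normSq_eq_norm_sq, hf.norm_eq D hD]; simp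

/-- The autocorrelation of `f`. -/
def corr (f : F[X] → ℂ) (L : F[X]) : ℂ := cmean fun G => f (G + L) * conj (f G)

lemma sum_exp_le_of_sum_eq_zero {ι : Type*} (s : Finset ι) (ψ : ι → ℝ) (lam : ℝ)
    (h0 : 0 ≤ lam) (h1 : lam ≤ 1 / 2) (hψ : ∀ i ∈ s, |ψ i| ≤ 2) (hsum : ∑ i ∈ s, ψ i = 0) :
    ∑ i ∈ s, Real.exp (lam * ψ i) ≤ s.card * Real.exp (4 * lam ^ 2) := by
  calc ∑ i ∈ s, Real.exp (lam * ψ i) ≤ ∑ i ∈ s, (1 + lam * ψ i + 4 * lam ^ 2) := by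
        refine Finset.sum_le_sum fun i hi => ?_
        have h2 := hψ i hi
        have h3 : |lam * ψ i| ≤ 1 := by
          rw [abs_mul, abs_of_nonneg h0]; nlinarith
        have h4 := (abs_le.1 (Real.abs_exp_sub_one_sub_id_le h3)).2
        have h5 : ψ i ^ 2 ≤ 4 := by rw [← sq_abs]; nlinarith [abs_nonneg (ψ i)]
        nlinarith [sq_nonneg lam]
    _ = s.card * (1 + 4 * lam ^ 2) := by
        rw [Finset.sum_add_distrib, Finset.sum_add_distrib, ← Finset.mul_sum, hsum]
        simp; ring
    _ ≤ _ := by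
        gcongr
        linarith [Real.add_one_le_exp (4 * lam ^ 2)]

lemma mean_decouple {β : Type} [Fintype β] [DecidableEq β] (W : F[X] → β) (d : ℕ)
    (z : Irr F d → β → V F d → ℝ) (hz : ∀ P w y, |z P w y| ≤ 1) (lam : ℝ)
    (h0 : 0 ≤ lam) (h1 : lam ≤ 1 / 2) :
    lam * ∑ P : Irr F d, mean (fun G => z P (W G) (residues d G P) -
        (qr F ^ d)⁻¹ * ∑ y, z P (W G) y) ≤
      ent W + ent (residues (F := F) d) - ent (fun G => (W G, residues d G)) +
        4 * lam ^ 2 * (Irr F d).card := by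
  classical
  have hq : 0 < qr F ^ d := pow_pos qr_pos _
  have hcard : ((Fintype.card (V F d) : ℕ) : ℝ) = qr F ^ d := by
    rw [Fintype.card_coe, card_V_real]
  set ψ : Irr F d → β → V F d → ℝ := fun P w y => z P w y - (qr F ^ d)⁻¹ * ∑ y, z P w y with hψ
  have hψ0 : ∀ P w, ∑ y, ψ P w y = 0 := by
    intro P w
    simp only [hψ, Finset.sum_sub_distrib, Finset.sum_const, Finset.card_univ, nsmul_eq_mul]
    rw [hcard]; field_simp; ring
  have hψ2 : ∀ P w y, |ψ P w y| ≤ 2 := by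
    intro P w y
    have h2 : |(qr F ^ d)⁻¹ * ∑ y, z P w y| ≤ 1 := by
      rw [abs_mul, abs_of_nonneg (inv_nonneg.2 hq.le), inv_mul_le_iff₀ hq, mul_one, ← hcard]
      refine (Finset.abs_sum_le_sum_abs _ _).trans ?_
      refine (Finset.sum_le_sum fun y _ => hz P w y).trans ?_
      simp
    exact (abs_sub _ _).trans (by linarith [hz P w y])
  have key := donsker_varadhan W (residues (F := F) d) (fun w y => ∑ P, lam * ψ P w (y P))
    (4 * lam ^ 2 * (Irr F d).card) ?_
  · refine le_trans (le_of_eq ?_) key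
    rw [mean_sum, Finset.mul_sum]
    exact Finset.sum_congr rfl fun P _ => (mean_const_mul _ _).symm
  · intro w
    calc ∑ y : Irr F d → V F d, pr (residues d) y * Real.exp (∑ P, lam * ψ P w (y P))
        = ∑ y : Irr F d → V F d, ∏ P, ((qr F ^ d)⁻¹ * Real.exp (lam * ψ P w (y P))) := by
          refine Finset.sum_congr rfl fun y _ => ?_
          rw [pr_residues, Real.exp_sum, Finset.prod_mul_distrib]
      _ = ∏ P : Irr F d, ∑ y : V F d, (qr F ^ d)⁻¹ * Real.exp (lam * ψ P w y) := by
          rw [Finset.prod_univ_sum, Fintype.piFinset_univ]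
      _ ≤ ∏ P : Irr F d, Real.exp (4 * lam ^ 2) := by
          refine Finset.prod_le_prod (fun P _ => Finset.sum_nonneg fun y _ => by positivity)
            fun P _ => ?_
          rw [← Finset.mul_sum, inv_mul_le_iff₀ hq, ← hcard]
          exact sum_exp_le_of_sum_eq_zero _ _ _ h0 h1 (fun y _ => hψ2 P w y) (hψ0 P w)
      _ = _ := by
          rw [Finset.prod_const, Finset.card_univ, Fintype.card_coe, ← Real.exp_nat_mul]
          ring_nf

lemma nm_eq (G : F[X]) : nm G = qr F ^ G.natDegree := rfl

lemma mean_sub_modByMonic {h : F[X] → ℝ} (hh : Bdd h) {P : F[X]} (hP : P.Monic) :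
    mean (fun G => h (G - G %ₘ P)) = mean fun G => h (P * G) := by
  classical
  have hb : Bdd fun G => if P ∣ G then h G else 0 := by
    obtain ⟨C, hC⟩ := hh
    refine ⟨C, fun G => ?_⟩
    dsimp only
    split_ifs
    · exact hC G
    · simpa using (abs_nonneg _).trans (hC 0)
  have e : ∀ G : F[X], h (G - G %ₘ P) =
      ∑ y ∈ V F P.natDegree, (if P ∣ G + -y then h (G + -y) else 0) := by
    intro G
    rw [Finset.sum_eq_single_of_mem (G %ₘ P) (modByMonic_mem_V hP rfl G)]
    · rw [if_pos, sub_eq_add_neg]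
      exact ⟨G /ₘ P, by linear_combination (-1 : F[X]) * modByMonic_add_div G P⟩
    · intro y hy hne
      refine if_neg fun hd => hne ?_
      have h2 : P ∣ G %ₘ P - y := by
        have h3 : P ∣ G - G %ₘ P := ⟨G /ₘ P, by linear_combination (-1 : F[X]) * modByMonic_add_div G P⟩
        have h4 := dvd_sub hd h3
        have e : G + -y - (G - G %ₘ P) = G %ₘ P - y := by ring
        rwa [e] at h4
      have h5 := sub_mem_V (modByMonic_mem_V hP rfl G) hy
      rw [mem_V] at h5
      have h6 := eq_zero_of_dvd_of_degree_lt h2 (by rwa [degree_eq_natDegree hP.ne_zero])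
      exact (sub_eq_zero.1 h6).symm
  simp only [e]
  rw [mean_sum]
  simp only [mean_translate hb]
  rw [Finset.sum_const, nsmul_eq_mul, card_V_real, mean_dilate hh hP]
  have := pow_pos (qr_pos (F := F)) P.natDegree
  field_simp

lemma exists_code (ε : ℝ) (hε : 0 < ε) : ∃ (A : Type) (_ : Fintype A) (_ : DecidableEq A)
    (val : A → ℂ) (code : ℂ → A), (∀ a, ‖val a‖ ≤ 1) ∧
      ∀ x : ℂ, ‖x‖ ≤ 1 → ‖val (code x) - x‖ ≤ ε := by
  classical
  obtain ⟨t, ht, htf, hcov⟩ := finite_cover_balls_of_compact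
    (isCompact_closedBall (0 : ℂ) 1) hε
  have hft := htf.fintype
  have hmem : ∀ x : ℂ, ‖x‖ ≤ 1 → ∃ a : t, ‖(a : ℂ) - x‖ ≤ ε := by
    intro x hx
    have := hcov (mem_closedBall_zero_iff.2 hx)
    simp only [Set.mem_iUnion, Metric.mem_ball, dist_eq_norm] at this
    obtain ⟨a, ha, h⟩ := this
    exact ⟨⟨a, ha⟩, by rw [norm_sub_rev]; exact h.le⟩
  have hne : Nonempty t := ⟨(hmem 0 (by simp)).choose⟩
  choose! code hcode using hmem
  exact ⟨t, hft, inferInstance, fun a => a, code, fun a => by simpa using ht a.2, hcode⟩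

lemma norm_mul_conj_sub_le {a b a' b' : ℂ} {ε : ℝ} (ha : ‖a‖ ≤ 1) (hb' : ‖b'‖ ≤ 1)
    (h : ‖a' - a‖ ≤ ε) (h' : ‖b' - b‖ ≤ ε) : ‖a' * conj b' - a * conj b‖ ≤ 2 * ε := by
  have e : a' * conj b' - a * conj b = (a' - a) * conj b' + a * conj (b' - b) := by
    rw [map_sub]; ring
  rw [e]
  refine (norm_add_le _ _).trans ?_
  rw [norm_mul, norm_mul, RCLike.norm_conj, RCLike.norm_conj]
  nlinarith [norm_nonneg (a' - a), norm_nonneg (b' - b), norm_nonneg a, norm_nonneg b']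

lemma UMul.corr_dilate {f : F[X] → ℂ} (hf : UMul f) {P : F[X]} (hP : P.Monic) (L : F[X]) :
    cmean (fun G => f (P * G + P * L) * conj (f (P * G))) = corr f L := by
  unfold corr
  congr 1; ext G
  rw [← mul_add, hf.map_mul _ _ hP, hf.map_mul _ _ hP, _root_.map_mul]
  linear_combination (f (G + L) * conj (f G)) * hf.mul_conj_self hP

lemma corr_average {f : F[X] → ℂ} (hf : UMul f) (n D : ℕ) {ε : ℝ} (hε : 0 < ε) :
    ∃ d, D ≤ d ∧ 20 ≤ d ∧ ∀ L ∈ V F n,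
      ‖((Irr F d).card : ℂ) * corr f L - ∑ P ∈ Irr F d, corr f (P * L)‖ ≤
        ε * (Irr F d).card := by
  obtain ⟨A, hA, hA', val, code, hval, hcode⟩ := exists_code (ε / 16) (by positivity)
  set lam := min (1 / 2) (ε / 16) with hlam
  have hl0 : 0 < lam := lt_min (by norm_num) (by positivity)
  have hl1 : lam ≤ 1 / 2 := min_le_left _ _
  have hl2 : lam ≤ ε / 16 := min_le_right _ _
  obtain ⟨d, hDd, hd, hI⟩ := exists_small_information (fun G => code (f G)) n D (lam ^ 2)
    (by positivity)
  refine ⟨d, hDd, hd, fun L hL => ?_⟩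
  set c := ((Irr F d).card : ℝ) with hc
  have hc0 : 0 ≤ c := Nat.cast_nonneg _
  set Δ := ((Irr F d).card : ℂ) * corr f L - ∑ P ∈ Irr F d, corr f (P * L) with hΔ
  obtain ⟨θ, hθ, hθΔ⟩ := exists_unit_re Δ
  set g : F[X] → ℂ := fun G => val (code (f G)) with hg
  have hg1 : ∀ G, ‖g G‖ ≤ 1 := fun G => hval _
  have hgf : ∀ G, ‖g G - f G‖ ≤ ε / 16 := fun G => hcode _ (hf.norm_le G)
  have hPL : ∀ P : Irr F d, ∀ y : V F d, -(y : F[X]) + P * L ∈ V F (d + n) := fun P y =>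
    add_mem_V (V_mono (Nat.le_add_right _ _) (neg_mem_V y.2))
      (mul_mem_V (mem_Irr.1 P.2).1 (mem_Irr.1 P.2).2.1 hL)
  have hy : ∀ y : V F d, -(y : F[X]) ∈ V F (d + n) := fun y =>
    V_mono (Nat.le_add_right _ _) (neg_mem_V y.2)
  have hre : ∀ a b : ℂ, ‖a‖ ≤ 1 → ‖b‖ ≤ 1 → |(θ * (a * conj b)).re| ≤ 1 := by
    intro a b ha hb
    refine (Complex.abs_re_le_norm _).trans ?_
    rw [norm_mul, norm_mul, RCLike.norm_conj, hθ, one_mul]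
    exact mul_le_one₀ ha (norm_nonneg _) hb
  set k : F[X] → F[X] → ℝ := fun P G => (θ * (g (G + P * L) * conj (g G))).re with hk
  have hkb : ∀ P, Bdd (k P) := fun P => ⟨1, fun G => hre _ _ (hg1 _) (hg1 _)⟩
  have key := mean_decouple (word (fun G => code (f G)) (d + n)) d
    (fun P w y => (θ * (val (w ⟨_, hPL P y⟩) * conj (val (w ⟨_, hy y⟩)))).re)
    (fun P w y => hre _ _ (hval _) (hval _)) lam hl0.le hl1
  have hmain : ∀ P : Irr F d, (θ * corr f L).re - (θ * corr f (P * L)).re - ε / 4 ≤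
      mean (fun G => k P (G - G %ₘ (P : F[X])) - (qr F ^ d)⁻¹ * ∑ y : V F d, k P (G - y)) := by
    intro P
    have hPm := (mem_Irr.1 P.2).1
    have e1 : mean (fun G : F[X] => ∑ y : V F d, k P (G - y)) = qr F ^ d * mean (k P) := by
      rw [mean_sum]
      simp only [sub_eq_add_neg, mean_translate (hkb P)]
      rw [Finset.sum_const, nsmul_eq_mul, Finset.card_univ, Fintype.card_coe, card_V_real]
    rw [mean_sub, mean_const_mul, e1, mean_sub_modByMonic (hkb P) hPm]
    have hq := pow_pos (qr_pos (F := F)) d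
    rw [inv_mul_cancel_left₀ hq.ne']
    have hclose : ∀ u v : F[X] → F[X],
        |mean (fun G => (θ * (g (u G) * conj (g (v G)))).re) -
          (θ * cmean (fun G => f (u G) * conj (f (v G)))).re| ≤ ε / 8 := by
      intro u v
      rw [← cmean_const_mul, ← cmean_re, ← Complex.sub_re, ← cmean_sub]
      refine (Complex.abs_re_le_norm _).trans (norm_cmean_le_of_le fun G => ?_)
      rw [← mul_sub, norm_mul, hθ, one_mul]
      exact (norm_mul_conj_sub_le (hf.norm_le _) (hg1 _) (hgf _) (hgf _)).trans (by linarith)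
    have h1 := abs_le.1 (hclose (fun G => (P : F[X]) * G + P * L) (fun G => (P : F[X]) * G))
    have h2 := abs_le.1 (hclose (fun G => G + (P : F[X]) * L) (fun G => G))
    rw [hf.corr_dilate hPm] at h1
    have : cmean (fun G => f (G + (P : F[X]) * L) * conj (f G)) = corr f (P * L) := rfl
    rw [this] at h2
    simp only [hk]
    linarith [h1.1, h2.2]
  have hsum := Finset.sum_le_sum fun (P : Irr F d) (_ : P ∈ Finset.univ) => hmain P
  have hL' : ∑ P : Irr F d, ((θ * corr f L).re - (θ * corr f (P * L)).re - ε / 4) =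
      ‖Δ‖ - ε / 4 * c := by
    rw [← hθΔ, hΔ, mul_sub, Complex.sub_re, Finset.mul_sum, Complex.re_sum,
      Finset.sum_sub_distrib, Finset.sum_sub_distrib,
      Finset.sum_coe_sort (Irr F d) (fun P => (θ * corr f (P * L)).re)]
    simp only [Finset.sum_const, Finset.card_univ, Fintype.card_coe, nsmul_eq_mul]
    have : (θ * ((Irr F d).card * corr f L)).re = c * (θ * corr f L).re := by
      rw [mul_left_comm, ← Complex.ofReal_natCast, Complex.re_ofReal_mul]
    rw [this]; ring
  rw [hL'] at hsum
  have hkey : lam * (‖Δ‖ - ε / 4 * c) ≤ lam ^ 2 * c + 4 * lam ^ 2 * c := by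
    refine (mul_le_mul_of_nonneg_left hsum hl0.le).trans (le_trans (le_of_eq ?_) (key.trans ?_))
    · refine congrArg (fun x => lam * x)
        (Finset.sum_congr rfl fun P _ => congrArg mean (funext fun G => ?_))
      have e : ∀ y : V F d, k P (G - y) = (θ * (val (word (fun G => code (f G)) (d + n) G
          ⟨_, hPL P y⟩) * conj (val (word (fun G => code (f G)) (d + n) G ⟨_, hy y⟩)))).re := by
        intro y
        simp only [hk, hg, shifts]
        rw [← add_assoc, sub_eq_add_neg]
      rw [← e (residues d G P), Finset.sum_congr rfl fun y _ => e y]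
      rfl
    · linarith
  have : ‖Δ‖ - ε / 4 * c ≤ 5 * lam * c := by
    have : lam * (‖Δ‖ - ε / 4 * c) ≤ lam * (5 * lam * c) := by linarith
    exact le_of_mul_le_mul_left this hl0
  nlinarith

lemma corr_zero {f : F[X] → ℂ} (hf : UMul f) : corr f 0 = 1 := by
  have h : corr f 0 = cmean fun _ : F[X] => ((1 : ℝ) : ℂ) := by
    refine cmean_congr ((hf.cbdd.comp _).mul hf.cbdd.conj) (CBdd.const _) ?_
    refine (eventually_big_degree 0).mono fun G hG => ?_
    rw [add_zero, hf.mul_conj_self hG.1]; simp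
  rw [h, cmean_ofReal, mean_const]; simp

lemma cmean_shift_mul_conj {f : F[X] → ℂ} (hf : UMul f) (L L' : F[X]) :
    cmean (fun G => f (G + L) * conj (f (G + L'))) = corr f (L - L') := by
  have h := cmean_translate (h := fun G => f (G + (L - L')) * conj (f G))
    ((hf.cbdd.comp _).mul hf.cbdd.conj) L'
  rw [corr, ← h]
  congr 1; ext G
  rw [show G + L' + (L - L') = G + L by ring]

lemma mean_normSq_sum {f : F[X] → ℂ} (hf : UMul f) (s : Finset F[X]) (a : F[X] → ℂ)
    (u : F[X] → F[X]) :
    ((mean fun G => ‖∑ L ∈ s, a L * f (G + u L)‖ ^ 2 : ℝ) : ℂ) =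
      ∑ L ∈ s, ∑ L' ∈ s, a L * conj (a L') * corr f (u L - u L') := by
  rw [← cmean_ofReal]
  have e : ∀ G, ((‖∑ L ∈ s, a L * f (G + u L)‖ ^ 2 : ℝ) : ℂ) = ∑ L ∈ s, ∑ L' ∈ s,
      a L * conj (a L') * (f (G + u L) * conj (f (G + u L'))) := by
    intro G
    rw [← Complex.normSq_eq_norm_sq, ← Complex.mul_conj, map_sum, Finset.sum_mul_sum]
    refine Finset.sum_congr rfl fun L _ => Finset.sum_congr rfl fun L' _ => ?_
    rw [map_mul]; ring
  simp only [e]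
  rw [cmean_sum]
  refine Finset.sum_congr rfl fun L _ => ?_
  rw [cmean_sum]
  refine Finset.sum_congr rfl fun L' _ => ?_
  rw [cmean_const_mul, cmean_shift_mul_conj hf]

/-- The average of `f` over the `Q`-multiples of height below `m` around `G`. -/
def Phi (f : F[X] → ℂ) (Q : F[X]) (m : ℕ) (G : F[X]) : ℂ :=
  ((qr F : ℂ) ^ m)⁻¹ * ∑ M ∈ V F m, f (G + Q * M)

lemma qrC_pow_ne_zero (m : ℕ) : (qr F : ℂ) ^ m ≠ 0 :=
  pow_ne_zero _ (Complex.ofReal_ne_zero.2 qr_pos.ne')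

lemma norm_qrC_pow (m : ℕ) : ‖(qr F : ℂ) ^ m‖ = qr F ^ m := by
  rw [norm_pow, Complex.norm_real, Real.norm_of_nonneg qr_pos.le]

lemma norm_average_le {m : ℕ} {h : F[X] → ℂ} {C : ℝ} (hC : ∀ M ∈ V F m, ‖h M‖ ≤ C) :
    ‖((qr F : ℂ) ^ m)⁻¹ * ∑ M ∈ V F m, h M‖ ≤ C := by
  rw [norm_mul, norm_inv, norm_qrC_pow, inv_mul_le_iff₀ (pow_pos qr_pos _)]
  refine (norm_sum_le _ _).trans ((Finset.sum_le_sum hC).trans ?_)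
  rw [Finset.sum_const, nsmul_eq_mul, card_V_real]

lemma norm_Phi_le {f : F[X] → ℂ} (hf : UMul f) (Q : F[X]) (m : ℕ) (G : F[X]) :
    ‖Phi f Q m G‖ ≤ 1 := norm_average_le fun _ _ => hf.norm_le _

lemma Phi_cbdd {f : F[X] → ℂ} (hf : UMul f) (Q : F[X]) (m : ℕ) : CBdd (Phi f Q m) :=
  ⟨1, norm_Phi_le hf Q m⟩

lemma normSq_average_le (m : ℕ) (h : F[X] → ℂ) :
    ‖((qr F : ℂ) ^ m)⁻¹ * ∑ M ∈ V F m, h M‖ ^ 2 ≤ (qr F ^ m)⁻¹ * ∑ M ∈ V F m, ‖h M‖ ^ 2 := by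
  have hq : 0 < qr F ^ m := pow_pos qr_pos _
  rw [norm_mul, norm_inv, norm_qrC_pow, mul_pow, inv_pow]
  have h1 : ‖∑ M ∈ V F m, h M‖ ^ 2 ≤ qr F ^ m * ∑ M ∈ V F m, ‖h M‖ ^ 2 := by
    rw [← card_V_real]
    refine le_trans ?_ sq_sum_le_card_mul_sum_sq
    exact pow_le_pow_left₀ (norm_nonneg _) (norm_sum_le _ _) 2
  rw [inv_mul_le_iff₀ (by positivity)]
  refine h1.trans (le_of_eq ?_)
  field_simp

lemma Phi_mul_average (f : F[X] → ℂ) (Q : F[X]) {S : F[X]} {k : ℕ} (hS : S.Monic)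
    (hk : S.natDegree = k) (m : ℕ) (G : F[X]) :
    ((qr F : ℂ) ^ k)⁻¹ * ∑ M ∈ V F k, Phi f (Q * S) m (G + Q * M) = Phi f Q (m + k) G := by
  simp only [Phi]
  rw [← Finset.mul_sum, ← mul_assoc, ← mul_inv, ← pow_add, add_comm k m, add_comm m k,
    sum_V_division hS hk]
  congr 1
  refine Finset.sum_congr rfl fun M _ => Finset.sum_congr rfl fun N _ => ?_
  congr 1; ring

lemma mean_normSq_Phi_anti {f : F[X] → ℂ} (hf : UMul f) (Q : F[X]) :
    Antitone fun m => mean fun G => ‖Phi f Q m G‖ ^ 2 := by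
  refine antitone_nat_of_succ_le fun m => ?_
  have e : ∀ G, Phi f Q (m + 1) G =
      ((qr F : ℂ) ^ 1)⁻¹ * ∑ c ∈ V F 1, Phi f Q m (G + Q * X ^ m * c) := by
    intro G
    simp only [Phi]
    rw [← Finset.mul_sum, ← mul_assoc, ← mul_inv, ← pow_add, add_comm 1 m,
      sum_V_division (monic_X_pow m) (natDegree_X_pow m), Finset.sum_comm]
    congr 1
    refine Finset.sum_congr rfl fun M _ => Finset.sum_congr rfl fun N _ => ?_
    congr 1; ring
  have hb := (Phi_cbdd hf Q m).normSq
  calc mean (fun G => ‖Phi f Q (m + 1) G‖ ^ 2)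
      ≤ mean (fun G => (qr F ^ 1)⁻¹ * ∑ c ∈ V F 1, ‖Phi f Q m (G + Q * X ^ m * c)‖ ^ 2) := by
        refine mean_mono (Phi_cbdd hf Q _).normSq ?_ (Eventually.of_forall fun G => ?_)
        · refine ⟨1, fun G => ?_⟩
          rw [abs_of_nonneg (by have := qr_pos (F := F); positivity),
            inv_mul_le_iff₀ (pow_pos qr_pos _), mul_one, ← card_V_real, Finset.card_eq_sum_ones]
          push_cast
          exact Finset.sum_le_sum fun c _ => pow_le_one₀ (norm_nonneg _) (norm_Phi_le hf _ _ _)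
        · rw [e]; exact normSq_average_le _ _
    _ = _ := by
        rw [mean_const_mul, mean_sum]
        rw [Finset.sum_congr rfl fun c _ => mean_translate hb (Q * X ^ m * c),
          Finset.sum_const, nsmul_eq_mul, card_V_real]
        rw [inv_mul_cancel_left₀ (pow_pos qr_pos _).ne']

lemma card_V_complex (m : ℕ) : ((V F m).card : ℂ) = (qr F : ℂ) ^ m := by
  rw [← Complex.ofReal_natCast, card_V_real]; push_cast; rfl

/-- The spectral weight of `f` at the additive character `χ` on scale `m` along multiples of
`Q`. -/
def spec (f : F[X] → ℂ) (Q : F[X]) (m : ℕ) (χ : AddChar F[X] ℂ) : ℝ :=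
  mean fun G => ‖∑ M ∈ V F m, ((qr F : ℂ) ^ m)⁻¹ * χ (-M) * f (G + Q * M)‖ ^ 2

lemma spec_eq {f : F[X] → ℂ} (hf : UMul f) (Q : F[X]) (m : ℕ) (χ : AddChar F[X] ℂ)
    (hχ : ∀ M, conj (χ M) = χ (-M)) :
    (spec f Q m χ : ℂ) = ((qr F : ℂ) ^ m)⁻¹ * ∑ M ∈ V F m, χ (-M) * corr f (Q * M) := by
  rw [spec, mean_normSq_sum hf (V F m) (fun M => ((qr F : ℂ) ^ m)⁻¹ * χ (-M)) (fun M => Q * M),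
    Finset.sum_comm]
  have hz : conj ((qr F : ℂ) ^ m)⁻¹ = ((qr F : ℂ) ^ m)⁻¹ := by
    rw [map_inv₀, map_pow, Complex.conj_ofReal]
  have hz0 := qrC_pow_ne_zero (F := F) m
  have h : ∀ L' ∈ V F m, ∑ L ∈ V F m, ((qr F : ℂ) ^ m)⁻¹ * χ (-L) *
      conj (((qr F : ℂ) ^ m)⁻¹ * χ (-L')) * corr f (Q * L - Q * L') =
      ((qr F : ℂ) ^ m)⁻¹ * ((qr F : ℂ) ^ m)⁻¹ * ∑ M ∈ V F m, χ (-M) * corr f (Q * M) := by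
    intro L' hL'
    rw [← sum_V_add (neg_mem_V hL') fun M => χ (-M) * corr f (Q * M), Finset.mul_sum]
    refine Finset.sum_congr rfl fun L _ => ?_
    rw [map_mul, hz, hχ, neg_neg, neg_add, neg_neg, AddChar.map_add_eq_mul, mul_add, mul_neg,
      ← sub_eq_add_neg]
    ring
  rw [Finset.sum_congr rfl h, Finset.sum_const, nsmul_eq_mul, card_V_complex, ← mul_assoc,
    ← mul_assoc, mul_inv_cancel₀ hz0, one_mul]

lemma mean_normSq_Phi {f : F[X] → ℂ} (hf : UMul f) (Q : F[X]) (m : ℕ) :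
    ((mean fun G => ‖Phi f Q m G‖ ^ 2 : ℝ) : ℂ) =
      ((qr F : ℂ) ^ m)⁻¹ * ∑ M ∈ V F m, corr f (Q * M) := by
  have h := spec_eq hf Q m 1 (by simp)
  simp only [AddChar.one_apply, one_mul, mul_one, spec, ← Finset.mul_sum] at h
  exact h

lemma exists_dual (N : ℕ) : ∃ (I : Type) (_ : Fintype I) (χ : I → AddChar F[X] ℂ),
    (∀ i M, conj (χ i M) = χ i (-M)) ∧
      ∀ L ∈ V F N, ∑ i, χ i L = if L = 0 then (qr F : ℂ) ^ N else 0 := by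
  classical
  have hfin : Finite (degreeLT F N) := finite_degreeLT (F := F) N
  have hft : Fintype (degreeLT F N) := Fintype.ofFinite _
  have hmem : ∀ G : F[X], modByMonicHom (X ^ N) G ∈ degreeLT F N := fun G => by
    rw [mem_degreeLT, ← mem_V]
    exact modByMonic_mem_V (monic_X_pow N) (natDegree_X_pow N) G
  let π : F[X] →+ degreeLT F N :=
    (LinearMap.codRestrict (degreeLT F N) (modByMonicHom (X ^ N)) hmem).toAddMonoidHom
  refine ⟨AddChar (degreeLT F N) ℂ, inferInstance, fun ψ => ψ.compAddMonoidHom π, ?_, ?_⟩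
  · intro ψ M
    rw [AddChar.compAddMonoidHom_apply, AddChar.compAddMonoidHom_apply, map_neg,
      AddChar.map_neg_eq_conj]
  · intro L hL
    simp only [AddChar.compAddMonoidHom_apply]
    rw [AddChar.sum_apply_eq_ite]
    have hπ : ((π L : degreeLT F N) : F[X]) = L := by
      change L %ₘ X ^ N = L
      rw [modByMonic_eq_self_iff (monic_X_pow N), degree_X_pow]
      exact mem_V.1 hL
    have h0 : π L = 0 ↔ L = 0 := by
      rw [← Subtype.coe_inj, hπ]; rfl
    have hc : ((Fintype.card (degreeLT F N) : ℕ) : ℂ) = (qr F : ℂ) ^ N := by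
      rw [← card_V_complex]
      congr 1
      rw [← Nat.card_eq_fintype_card, Nat.card_congr (degreeLTEquiv F N).toEquiv, card_V]
      simp
    rw [hc]
    exact if_congr h0 rfl rfl

lemma spec_nonneg {f : F[X] → ℂ} (hf : UMul f) (Q : F[X]) (m : ℕ) (χ : AddChar F[X] ℂ) : 0 ≤ spec f Q m χ := by
  unfold spec
  refine mean_nonneg (CBdd.normSq (CBdd.sum _ fun M _ => ?_)) fun G => by positivity
  exact (CBdd.const _).mul (hf.cbdd.comp _)

section Spectral
variable {f : F[X] → ℂ} {N : ℕ} {I : Type} [Fintype I] {χ : I → AddChar F[X] ℂ}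

lemma corr_eq_sum_spec (hf : UMul f) (hχ : ∀ i M, conj (χ i M) = χ i (-M))
    (hχs : ∀ L ∈ V F N, ∑ i, χ i L = if L = 0 then (qr F : ℂ) ^ N else 0)
    {L : F[X]} (hL : L ∈ V F N) : corr f L = ∑ i, (spec f 1 N (χ i) : ℂ) * χ i L := by
  have hz0 := qrC_pow_ne_zero (F := F) N
  simp only [fun i => spec_eq hf 1 N (χ i) (hχ i), one_mul, Finset.mul_sum, Finset.sum_mul]
  rw [Finset.sum_comm]
  have h : ∀ M ∈ V F N, ∑ i, ((qr F : ℂ) ^ N)⁻¹ * (χ i (-M) * corr f M) * χ i L =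
      if M = L then corr f M else 0 := by
    intro M hM
    have h1 := hχs (L - M) (sub_mem_V hL hM)
    calc _ = ((qr F : ℂ) ^ N)⁻¹ * corr f M * ∑ i, χ i (L - M) := by
          rw [Finset.mul_sum]
          refine Finset.sum_congr rfl fun i _ => ?_
          rw [sub_eq_add_neg, AddChar.map_add_eq_mul]; ring
      _ = _ := by
          rw [h1]
          by_cases hML : M = L
          · subst hML; simp; field_simp
          · rw [if_neg hML, if_neg (sub_ne_zero.2 (Ne.symm hML)), mul_zero]
  rw [Finset.sum_congr rfl h, Finset.sum_ite_eq' , if_pos hL]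

lemma sum_normSq_corr (hf : UMul f) (hχ : ∀ i M, conj (χ i M) = χ i (-M))
    (hχs : ∀ L ∈ V F N, ∑ i, χ i L = if L = 0 then (qr F : ℂ) ^ N else 0) :
    ∑ L ∈ V F N, ‖corr f L‖ ^ 2 = qr F ^ N * ∑ i, spec f 1 N (χ i) ^ 2 := by
  have hz0 := qrC_pow_ne_zero (F := F) N
  have h1 : ∀ i, ∑ L ∈ V F N, conj (χ i L) * corr f L = (qr F : ℂ) ^ N * spec f 1 N (χ i) := by
    intro i
    rw [spec_eq hf 1 N (χ i) (hχ i), mul_inv_cancel_left₀ hz0]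
    simp only [hχ, one_mul]
  have key : ((∑ L ∈ V F N, ‖corr f L‖ ^ 2 : ℝ) : ℂ) =
      ((qr F ^ N * ∑ i, spec f 1 N (χ i) ^ 2 : ℝ) : ℂ) := by
    simp only [Complex.ofReal_mul, Complex.ofReal_pow, Complex.ofReal_sum]
    calc _ = ∑ L ∈ V F N, conj (∑ i, (spec f 1 N (χ i) : ℂ) * χ i L) * corr f L := by
          refine Finset.sum_congr rfl fun L hL => ?_
          rw [← corr_eq_sum_spec hf hχ hχs hL, mul_comm, Complex.mul_conj,
            Complex.normSq_eq_norm_sq]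
          push_cast; rfl
      _ = ∑ L ∈ V F N, ∑ i, (spec f 1 N (χ i) : ℂ) * (conj (χ i L) * corr f L) := by
          refine Finset.sum_congr rfl fun L _ => ?_
          rw [map_sum, Finset.sum_mul]
          refine Finset.sum_congr rfl fun i _ => ?_
          rw [map_mul, Complex.conj_ofReal, mul_assoc]
      _ = _ := by
          rw [Finset.sum_comm, Finset.mul_sum]
          refine Finset.sum_congr rfl fun i _ => ?_
          rw [← Finset.mul_sum, h1]; ring
  exact_mod_cast key

lemma sum_spec (hf : UMul f) (hχ : ∀ i M, conj (χ i M) = χ i (-M))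
    (hχs : ∀ L ∈ V F N, ∑ i, χ i L = if L = 0 then (qr F : ℂ) ^ N else 0) :
    ∑ i, spec f 1 N (χ i) = 1 := by
  have h := corr_eq_sum_spec hf hχ hχs (zero_mem_V N)
  rw [corr_zero hf] at h
  simp only [AddChar.map_zero_eq_one, mul_one] at h
  exact_mod_cast h.symm

open Classical in
lemma sum_spec_trivial (hf : UMul f) (hχ : ∀ i M, conj (χ i M) = χ i (-M))
    (hχs : ∀ L ∈ V F N, ∑ i, χ i L = if L = 0 then (qr F : ℂ) ^ N else 0)
    {Q : F[X]} {m : ℕ} (hQ : ∀ M ∈ V F m, Q * M ∈ V F N) :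
    ∑ i, (if ∀ M ∈ V F m, χ i (Q * M) = 1 then spec f 1 N (χ i) else 0) =
      mean fun G => ‖Phi f Q m G‖ ^ 2 := by
  have hz0 := qrC_pow_ne_zero (F := F) m
  have key : ((∑ i, (if ∀ M ∈ V F m, χ i (Q * M) = 1 then spec f 1 N (χ i) else 0) : ℝ) : ℂ) =
      ((mean fun G => ‖Phi f Q m G‖ ^ 2 : ℝ) : ℂ) := by
    rw [mean_normSq_Phi hf, Finset.sum_congr rfl fun M hM => corr_eq_sum_spec hf hχ hχs (hQ M hM),
      Finset.sum_comm, Finset.mul_sum,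
      Complex.ofReal_sum]
    refine Finset.sum_congr rfl fun i _ => ?_
    have h : ∑ L ∈ V F m, χ i (Q * L) =
        if ∀ M ∈ V F m, χ i (Q * M) = 1 then (qr F : ℂ) ^ m else 0 :=
      (sum_char_V (mulChar (χ i) Q) m).trans (if_congr Iff.rfl rfl rfl)
    rw [← Finset.mul_sum, h]
    by_cases hM : ∀ M ∈ V F m, χ i (Q * M) = 1
    · rw [if_pos hM, if_pos hM]; field_simp
    · rw [if_neg hM, if_neg hM]; simp
  exact_mod_cast key

end Spectral

/-- `f` has no bias along any arithmetic progression. -/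
def Unbiased (f : F[X] → ℂ) : Prop :=
  ∀ Q : F[X], Q.Monic → ∀ ε > 0, ∃ m, mean (fun G => ‖Phi f Q m G‖ ^ 2) < ε

lemma spec_le_of_unbiased {f : F[X] → ℂ} (hf : UMul f) (hub : Unbiased f) (n : ℕ)
    (ψ : AddChar F[X] ℂ) (hψ : ∀ M, conj (ψ M) = ψ (-M)) :
    spec f 1 n ψ ≤ 128 * (qr F ^ n)⁻¹ := by
  classical
  have hq := qr_pos (F := F)
  refine le_of_forall_pos_le_add fun ε hε => ?_
  set Z := (prodV F n).natDegree with hZ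
  set B := ((MonLE F Z).card : ℝ) with hB
  have hB0 : 0 ≤ B := Nat.cast_nonneg _
  obtain ⟨m₀, hm₀⟩ : ∃ m₀, ∀ Q ∈ MonLE F Z, ∀ m, m₀ ≤ m →
      mean (fun G => ‖Phi f Q m G‖ ^ 2) ≤ ε / (2 * (B + 1)) := by
    have h : ∀ Q : F[X], ∃ m₀, Q ∈ MonLE F Z → ∀ m, m₀ ≤ m →
        mean (fun G => ‖Phi f Q m G‖ ^ 2) ≤ ε / (2 * (B + 1)) := by
      intro Q
      by_cases hQ : Q ∈ MonLE F Z
      · obtain ⟨m, hm⟩ := hub Q (mem_MonLE.1 hQ).1 (ε / (2 * (B + 1))) (by positivity)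
        exact ⟨m, fun _ m' hm' => (mean_normSq_Phi_anti hf Q hm').trans hm.le⟩
      · exact ⟨0, fun h => absurd h hQ⟩
    choose m₁ hm₁ using h
    refine ⟨(MonLE F Z).sup m₁, fun Q hQ m hm => hm₁ Q hQ m ((Finset.le_sup hQ).trans hm)⟩
  obtain ⟨d, hDd, hd, hcorr⟩ := corr_average hf n (4 * n + 16 + m₀ + Z) (half_pos hε)
  obtain ⟨I, hI, χ, hχ, hχs⟩ := exists_dual (F := F) (d + n)
  set c := ((Irr F d).card : ℝ) with hc
  have hcpos : 0 < c := by
    have h1 := qr_pow_le_card_Irr (F := F) d hd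
    have h2 : 0 < qr F ^ d := pow_pos hq d
    have h3 : 0 < 2 * (d : ℝ) * c := h2.trans_le h1
    exact pos_of_mul_pos_right h3 (by positivity)
  set A : I → ℝ := fun i => (((Irr F d).filter fun P => ∀ L ∈ V F n, χ i (P * L) = ψ L).card : ℝ)
    with hA
  have hAc : ∀ i, A i ≤ c := fun i => by
    simp only [hA, hc]; exact_mod_cast Finset.card_filter_le _ _
  have e1 : ∑ P ∈ Irr F d, ((qr F : ℂ) ^ n)⁻¹ * ∑ L ∈ V F n, ψ (-L) * corr f (P * L) =
      ((∑ i, spec f 1 (d + n) (χ i) * A i : ℝ) : ℂ) := by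
    have h1 : ∀ P ∈ Irr F d, ((qr F : ℂ) ^ n)⁻¹ * ∑ L ∈ V F n, ψ (-L) * corr f (P * L) =
        ∑ i, (spec f 1 (d + n) (χ i) : ℂ) *
          (if ∀ L ∈ V F n, χ i (P * L) = ψ L then 1 else 0) := by
      intro P hP
      have h2 : ∀ L ∈ V F n, ψ (-L) * corr f (P * L) =
          ∑ i, (spec f 1 (d + n) (χ i) : ℂ) * (χ i (P * L) * ψ⁻¹ L) := by
        intro L hL
        rw [corr_eq_sum_spec hf hχ hχs (mul_mem_V (mem_Irr.1 hP).1 (mem_Irr.1 hP).2.1 hL),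
          Finset.mul_sum]
        refine Finset.sum_congr rfl fun i _ => ?_
        rw [AddChar.inv_apply]; ring
      rw [Finset.sum_congr rfl h2, Finset.sum_comm, Finset.mul_sum]
      refine Finset.sum_congr rfl fun i _ => ?_
      have h3 : ∑ L ∈ V F n, χ i (P * L) * ψ⁻¹ L =
          if ∀ L ∈ V F n, χ i (P * L) = ψ L then (qr F : ℂ) ^ n else 0 := by
        refine (sum_char_V (mulChar (χ i) P * ψ⁻¹) n).trans (if_congr ?_ rfl rfl)
        refine forall₂_congr fun L _ => ?_
        rw [AddChar.mul_apply, mulChar_apply, AddChar.inv_apply', mul_inv_eq_one₀]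
        exact (AddChar.val_isUnit ψ L).ne_zero
      have hz0 := qrC_pow_ne_zero (F := F) n
      rw [← Finset.mul_sum, h3]
      by_cases hM : ∀ L ∈ V F n, χ i (P * L) = ψ L
      · rw [if_pos hM, if_pos hM]; field_simp
      · rw [if_neg hM, if_neg hM]; simp
    rw [Finset.sum_congr rfl h1, Finset.sum_comm, Complex.ofReal_sum]
    refine Finset.sum_congr rfl fun i _ => ?_
    rw [← Finset.mul_sum, Finset.sum_boole, Complex.ofReal_mul]
    simp [hA]
  have e2 : ‖((c * spec f 1 n ψ - ∑ i, spec f 1 (d + n) (χ i) * A i : ℝ) : ℂ)‖ ≤ ε / 2 * c := by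
    rw [Complex.ofReal_sub, ← e1, Complex.ofReal_mul, spec_eq hf 1 n ψ hψ, ← Finset.mul_sum,
      mul_left_comm, ← mul_sub, Finset.sum_comm, Finset.mul_sum, ← Finset.sum_sub_distrib]
    refine norm_average_le fun L hL => ?_
    have h3 : ‖ψ (-L)‖ = 1 := by
      have h4 : ψ (-L) * conj (ψ (-L)) = 1 := by
        rw [hψ, ← AddChar.map_add_eq_mul]; simp
      rw [Complex.mul_conj, Complex.normSq_eq_norm_sq] at h4
      have h5 : ‖ψ (-L)‖ ^ 2 = 1 := by exact_mod_cast h4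
      nlinarith [norm_nonneg (ψ (-L))]
    rw [one_mul, ← Finset.mul_sum, mul_left_comm, ← mul_sub, norm_mul, h3, one_mul]
    have := hcorr L hL
    simpa [hc] using this
  rw [Complex.norm_real, Real.norm_eq_abs] at e2
  have e3 := (abs_le.1 e2).2
  set E : I → F[X] → ℝ := fun i Q =>
    if ∀ M ∈ V F (d - Z), χ i (Q * M) = 1 then spec f 1 (d + n) (χ i) else 0 with hE
  have hE0 : ∀ i Q, 0 ≤ E i Q := fun i Q => by
    simp only [hE]; split_ifs
    · exact spec_nonneg hf _ _ _
    · exact le_rfl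
  have e4 : ∀ i, spec f 1 (d + n) (χ i) * A i ≤
      spec f 1 (d + n) (χ i) * (128 * (qr F ^ n)⁻¹ * c) + c * ∑ Q ∈ MonLE F Z, E i Q := by
    intro i
    have h0 := spec_nonneg hf 1 (d + n) (χ i)
    have hs : 0 ≤ ∑ Q ∈ MonLE F Z, E i Q := Finset.sum_nonneg fun Q _ => hE0 i Q
    rcases card_Irr_char_le (χ i) ψ n d (by omega) with ⟨Q, hQm, hQd, hQ⟩ | h
    · have h1 : spec f 1 (d + n) (χ i) ≤ ∑ Q ∈ MonLE F Z, E i Q := by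
        have h2 : E i Q = spec f 1 (d + n) (χ i) := if_pos hQ
        rw [← h2]
        exact Finset.single_le_sum (fun Q _ => hE0 i Q) (mem_MonLE.2 ⟨hQm, hQd⟩)
      have h2 : spec f 1 (d + n) (χ i) * A i ≤ (∑ Q ∈ MonLE F Z, E i Q) * c :=
        mul_le_mul h1 (hAc i) (Nat.cast_nonneg _) hs
      have h3 : 0 ≤ spec f 1 (d + n) (χ i) * (128 * (qr F ^ n)⁻¹ * c) := by positivity
      linarith
    · have h1 := qr_pow_le_card_Irr (F := F) d hd
      have hd0 : (0 : ℝ) < d := by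
        have : 0 < d := by omega
        exact_mod_cast this
      have h2 : A i ≤ 128 * (qr F ^ n)⁻¹ * c := by
        have h3 : A i * d ≤ 128 * (qr F ^ n)⁻¹ * c * d := by
          refine le_trans ?_ (h.trans ?_)
          · apply le_of_eq; simp only [hA]
          · calc 64 * (qr F ^ d / qr F ^ n) ≤ 64 * (2 * d * c / qr F ^ n) := by gcongr
              _ = _ := by ring
        exact le_of_mul_le_mul_right h3 hd0
      have h3 := mul_le_mul_of_nonneg_left h2 h0
      have h4 : 0 ≤ c * ∑ Q ∈ MonLE F Z, E i Q := by positivity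
      linarith
  have e5 : ∑ i, ∑ Q ∈ MonLE F Z, E i Q ≤ ε / 2 := by
    rw [Finset.sum_comm]
    have h1 : ∀ Q ∈ MonLE F Z, ∑ i, E i Q ≤ ε / (2 * (B + 1)) := by
      intro Q hQ
      have hQ' := mem_MonLE.1 hQ
      have h2 := sum_spec_trivial hf hχ hχs (Q := Q) (m := d - Z) fun M hM =>
        V_mono (by omega) (mul_mem_V hQ'.1 rfl hM)
      refine le_trans (le_of_eq ?_) (hm₀ Q hQ (d - Z) (by omega))
      rw [← h2]
    refine (Finset.sum_le_sum h1).trans ?_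
    rw [Finset.sum_const, nsmul_eq_mul, ← hB, ← mul_div_assoc, div_le_div_iff₀ (by positivity)
      (by norm_num)]
    nlinarith
  have e6 : ∑ i, spec f 1 (d + n) (χ i) * A i ≤ 128 * (qr F ^ n)⁻¹ * c + c * (ε / 2) := by
    refine (Finset.sum_le_sum fun i _ => e4 i).trans ?_
    rw [Finset.sum_add_distrib, ← Finset.sum_mul, sum_spec hf hχ hχs, one_mul, ← Finset.mul_sum]
    gcongr
  have : c * spec f 1 n ψ ≤ c * (128 * (qr F ^ n)⁻¹ + ε) := by nlinarith
  exact le_of_mul_le_mul_left this hcpos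

lemma corr_eq_zero_of_unbiased {f : F[X] → ℂ} (hf : UMul f) (hub : Unbiased f) {L : F[X]}
    (hL : L ≠ 0) : corr f L = 0 := by
  classical
  have hq := qr_pos (F := F)
  have hsum : ∀ n, ∑ L ∈ V F n, ‖corr f L‖ ^ 2 ≤ 128 := by
    intro n
    obtain ⟨I, hI, χ, hχ, hχs⟩ := exists_dual (F := F) n
    have hqn : 0 < qr F ^ n := pow_pos hq n
    rw [sum_normSq_corr hf hχ hχs]
    have h1 : ∑ i, spec f 1 n (χ i) ^ 2 ≤ 128 * (qr F ^ n)⁻¹ := by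
      calc _ ≤ ∑ i, 128 * (qr F ^ n)⁻¹ * spec f 1 n (χ i) := by
            refine Finset.sum_le_sum fun i _ => ?_
            rw [sq]
            exact mul_le_mul_of_nonneg_right (spec_le_of_unbiased hf hub n _ (hχ i))
              (spec_nonneg hf _ _ _)
        _ = _ := by rw [← Finset.mul_sum, sum_spec hf hχ hχs, mul_one]
    calc _ ≤ qr F ^ n * (128 * (qr F ^ n)⁻¹) := by gcongr
      _ = 128 := by field_simp
  rw [← norm_eq_zero]
  refine le_antisymm (le_of_forall_pos_le_add fun ε hε => ?_) (norm_nonneg _)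
  obtain ⟨n, hn⟩ := exists_mem_V L
  obtain ⟨D, hD⟩ := exists_nat_gt (128 / (ε / 2) ^ 2)
  obtain ⟨d, hDd, hd, h⟩ := corr_average hf n D (half_pos hε)
  set c := ((Irr F d).card : ℝ) with hc
  have hcd : (d : ℝ) ≤ c := by
    have h1 := qr_pow_le_card_Irr (F := F) d hd
    have h2 : (2 : ℝ) ^ d ≤ qr F ^ d := pow_le_pow_left₀ (by norm_num) two_le_qr d
    have h3 : (8 : ℝ) * d ^ 2 ≤ 2 ^ d := by exact_mod_cast eight_sq_le_two_pow d (by omega)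
    have hd0 : (0 : ℝ) < d := by
      have : 0 < d := by omega
      exact_mod_cast this
    have h4 : (d : ℝ) * (4 * d) ≤ d * c := by nlinarith
    have := le_of_mul_le_mul_left h4 hd0
    linarith
  have hcD : 128 / (ε / 2) ^ 2 ≤ c := by
    have : (D : ℝ) ≤ d := by exact_mod_cast hDd
    linarith
  have hc0 : 0 < c := lt_of_lt_of_le (by positivity) hcD
  have h1 : ∑ P ∈ Irr F d, ‖corr f (P * L)‖ ^ 2 ≤ 128 := by
    refine le_trans ?_ (hsum (d + n))
    have : ∑ P ∈ Irr F d, ‖corr f (P * L)‖ ^ 2 =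
        ∑ M ∈ (Irr F d).image (fun P => P * L), ‖corr f M‖ ^ 2 :=
      (Finset.sum_image (f := fun M => ‖corr f M‖ ^ 2) (g := fun P => P * L)
        fun P _ P' _ he => mul_right_cancel₀ hL he).symm
    rw [this]
    refine Finset.sum_le_sum_of_subset_of_nonneg ?_ fun _ _ _ => by positivity
    intro M hM
    obtain ⟨P, hP, rfl⟩ := Finset.mem_image.1 hM
    exact mul_mem_V (mem_Irr.1 hP).1 (mem_Irr.1 hP).2.1 hn
  have h2 : (∑ P ∈ Irr F d, ‖corr f (P * L)‖) ^ 2 ≤ c * 128 :=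
    sq_sum_le_card_mul_sum_sq.trans (by gcongr)
  have h3 : ∑ P ∈ Irr F d, ‖corr f (P * L)‖ ≤ c * (ε / 2) := by
    refine abs_le_of_sq_le_sq' ?_ (by positivity) |>.2
    refine h2.trans ?_
    rw [div_le_iff₀ (by positivity)] at hcD
    nlinarith
  have h4 : ‖((Irr F d).card : ℂ) * corr f L‖ ≤ c * (ε / 2) + ε / 2 * c := by
    calc _ = ‖(((Irr F d).card : ℂ) * corr f L - ∑ P ∈ Irr F d, corr f (P * L)) +
            ∑ P ∈ Irr F d, corr f (P * L)‖ := by rw [sub_add_cancel]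
      _ ≤ _ := by
          refine (norm_add_le _ _).trans ?_
          have := norm_sum_le (Irr F d) fun P => corr f (P * L)
          linarith [h L hn]
  rw [norm_mul, Complex.norm_natCast] at h4
  rw [zero_add]
  exact le_of_mul_le_mul_left (by linarith) hc0

/-- A unimodular multiplicative function with bounded short sums is biased along some
arithmetic progression. -/
theorem not_unbiased {f : F[X] → ℂ} (hf : UMul f) {C : ℝ}
    (hC : ∀ H : ℕ, ∀ᶠ G in big F, ‖∑ L ∈ V F H, f (G + L)‖ ≤ C) : ¬ Unbiased f := by
  intro hub
  have h : ∀ H, qr F ^ H ≤ C ^ 2 := by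
    intro H
    have h1 := mean_normSq_sum hf (V F H) (fun _ => 1) (fun L => L)
    have h2 : ∀ L ∈ V F H, ∑ L' ∈ V F H, (1 : ℂ) * conj (1 : ℂ) * corr f (L - L') = 1 := by
      intro L hL
      rw [Finset.sum_eq_single_of_mem L hL]
      · rw [sub_self, corr_zero hf]; simp
      · intro L' _ hne
        rw [corr_eq_zero_of_unbiased hf hub (sub_ne_zero.2 (Ne.symm hne)), mul_zero]
    rw [Finset.sum_congr rfl h2, Finset.sum_const, nsmul_eq_mul, mul_one, ← Complex.ofReal_natCast,
      Complex.ofReal_inj, card_V_real] at h1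
    rw [← h1, ← mean_const (F := F) (C ^ 2)]
    simp only [one_mul]
    refine mean_mono (CBdd.normSq (CBdd.sum _ fun L _ => hf.cbdd.comp _)) ⟨|C ^ 2|, fun _ => le_rfl⟩ ?_
    exact (hC H).mono fun G hG => pow_le_pow_left₀ (norm_nonneg _) hG 2
  obtain ⟨H, hH⟩ := pow_unbounded_of_one_lt (C ^ 2) (one_lt_qr (F := F))
  exact absurd (h H) (not_le.2 hH)

/-- Uniformly bounded real families. -/
def RB (h : ℕ → F[X] → ℝ) : Prop := ∃ C, ∀ m G, |h m G| ≤ C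

/-- Uniformly bounded complex families. -/
def CB (h : ℕ → F[X] → ℂ) : Prop := ∃ C, ∀ m G, ‖h m G‖ ≤ C

lemma RB.bdd {h : ℕ → F[X] → ℝ} (hh : RB h) (m : ℕ) : Bdd (h m) :=
  hh.elim fun C hC => ⟨C, hC m⟩

lemma CB.comp {h : ℕ → F[X] → ℂ} (hh : CB h) (φ : ℕ → ℕ) (g : ℕ → F[X] → F[X]) :
    CB fun m G => h (φ m) (g m G) :=
  hh.elim fun C hC => ⟨C, fun _ _ => hC _ _⟩

lemma CB.mul {g h : ℕ → F[X] → ℂ} (hg : CB g) (hh : CB h) : CB fun m G => g m G * h m G := by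
  obtain ⟨A, hA⟩ := hg
  obtain ⟨B, hB⟩ := hh
  refine ⟨A * B, fun m G => ?_⟩
  rw [norm_mul]
  exact mul_le_mul (hA m G) (hB m G) (norm_nonneg _) ((norm_nonneg _).trans (hA m G))

lemma CB.add {g h : ℕ → F[X] → ℂ} (hg : CB g) (hh : CB h) : CB fun m G => g m G + h m G := by
  obtain ⟨A, hA⟩ := hg
  obtain ⟨B, hB⟩ := hh
  exact ⟨A + B, fun m G => (norm_add_le _ _).trans (add_le_add (hA m G) (hB m G))⟩

lemma CB.sub {g h : ℕ → F[X] → ℂ} (hg : CB g) (hh : CB h) : CB fun m G => g m G - h m G := by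
  obtain ⟨A, hA⟩ := hg
  obtain ⟨B, hB⟩ := hh
  exact ⟨A + B, fun m G => (norm_sub_le _ _).trans (add_le_add (hA m G) (hB m G))⟩

lemma CB.conj {h : ℕ → F[X] → ℂ} (hh : CB h) : CB fun m G => conj (h m G) :=
  hh.elim fun C hC => ⟨C, fun m G => by rw [RCLike.norm_conj]; exact hC m G⟩

lemma CB.const (c : ℂ) : CB (F := F) fun _ _ => c := ⟨‖c‖, fun _ _ => le_rfl⟩

lemma CB.const_mul {h : ℕ → F[X] → ℂ} (hh : CB h) (c : ℂ) : CB fun m G => c * h m G :=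
  (CB.const c).mul hh

lemma CB.sum {I : Type*} (s : Finset I) {h : I → ℕ → F[X] → ℂ} (hh : ∀ i ∈ s, CB (h i)) :
    CB fun m G => ∑ i ∈ s, h i m G := by
  classical
  induction s using Finset.induction_on with
  | empty => simpa using CB.const 0
  | insert i s hi ih =>
    simp only [Finset.sum_insert hi]
    exact (hh i (Finset.mem_insert_self i s)).add
      (ih fun j hj => hh j (Finset.mem_insert_of_mem hj))

lemma CB.ite {h : ℕ → F[X] → ℂ} (hh : CB h) (p : ℕ → F[X] → Prop) [∀ m G, Decidable (p m G)] :
    CB fun m G => if p m G then h m G else 0 := by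
  obtain ⟨C, hC⟩ := hh
  refine ⟨C, fun m G => ?_⟩
  beta_reduce
  split_ifs
  · exact hC m G
  · simpa using (norm_nonneg _).trans (hC m G)

lemma CB.re {h : ℕ → F[X] → ℂ} (hh : CB h) : RB fun m G => (h m G).re :=
  hh.elim fun C hC => ⟨C, fun m G => (abs_re_le_norm _).trans (hC m G)⟩

lemma CB.normSq {h : ℕ → F[X] → ℂ} (hh : CB h) : RB fun m G => ‖h m G‖ ^ 2 := by
  obtain ⟨C, hC⟩ := hh
  refine ⟨C ^ 2, fun m G => ?_⟩
  rw [abs_of_nonneg (sq_nonneg _)]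
  exact pow_le_pow_left₀ (norm_nonneg _) (hC m G) 2

lemma abs_mean_le {h : F[X] → ℝ} {C : ℝ} (hC : ∀ G, |h G| ≤ C) : |mean h| ≤ C := by
  have hb : Bdd h := ⟨C, hC⟩
  have hc : ∀ c : ℝ, Bdd (fun _ : F[X] => c) := fun c => ⟨|c|, fun _ => le_rfl⟩
  rw [abs_le]
  constructor
  · rw [← mean_const (F := F) (-C)]
    exact mean_mono (hc _) hb (Eventually.of_forall fun G => (abs_le.1 (hC G)).1)
  · rw [← mean_const (F := F) C]
    exact mean_mono hb (hc _) (Eventually.of_forall fun G => (abs_le.1 (hC G)).2)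

/-- The generalized limit over `m` of the means of `h m`. -/
def E : (ℕ → F[X] → ℝ) →ₗ[ℝ] ℝ :=
  genLim ∘ₗ LinearMap.pi fun m => mean ∘ₗ LinearMap.proj m

lemma E_apply (h : ℕ → F[X] → ℝ) : E h = genLim fun m => mean (h m) := rfl

lemma RB.mean_bounded {h : ℕ → F[X] → ℝ} (hh : RB h) : ∃ C, ∀ m, |mean (h m)| ≤ C :=
  hh.elim fun C hC => ⟨C, fun m => abs_mean_le (hC m)⟩

lemma E_le {h : ℕ → F[X] → ℝ} (hh : RB h) {b : ℝ} (H : ∀ᶠ m in atTop, mean (h m) ≤ b) :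
    E h ≤ b :=
  genLim_le hh.mean_bounded H

lemma E_eq_of_tendsto {h : ℕ → F[X] → ℝ} (hh : RB h) {b : ℝ}
    (H : Tendsto (fun m => mean (h m)) atTop (nhds b)) : E h = b :=
  genLim_eq_of_tendsto hh.mean_bounded H

lemma E_mono_mean {g h : ℕ → F[X] → ℝ} (hg : RB g) (hh : RB h)
    (H : ∀ᶠ m in atTop, mean (g m) ≤ mean (h m)) : E g ≤ E h := by
  have hs : RB (g - h) := by
    obtain ⟨A, hA⟩ := hg
    obtain ⟨B, hB⟩ := hh
    exact ⟨A + B, fun m G => (abs_sub _ _).trans (add_le_add (hA m G) (hB m G))⟩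
  have : E (g - h) ≤ 0 := E_le hs (H.mono fun m hm => by
    rw [Pi.sub_apply, map_sub]; linarith)
  rw [map_sub] at this
  linarith

lemma E_mono {g h : ℕ → F[X] → ℝ} (hg : RB g) (hh : RB h)
    (H : ∀ᶠ m in atTop, ∀ᶠ G in big F, g m G ≤ h m G) : E g ≤ E h :=
  E_mono_mean hg hh (H.mono fun m hm => mean_mono (hg.bdd m) (hh.bdd m) hm)

lemma E_congr_mean {g h : ℕ → F[X] → ℝ} (H : ∀ m, mean (g m) = mean (h m)) : E g = E h := by
  rw [E_apply, E_apply]; simp only [H]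

lemma E_nonneg {h : ℕ → F[X] → ℝ} (hh : RB h) (h0 : ∀ m G, 0 ≤ h m G) : 0 ≤ E h := by
  have := E_mono (g := 0) ⟨0, fun _ _ => by simp⟩ hh
    (Eventually.of_forall fun m => Eventually.of_forall fun G => h0 m G)
  rwa [map_zero] at this

lemma E_const (c : ℝ) : E (F := F) (fun _ _ => c) = c := by
  refine E_eq_of_tendsto ⟨|c|, fun _ _ => le_rfl⟩ ?_
  simp only [mean_const]
  exact tendsto_const_nhds

lemma E_add (g h : ℕ → F[X] → ℝ) : E (fun m G => g m G + h m G) = E g + E h := map_add E g h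

lemma E_const_mul (c : ℝ) (h : ℕ → F[X] → ℝ) : E (fun m G => c * h m G) = c * E h :=
  map_smul E c h

lemma E_sum {I : Type*} (s : Finset I) (h : I → ℕ → F[X] → ℝ) :
    E (fun m G => ∑ i ∈ s, h i m G) = ∑ i ∈ s, E (h i) := by
  rw [← map_sum]
  congr 1
  ext m G
  simp

lemma E_translate {h : ℕ → F[X] → ℝ} (hh : RB h) (L : F[X]) :
    E (fun m G => h m (G + L)) = E h :=
  E_congr_mean fun m => mean_translate (hh.bdd m) L

open Classical in
lemma E_dilate {h : ℕ → F[X] → ℝ} (hh : RB h) {D : F[X]} (hD : D.Monic) :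
    E (fun m G => if D ∣ G then h m G else 0) = (nm D)⁻¹ * E fun m G => h m (D * G) := by
  rw [← E_const_mul]
  refine E_congr_mean fun m => ?_
  rw [mean_const_mul]
  exact mean_dilate (hh.bdd m) hD

/-- The seminorm attached to `E`. -/
def nrm (h : ℕ → F[X] → ℂ) : ℝ := √(E fun m G => ‖h m G‖ ^ 2)

lemma nrm_nonneg (h : ℕ → F[X] → ℂ) : 0 ≤ nrm h := Real.sqrt_nonneg _

lemma nrm_sq {h : ℕ → F[X] → ℂ} (hh : CB h) : nrm h ^ 2 = E fun m G => ‖h m G‖ ^ 2 :=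
  Real.sq_sqrt (E_nonneg hh.normSq fun _ _ => sq_nonneg _)

lemma nrm_mono {g h : ℕ → F[X] → ℂ} (hg : CB g) (hh : CB h)
    (H : ∀ᶠ m in atTop, ∀ᶠ G in big F, ‖g m G‖ ≤ ‖h m G‖) : nrm g ≤ nrm h :=
  Real.sqrt_le_sqrt (E_mono hg.normSq hh.normSq (H.mono fun m hm => hm.mono fun G hG =>
    pow_le_pow_left₀ (norm_nonneg _) hG 2))

lemma nrm_congr {g h : ℕ → F[X] → ℂ} (hg : CB g) (hh : CB h)
    (H : ∀ᶠ m in atTop, ∀ᶠ G in big F, g m G = h m G) : nrm g = nrm h :=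
  le_antisymm (nrm_mono hg hh (H.mono fun m hm => hm.mono fun G hG => by rw [hG]))
    (nrm_mono hh hg (H.mono fun m hm => hm.mono fun G hG => by rw [hG]))

lemma nrm_const (c : ℂ) : nrm (F := F) (fun _ _ => c) = ‖c‖ := by
  rw [nrm, E_const, Real.sqrt_sq (norm_nonneg c)]

lemma nrm_const_mul (c : ℂ) (h : ℕ → F[X] → ℂ) : nrm (fun m G => c * h m G) = ‖c‖ * nrm h := by
  simp only [nrm, norm_mul, mul_pow]
  rw [E_const_mul, Real.sqrt_mul (sq_nonneg _), Real.sqrt_sq (norm_nonneg c)]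

lemma nrm_translate {h : ℕ → F[X] → ℂ} (hh : CB h) (L : F[X]) :
    nrm (fun m G => h m (G + L)) = nrm h := by
  rw [nrm, nrm]
  congr 1
  exact E_translate hh.normSq L

/-- The real inner product attached to `E`. -/
def ip (g h : ℕ → F[X] → ℂ) : ℝ := E fun m G => (g m G * conj (h m G)).re

lemma ip_sum_right {I : Type*} (s : Finset I) (g : ℕ → F[X] → ℂ) (h : I → ℕ → F[X] → ℂ) :
    ip g (fun m G => ∑ i ∈ s, h i m G) = ∑ i ∈ s, ip g (h i) := by
  simp only [ip, map_sum, Finset.mul_sum, re_sum, E_sum]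

lemma ip_comm (g h : ℕ → F[X] → ℂ) : ip g h = ip h g := by
  rw [ip, ip]
  congr 1
  ext m G
  simp only [mul_re, conj_re, conj_im]
  ring

lemma nrm_add_sq {g h : ℕ → F[X] → ℂ} (hg : CB g) (hh : CB h) :
    nrm (fun m G => g m G + h m G) ^ 2 = nrm g ^ 2 + 2 * ip g h + nrm h ^ 2 := by
  rw [nrm_sq (hg.add hh), nrm_sq hg, nrm_sq hh, ip, ← E_const_mul, ← E_add, ← E_add]
  congr 1
  ext m G
  rw [← normSq_eq_norm_sq, normSq_add, normSq_eq_norm_sq, normSq_eq_norm_sq]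
  ring

lemma ip_const_mul_right (c : ℝ) (g h : ℕ → F[X] → ℂ) :
    ip g (fun m G => (c : ℂ) * h m G) = c * ip g h := by
  rw [ip, ip, ← E_const_mul]
  congr 1
  ext m G
  rw [_root_.map_mul, conj_ofReal, mul_left_comm, re_ofReal_mul]

lemma ip_le {g h : ℕ → F[X] → ℂ} (hg : CB g) (hh : CB h) : |ip g h| ≤ nrm g * nrm h := by
  have key : ∀ x : ℝ, 0 ≤ nrm h ^ 2 * (x * x) + (2 * ip g h) * x + nrm g ^ 2 := fun x => by
    have h1 := nrm_add_sq hg (hh.const_mul (x : ℂ))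
    rw [nrm_const_mul, ip_const_mul_right, norm_real, mul_pow, Real.norm_eq_abs, sq_abs] at h1
    nlinarith [sq_nonneg (nrm fun m G => g m G + (x : ℂ) * h m G)]
  have h2 := discrim_le_zero key
  rw [discrim] at h2
  refine abs_le_of_sq_le_sq ?_ (mul_nonneg (nrm_nonneg _) (nrm_nonneg _))
  nlinarith

lemma nrm_add_le {g h : ℕ → F[X] → ℂ} (hg : CB g) (hh : CB h) :
    nrm (fun m G => g m G + h m G) ≤ nrm g + nrm h := by
  refine abs_le_of_sq_le_sq' ?_ (add_nonneg (nrm_nonneg _) (nrm_nonneg _)) |>.2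
  rw [nrm_add_sq hg hh]
  nlinarith [(abs_le.1 (ip_le hg hh)).2]

lemma nrm_sub_le {g h : ℕ → F[X] → ℂ} (hg : CB g) (hh : CB h) :
    nrm (fun m G => g m G - h m G) ≤ nrm g + nrm h := by
  have := nrm_add_le hg (hh.const_mul (-1))
  rw [nrm_const_mul] at this
  simpa [sub_eq_add_neg] using this

lemma nrm_le_add_sub {g h : ℕ → F[X] → ℂ} (hg : CB g) (hh : CB h) :
    nrm g ≤ nrm h + nrm (fun m G => g m G - h m G) := by
  simpa using nrm_add_le hh (hg.sub hh)

lemma nrm_sub_comm (g h : ℕ → F[X] → ℂ) :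
    nrm (fun m G => g m G - h m G) = nrm fun m G => h m G - g m G := by
  simp only [nrm, norm_sub_rev]

lemma nrm_eq_of_null {g h : ℕ → F[X] → ℂ} (hg : CB g) (hh : CB h)
    (H : nrm (fun m G => g m G - h m G) = 0) : nrm g = nrm h := by
  refine le_antisymm ?_ ?_
  · simpa [H] using nrm_le_add_sub hg hh
  · have := nrm_le_add_sub hh hg
    rw [nrm_sub_comm, H] at this
    simpa using this

lemma nrm_sum_le {I : Type*} (s : Finset I) {h : I → ℕ → F[X] → ℂ} (hh : ∀ i ∈ s, CB (h i)) :
    nrm (fun m G => ∑ i ∈ s, h i m G) ≤ ∑ i ∈ s, nrm (h i) := by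
  classical
  induction s using Finset.induction_on with
  | empty => simp [nrm_const]
  | insert i s hi ih =>
    simp only [Finset.sum_insert hi]
    have hs : ∀ j ∈ s, CB (h j) := fun j hj => hh j (Finset.mem_insert_of_mem hj)
    exact (nrm_add_le (hh i (Finset.mem_insert_self i s)) (CB.sum s hs)).trans
      (add_le_add le_rfl (ih hs))

lemma nrm_sum_null {I : Type*} (s : Finset I) {h : I → ℕ → F[X] → ℂ} (hh : ∀ i ∈ s, CB (h i))
    (h0 : ∀ i ∈ s, nrm (h i) = 0) : nrm (fun m G => ∑ i ∈ s, h i m G) = 0 :=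
  le_antisymm ((nrm_sum_le s hh).trans_eq (Finset.sum_eq_zero h0)) (nrm_nonneg _)

lemma nrm_average_le {I : Type*} (s : Finset I) (hs : s.Nonempty) {h : I → ℕ → F[X] → ℂ}
    (hh : ∀ i ∈ s, CB (h i)) {c : ℝ} (hc : ∀ i ∈ s, nrm (h i) ≤ c) :
    nrm (fun m G => (s.card : ℂ)⁻¹ * ∑ i ∈ s, h i m G) ≤ c := by
  rw [nrm_const_mul, norm_inv, Complex.norm_natCast]
  have h1 := (nrm_sum_le s hh).trans (Finset.sum_le_card_nsmul s _ c hc)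
  rw [nsmul_eq_mul] at h1
  have hpos : (0 : ℝ) < s.card := by exact_mod_cast hs.card_pos
  rwa [inv_mul_le_iff₀ hpos]

lemma Phi_cb {f : F[X] → ℂ} (hf : UMul f) (Q : F[X]) : CB (Phi f Q) :=
  ⟨1, norm_Phi_le hf Q⟩

lemma Phi_dilate {f : F[X] → ℂ} (hf : UMul f) {D : F[X]} (hD : D.Monic) (Q : F[X]) (m : ℕ)
    (G : F[X]) : Phi f (D * Q) m (D * G) = f D * Phi f Q m G := by
  simp only [Phi]
  rw [mul_left_comm, Finset.mul_sum (V F m) _ (f D)]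
  congr 1
  refine Finset.sum_congr rfl fun M _ => ?_
  rw [mul_assoc, ← mul_add, hf.map_mul D _ hD]

lemma Phi_add_mul (f : F[X] → ℂ) (Q : F[X]) {m : ℕ} {M : F[X]} (hM : M ∈ V F m) (G : F[X]) :
    Phi f Q m (G + Q * M) = Phi f Q m G := by
  simp only [Phi]
  congr 1
  refine (Finset.sum_congr rfl fun N _ => ?_).trans (sum_V_add hM fun N => f (G + Q * N))
  congr 1; ring

lemma Phi_add (f : F[X] → ℂ) (Q : F[X]) (m p : ℕ) (G : F[X]) : Phi f Q (m + p) G =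
    ((qr F : ℂ) ^ p)⁻¹ * ∑ c ∈ V F p, Phi f Q m (G + Q * (X ^ m * c)) := by
  simp only [Phi]
  rw [← Finset.mul_sum, ← mul_assoc, ← mul_inv, ← pow_add, add_comm p m,
    sum_V_division (monic_X_pow m) (natDegree_X_pow m), Finset.sum_comm]
  congr 1
  refine Finset.sum_congr rfl fun M _ => Finset.sum_congr rfl fun N _ => ?_
  congr 1; ring

lemma mean_normSq_Phi_sub {f : F[X] → ℂ} (hf : UMul f) (Q : F[X]) (m p : ℕ) :
    mean (fun G => ‖Phi f Q m G - Phi f Q (m + p) G‖ ^ 2) =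
      mean (fun G => ‖Phi f Q m G‖ ^ 2) - mean (fun G => ‖Phi f Q (m + p) G‖ ^ 2) := by
  set A := fun G => Phi f Q m G with hA
  set B := fun G => Phi f Q (m + p) G with hB
  have hAb : CBdd A := Phi_cbdd hf Q m
  have hBb : CBdd B := Phi_cbdd hf Q (m + p)
  have h1 : ∀ c ∈ V F p, mean (fun G => (A (G + Q * (X ^ m * c)) * conj (B G)).re) =
      mean fun G => (A G * conj (B G)).re := fun c hc => by
    rw [← mean_translate (hAb.mul hBb.conj).re (Q * (X ^ m * c))]
    congr 1
    ext G
    rw [hB]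
    simp only
    rw [Phi_add_mul f Q (mul_mem_V (monic_X_pow m) (natDegree_X_pow m) hc)]
  have h2 : mean (fun G => (A G * conj (B G)).re) = mean fun G => ‖B G‖ ^ 2 := by
    have e : ∀ G, ‖B G‖ ^ 2 = (qr F ^ p)⁻¹ *
        ∑ c ∈ V F p, (A (G + Q * (X ^ m * c)) * conj (B G)).re := fun G => by
      rw [← re_sum, ← Finset.sum_mul, ← Complex.re_ofReal_mul, ← mul_assoc]
      have : ((((qr F ^ p)⁻¹ : ℝ) : ℂ) * ∑ c ∈ V F p, A (G + Q * (X ^ m * c))) = B G := by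
        rw [hB]; simp only
        rw [Phi_add, Complex.ofReal_inv, Complex.ofReal_pow]
      rw [this, mul_conj, ofReal_re, normSq_eq_norm_sq]
    simp only [e]
    rw [mean_const_mul, mean_sum, Finset.sum_congr rfl h1, Finset.sum_const, nsmul_eq_mul,
      card_V_real, inv_mul_cancel_left₀ (pow_pos qr_pos p).ne']
  have e2 : ∀ G, ‖A G - B G‖ ^ 2 = ‖A G‖ ^ 2 + ‖B G‖ ^ 2 - 2 * (A G * conj (B G)).re :=
    fun G => by
      rw [← normSq_eq_norm_sq, normSq_sub, normSq_eq_norm_sq, normSq_eq_norm_sq]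
  change mean (fun G => ‖A G - B G‖ ^ 2) = mean (fun G => ‖A G‖ ^ 2) - _
  rw [funext e2, mean_sub, mean_add, mean_const_mul, h2]
  ring

lemma nrm_Phi_sub_shift {f : F[X] → ℂ} (hf : UMul f) (Q : F[X]) (p : ℕ) :
    nrm (fun m G => Phi f Q m G - Phi f Q (m + p) G) = 0 := by
  have hb := (Phi_cb hf Q).sub ((Phi_cb hf Q).comp (fun m => m + p) fun _ G => G)
  have hlim : Tendsto (fun m => mean fun G => ‖Phi f Q m G‖ ^ 2) atTop
      (nhds (⨅ m, mean fun G => ‖Phi f Q m G‖ ^ 2)) :=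
    tendsto_atTop_ciInf (mean_normSq_Phi_anti hf Q)
      ⟨0, by
        rintro _ ⟨m, rfl⟩
        exact mean_nonneg (Phi_cbdd hf Q m).normSq fun _ => sq_nonneg _⟩
  rw [nrm, E_eq_of_tendsto hb.normSq (b := 0), Real.sqrt_zero]
  simp only [mean_normSq_Phi_sub hf]
  simpa using hlim.sub ((tendsto_add_atTop_iff_nat p).2 hlim)

lemma nrm_Phi_shift {f : F[X] → ℂ} (hf : UMul f) (Q : F[X]) (p : ℕ) :
    nrm (fun m G => Phi f Q (m + p) G) = nrm (Phi f Q) :=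
  (nrm_eq_of_null (Phi_cb hf Q) ((Phi_cb hf Q).comp (fun m => m + p) fun _ G => G)
    (nrm_Phi_sub_shift hf Q p)).symm

lemma nrm_Phi_le_mul {f : F[X] → ℂ} (hf : UMul f) (Q : F[X]) {S : F[X]} (hS : S.Monic) :
    nrm (Phi f Q) ≤ nrm (Phi f (Q * S)) := by
  rw [← nrm_Phi_shift hf Q S.natDegree]
  simp only [← Phi_mul_average f Q hS rfl]
  have hb := Phi_cb hf (Q * S)
  have := nrm_average_le (V F S.natDegree) ⟨0, zero_mem_V _⟩
    (h := fun M m G => Phi f (Q * S) m (G + Q * M))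
    (fun M _ => hb.comp (fun m => m) fun _ G => G + Q * M)
    (fun M _ => (nrm_translate hb (Q * M)).le)
  rwa [card_V_complex] at this

open Classical in
lemma nrm_dvd_sq {h : ℕ → F[X] → ℂ} (hh : CB h) {D : F[X]} (hD : D.Monic) :
    nrm (fun m G => if D ∣ G then h m G else 0) ^ 2 =
      (nm D)⁻¹ * nrm (fun m G => h m (D * G)) ^ 2 := by
  rw [nrm_sq (hh.ite fun _ G => D ∣ G), nrm_sq (hh.comp (fun m => m) fun _ G => D * G),
    ← E_dilate hh.normSq hD]
  congr 1
  ext m G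
  split_ifs <;> simp

lemma nrm_Phi_dilate {f : F[X] → ℂ} (hf : UMul f) {D : F[X]} (hD : D.Monic) (Q : F[X]) :
    nrm (fun m G => Phi f (D * Q) m (D * G)) = nrm (Phi f Q) := by
  simp only [Phi_dilate hf hD]
  rw [nrm_const_mul, hf.norm_eq D hD, one_mul]

open Classical in
lemma nrm_Phi_dvd_sq {f : F[X] → ℂ} (hf : UMul f) {D : F[X]} (hD : D.Monic) (Q : F[X]) :
    nrm (fun m G => if D ∣ G then Phi f (D * Q) m G else 0) ^ 2 =
      (nm D)⁻¹ * nrm (Phi f Q) ^ 2 := by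
  rw [nrm_dvd_sq (Phi_cb hf _) hD, nrm_Phi_dilate hf hD]

open Classical in
lemma nrm_sq_split {h : ℕ → F[X] → ℂ} (hh : CB h) (p : ℕ → F[X] → Prop) :
    nrm h ^ 2 = nrm (fun m G => if p m G then h m G else 0) ^ 2 +
      nrm (fun m G => if p m G then 0 else h m G) ^ 2 := by
  have hb : CB fun m G => if p m G then 0 else h m G := by
    simpa only [ite_not] using hh.ite fun m G => ¬ p m G
  rw [nrm_sq hh, nrm_sq (hh.ite p), nrm_sq hb, ← E_add]
  congr 1
  ext m G
  split_ifs <;> simp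

open Classical in
lemma nrm_Phi_not_dvd {f : F[X] → ℂ} (hf : UMul f) {D : F[X]} (hD : D.Monic) (Q : F[X]) :
    (1 - (nm D)⁻¹) * nrm (Phi f Q) ^ 2 ≤
      nrm (fun m G => if D ∣ G then 0 else Phi f (D * Q) m G) ^ 2 := by
  have h1 := nrm_sq_split (Phi_cb hf (D * Q)) fun _ G => D ∣ G
  rw [nrm_Phi_dvd_sq hf hD] at h1
  have h2 := nrm_Phi_le_mul hf Q hD
  rw [mul_comm] at h2
  nlinarith [pow_le_pow_left₀ (nrm_nonneg _) h2 2]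

lemma exists_rho {R D : F[X]} (hD : D.Monic) (hc : IsCoprime D R) (G : F[X]) :
    ∃ Y, ∃ M ∈ V F D.natDegree, D * Y = G + R * M := by
  obtain ⟨a, b, hab⟩ := hc
  refine ⟨a * G + R * (-(b * G) /ₘ D) * (-1), (-(b * G)) %ₘ D, modByMonic_mem_V hD rfl _, ?_⟩
  have h1 := modByMonic_add_div (-(b * G)) D
  linear_combination -R * h1 + G * hab

lemma rho_unique_aux {R D : F[X]} (hD : D.Monic) (hc : IsCoprime D R) {G Y Y' M M' : F[X]}
    (hM : M ∈ V F D.natDegree) (hM' : M' ∈ V F D.natDegree) (h : D * Y = G + R * M)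
    (h' : D * Y' = G + R * M') : M = M' ∧ Y = Y' := by
  have h1 : D ∣ M - M' := hc.dvd_of_dvd_mul_left
    ⟨Y - Y', by linear_combination h' - h⟩
  have h2 : M - M' = 0 := by
    refine eq_zero_of_dvd_of_degree_lt h1 ?_
    rw [degree_eq_natDegree hD.ne_zero]
    exact mem_V.1 (sub_mem_V hM hM')
  have h3 : M = M' := sub_eq_zero.1 h2
  refine ⟨h3, mul_left_cancel₀ hD.ne_zero ?_⟩
  rw [h, h', h3]

open Classical in
/-- The quotient by `D` of the element of `G + R * V` divisible by `D`. -/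
def rho (R D G : F[X]) : F[X] :=
  if h : ∃ Y, ∃ M ∈ V F D.natDegree, D * Y = G + R * M then h.choose else 0

lemma rho_spec {R D : F[X]} (hD : D.Monic) (hc : IsCoprime D R) (G : F[X]) :
    ∃ M ∈ V F D.natDegree, D * rho R D G = G + R * M := by
  have h := exists_rho hD hc G
  rw [rho, dif_pos h]
  exact h.choose_spec

lemma rho_eq {R D : F[X]} (hD : D.Monic) (hc : IsCoprime D R) {G Y M : F[X]}
    (hM : M ∈ V F D.natDegree) (h : D * Y = G + R * M) : rho R D G = Y := by
  obtain ⟨M', hM', h'⟩ := rho_spec hD hc G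
  exact (rho_unique_aux hD hc hM' hM h' h).2

lemma rho_mul {R D₁ D₂ : F[X]} (h₁ : D₁.Monic) (h₂ : D₂.Monic) (c₁ : IsCoprime D₁ R)
    (c₂ : IsCoprime D₂ R) (G : F[X]) : rho R (D₁ * D₂) G = rho R D₂ (rho R D₁ G) := by
  obtain ⟨M₁, hM₁, e₁⟩ := rho_spec h₁ c₁ G
  obtain ⟨M₂, hM₂, e₂⟩ := rho_spec h₂ c₂ (rho R D₁ G)
  refine rho_eq (h₁.mul h₂) (c₁.mul_left c₂) (M := M₁ + D₁ * M₂) ?_ ?_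
  · rw [h₁.natDegree_mul h₂]
    exact add_mem_V (V_mono (Nat.le_add_right _ _) hM₁) (mul_mem_V h₁ rfl hM₂)
  · linear_combination e₁ + D₁ * e₂

lemma rho_one (R G : F[X]) : rho R 1 G = G :=
  rho_eq monic_one isCoprime_one_left (zero_mem_V _) (by ring)

open Classical in
lemma sum_V_dvd {A : Type*} [AddCommMonoid A] {R D : F[X]} (hD : D.Monic) (hc : IsCoprime D R)
    {G M₀ Y : F[X]} (hM₀ : M₀ ∈ V F D.natDegree) (h₀ : D * Y = G + R * M₀) (k : ℕ)
    (g : F[X] → A) :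
    ∑ M ∈ V F (D.natDegree + k), (if D ∣ G + R * M then g M else 0) =
      ∑ N ∈ V F k, g (M₀ + D * N) := by
  rw [sum_V_division hD rfl, Finset.sum_eq_single M₀]
  · refine Finset.sum_congr rfl fun N _ => if_pos ⟨Y + R * N, ?_⟩
    linear_combination -h₀
  · intro M hM hne
    refine Finset.sum_eq_zero fun N _ => if_neg ?_
    rintro ⟨Z, hZ⟩
    exact hne (rho_unique_aux hD hc hM hM₀ (Y := Z - R * N) (by linear_combination -hZ) h₀).1
  · exact fun h => absurd hM₀ h

lemma mean_comp_rho {h : F[X] → ℝ} (hh : Bdd h) {R D : F[X]} (hD : D.Monic)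
    (hc : IsCoprime D R) : mean (fun G => h (rho R D G)) = mean h := by
  classical
  set k : F[X] → ℝ := fun G => if D ∣ G then h (G /ₘ D) else 0 with hk
  have hkb : Bdd k := by
    obtain ⟨C, hC⟩ := hh
    refine ⟨C, fun G => ?_⟩
    simp only [hk]
    split_ifs
    · exact hC _
    · simpa using (abs_nonneg _).trans (hC 0)
  have e : ∀ G, h (rho R D G) = ∑ M ∈ V F D.natDegree, k (G + R * M) := fun G => by
    obtain ⟨M₀, hM₀, h₀⟩ := rho_spec hD hc G
    have := sum_V_dvd hD hc hM₀ h₀ 0 fun M => h ((G + R * M) /ₘ D)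
    rw [add_zero] at this
    rw [hk, this, Finset.sum_eq_single 0]
    · rw [mul_zero, add_zero, ← h₀, mul_divByMonic_cancel_left _ hD]
    · intro N hN hne
      refine absurd ?_ hne
      have hN1 := mem_V.1 hN
      rw [Nat.cast_zero] at hN1
      exact degree_eq_bot.1 (Nat.WithBot.lt_zero_iff.1 hN1)
    · exact fun h => absurd (zero_mem_V _) h
  simp only [e]
  rw [mean_sum, Finset.sum_congr rfl fun M _ => mean_translate hkb (R * M), Finset.sum_const,
    nsmul_eq_mul, card_V_real, hk, mean_dilate (h := fun G => h (G /ₘ D))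
      (hh.elim fun C hC => ⟨C, fun G => hC _⟩) hD, mul_inv_cancel_left₀ (pow_pos qr_pos _).ne']
  simp only [mul_divByMonic_cancel_left _ hD]

lemma nrm_comp_rho {h : ℕ → F[X] → ℂ} (hh : CB h) {R D : F[X]} (hD : D.Monic)
    (hc : IsCoprime D R) : nrm (fun m G => h m (rho R D G)) = nrm h := by
  rw [nrm, nrm]
  congr 1
  exact E_congr_mean fun m => mean_comp_rho (hh.normSq.bdd m) hD hc

/-- The defect of equivariance of `Phi f R` under `rho R D`. -/
def err (f : F[X] → ℂ) (R D : F[X]) : ℝ :=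
  nrm fun m G => Phi f R m G - f D * Phi f R m (rho R D G)

lemma UMul.map_one {f : F[X] → ℂ} (hf : UMul f) : f 1 = 1 := by
  have h := hf.map_mul 1 1 monic_one
  rw [mul_one] at h
  have h1 : f 1 ≠ 0 := fun h0 => by simpa [h0] using hf.norm_eq 1 monic_one
  exact (mul_left_cancel₀ h1 (by rw [← h, mul_one])).symm

lemma err_one {f : F[X] → ℂ} (hf : UMul f) (R : F[X]) : err f R 1 = 0 := by
  simp only [err, rho_one, hf.map_one, one_mul, sub_self, nrm_const, norm_zero]

lemma err_mul_le {f : F[X] → ℂ} (hf : UMul f) {R D₁ D₂ : F[X]} (h₁ : D₁.Monic) (h₂ : D₂.Monic)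
    (c₁ : IsCoprime D₁ R) (c₂ : IsCoprime D₂ R) :
    err f R (D₁ * D₂) ≤ err f R D₁ + err f R D₂ := by
  have hb := Phi_cb hf R
  have hb₁ := hb.sub ((hb.comp (fun m => m) fun _ G => rho R D₁ G).const_mul (f D₁))
  have hb₂ := hb.sub ((hb.comp (fun m => m) fun _ G => rho R D₂ G).const_mul (f D₂))
  have hb₃ := (hb₂.comp (fun m => m) fun _ G => rho R D₁ G).const_mul (f D₁)
  have h := nrm_add_le hb₁ hb₃
  rw [nrm_const_mul, hf.norm_eq _ h₁, one_mul, nrm_comp_rho hb₂ h₁ c₁] at h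
  refine le_trans (le_of_eq ?_) h
  rw [err]
  congr 1
  ext m G
  rw [rho_mul h₁ h₂ c₁ c₂, hf.map_mul _ _ h₁]
  ring

lemma bessel_real {I B : Type*} [DecidableEq I] (s : Finset I) (T : Finset B) (a : B → ℝ)
    (c : I → B → ℝ) (w : I → ℝ) (hw : ∀ i ∈ s, 0 < w i)
    (horth : ∀ i ∈ s, ∀ j ∈ s, ∑ x ∈ T, c i x * c j x = if i = j then w i else 0) :
    ∑ i ∈ s, (w i)⁻¹ * (∑ x ∈ T, a x * c i x) ^ 2 ≤ ∑ x ∈ T, a x ^ 2 := by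
  set A : I → ℝ := fun i => ∑ x ∈ T, a x * c i x with hA
  set l : I → ℝ := fun i => (w i)⁻¹ * A i with hl
  have h0 : 0 ≤ ∑ x ∈ T, (a x - ∑ i ∈ s, l i * c i x) ^ 2 :=
    Finset.sum_nonneg fun _ _ => sq_nonneg _
  have h1 : ∑ x ∈ T, a x * ∑ i ∈ s, l i * c i x = ∑ i ∈ s, (w i)⁻¹ * A i ^ 2 := by
    simp only [Finset.mul_sum]
    rw [Finset.sum_comm]
    refine Finset.sum_congr rfl fun i _ => ?_
    rw [sq, ← mul_assoc]
    change _ = l i * A i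
    rw [hA, Finset.mul_sum]
    exact Finset.sum_congr rfl fun x _ => by ring
  have h2 : ∑ x ∈ T, (∑ i ∈ s, l i * c i x) ^ 2 = ∑ i ∈ s, (w i)⁻¹ * A i ^ 2 := by
    simp only [sq, Finset.sum_mul_sum]
    rw [Finset.sum_comm]
    refine Finset.sum_congr rfl fun i hi => ?_
    rw [Finset.sum_comm]
    have : ∀ j ∈ s, ∑ x ∈ T, l i * c i x * (l j * c j x) =
        if i = j then l i * l i * w i else 0 := fun j hj => by
      have := horth i hi j hj
      calc ∑ x ∈ T, l i * c i x * (l j * c j x) = l i * l j * ∑ x ∈ T, c i x * c j x := by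
            rw [Finset.mul_sum]
            exact Finset.sum_congr rfl fun x _ => by ring
        _ = _ := by
            rw [this]
            split_ifs with h
            · rw [h]
            · rw [mul_zero]
    rw [Finset.sum_congr rfl this, Finset.sum_ite_eq, if_pos hi, hl]
    have := (hw i hi).ne'
    field_simp
  have h3 : ∑ x ∈ T, (a x - ∑ i ∈ s, l i * c i x) ^ 2 = ∑ x ∈ T, a x ^ 2 -
      2 * ∑ x ∈ T, a x * ∑ i ∈ s, l i * c i x + ∑ x ∈ T, (∑ i ∈ s, l i * c i x) ^ 2 := by
    rw [Finset.mul_sum, ← Finset.sum_sub_distrib, ← Finset.sum_add_distrib]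
    exact Finset.sum_congr rfl fun x _ => by ring
  rw [h3, h1, h2] at h0
  linarith

lemma bessel {I B : Type*} [DecidableEq I] (s : Finset I) (T : Finset B) (a : B → ℂ)
    (c : I → B → ℝ) (w : I → ℝ) (hw : ∀ i ∈ s, 0 < w i)
    (horth : ∀ i ∈ s, ∀ j ∈ s, ∑ x ∈ T, c i x * c j x = if i = j then w i else 0) :
    ∑ i ∈ s, (w i)⁻¹ * ‖∑ x ∈ T, a x * c i x‖ ^ 2 ≤ ∑ x ∈ T, ‖a x‖ ^ 2 := by
  have h1 := bessel_real s T (fun x => (a x).re) c w hw horth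
  have h2 := bessel_real s T (fun x => (a x).im) c w hw horth
  have e : ∀ z : ℂ, ‖z‖ ^ 2 = z.re ^ 2 + z.im ^ 2 := fun z => by
    rw [← normSq_eq_norm_sq, normSq_apply]; ring
  simp only [e, re_sum, im_sum, re_mul_ofReal, im_mul_ofReal, mul_add, Finset.sum_add_distrib]
  exact add_le_add h1 h2

open Classical in
lemma count_V_dvd {R D : F[X]} (hD : D.Monic) (hc : IsCoprime D R) (G : F[X]) {m : ℕ}
    (hm : D.natDegree ≤ m) :
    nm D * ∑ M ∈ V F m, (if D ∣ G + R * M then (1 : ℝ) else 0) = qr F ^ m := by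
  obtain ⟨M₀, hM₀, h₀⟩ := rho_spec hD hc G
  obtain ⟨k, rfl⟩ := Nat.exists_eq_add_of_le hm
  rw [sum_V_dvd hD hc hM₀ h₀ k fun _ => (1 : ℝ), Finset.sum_const, nsmul_eq_mul, card_V_real,
    mul_one, nm_eq, pow_add]

open Classical in
lemma sum_V_dvd_Phi {f : F[X] → ℂ} (hf : UMul f) {R D : F[X]} (hD : D.Monic)
    (hc : IsCoprime D R) (G : F[X]) (k : ℕ) :
    ∑ M ∈ V F (D.natDegree + k), (if D ∣ G + R * M then f (G + R * M) else 0) =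
      (qr F : ℂ) ^ k * (f D * Phi f R k (rho R D G)) := by
  obtain ⟨M₀, hM₀, h₀⟩ := rho_spec hD hc G
  rw [sum_V_dvd hD hc hM₀ h₀ k fun M => f (G + R * M), Phi, mul_left_comm (f D),
    mul_inv_cancel_left₀ (qrC_pow_ne_zero k), Finset.mul_sum]
  refine Finset.sum_congr rfl fun N _ => ?_
  rw [← hf.map_mul _ _ hD]
  congr 1
  linear_combination -h₀

lemma turan_kubilius_pointwise {f : F[X] → ℂ} (hf : UMul f) {R : F[X]} (s : Finset F[X])
    (hs : ∀ P ∈ s, P.Monic ∧ Irreducible P ∧ IsCoprime P R) {m : ℕ}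
    (hm : ∀ P ∈ s, ∀ P' ∈ s, P.natDegree + P'.natDegree ≤ m) (G : F[X]) :
    ∑ P ∈ s, (nm P - 1)⁻¹ *
      ‖Phi f R m G - f P * Phi f R (m - P.natDegree) (rho R P G)‖ ^ 2 ≤ 1 := by
  classical
  have hq : 0 < qr F ^ m := pow_pos qr_pos m
  set c : F[X] → F[X] → ℝ := fun P M => nm P * (if P ∣ G + R * M then 1 else 0) - 1 with hcdef
  have hle : ∀ P ∈ s, P.natDegree ≤ m := fun P hP =>
    (Nat.le_add_right _ _).trans (hm P hP P hP)
  have hcount : ∀ P ∈ s, ∑ M ∈ V F m, nm P * (if P ∣ G + R * M then (1 : ℝ) else 0) = qr F ^ m :=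
    fun P hP => by
      rw [← Finset.mul_sum]
      exact count_V_dvd (hs P hP).1 (hs P hP).2.2 G (hle P hP)
  have horth : ∀ P ∈ s, ∀ P' ∈ s, ∑ M ∈ V F m, c P M * c P' M =
      if P = P' then qr F ^ m * (nm P - 1) else 0 := fun P hP P' hP' => by
    have e : ∑ M ∈ V F m, c P M * c P' M =
        ∑ M ∈ V F m, nm P * nm P' * ((if P ∣ G + R * M then (1 : ℝ) else 0) *
          if P' ∣ G + R * M then (1 : ℝ) else 0) - qr F ^ m - qr F ^ m + qr F ^ m := by
      nth_rw 1 [← hcount P hP]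
      rw [← hcount P' hP', ← Finset.sum_sub_distrib, ← Finset.sum_sub_distrib, hcount P' hP',
        ← card_V_real, Finset.cast_card, ← Finset.sum_add_distrib]
      exact Finset.sum_congr rfl fun M _ => by simp only [hcdef]; ring
    rw [e]
    split_ifs with h
    · subst h
      have : ∀ M, (if P ∣ G + R * M then (1 : ℝ) else 0) * (if P ∣ G + R * M then (1 : ℝ) else 0) =
          if P ∣ G + R * M then (1 : ℝ) else 0 := fun M => by split_ifs <;> simp
      simp only [this, mul_assoc]
      rw [← Finset.mul_sum, hcount P hP]
      ring
    · have hcop : IsCoprime P P' :=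
        irr_coprime (mem_Irr.2 ⟨(hs P hP).1, rfl, (hs P hP).2.1⟩)
          (mem_Irr.2 ⟨(hs P' hP').1, rfl, (hs P' hP').2.1⟩) h
      have : ∀ M, (if P ∣ G + R * M then (1 : ℝ) else 0) *
          (if P' ∣ G + R * M then (1 : ℝ) else 0) = if P * P' ∣ G + R * M then (1 : ℝ) else 0 :=
        fun M => by
          have hiff : P * P' ∣ G + R * M ↔ P ∣ G + R * M ∧ P' ∣ G + R * M :=
            ⟨fun h => ⟨(dvd_mul_right _ _).trans h, (dvd_mul_left _ _).trans h⟩,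
              fun h => hcop.mul_dvd h.1 h.2⟩
          simp only [hiff]
          split_ifs <;> simp_all
      simp only [this]
      rw [← Finset.mul_sum, ← nm_mul (hs P hP).1 (hs P' hP').1,
        count_V_dvd ((hs P hP).1.mul (hs P' hP').1)
        ((hs P hP).2.2.mul_left (hs P' hP').2.2) G
        (by rw [(hs P hP).1.natDegree_mul (hs P' hP').1]; exact hm P hP P' hP')]
      ring
  have hw : ∀ P ∈ s, 0 < qr F ^ m * (nm P - 1) := fun P hP =>
    mul_pos hq (sub_pos.2 (one_lt_nm (hs P hP).2.1))
  have hb := bessel s (V F m) (fun M => f (G + R * M)) c _ hw horth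
  have hin : ∀ P ∈ s, ∑ M ∈ V F m, f (G + R * M) * (c P M : ℂ) =
      (qr F : ℂ) ^ m * (f P * Phi f R (m - P.natDegree) (rho R P G) - Phi f R m G) :=
    fun P hP => by
      obtain ⟨k, hk⟩ := Nat.exists_eq_add_of_le (hle P hP)
      have h1 := sum_V_dvd_Phi hf (hs P hP).1 (hs P hP).2.2 G k
      rw [← hk] at h1
      have hk' : m - P.natDegree = k := by omega
      have h2 : (qr F : ℂ) ^ m * Phi f R m G = ∑ M ∈ V F m, f (G + R * M) := by
        rw [Phi, mul_inv_cancel_left₀ (qrC_pow_ne_zero m)]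
      have h3 : (qr F : ℂ) ^ m = (qr F : ℂ) ^ P.natDegree * (qr F : ℂ) ^ k := by rw [hk, pow_add]
      rw [hk', mul_sub, h2, h3, mul_assoc, ← h1, Finset.mul_sum, ← Finset.sum_sub_distrib]
      refine Finset.sum_congr rfl fun M _ => ?_
      simp only [hcdef, nm_eq]
      split_ifs
      · rw [Complex.ofReal_sub, Complex.ofReal_mul, Complex.ofReal_pow, Complex.ofReal_one]; ring
      · rw [Complex.ofReal_sub, Complex.ofReal_mul, Complex.ofReal_zero, Complex.ofReal_one]; ring
  have hr : ∑ M ∈ V F m, ‖f (G + R * M)‖ ^ 2 ≤ qr F ^ m := by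
    rw [← card_V_real, Finset.cast_card]
    exact Finset.sum_le_sum fun M _ => pow_le_one₀ (norm_nonneg _) (hf.norm_le _)
  have h4 := hb.trans hr
  rw [← mul_le_mul_iff_right₀ hq, mul_one, Finset.mul_sum]
  refine le_trans (le_of_eq (Finset.sum_congr rfl fun P hP => ?_)) h4
  rw [hin P hP, norm_mul, norm_qrC_pow, norm_sub_rev, mul_inv, mul_pow]
  field_simp

lemma nrm_Phi_sub_pred {f : F[X] → ℂ} (hf : UMul f) (Q : F[X]) (p : ℕ) :
    nrm (fun m G => Phi f Q (m - p) G - Phi f Q m G) = 0 := by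
  have hb := ((Phi_cb hf Q).comp (fun m => m - p) fun _ G => G).sub (Phi_cb hf Q)
  have hlim : Tendsto (fun m => mean fun G => ‖Phi f Q m G‖ ^ 2) atTop
      (nhds (⨅ m, mean fun G => ‖Phi f Q m G‖ ^ 2)) :=
    tendsto_atTop_ciInf (mean_normSq_Phi_anti hf Q)
      ⟨0, by
        rintro _ ⟨m, rfl⟩
        exact mean_nonneg (Phi_cbdd hf Q m).normSq fun _ => sq_nonneg _⟩
  rw [nrm, E_eq_of_tendsto hb.normSq (b := 0), Real.sqrt_zero]
  have h1 := (hlim.comp (tendsto_sub_atTop_nat p)).sub hlim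
  rw [sub_self] at h1
  refine h1.congr' ((eventually_ge_atTop p).mono fun m hm => ?_)
  have h2 := mean_normSq_Phi_sub hf Q (m - p) p
  rw [Nat.sub_add_cancel hm] at h2
  exact h2.symm

lemma turan_kubilius {f : F[X] → ℂ} (hf : UMul f) {R : F[X]} (s : Finset F[X])
    (hs : ∀ P ∈ s, P.Monic ∧ Irreducible P ∧ IsCoprime P R) :
    ∑ P ∈ s, (nm P - 1)⁻¹ * err f R P ^ 2 ≤ 1 := by
  have hb := Phi_cb hf R
  have hbP : ∀ P, CB fun m G => Phi f R m G - f P * Phi f R (m - P.natDegree) (rho R P G) :=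
    fun P => hb.sub ((hb.comp (fun m => m - P.natDegree) fun _ G => rho R P G).const_mul (f P))
  have hbP' : ∀ P, CB fun m G => Phi f R m G - f P * Phi f R m (rho R P G) :=
    fun P => hb.sub ((hb.comp (fun m => m) fun _ G => rho R P G).const_mul (f P))
  have e : ∀ P ∈ s, err f R P =
      nrm fun m G => Phi f R m G - f P * Phi f R (m - P.natDegree) (rho R P G) := fun P hP => by
    refine nrm_eq_of_null (hbP' P) (hbP P) ?_
    have h1 := nrm_comp_rho (((hb.comp (fun m => m - P.natDegree) fun _ G => G).sub hb))
      (hs P hP).1 (hs P hP).2.2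
    rw [nrm_Phi_sub_pred hf R P.natDegree] at h1
    have h2 := nrm_const_mul (f P) fun m G =>
      Phi f R (m - P.natDegree) (rho R P G) - Phi f R m (rho R P G)
    rw [h1, mul_zero] at h2
    rw [← h2]
    congr 1
    ext m G
    ring
  have e2 : ∑ P ∈ s, (nm P - 1)⁻¹ * err f R P ^ 2 = E fun m G => ∑ P ∈ s, (nm P - 1)⁻¹ *
      ‖Phi f R m G - f P * Phi f R (m - P.natDegree) (rho R P G)‖ ^ 2 := by
    rw [E_sum]
    refine Finset.sum_congr rfl fun P hP => ?_
    rw [E_const_mul, e P hP, nrm_sq (hbP P)]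
  rw [e2]
  refine le_trans (E_mono ?_ (h := fun _ _ => 1) ⟨|1|, fun _ _ => le_rfl⟩ ?_) (E_const 1).le
  · choose C hC using fun P => (hbP P).normSq
    refine ⟨∑ P ∈ s, |(nm P - 1)⁻¹| * C P, fun m G => (Finset.abs_sum_le_sum_abs _ _).trans
      (Finset.sum_le_sum fun P _ => ?_)⟩
    rw [abs_mul]
    exact mul_le_mul_of_nonneg_left (hC P m G) (abs_nonneg _)
  · refine (eventually_ge_atTop (2 * s.sup natDegree)).mono fun m hm =>
      Eventually.of_forall fun G => turan_kubilius_pointwise hf s hs (fun P hP P' hP' => ?_) G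
    have h1 : P.natDegree ≤ s.sup natDegree := Finset.le_sup (f := natDegree) hP
    have h2 : P'.natDegree ≤ s.sup natDegree := Finset.le_sup (f := natDegree) hP'
    omega

lemma exists_tail_lt {B : F[X] → Prop} {K : ℝ}
    (hK : ∀ s : Finset F[X], (∀ P ∈ s, B P) → ∑ P ∈ s, (nm P)⁻¹ ≤ K) {δ : ℝ} (hδ : 0 < δ) :
    ∃ W : Finset F[X], (∀ P ∈ W, B P) ∧
      ∀ s : Finset F[X], (∀ P ∈ s, B P ∧ P ∉ W) → ∑ P ∈ s, (nm P)⁻¹ < δ := by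
  classical
  have h0 : ∀ P : F[X], 0 ≤ if B P then (nm P)⁻¹ else 0 := fun P => by
    split_ifs
    · exact inv_nonneg.2 (nm_pos P).le
    · exact le_rfl
  have hsum : Summable fun P : F[X] => if B P then (nm P)⁻¹ else 0 :=
    summable_of_sum_le h0 (c := K) fun s => by
      rw [← Finset.sum_filter]
      exact hK _ fun P hP => (Finset.mem_filter.1 hP).2
  obtain ⟨W, hW⟩ := summable_iff_vanishing_norm.1 hsum δ hδ
  refine ⟨W.filter B, fun P hP => (Finset.mem_filter.1 hP).2, fun s hs => ?_⟩
  have hd : Disjoint s W := Finset.disjoint_left.2 fun P hP hPW =>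
    (hs P hP).2 (Finset.mem_filter.2 ⟨hPW, (hs P hP).1⟩)
  have := (le_abs_self _).trans_lt (hW s hd)
  rwa [Finset.sum_congr rfl fun P hP => if_pos (hs P hP).1] at this

open Classical in
lemma monAvg_dvd {P : F[X]} (hP : P.Monic) {n : ℕ} (hn : P.natDegree ≤ n) :
    monAvg n (fun G => if P ∣ G then (1 : ℝ) else 0) = (nm P)⁻¹ := by
  obtain ⟨k, rfl⟩ := Nat.exists_eq_add_of_le' hn
  have hq := qr_pos (F := F)
  rw [monAvg, ← Finset.sum_filter, sum_Mon_dvd hP fun _ => (1 : ℝ), Finset.sum_const, card_Mon,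
    nsmul_eq_mul, mul_one, Nat.cast_pow, nm_eq, pow_add, mul_inv, mul_comm, ← mul_assoc,
    mul_inv_cancel₀ (pow_pos hq k).ne', one_mul]

lemma mean_le_of_monAvg {h : F[X] → ℝ} (hh : Bdd h) {b : ℝ} (H : ∀ n, monAvg n h ≤ b) :
    mean h ≤ b := by
  rw [mean_apply]
  obtain ⟨C, hC⟩ := hh
  have hc : cesLim (fun _ => b) = b :=
    cesLim_eq_of_tendsto ⟨|b|, fun _ => le_rfl⟩ tendsto_const_nhds
  rw [← hc]
  exact cesLim_mono ⟨C, fun n => abs_monAvg_le hC⟩ ⟨|b|, fun _ => le_rfl⟩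
    (Eventually.of_forall fun n => H n)

open Classical in
lemma mean_exists_dvd_le {B : F[X] → Prop} (hB : ∀ P, B P → P.Monic) {δ : ℝ}
    (hδ : ∀ s : Finset F[X], (∀ P ∈ s, B P) → ∑ P ∈ s, (nm P)⁻¹ ≤ δ) :
    mean (fun G => if ∃ P, B P ∧ P ∣ G then (1 : ℝ) else 0) ≤ δ := by
  refine mean_le_of_monAvg ⟨1, fun G => by split_ifs <;> simp⟩ fun n => ?_
  set s := (MonLE F n).filter B with hs
  have h1 : ∀ G ∈ Mon F n, (if ∃ P, B P ∧ P ∣ G then (1 : ℝ) else 0) ≤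
      ∑ P ∈ s, if P ∣ G then (1 : ℝ) else 0 := fun G hG => by
    rw [mem_Mon] at hG
    have h0 : ∀ P ∈ s, (0 : ℝ) ≤ if P ∣ G then 1 else 0 := fun P _ => by split_ifs <;> simp
    split_ifs with h
    · obtain ⟨P, hP, hPG⟩ := h
      have hPs : P ∈ s := Finset.mem_filter.2 ⟨mem_MonLE.2 ⟨hB P hP,
        hG.2 ▸ natDegree_le_of_dvd hPG hG.1.ne_zero⟩, hP⟩
      refine le_trans (le_of_eq ?_) (Finset.single_le_sum h0 hPs)
      rw [if_pos hPG]
    · exact Finset.sum_nonneg h0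
  refine (monAvg_le h1).trans (le_trans (le_of_eq ?_)
    (hδ s fun P hP => (Finset.mem_filter.1 hP).2))
  rw [monAvg, Finset.sum_comm, Finset.mul_sum]
  refine Finset.sum_congr rfl fun P hP => ?_
  have h2 := mem_MonLE.1 (Finset.mem_filter.1 hP).1
  exact monAvg_dvd h2.1 h2.2

lemma exists_crt {A B : F[X]} (h : IsCoprime A B) (a b : F[X]) : ∃ y, A ∣ y - a ∧ B ∣ y - b := by
  obtain ⟨u, v, huv⟩ := h
  exact ⟨u * A * b + v * B * a, ⟨u * (b - a), by linear_combination a * huv⟩,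
    ⟨v * (a - b), by linear_combination b * huv⟩⟩

lemma exists_monic_avoiding {B : F[X] → Prop} (hB : ∀ P, B P → P.Monic ∧ Irreducible P)
    {R : F[X]} (hR : R.Monic) (hBR : ∀ P, B P → IsCoprime P R) {K : ℝ}
    (hK : ∀ s : Finset F[X], (∀ P ∈ s, B P) → ∑ P ∈ s, (nm P)⁻¹ ≤ K) (v : F[X]) :
    ∃ G : F[X], G.Monic ∧ R ∣ G - v ∧ ∀ P, B P → ¬ P ∣ G := by
  classical
  by_contra hcon
  push Not at hcon
  have hcop : ∀ P P', B P → B P' → P ≠ P' → IsCoprime P P' := fun P P' h h' hne =>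
    irr_coprime (mem_Irr.2 ⟨(hB P h).1, rfl, (hB P h).2⟩)
      (mem_Irr.2 ⟨(hB P' h').1, rfl, (hB P' h').2⟩) hne
  obtain ⟨W, hWB, hW⟩ := exists_tail_lt hK (δ := 1 / 2) (by norm_num)
  set Z := ∏ P ∈ W, P with hZ
  have hZm : Z.Monic := monic_prod_of_monic _ _ fun P hP => (hB P (hWB P hP)).1
  have hZR : IsCoprime R Z := IsCoprime.prod_right fun P hP => (hBR P (hWB P hP)).symm
  obtain ⟨v', hv'R, hv'Z⟩ := exists_crt hZR v 1
  set N := R * Z with hN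
  have hNm : N.Monic := hR.mul hZm
  have hN0 : 0 < (nm N)⁻¹ := inv_pos.2 (nm_pos N)
  obtain ⟨W₁, hWB₁, hW₁⟩ := exists_tail_lt hK (δ := (nm N)⁻¹ / 2) (by linarith)
  have hcopN : ∀ P, B P → P ∉ W → IsCoprime P N := fun P hP hPW =>
    (hBR P hP).mul_right (IsCoprime.prod_right fun P' hP' =>
      hcop P P' hP (hWB P' hP') fun h => hPW (h ▸ hP'))
  choose! y hy using fun P (h : B P ∧ P ∉ W) => exists_crt (hcopN P h.1 h.2) 0 v'
  have hS : ∀ P ∈ W₁ \ W, B P ∧ P ∉ W := fun P hP =>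
    ⟨hWB₁ P (Finset.mem_sdiff.1 hP).1, (Finset.mem_sdiff.1 hP).2⟩
  have key : ∀ᶠ G in big F, (if N ∣ G - v' then (1 : ℝ) else 0) ≤
      (∑ P ∈ W₁ \ W, if P * N ∣ G - y P then (1 : ℝ) else 0) +
        if ∃ P, (B P ∧ P ∉ W₁) ∧ P ∣ G then (1 : ℝ) else 0 := by
    refine (eventually_big_degree 0).mono fun G hG => ?_
    have h0 : ∀ P ∈ W₁ \ W, (0 : ℝ) ≤ if P * N ∣ G - y P then 1 else 0 :=
      fun P _ => by split_ifs <;> simp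
    by_cases hd : N ∣ G - v'
    · rw [if_pos hd]
      have hRG : R ∣ G - v := by
        have := ((dvd_mul_right R Z).trans hd).add hv'R
        simpa using this
      have hZG : Z ∣ G - 1 := by
        have := ((dvd_mul_left Z R).trans hd).add hv'Z
        simpa using this
      obtain ⟨P, hP, hPG⟩ := hcon G hG.1 hRG
      have hPW : P ∉ W := fun hPW => by
        have h1 : P ∣ G - 1 := (Finset.dvd_prod_of_mem (fun P => P) hPW).trans hZG
        have h2 : P ∣ 1 := by simpa using dvd_sub hPG h1
        exact (hB P hP).2.not_isUnit (isUnit_of_dvd_one h2)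
      by_cases hP₁ : P ∈ W₁
      · have hmem : P ∈ W₁ \ W := Finset.mem_sdiff.2 ⟨hP₁, hPW⟩
        have hdvd : P * N ∣ G - y P := by
          have hyP := hy P ⟨hP, hPW⟩
          refine (hcopN P hP hPW).mul_dvd ?_ ?_
          · have := hPG.sub hyP.1
            simpa using this
          · have := hd.sub hyP.2
            simpa using this
        have h1 := Finset.single_le_sum h0 hmem
        rw [if_pos hdvd] at h1
        have h2 : (0 : ℝ) ≤ if ∃ P, (B P ∧ P ∉ W₁) ∧ P ∣ G then 1 else 0 := by
          split_ifs <;> simp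
        linarith
      · have h1 := Finset.sum_nonneg h0
        rw [if_pos (⟨P, ⟨hP, hP₁⟩, hPG⟩ : ∃ P, (B P ∧ P ∉ W₁) ∧ P ∣ G)]
        linarith
    · rw [if_neg hd]
      have h1 := Finset.sum_nonneg h0
      have h2 : (0 : ℝ) ≤ if ∃ P, (B P ∧ P ∉ W₁) ∧ P ∣ G then 1 else 0 := by
        split_ifs <;> simp
      linarith
  have hb : ∀ (p : F[X] → Prop) [DecidablePred p], Bdd fun G => if p G then (1 : ℝ) else 0 :=
    fun p _ => ⟨1, fun G => by beta_reduce; split_ifs <;> simp⟩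
  have h1 := mean_mono (hb _) ?_ key
  · rw [mean_dvd_sub hNm, mean_add, mean_sum] at h1
    have h2 : ∀ P ∈ W₁ \ W, mean (fun G => if P * N ∣ G - y P then (1 : ℝ) else 0) =
        (nm N)⁻¹ * (nm P)⁻¹ := fun P hP => by
      rw [mean_dvd_sub ((hB P (hS P hP).1).1.mul hNm), nm_mul (hB P (hS P hP).1).1 hNm, mul_inv,
        mul_comm]
    rw [Finset.sum_congr rfl h2, ← Finset.mul_sum] at h1
    have h3 := hW _ hS
    have h4 := mean_exists_dvd_le (B := fun P => B P ∧ P ∉ W₁) (fun P hP => (hB P hP.1).1)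
      (δ := (nm N)⁻¹ / 2) fun s hs => (hW₁ s hs).le
    nlinarith
  · refine ⟨(W₁ \ W).card + 1, fun G => ?_⟩
    beta_reduce
    have h0 : ∀ P ∈ W₁ \ W, (0 : ℝ) ≤ if P * N ∣ G - y P then 1 else 0 :=
      fun P _ => by split_ifs <;> simp
    have h5 : ∑ P ∈ W₁ \ W, (if P * N ∣ G - y P then (1 : ℝ) else 0) ≤ (W₁ \ W).card := by
      rw [Finset.cast_card]
      exact Finset.sum_le_sum fun P _ => by split_ifs <;> simp
    have h6 := Finset.sum_nonneg h0
    rw [abs_le]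
    constructor <;> split_ifs <;> linarith

/-- The class of `v` modulo `R` contains monic polynomials of arbitrarily small defect. -/
def Good (f : F[X] → ℂ) (R v : F[X]) : Prop :=
  ∀ ε > 0, ∃ D : F[X], D.Monic ∧ IsCoprime D R ∧ R ∣ D - v ∧ err f R D < ε

lemma Good.mul {f : F[X] → ℂ} (hf : UMul f) {R v w : F[X]} (hv : Good f R v)
    (hw : Good f R w) : Good f R (v * w) := fun ε hε => by
  obtain ⟨D, hD, hDc, hDv, hDe⟩ := hv (ε / 2) (by linarith)
  obtain ⟨D', hD', hDc', hDv', hDe'⟩ := hw (ε / 2) (by linarith)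
  refine ⟨D * D', hD.mul hD', hDc.mul_left hDc', ?_, ?_⟩
  · have : D * D' - v * w = (D - v) * D' + v * (D' - w) := by ring
    rw [this]
    exact (hDv.mul_right _).add (hDv'.mul_left _)
  · linarith [err_mul_le hf hD hD' hDc hDc']

lemma Good.congr {f : F[X] → ℂ} {R v w : F[X]} (hv : Good f R v) (h : R ∣ v - w) :
    Good f R w := fun ε hε => by
  obtain ⟨D, hD, hDc, hDv, hDe⟩ := hv ε hε
  exact ⟨D, hD, hDc, by simpa using hDv.add h, hDe⟩

lemma Good.one {f : F[X] → ℂ} (hf : UMul f) (R : F[X]) : Good f R 1 := fun ε hε =>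
  ⟨1, monic_one, isCoprime_one_left, by simp, by rw [err_one hf]; exact hε⟩

lemma good_of_factors {f : F[X] → ℂ} (hf : UMul f) {R : F[X]} (n : ℕ) :
    ∀ G : F[X], G.natDegree = n → G.Monic →
      (∀ P : F[X], P.Monic → Irreducible P → P ∣ G → Good f R P) → Good f R G := by
  induction n using Nat.strong_induction_on with
  | _ n ih =>
    intro G hn hG hP
    by_cases h0 : G.natDegree = 0
    · rw [hG.natDegree_eq_zero.1 h0]
      exact Good.one hf R
    · have hu : ¬ IsUnit G := fun hu => h0 (natDegree_eq_zero_of_isUnit hu)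
      obtain ⟨P, hPm, hPi, H, rfl⟩ := exists_monic_irreducible_factor G hu
      have hH : H.Monic := hPm.of_mul_monic_left hG
      have hlt : 0 < P.natDegree := hPi.natDegree_pos
      refine (hP P hPm hPi (dvd_mul_right _ _)).mul hf (ih H.natDegree ?_ H rfl hH
        fun P' h1 h2 h3 => hP P' h1 h2 (h3.mul_left P))
      rw [← hn, hPm.natDegree_mul hH]
      omega

theorem good_of_coprime {f : F[X] → ℂ} (hf : UMul f) {R : F[X]} (hR : R.Monic) {v : F[X]}
    (hv : IsCoprime v R) : Good f R v := by
  classical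
  set B : F[X] → Prop := fun P => P.Monic ∧ Irreducible P ∧ IsCoprime P R ∧ ¬ Good f R P with hB
  have hex : ∀ u : F[X], ∃ e : ℝ, 0 < e ∧ (¬ Good f R u → ∀ D : F[X], D.Monic → IsCoprime D R →
      R ∣ D - u → e ≤ err f R D) := fun u => by
    by_cases hu : Good f R u
    · exact ⟨1, one_pos, fun h => absurd hu h⟩
    · rw [Good] at hu
      push Not at hu
      obtain ⟨e, he, h⟩ := hu
      exact ⟨e, he, fun _ => h⟩
  choose e he0 he using hex
  obtain ⟨u₀, -, hu₀⟩ := Finset.exists_min_image (V F R.natDegree) e ⟨0, zero_mem_V _⟩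
  have hBe : ∀ P, B P → e u₀ ≤ err f R P := fun P hP => by
    have h1 : R ∣ P - P %ₘ R := by
      rw [modByMonic_eq_sub_mul_div P R]
      simp
    refine (hu₀ _ (modByMonic_mem_V hR rfl P)).trans
      (he (P %ₘ R) (fun hg => hP.2.2.2 (hg.congr ?_)) P hP.1 hP.2.2.1 h1)
    rw [dvd_sub_comm]
    exact h1
  have hK : ∀ s : Finset F[X], (∀ P ∈ s, B P) → ∑ P ∈ s, (nm P)⁻¹ ≤ (e u₀ ^ 2)⁻¹ :=
    fun s hs => by
      have hp : 0 < e u₀ ^ 2 := pow_pos (he0 u₀) 2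
      have h1 := turan_kubilius hf s fun P hP => ⟨(hs P hP).1, (hs P hP).2.1, (hs P hP).2.2.1⟩
      rw [← mul_le_mul_iff_left₀ hp, inv_mul_cancel₀ hp.ne', Finset.sum_mul]
      refine le_trans (Finset.sum_le_sum fun P hP => ?_) h1
      have h2 := one_lt_nm (hs P hP).2.1
      refine mul_le_mul ?_ (pow_le_pow_left₀ (he0 u₀).le (hBe P (hs P hP)) 2) hp.le
        (inv_nonneg.2 (by linarith))
      exact inv_anti₀ (by linarith) (by linarith)
  obtain ⟨G, hG, hGv, hGB⟩ := exists_monic_avoiding (B := B) (fun P h => ⟨h.1, h.2.1⟩) hR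
    (fun P h => h.2.2.1) hK v
  refine Good.congr (good_of_factors hf _ G rfl hG fun P hP hPi hPG => ?_) hGv
  by_contra hbad
  refine hGB P ⟨hP, hPi, ?_, hbad⟩ hPG
  refine IsCoprime.of_isCoprime_of_dvd_left ?_ hPG
  obtain ⟨Y, hY⟩ := hGv
  have : G = v + R * Y := by linear_combination hY
  rw [this]
  exact hv.add_mul_left_left Y

open Classical in
lemma energy_invariant {f : F[X] → ℂ} (hf : UMul f) {R S v : F[X]} (hR : R.Monic) (hS : S ∣ R)
    (hv : IsCoprime v R) (x : F[X]) :
    nrm (fun m G => if S ∣ G - v * x then Phi f R m G else 0) =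
      nrm fun m G => if S ∣ G - x then Phi f R m G else 0 := by
  have hb := Phi_cb hf R
  have key : ∀ ε > 0, |nrm (fun m G => if S ∣ G - v * x then Phi f R m G else 0) -
      nrm (fun m G => if S ∣ G - x then Phi f R m G else 0)| ≤ ε := fun ε hε => by
    obtain ⟨D, hD, hDc, hDv, hDe⟩ := good_of_coprime hf hR hv ε hε
    have hbρ := (hb.comp (fun m => m) fun _ G => rho R D G).const_mul (f D)
    have hiff : ∀ G, S ∣ G - v * x ↔ S ∣ rho R D G - x := fun G => by
      obtain ⟨M, -, hM⟩ := rho_spec hD hDc G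
      have h1 : S ∣ D - v := hS.trans hDv
      have h2 : D * (rho R D G - x) = (G - v * x) + (R * M - (D - v) * x) := by
        linear_combination hM
      have h3 : S ∣ R * M - (D - v) * x := (hS.mul_right M).sub (h1.mul_right x)
      have h4 : IsCoprime S D := (IsCoprime.of_isCoprime_of_dvd_right hDc hS).symm
      rw [← dvd_add_left h3, ← h2]
      exact ⟨fun h => h4.dvd_of_dvd_mul_left h, fun h => h.mul_left D⟩
    have e2 : nrm (fun m G => if S ∣ G - x then Phi f R m G else 0) =
        nrm fun m G => if S ∣ G - v * x then f D * Phi f R m (rho R D G) else 0 := by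
      rw [← nrm_comp_rho (hb.ite fun _ G => S ∣ G - x) hD hDc]
      have h5 := nrm_const_mul (f D) fun m G =>
        if S ∣ rho R D G - x then Phi f R m (rho R D G) else 0
      rw [hf.norm_eq D hD, one_mul] at h5
      rw [← h5]
      congr 1
      ext m G
      simp only [hiff]
      split_ifs <;> simp
    have hb1 := hb.ite fun _ G => S ∣ G - v * x
    have hb2 := hbρ.ite fun _ G => S ∣ G - v * x
    have h6 : nrm (fun m G => (if S ∣ G - v * x then Phi f R m G else 0) -
        if S ∣ G - v * x then f D * Phi f R m (rho R D G) else 0) ≤ err f R D := by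
      refine nrm_mono (hb1.sub hb2) (hb.sub hbρ)
        (Eventually.of_forall fun m => Eventually.of_forall fun G => ?_)
      split_ifs <;> simp
    rw [e2, abs_le]
    have h7 := nrm_le_add_sub hb1 hb2
    have h8 := nrm_le_add_sub hb2 hb1
    rw [nrm_sub_comm] at h8
    constructor <;> linarith
  exact eq_of_abs_sub_nonpos (le_of_forall_pos_le_add fun ε hε => by simpa using key ε hε)

lemma X_isCoprime_iff {x : F[X]} : IsCoprime x X ↔ ¬ X ∣ x := by
  rw [isCoprime_comm, irreducible_X.coprime_iff_not_dvd]

open Classical in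
lemma energy_unit_const {f : F[X] → ℂ} (hf : UMul f) {Q' : F[X]} (hQ' : Q'.Monic)
    (hc : IsCoprime X Q') {n N : ℕ} (hn : n ≤ N) {x : F[X]} (hx : ¬ X ∣ x) :
    nrm (fun m G => if X ^ n ∣ G - x then Phi f (X ^ N * Q') m G else 0) =
      nrm fun m G => if X ^ n ∣ G - 1 then Phi f (X ^ N * Q') m G else 0 := by
  have hcN : IsCoprime ((X : F[X]) ^ N) Q' := hc.pow_left
  obtain ⟨v, hvX, hvQ⟩ := exists_crt hcN x 1
  have hxX : IsCoprime x (X ^ N) := (X_isCoprime_iff.2 hx).pow_right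
  have hv : IsCoprime v (X ^ N * Q') := by
    refine IsCoprime.mul_right ?_ ?_
    · obtain ⟨Y, hY⟩ := hvX
      rw [show v = x + X ^ N * Y by linear_combination hY]
      exact hxX.add_mul_left_left Y
    · obtain ⟨Y, hY⟩ := hvQ
      rw [show v = 1 + Q' * Y by linear_combination hY]
      exact isCoprime_one_left.add_mul_left_left Y
  have hXn : (X : F[X]) ^ n ∣ X ^ N * Q' := (pow_dvd_pow X hn).mul_right Q'
  rw [← energy_invariant hf ((monic_X_pow N).mul hQ') hXn hv 1]
  congr 1
  ext m G
  have h1 : (X : F[X]) ^ n ∣ v - x := (pow_dvd_pow X hn).trans hvX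
  have h2 : X ^ n ∣ G - v * 1 ↔ X ^ n ∣ G - x := by
    rw [← dvd_add_left h1]
    ring_nf
  simp only [h2]

open Classical in
lemma energy_unit_ge {f : F[X] → ℂ} (hf : UMul f) {Q' : F[X]} (hQ' : Q'.Monic)
    (hc : IsCoprime X Q') {n N : ℕ} (hn : n ≤ N) {x : F[X]} (hx : ¬ X ∣ x) (hn0 : 1 ≤ n) :
    nrm (fun m G => if X ∣ G then 0 else Phi f (X ^ N * Q') m G) ^ 2 ≤ qr F ^ n *
      nrm (fun m G => if X ^ n ∣ G - x then Phi f (X ^ N * Q') m G else 0) ^ 2 := by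
  set Ph := Phi f (X ^ N * Q')
  have hb : CB Ph := Phi_cb hf _
  have hb0 : CB fun m G => if X ∣ G then 0 else Ph m G := by
    simpa only [ite_not] using hb.ite fun _ G => ¬ X ∣ G
  have hX : (X : F[X]) ∣ X ^ n := dvd_pow_self X (by omega)
  set s := (V F n).filter fun y => ¬ X ∣ y with hs
  have hE : nrm (fun m G => if X ∣ G then 0 else Ph m G) ^ 2 ≤
      ∑ y ∈ s, nrm (fun m G => if X ^ n ∣ G - y then Ph m G else 0) ^ 2 := by
    have h1 : ∀ y, nrm (fun m G => if X ^ n ∣ G - y then Ph m G else 0) ^ 2 =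
        E fun m G => ‖if X ^ n ∣ G - y then Ph m G else 0‖ ^ 2 :=
      fun y => nrm_sq (hb.ite fun _ G => X ^ n ∣ G - y)
    simp only [h1]
    rw [nrm_sq hb0, ← E_sum]
    refine E_mono hb0.normSq ?_ (Eventually.of_forall fun m => Eventually.of_forall fun G => ?_)
    · choose C hC using fun y => (hb.ite fun _ G => X ^ n ∣ G - y).normSq
      exact ⟨∑ y ∈ s, C y, fun m G => (Finset.abs_sum_le_sum_abs _ _).trans
        (Finset.sum_le_sum fun y _ => hC y m G)⟩
    · have h0 : ∀ y ∈ s, 0 ≤ ‖if X ^ n ∣ G - y then Ph m G else 0‖ ^ 2 :=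
        fun _ _ => sq_nonneg _
      by_cases hG : X ∣ G
      · rw [if_pos hG, norm_zero, zero_pow two_ne_zero]
        exact Finset.sum_nonneg h0
      · rw [if_neg hG]
        have h2 : X ^ n ∣ G - G %ₘ X ^ n := by
          rw [modByMonic_eq_sub_mul_div G (X ^ n)]
          simp
        have hmem : G %ₘ X ^ n ∈ s := by
          refine Finset.mem_filter.2
            ⟨modByMonic_mem_V (monic_X_pow n) (natDegree_X_pow n) G, fun h => hG ?_⟩
          simpa using (hX.trans h2).add h
        refine le_trans (le_of_eq ?_) (Finset.single_le_sum h0 hmem)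
        rw [if_pos h2]
  refine hE.trans ?_
  have h3 : ∀ y ∈ s, nrm (fun m G => if X ^ n ∣ G - y then Ph m G else 0) ^ 2 =
      nrm (fun m G => if X ^ n ∣ G - x then Ph m G else 0) ^ 2 := fun y hy => by
    rw [energy_unit_const hf hQ' hc hn (Finset.mem_filter.1 hy).2,
      energy_unit_const hf hQ' hc hn hx]
  rw [Finset.sum_congr rfl h3, Finset.sum_const, nsmul_eq_mul]
  refine mul_le_mul_of_nonneg_right ?_ (sq_nonneg _)
  rw [← card_V_real]
  exact_mod_cast Finset.card_filter_le _ _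

lemma mul_modByMonic_mul {S B : F[X]} (hS : S.Monic) (hB : B.Monic) (A : F[X]) :
    (S * A) %ₘ (S * B) = S * (A %ₘ B) := by
  refine (div_modByMonic_unique (A /ₘ B) (S * (A %ₘ B)) (hS.mul hB) ⟨?_, ?_⟩).2
  · linear_combination S * modByMonic_add_div A B
  · rw [degree_mul, degree_mul]
    exact WithBot.add_lt_add_left (degree_ne_bot.2 hS.ne_zero) (degree_modByMonic_lt A hB)

lemma dvd_self_sub_modByMonic {S : F[X]} (A : F[X]) : S ∣ A - A %ₘ S :=
  ⟨A /ₘ S, by linear_combination -modByMonic_add_div A S⟩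

lemma sum_V_mul_modByMonic {A : Type} [AddCommMonoid A] {S Y : F[X]} {k : ℕ} (hS : S.Monic)
    (hk : S.natDegree = k) (hc : IsCoprime Y S) (g : F[X] → A) :
    ∑ M ∈ V F k, g ((M * Y) %ₘ S) = ∑ M ∈ V F k, g M := by
  have hinj : Set.InjOn (fun M => (M * Y) %ₘ S) (V F k) := fun M hM N hN h => by
    have h1 : S ∣ (M - N) * Y := by
      have h2 := (dvd_self_sub_modByMonic (S := S) (M * Y)).sub
        (dvd_self_sub_modByMonic (S := S) (N * Y))
      have h3 : (M * Y) %ₘ S = (N * Y) %ₘ S := h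
      rw [h3] at h2
      convert h2 using 1
      ring
    have h4 : S ∣ M - N := hc.symm.dvd_of_dvd_mul_right h1
    have h5 : M - N ∈ V F k := sub_mem_V hM hN
    rw [mem_V] at h5
    have h6 : M - N = 0 := eq_zero_of_dvd_of_degree_lt h4 (by
      rwa [degree_eq_natDegree hS.ne_zero, hk])
    exact sub_eq_zero.1 h6
  have himg : (V F k).image (fun M => (M * Y) %ₘ S) = V F k := by
    refine Finset.eq_of_subset_of_card_le (fun M hM => ?_) ?_
    · obtain ⟨N, -, rfl⟩ := Finset.mem_image.1 hM
      exact modByMonic_mem_V hS hk _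
    · rw [Finset.card_image_of_injOn hinj]
  conv_rhs => rw [← himg]
  rw [Finset.sum_image hinj]

lemma twist_average (f : F[X] → ℂ) {P Q Y : F[X]} {p a K : ℕ} (hP : P.Monic)
    (hp : P.natDegree = p) (hQ : Q.Monic) (ha : a ≤ K) (hc : IsCoprime Y (P ^ (K - a))) (m : ℕ) :
    ((V F (p * K)).card : ℂ)⁻¹ * ∑ M ∈ V F (p * K),
      Phi f (P ^ (K + 1) * Q) m (P ^ a * Y + (P * Q * M * (P ^ a * Y)) %ₘ (P ^ (K + 1) * Q)) =
      Phi f (P ^ (a + 1) * Q) (m + p * (K - a)) (P ^ a * Y) := by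
  have hS : (P ^ (K - a)).Monic := hP.pow _
  have hk : (P ^ (K - a)).natDegree = p * (K - a) := by
    rw [hP.natDegree_pow, hp, mul_comm]
  have hR : P ^ (K + 1) * Q = (P ^ (a + 1) * Q) * P ^ (K - a) := by
    have : K + 1 = (a + 1) + (K - a) := by omega
    rw [this, pow_add]
    ring
  have hmod : ∀ M, (P * Q * M * (P ^ a * Y)) %ₘ (P ^ (K + 1) * Q) =
      (P ^ (a + 1) * Q) * ((M * Y) %ₘ P ^ (K - a)) := fun M => by
    rw [hR, ← mul_modByMonic_mul ((hP.pow _).mul hQ) hS]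
    congr 1
    ring
  have hKa : p * K = p * (K - a) + p * a := by
    rw [← mul_add]
    congr 1
    omega
  have hsplit : ∀ M N, ((M + P ^ (K - a) * N) * Y) %ₘ P ^ (K - a) = (M * Y) %ₘ P ^ (K - a) :=
    fun M N => by
      have : (M + P ^ (K - a) * N) * Y = M * Y + P ^ (K - a) * (N * Y) := by ring
      rw [this, add_modByMonic, (modByMonic_eq_zero_iff_dvd hS).2 (dvd_mul_right _ _), add_zero]
  rw [← Phi_mul_average f (P ^ (a + 1) * Q) hS hk m (P ^ a * Y), ← hR, card_V_complex]
  simp only [hmod]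
  rw [hKa, sum_V_division hS hk]
  simp only [hsplit, Finset.sum_const]
  rw [← Finset.smul_sum,
    sum_V_mul_modByMonic hS hk hc fun M => Phi f (P ^ (K + 1) * Q) m (P ^ a * Y + P ^ (a + 1) * Q * M)]
  rw [nsmul_eq_mul, card_V_complex, pow_add, mul_inv]
  have := qrC_pow_ne_zero (F := F) (p * a)
  field_simp

open Classical in
/-- The contribution to a twisted correlation of the polynomials divisible by `P ^ a`. -/
def layer (f : F[X] → ℂ) (P Q : F[X]) (a m : ℕ) (G : F[X]) : ℂ :=
  if P ^ a ∣ G then Phi f (P ^ (a + 1) * Q) m G else 0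

lemma layer_cb {f : F[X] → ℂ} (hf : UMul f) (P Q : F[X]) (a : ℕ) : CB (layer f P Q a) := by
  classical
  exact (Phi_cb hf (P ^ (a + 1) * Q)).ite fun _ G => P ^ a ∣ G

/-- Multiplication by `1 + P Q M` modulo `P ^ (K + 1) Q`. -/
def twist (P Q : F[X]) (K : ℕ) (M G : F[X]) : F[X] :=
  G + (P * Q * M * G) %ₘ (P ^ (K + 1) * Q)

lemma exists_valuation {P : F[X]} (hP : Irreducible P) (K : ℕ) (G : F[X]) :
    ∃ a ≤ K, ∃ Y, G = P ^ a * Y ∧ IsCoprime Y (P ^ (K - a)) := by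
  induction K with
  | zero => exact ⟨0, le_rfl, G, by simp, by simpa using isCoprime_one_right⟩
  | succ K ih =>
    obtain ⟨a, ha, Y, hY, hc⟩ := ih
    rcases eq_or_lt_of_le ha with rfl | hlt
    · by_cases hd : P ∣ Y
      · obtain ⟨Z, rfl⟩ := hd
        exact ⟨a + 1, le_rfl, Z, by rw [hY]; ring, by simpa using isCoprime_one_right⟩
      · refine ⟨a, by omega, Y, hY, ?_⟩
        exact ((hP.coprime_iff_not_dvd.2 hd).symm).pow_right
    · refine ⟨a, by omega, Y, hY, ?_⟩
      exact ((IsCoprime.pow_right_iff (by omega)).1 hc).pow_right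

lemma nrm_null_of_le {g h : ℕ → F[X] → ℂ} (hg : CB g) (hh : CB h) (h0 : nrm h = 0)
    (H : ∀ᶠ m in atTop, ∀ᶠ G in big F, ‖g m G‖ ≤ ‖h m G‖) : nrm g = 0 :=
  le_antisymm ((nrm_mono hg hh H).trans h0.le) (nrm_nonneg _)

lemma CB.norm {h : ℕ → F[X] → ℂ} (hh : CB h) : CB fun m G => (‖h m G‖ : ℂ) := by
  obtain ⟨C, hC⟩ := hh
  exact ⟨C, fun m G => by rw [Complex.norm_real, norm_norm]; exact hC m G⟩

lemma nrm_norm (h : ℕ → F[X] → ℂ) : nrm (fun m G => (‖h m G‖ : ℂ)) = nrm h := by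
  simp only [nrm, Complex.norm_real, norm_norm]

open Classical in
lemma nrm_layer_sub_twist {f : F[X] → ℂ} (hf : UMul f) {P Q : F[X]} {p : ℕ} (hP : P ∈ Irr F p)
    (hQ : Q.Monic) (hnull : nrm (Phi f Q) = 0) (K : ℕ) :
    nrm (fun m G => ∑ a ∈ Finset.range (K + 1), layer f P Q a m G -
      ((V F (p * K)).card : ℂ)⁻¹ * ∑ M ∈ V F (p * K),
        Phi f (P ^ (K + 1) * Q) m (twist P Q K M G)) = 0 := by
  obtain ⟨hPm, hPp, hPi⟩ := mem_Irr.1 hP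
  have hcb := fun Q' => Phi_cb hf Q'
  let d : ℕ → ℕ → F[X] → ℂ := fun a m G =>
    Phi f (P ^ (a + 1) * Q) m G - Phi f (P ^ (a + 1) * Q) (m + p * (K - a)) G
  let e : ℕ → ℕ → F[X] → ℂ := fun b m G =>
    if P ^ (b + 1) ∣ G then Phi f (P ^ (b + 1) * Q) m G else 0
  have hd : ∀ a, CB (d a) := fun a =>
    (hcb _).sub ((hcb (P ^ (a + 1) * Q)).comp (fun m => m + p * (K - a)) fun _ G => G)
  have he : ∀ b, CB (e b) := fun b => (hcb _).ite fun _ G => P ^ (b + 1) ∣ G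
  have hd0 : ∀ a, nrm (d a) = 0 := fun a => nrm_Phi_sub_shift hf _ _
  have he0 : ∀ b, nrm (e b) = 0 := fun b => by
    have := nrm_Phi_dvd_sq hf (hPm.pow (b + 1)) Q
    rw [hnull] at this
    simpa using this
  have hsum : CB fun m G => ∑ a ∈ Finset.range (K + 1), ((‖d a m G‖ : ℂ) + (‖e a m G‖ : ℂ)) :=
    CB.sum _ fun a _ => (hd a).norm.add (he a).norm
  have hL : CB fun m G => ∑ a ∈ Finset.range (K + 1), layer f P Q a m G :=
    CB.sum _ fun a _ => layer_cb hf P Q a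
  have hR : CB fun m G => ((V F (p * K)).card : ℂ)⁻¹ * ∑ M ∈ V F (p * K),
        Phi f (P ^ (K + 1) * Q) m (twist P Q K M G) :=
    (CB.sum _ fun M _ => (hcb _).comp (fun m => m) fun _ G => twist P Q K M G).const_mul _
  refine nrm_null_of_le (hL.sub hR) hsum ?_ (Eventually.of_forall fun m =>
    Eventually.of_forall fun G => ?_)
  · refine nrm_sum_null _ (fun a _ => (hd a).norm.add (he a).norm) fun a _ => ?_
    refine le_antisymm ((nrm_add_le (hd a).norm (he a).norm).trans ?_) (nrm_nonneg _)
    rw [nrm_norm, nrm_norm, hd0, he0, add_zero]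
  · obtain ⟨a, ha, Y, hG, hc⟩ := exists_valuation hPi K G
    have h1 : ∑ b ∈ Finset.range (K + 1), layer f P Q b m G =
        ∑ b ∈ Finset.range a, e b m G + Phi f (P ^ (a + 1) * Q) m G := by
      rw [← Finset.sum_subset (Finset.range_subset_range.2 (Nat.succ_le_succ ha)),
        Finset.sum_range_succ]
      · congr 1
        · refine Finset.sum_congr rfl fun b hb => ?_
          have hb' := Finset.mem_range.1 hb
          have h2 : P ^ (b + 1) ∣ G := by
            rw [hG]
            exact (pow_dvd_pow P hb').mul_right Y
          simp only [layer, e, if_pos h2, if_pos ((pow_dvd_pow P b.le_succ).trans h2)]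
        · rw [layer, if_pos (hG ▸ dvd_mul_right _ _)]
      · intro b hb hb'
        rw [Finset.mem_range] at hb hb'
        rw [layer, if_neg]
        intro hdvd
        have h3 : P ^ (a + 1) ∣ P ^ a * Y := hG ▸ (pow_dvd_pow P (by omega)).trans hdvd
        rw [pow_succ, mul_dvd_mul_iff_left (pow_ne_zero _ hPm.ne_zero)] at h3
        have h4 : IsCoprime Y P := (IsCoprime.pow_right_iff (by omega)).1 hc
        exact hPi.not_isUnit (h4.isUnit_of_dvd' h3 dvd_rfl)
    have h5 := twist_average f hPm hPp hQ ha hc m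
    rw [← hG] at h5
    have h6 : ∑ b ∈ Finset.range (K + 1), layer f P Q b m G -
        ((V F (p * K)).card : ℂ)⁻¹ * ∑ M ∈ V F (p * K),
          Phi f (P ^ (K + 1) * Q) m (twist P Q K M G) = ∑ b ∈ Finset.range a, e b m G + d a m G := by
      simp only [twist]
      rw [h5, h1]
      simp only [d]
      ring
    rw [h6]
    have h7 : ∑ a ∈ Finset.range (K + 1), ((‖d a m G‖ : ℂ) + (‖e a m G‖ : ℂ)) =
        ((∑ a ∈ Finset.range (K + 1), (‖d a m G‖ + ‖e a m G‖) : ℝ) : ℂ) := by push_cast; rfl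
    rw [h7, Complex.norm_real, Real.norm_of_nonneg (Finset.sum_nonneg fun _ _ => by positivity),
      Finset.sum_add_distrib, add_comm]
    refine (norm_add_le _ _).trans ?_
    refine add_le_add ?_ ((norm_sum_le _ _).trans ?_)
    · exact Finset.single_le_sum (f := fun a => ‖d a m G‖) (fun _ _ => norm_nonneg _)
        (Finset.mem_range.2 (Nat.lt_succ_of_le ha))
    · exact Finset.sum_le_sum_of_subset_of_nonneg (Finset.range_subset_range.2 (by omega))
        fun _ _ _ => norm_nonneg _

lemma nrm_comp_near {h : ℕ → F[X] → ℂ} (hh : CB h) {g : F[X] → F[X]} {r : ℕ}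
    (hg : ∀ G, g G - G ∈ V F r) :
    nrm (fun m G => h m (g G)) ^ 2 ≤ qr F ^ r * nrm h ^ 2 := by
  have hb := hh.comp (fun m => m) fun _ G => g G
  have hs : ∀ z, RB fun m G => ‖h m (G + z)‖ ^ 2 := fun z =>
    (hh.comp (fun m => m) fun _ G => G + z).normSq
  have hsum : RB fun m G => ∑ z ∈ V F r, ‖h m (G + z)‖ ^ 2 := by
    choose c hc using hs
    exact ⟨∑ z ∈ V F r, c z, fun m G => (Finset.abs_sum_le_sum_abs _ _).trans
      (Finset.sum_le_sum fun z _ => hc z m G)⟩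
  rw [nrm_sq hb, nrm_sq hh]
  refine (E_mono hb.normSq hsum (Eventually.of_forall fun m => Eventually.of_forall fun G => ?_)).trans ?_
  · have := Finset.single_le_sum (f := fun z => ‖h m (G + z)‖ ^ 2) (fun _ _ => by positivity) (hg G)
    simpa using this
  · rw [E_sum]
    have : ∀ z ∈ V F r, E (fun m G => ‖h m (G + z)‖ ^ 2) = E fun m G => ‖h m G‖ ^ 2 := fun z _ =>
      E_translate hh.normSq z
    rw [Finset.sum_congr rfl this, Finset.sum_const, nsmul_eq_mul, card_V_real]

open Classical in
lemma nrm_dvd_const {D : F[X]} (hD : D.Monic) (C : ℝ) :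
    nrm (fun _ G => if D ∣ G then (C : ℂ) else 0) ^ 2 = (nm D)⁻¹ * C ^ 2 := by
  rw [nrm_dvd_sq (CB.const (C : ℂ)) hD, nrm_const, Complex.norm_real, Real.norm_eq_abs, sq_abs]

/-- The sums of `f` over `B + A` are bounded by `C` whenever `B` is a monic multiple of `X ^ n`. -/
def ShiftBounded (f : F[X] → ℂ) (n : ℕ) (C : ℝ) (A : Finset F[X]) : Prop :=
  ∀ B : F[X], B.Monic → n ≤ B.natDegree → X ^ n ∣ B → ‖∑ L ∈ A, f (B + L)‖ ≤ C

lemma ShiftBounded.norm_sum_Phi_le {f : F[X] → ℂ} {n : ℕ} {C : ℝ} {A : Finset F[X]}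
    (hA : ShiftBounded f n C A) {R H : F[X]} {m : ℕ} (hR : R.Monic) (hXR : X ^ n ∣ R)
    (hH : H.Monic) (hdeg : R.natDegree + m ≤ H.natDegree) (hn : n ≤ H.natDegree) (hXH : X ^ n ∣ H) :
    ‖∑ L ∈ A, Phi f R m (H + L)‖ ≤ C := by
  have h1 : ∑ L ∈ A, Phi f R m (H + L) =
      ((qr F : ℂ) ^ m)⁻¹ * ∑ M ∈ V F m, ∑ L ∈ A, f ((H + R * M) + L) := by
    simp only [Phi]
    rw [← Finset.mul_sum, Finset.sum_comm]
    congr 1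
    refine Finset.sum_congr rfl fun M _ => Finset.sum_congr rfl fun L _ => ?_
    congr 1
    ring
  rw [h1, norm_mul, norm_inv, norm_qrC_pow]
  have h2 : ‖∑ M ∈ V F m, ∑ L ∈ A, f ((H + R * M) + L)‖ ≤ ∑ M ∈ V F m, C := by
    refine norm_sum_le_of_le _ fun M hM => ?_
    obtain ⟨h3, h4⟩ := monic_add_of_mem_V hH hdeg (mul_mem_V hR rfl hM)
    exact hA _ h3 (h4 ▸ hn) (dvd_add hXH (hXR.mul_right M))
  rw [Finset.sum_const, nsmul_eq_mul, card_V_real] at h2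
  have h5 : 0 < qr F ^ m := pow_pos qr_pos m
  rw [inv_mul_le_iff₀ h5]
  exact h2

lemma twist_sub_mem_V {P Q : F[X]} (hP : P.Monic) (hQ : Q.Monic) (K : ℕ) (M G : F[X]) :
    twist P Q K M G - G ∈ V F (P ^ (K + 1) * Q).natDegree := by
  rw [twist, add_sub_cancel_left]
  exact modByMonic_mem_V ((hP.pow _).mul hQ) rfl _

lemma dvd_twist_sub (P Q : F[X]) (K : ℕ) (M G : F[X]) :
    P ^ (K + 1) * Q ∣ twist P Q K M G - (1 + P * Q * M) * G := by
  have := (dvd_self_sub_modByMonic (S := P ^ (K + 1) * Q) (P * Q * M * G)).neg_right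
  convert this using 1
  rw [twist]
  ring

lemma isCoprime_twist_multiplier (P Q : F[X]) (K : ℕ) (M : F[X]) :
    IsCoprime (1 + P * Q * M) (P ^ (K + 1) * Q) := by
  have h1 : IsCoprime (1 + P * Q * M) P := ⟨1, -(Q * M), by ring⟩
  have h2 : IsCoprime (1 + P * Q * M) Q := ⟨1, -(P * M), by ring⟩
  exact h1.pow_right.mul_right h2

lemma mem_V_of_mul_mem_V {S M : F[X]} {k d : ℕ} (hS : S.Monic) (hk : S.natDegree = k)
    (h : S * M ∈ V F (k + d)) : M ∈ V F d := by
  rw [mem_V] at h ⊢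
  by_cases hM : M = 0
  · rw [hM, degree_zero]; exact WithBot.bot_lt_coe d
  rw [degree_mul, degree_eq_natDegree hS.ne_zero, degree_eq_natDegree hM, hk] at h
  rw [degree_eq_natDegree hM]
  have h' : k + M.natDegree < k + d := by exact_mod_cast h
  exact_mod_cast (by omega : M.natDegree < d)

/-- A twist commutes with bounded translations after applying `rho`. -/
lemma rho_twist_add {P Q D M L : F[X]} {K : ℕ} (hP : P.Monic) (hQ : Q.Monic) (hD : D.Monic)
    (hc : IsCoprime D (P ^ (K + 1) * Q)) (hDM : P ^ (K + 1) * Q ∣ D - (1 + P * Q * M))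
    (hL : L ∈ V F (P ^ (K + 1) * Q).natDegree) (G : F[X]) :
    rho (P ^ (K + 1) * Q) D (twist P Q K M (G + L)) =
      rho (P ^ (K + 1) * Q) D (twist P Q K M G) + L := by
  have hR : (P ^ (K + 1) * Q).Monic := (hP.pow _).mul hQ
  obtain ⟨M₀, hM₀, h0⟩ := rho_spec hD hc (twist P Q K M G)
  have h1 := dvd_twist_sub P Q K M G
  have h2 := dvd_twist_sub P Q K M (G + L)
  have t1 := twist_sub_mem_V hP hQ K M G
  have t2 := twist_sub_mem_V hP hQ K M (G + L)
  set R := P ^ (K + 1) * Q with hRdef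
  have h3 : R ∣ twist P Q K M G - twist P Q K M (G + L) + D * L := by
    have : twist P Q K M G - twist P Q K M (G + L) + D * L =
      (twist P Q K M G - (1 + P * Q * M) * G) - (twist P Q K M (G + L) - (1 + P * Q * M) * (G + L))
        + (D - (1 + P * Q * M)) * L := by ring
    rw [this]
    exact (h1.sub h2).add (hDM.mul_right L)
  obtain ⟨N, hN⟩ := h3
  have hNV : N ∈ V F D.natDegree := by
    refine mem_V_of_mul_mem_V hR rfl ?_
    rw [← hN]
    have e : twist P Q K M G - twist P Q K M (G + L) + D * L =
      (twist P Q K M G - G) - (twist P Q K M (G + L) - (G + L)) - L + D * L := by ring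
    rw [e]
    refine add_mem_V (V_mono (Nat.le_add_right _ _) (sub_mem_V (sub_mem_V t1 t2) hL)) ?_
    rw [add_comm]
    exact mul_mem_V hD rfl hL
  refine rho_eq hD hc (add_mem_V hM₀ hNV) ?_
  linear_combination h0 + hN

lemma rho_big {P Q D M : F[X]} {K n m : ℕ} (hP : P.Monic) (hQ : Q.Monic) (hD : D.Monic)
    (hc : IsCoprime D (P ^ (K + 1) * Q)) (hX : X ^ n ∣ P ^ (K + 1) * Q) {G : F[X]} (hG : G.Monic)
    (hdeg : (P ^ (K + 1) * Q).natDegree + D.natDegree + m ≤ G.natDegree) :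
    (rho (P ^ (K + 1) * Q) D (twist P Q K M G)).Monic ∧
      m ≤ (rho (P ^ (K + 1) * Q) D (twist P Q K M G)).natDegree ∧
      (X ^ n ∣ G → X ^ n ∣ rho (P ^ (K + 1) * Q) D (twist P Q K M G)) := by
  have hR : (P ^ (K + 1) * Q).Monic := (hP.pow _).mul hQ
  obtain ⟨M₀, hM₀, h0⟩ := rho_spec hD hc (twist P Q K M G)
  have t1 := twist_sub_mem_V hP hQ K M G
  have h1 := dvd_twist_sub P Q K M G
  set R := P ^ (K + 1) * Q with hRdef
  set Y := rho R D (twist P Q K M G) with hY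
  have e : D * Y = G + ((twist P Q K M G - G) + R * M₀) := by rw [h0]; ring
  have hmem : (twist P Q K M G - G) + R * M₀ ∈ V F (R.natDegree + D.natDegree) :=
    add_mem_V (V_mono (Nat.le_add_right _ _) t1) (mul_mem_V hR rfl hM₀)
  obtain ⟨h2, h3⟩ := monic_add_of_mem_V hG (by omega) hmem
  rw [← e] at h2 h3
  have hYm : Y.Monic := hD.of_mul_monic_left h2
  refine ⟨hYm, ?_, fun hXG => ?_⟩
  · rw [hD.natDegree_mul hYm] at h3
    omega
  · have h4 : X ^ n ∣ D * Y := by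
      rw [h0]
      have : twist P Q K M G + R * M₀ =
        (twist P Q K M G - (1 + P * Q * M) * G) + (1 + P * Q * M) * G + R * M₀ := by ring
      rw [this]
      exact ((hX.trans h1).add (hXG.mul_left _)).add (hX.mul_right _)
    exact (IsCoprime.of_isCoprime_of_dvd_right hc hX).symm.dvd_of_dvd_mul_left h4

lemma nm_X_pow (n : ℕ) : nm (X ^ n : F[X]) = qr F ^ n := by
  rw [nm_eq, natDegree_X_pow]

open Classical in
lemma nrm_twist_le {f : F[X] → ℂ} (hf : UMul f) {P Q : F[X]} (hP : P.Monic) (hQ : Q.Monic)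
    {K n : ℕ} (hX : X ^ n ∣ P ^ (K + 1) * Q) {A : Finset F[X]} (hAV : A ⊆ V F n) {C : ℝ}
    (hA : ShiftBounded f n C A) (hC : 0 ≤ C) (M : F[X]) :
    nrm (fun m G => if X ^ n ∣ G then ∑ L ∈ A, Phi f (P ^ (K + 1) * Q) m (twist P Q K M (G + L))
      else 0) ≤ C * √((qr F ^ n)⁻¹) := by
  have hR : (P ^ (K + 1) * Q).Monic := (hP.pow _).mul hQ
  have hnR : n ≤ (P ^ (K + 1) * Q).natDegree := by
    simpa using natDegree_le_of_dvd hX hR.ne_zero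
  set R := P ^ (K + 1) * Q with hRdef
  have hb := Phi_cb hf R
  set c := (A.card : ℝ) * √(qr F ^ R.natDegree) with hcdef
  have hc0 : 0 ≤ c := by positivity
  refine le_of_forall_pos_le_add fun ε hε => ?_
  obtain ⟨D, hD, hDc, hDv, hDe⟩ := good_of_coprime hf hR (isCoprime_twist_multiplier P Q K M)
    (ε / (c + 1)) (by positivity)
  have hbρ := (hb.comp (fun m => m) fun _ G => rho R D G).const_mul (f D)
  have hbT : ∀ L, CB fun m G => Phi f R m (twist P Q K M (G + L)) := fun L =>
    hb.comp (fun m => m) fun _ G => twist P Q K M (G + L)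
  have hbT' : ∀ L, CB fun m G => f D * Phi f R m (rho R D (twist P Q K M (G + L))) := fun L =>
    hbρ.comp (fun m => m) fun _ G => twist P Q K M (G + L)
  have h1 : nrm (fun m G => if X ^ n ∣ G then
      ∑ L ∈ A, f D * Phi f R m (rho R D (twist P Q K M (G + L))) else 0) ≤
      C * √((qr F ^ n)⁻¹) := by
    have h2 : nrm (fun _ G => if (X : F[X]) ^ n ∣ G then (C : ℂ) else 0) = C * √((qr F ^ n)⁻¹) := by
      have h3 := nrm_dvd_const (F := F) (monic_X_pow n) C
      rw [nm_X_pow] at h3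
      rw [← Real.sqrt_sq (nrm_nonneg _), h3, Real.sqrt_mul (by have := qr_pos (F := F); positivity),
        Real.sqrt_sq hC, mul_comm]
    rw [← h2]
    refine nrm_mono ((CB.sum _ fun L _ => hbT' L).ite _) ((CB.const _).ite _)
      (Eventually.of_forall fun m => ?_)
    filter_upwards [eventually_big_degree (F := F) (R.natDegree + D.natDegree + (R.natDegree + m))]
      with G hG
    by_cases hXG : X ^ n ∣ G
    · obtain ⟨g1, g2, g3⟩ := rho_big (M := M) hP hQ hD hDc hX hG.1 hG.2
      rw [if_pos hXG, if_pos hXG, ← Finset.mul_sum, norm_mul, hf.norm_eq D hD, one_mul,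
        Complex.norm_real, Real.norm_of_nonneg hC]
      rw [Finset.sum_congr rfl fun L hL =>
        by rw [rho_twist_add hP hQ hD hDc hDv (V_mono hnR (hAV hL)) G]]
      exact hA.norm_sum_Phi_le hR hX g1 g2 (le_trans (by omega) g2) (g3 hXG)
    · rw [if_neg hXG, if_neg hXG]
  have h4 : ∀ L ∈ A, nrm (fun m G => Phi f R m (twist P Q K M (G + L)) -
      f D * Phi f R m (rho R D (twist P Q K M (G + L)))) ≤
      √(qr F ^ R.natDegree) * (ε / (c + 1)) := fun L hL => by
    have h5 := nrm_comp_near (hb.sub hbρ) (g := fun G => twist P Q K M (G + L))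
      (r := R.natDegree) fun G => by
        have := add_mem_V (twist_sub_mem_V hP hQ K M (G + L)) (V_mono hnR (hAV hL))
        convert this using 1
        ring
    have h6 := Real.sqrt_le_sqrt h5
    rw [Real.sqrt_sq (nrm_nonneg _), Real.sqrt_mul (by have := qr_pos (F := F); positivity),
      Real.sqrt_sq (nrm_nonneg _)] at h6
    refine h6.trans (mul_le_mul_of_nonneg_left ?_ (Real.sqrt_nonneg _))
    exact hDe.le
  refine (nrm_le_add_sub ((CB.sum _ fun L _ => hbT L).ite _)
    ((CB.sum _ fun L _ => hbT' L).ite fun _ G => X ^ n ∣ G)).trans (add_le_add h1 ?_)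
  have h7 : nrm (fun m G => ∑ L ∈ A, (Phi f R m (twist P Q K M (G + L)) -
      f D * Phi f R m (rho R D (twist P Q K M (G + L))))) ≤ ε := by
    refine (nrm_sum_le _ fun L _ => (hbT L).sub (hbT' L)).trans ?_
    refine (Finset.sum_le_card_nsmul _ _ _ h4).trans ?_
    rw [nsmul_eq_mul, ← mul_assoc, ← hcdef, mul_div_assoc', div_le_iff₀ (by positivity)]
    nlinarith
  refine le_trans (nrm_mono ?_ (CB.sum _ fun L _ => (hbT L).sub (hbT' L))
    (Eventually.of_forall fun m => Eventually.of_forall fun G => ?_)) h7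
  · exact ((CB.sum _ fun L _ => hbT L).ite _).sub ((CB.sum _ fun L _ => hbT' L).ite _)
  · by_cases hXG : X ^ n ∣ G
    · rw [if_pos hXG, if_pos hXG, ← Finset.sum_sub_distrib]
    · rw [if_neg hXG, if_neg hXG]
      simp

open Classical in
/-- Sum over `A` of the translated layers, restricted to multiples of `X ^ n`. -/
def layerSum (f : F[X] → ℂ) (P Q : F[X]) (n : ℕ) (A : Finset F[X]) (a m : ℕ) (G : F[X]) : ℂ :=
  if X ^ n ∣ G then ∑ L ∈ A, layer f P Q a m (G + L) else 0

lemma layerSum_cb {f : F[X] → ℂ} (hf : UMul f) (P Q : F[X]) (n : ℕ) (A : Finset F[X]) (a : ℕ) :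
    CB (layerSum f P Q n A a) := by
  classical
  exact (CB.sum A fun L _ => (layer_cb hf P Q a).comp (fun m => m) fun _ G => G + L).ite
    fun _ G => X ^ n ∣ G

lemma nrm_sum_layerSum_le {f : F[X] → ℂ} (hf : UMul f) {P Q : F[X]} {p : ℕ} (hP : P ∈ Irr F p)
    (hQ : Q.Monic) (hnull : nrm (Phi f Q) = 0) {K n : ℕ} (hX : X ^ n ∣ P ^ (K + 1) * Q)
    {A : Finset F[X]} (hAV : A ⊆ V F n) {C : ℝ} (hA : ShiftBounded f n C A) (hC : 0 ≤ C) :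
    nrm (fun m G => ∑ a ∈ Finset.range (K + 1), layerSum f P Q n A a m G) ^ 2 ≤
      C ^ 2 * (qr F ^ n)⁻¹ := by
  classical
  have hPm := (mem_Irr.1 hP).1
  set R := P ^ (K + 1) * Q with hRdef
  set S := V F (p * K) with hS
  have hb := Phi_cb hf R
  have hbT : ∀ M L, CB fun m G => Phi f R m (twist P Q K M (G + L)) := fun M L =>
    hb.comp (fun m => m) fun _ G => twist P Q K M (G + L)
  have hb1 : ∀ M, CB fun m G => if X ^ n ∣ G then ∑ L ∈ A, Phi f R m (twist P Q K M (G + L))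
      else 0 := fun M => (CB.sum _ fun L _ => hbT M L).ite _
  have hne : S.Nonempty := ⟨0, zero_mem_V _⟩
  have h1 := nrm_average_le S hne (fun M _ => hb1 M)
    fun M _ => nrm_twist_le hf hPm hQ hX hAV hA hC M
  have hbl : CB fun m G => ∑ a ∈ Finset.range (K + 1), layerSum f P Q n A a m G :=
    CB.sum _ fun a _ => layerSum_cb hf P Q n A a
  have h2 : nrm (fun m G => ∑ a ∈ Finset.range (K + 1), layerSum f P Q n A a m G) =
      nrm fun m G => (S.card : ℂ)⁻¹ * ∑ M ∈ S, if X ^ n ∣ G then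
        ∑ L ∈ A, Phi f R m (twist P Q K M (G + L)) else 0 := by
    have hb2 : CB fun m G => (S.card : ℂ)⁻¹ * ∑ M ∈ S, if X ^ n ∣ G then
        ∑ L ∈ A, Phi f R m (twist P Q K M (G + L)) else 0 :=
      (CB.sum _ fun M _ => hb1 M).const_mul _
    refine nrm_eq_of_null hbl hb2 ?_
    have hnl := nrm_layer_sub_twist hf hP hQ hnull K
    have hbd : CB fun m G => ∑ a ∈ Finset.range (K + 1), layer f P Q a m G -
        (S.card : ℂ)⁻¹ * ∑ M ∈ S, Phi f R m (twist P Q K M G) :=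
      (CB.sum _ fun a _ => layer_cb hf P Q a).sub
        ((CB.sum _ fun M _ => hb.comp (fun m => m) fun _ G => twist P Q K M G).const_mul _)
    have hbdL := fun L => hbd.comp (fun m => m) fun _ G => G + L
    have h3 := nrm_sum_null A (fun L _ => hbdL L) fun L _ =>
      (nrm_translate hbd L).trans hnl
    refine nrm_null_of_le (hbl.sub hb2) (CB.sum A fun L _ => hbdL L) h3
      (Eventually.of_forall fun m => Eventually.of_forall fun G => ?_)
    simp only [layerSum]
    by_cases hXG : X ^ n ∣ G
    · simp only [if_pos hXG]
      rw [Finset.sum_sub_distrib, ← Finset.mul_sum, Finset.sum_comm (s := S), Finset.sum_comm (t := A)]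
    · simp [if_neg hXG]
  rw [← h2] at h1
  have h4 := pow_le_pow_left₀ (nrm_nonneg _) h1 2
  rwa [mul_pow, Real.sq_sqrt (by have := qr_pos (F := F); positivity)] at h4

lemma layer_add (f : F[X] → ℂ) (P Q : F[X]) (a : ℕ) {m : ℕ} {N : F[X]} (hN : N ∈ V F m) (G : F[X]) :
    layer f P Q a m (G + P ^ (a + 1) * Q * N) = layer f P Q a m G := by
  have h : P ^ a ∣ P ^ (a + 1) * Q * N := ((pow_dvd_pow P a.le_succ).mul_right Q).mul_right N
  classical
  have hd : P ^ a ∣ G + P ^ (a + 1) * Q * N ↔ P ^ a ∣ G := dvd_add_left h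
  simp only [layer, hd, Phi_add_mul f _ hN G]

lemma nrm_layer_average {f : F[X] → ℂ} (hf : UMul f) {P Q : F[X]} {p : ℕ} (hP : P.Monic)
    (hp : P.natDegree = p) (hnull : nrm (Phi f Q) = 0) (b : ℕ) :
    nrm (fun m G => ∑ c ∈ V F p, layer f P Q b m (G + P ^ b * Q * c)) = 0 := by
  classical
  have hb := Phi_cb hf (P ^ b * Q)
  have hbs := hb.comp (fun m => m + p) fun _ G => G
  have h1 : (fun m G => ∑ c ∈ V F p, layer f P Q b m (G + P ^ b * Q * c)) =
      fun m G => (qr F : ℂ) ^ p * if P ^ b ∣ G then Phi f (P ^ b * Q) (m + p) G else 0 := by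
    ext m G
    have hd : ∀ c, P ^ b ∣ G + P ^ b * Q * c ↔ P ^ b ∣ G := fun c =>
      dvd_add_left ((dvd_mul_right _ _).mul_right _)
    simp only [layer, hd]
    split_ifs with h
    · have h2 := Phi_mul_average f (P ^ b * Q) hP hp m G
      have h3 : P ^ b * Q * P = P ^ (b + 1) * Q := by ring
      rw [h3] at h2
      rw [← h2, mul_inv_cancel_left₀ (qrC_pow_ne_zero p)]
    · simp
  rw [h1, nrm_const_mul]
  have h4 : nrm (fun m G => if P ^ b ∣ G then Phi f (P ^ b * Q) m G else 0) = 0 := by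
    have := nrm_Phi_dvd_sq hf (hP.pow b) Q
    rw [hnull] at this
    simpa using this
  have h5 : nrm (fun m G => if P ^ b ∣ G then Phi f (P ^ b * Q) m G else 0) =
      nrm fun m G => if P ^ b ∣ G then Phi f (P ^ b * Q) (m + p) G else 0 := by
    refine nrm_eq_of_null (hb.ite _) (hbs.ite fun _ G => P ^ b ∣ G) ?_
    refine nrm_null_of_le ((hb.ite _).sub (hbs.ite fun _ G => P ^ b ∣ G)) (hb.sub hbs)
      (nrm_Phi_sub_shift hf _ p) (Eventually.of_forall fun m => Eventually.of_forall fun G => ?_)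
    split_ifs <;> simp
  rw [← h5, h4, mul_zero]

lemma ip_translate {g h : ℕ → F[X] → ℂ} (hg : CB g) (hh : CB h) (L : F[X]) :
    ip (fun m G => g m (G + L)) (fun m G => h m (G + L)) = ip g h :=
  E_translate (hg.mul hh.conj).re L

lemma ip_congr {g g' h h' : ℕ → F[X] → ℂ} (hg : CB g) (hg' : CB g') (hh : CB h) (hh' : CB h')
    (H : ∀ᶠ m in atTop, ∀ᶠ G in big F, g m G = g' m G ∧ h m G = h' m G) : ip g h = ip g' h' := by
  refine le_antisymm (E_mono (hg.mul hh.conj).re (hg'.mul hh'.conj).re ?_)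
    (E_mono (hg'.mul hh'.conj).re (hg.mul hh.conj).re ?_) <;>
  · refine H.mono fun m hm => hm.mono fun G hG => ?_
    rw [hG.1, hG.2]

lemma ip_eq_zero_of_null {g h : ℕ → F[X] → ℂ} (hg : CB g) (hh : CB h) (h0 : nrm h = 0) :
    ip g h = 0 := by
  have := ip_le hg hh
  rw [h0, mul_zero] at this
  exact abs_nonpos_iff.1 this

lemma exists_mem_V_ge (N : F[X]) : ∃ k, ∀ m ≥ k, N ∈ V F m := by
  obtain ⟨k, hk⟩ := exists_mem_V N
  exact ⟨k, fun m hm => V_mono hm hk⟩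

lemma ip_layerSum_eq_zero {f : F[X] → ℂ} (hf : UMul f) {P Q : F[X]} {p : ℕ} (hP : P.Monic)
    (hp : P.natDegree = p) (hnull : nrm (Phi f Q) = 0) {n : ℕ} (hX : X ^ n ∣ Q) (A : Finset F[X])
    {a b : ℕ} (hab : a < b) :
    ip (layerSum f P Q n A a) (layerSum f P Q n A b) = 0 := by
  classical
  have ha := layerSum_cb hf P Q n A a
  have hb := layerSum_cb hf P Q n A b
  have hXc : ∀ c G, X ^ n ∣ G + P ^ b * Q * c ↔ X ^ n ∣ G := fun c G =>
    dvd_add_left ((hX.mul_left _).mul_right _)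
  have hbc : ∀ c, CB fun m G => layerSum f P Q n A b m (G + P ^ b * Q * c) := fun c =>
    hb.comp (fun m => m) fun _ G => G + P ^ b * Q * c
  have hac : ∀ c, CB fun m G => layerSum f P Q n A a m (G + P ^ b * Q * c) := fun c =>
    ha.comp (fun m => m) fun _ G => G + P ^ b * Q * c
  have h1 : ∀ c ∈ V F p, ip (layerSum f P Q n A a)
      (fun m G => layerSum f P Q n A b m (G + P ^ b * Q * c)) =
      ip (layerSum f P Q n A a) (layerSum f P Q n A b) := fun c _ => by
    rw [← ip_translate ha hb (P ^ b * Q * c)]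
    refine ip_congr ha (hac c) (hbc c) (hbc c) ?_
    obtain ⟨k, hk⟩ := exists_mem_V_ge (P ^ (b - a - 1) * c)
    filter_upwards [eventually_ge_atTop k] with m hm
    refine Eventually.of_forall fun G => ⟨?_, rfl⟩
    have h2 : P ^ b * Q * c = P ^ (a + 1) * Q * (P ^ (b - a - 1) * c) := by
      have : b = (a + 1) + (b - a - 1) := by omega
      conv_lhs => rw [this, pow_add]
      ring
    have h3 : ∀ L, layer f P Q a m (G + P ^ b * Q * c + L) = layer f P Q a m (G + L) := fun L => by
      rw [add_right_comm, h2, layer_add f P Q a (hk m hm)]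
    simp only [layerSum, hXc, h3]
  have h4 := Finset.sum_congr rfl h1
  rw [← ip_sum_right, Finset.sum_const, nsmul_eq_mul] at h4
  have h5 : nrm (fun m G => ∑ c ∈ V F p, layerSum f P Q n A b m (G + P ^ b * Q * c)) = 0 := by
    have hl := layer_cb hf P Q b
    have hav : CB fun m G => ∑ c ∈ V F p, layer f P Q b m (G + P ^ b * Q * c) :=
      CB.sum _ fun c _ => hl.comp (fun m => m) fun _ G => G + P ^ b * Q * c
    have hav' := fun L => hav.comp (fun m => m) fun _ G => G + L
    refine nrm_null_of_le (CB.sum _ fun c _ => hbc c) (CB.sum A fun L _ => hav' L)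
      (nrm_sum_null A (fun L _ => hav' L) fun L _ =>
        (nrm_translate hav L).trans (nrm_layer_average hf hP hp hnull b))
      (Eventually.of_forall fun m => Eventually.of_forall fun G => ?_)
    simp only [layerSum, hXc]
    by_cases hXG : X ^ n ∣ G
    · simp only [if_pos hXG]
      rw [Finset.sum_comm]
      refine le_of_eq (congrArg _ (Finset.sum_congr rfl fun L _ => Finset.sum_congr rfl fun c _ => ?_))
      rw [add_right_comm]
    · simp [if_neg hXG]
  rw [ip_eq_zero_of_null ha (CB.sum _ fun c _ => hbc c) h5] at h4
  have h6 : ((V F p).card : ℝ) ≠ 0 := by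
    rw [card_V_real]
    exact (pow_pos qr_pos p).ne'
  rcases mul_eq_zero.1 h4.symm with h | h
  · exact absurd h h6
  · exact h

lemma nrm_sum_sq_of_orthogonal {h : ℕ → ℕ → F[X] → ℂ} (hh : ∀ a, CB (h a))
    (ho : ∀ a b, a < b → ip (h a) (h b) = 0) (K : ℕ) :
    nrm (fun m G => ∑ a ∈ Finset.range K, h a m G) ^ 2 = ∑ a ∈ Finset.range K, nrm (h a) ^ 2 := by
  induction K with
  | zero =>
    have := nrm_const (F := F) 0
    simpa using this
  | succ K ih =>
    simp only [Finset.sum_range_succ]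
    have h0 : ∑ a ∈ Finset.range K, ip (h K) (h a) = 0 := Finset.sum_eq_zero fun a ha => by
      rw [ip_comm]
      exact ho a K (Finset.mem_range.1 ha)
    rw [nrm_add_sq (CB.sum _ fun a _ => hh a) (hh K), ih, ip_comm, ip_sum_right, h0]
    ring

lemma lexNum_eq_sum {ι : F → ℕ} (h0 : ι 0 = 0) {L : F[X]} {n : ℕ} (hL : L ∈ V F n) :
    lexNum ι L = ∑ i ∈ Finset.range n, ι (L.coeff i) * Fintype.card F ^ i := by
  have h1 := Finset.sum_subset (f := fun i => ι (L.coeff i) * Fintype.card F ^ i)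
    (Finset.range_subset_range.2 (le_max_left (L.natDegree + 1) n)) fun i _ hi => by
      rw [Finset.mem_range] at hi
      rw [coeff_eq_zero_of_natDegree_lt (by omega), h0, zero_mul]
  have h2 := Finset.sum_subset (f := fun i => ι (L.coeff i) * Fintype.card F ^ i)
    (Finset.range_subset_range.2 (le_max_right (L.natDegree + 1) n)) fun i _ hi => by
      rw [Finset.mem_range] at hi
      rw [mem_V_iff_coeff.1 hL i (by omega), h0, zero_mul]
  rw [lexNum, h1, h2]

lemma sum_digits_lt {q : ℕ} (d : ℕ → ℕ) (hd : ∀ i, d i < q) (n : ℕ) :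
    ∑ i ∈ Finset.range n, d i * q ^ i < q ^ n := by
  induction n with
  | zero => simp
  | succ n ih =>
    rw [Finset.sum_range_succ, pow_succ]
    have := Nat.mul_le_mul_right (q ^ n) (Nat.succ_le_of_lt (hd n))
    rw [Nat.succ_mul] at this
    linarith [mul_comm q (q ^ n)]

lemma digits_unique {q : ℕ} {d e : ℕ → ℕ} (hd : ∀ i, d i < q) (he : ∀ i, e i < q) {n : ℕ}
    (h : ∑ i ∈ Finset.range n, d i * q ^ i = ∑ i ∈ Finset.range n, e i * q ^ i) :
    ∀ i < n, d i = e i := by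
  induction n with
  | zero => intro i hi; omega
  | succ n ih =>
    rw [Finset.sum_range_succ, Finset.sum_range_succ] at h
    have h1 := sum_digits_lt d hd n
    have h2 := sum_digits_lt e he n
    have hn : d n = e n := by
      have h3 := congrArg (· / q ^ n) h
      have hq : 0 < q ^ n := by omega
      simpa [Nat.add_mul_div_right _ _ hq, Nat.div_eq_of_lt h1, Nat.div_eq_of_lt h2] using h3
    rw [hn] at h
    intro i hi
    rcases Nat.lt_succ_iff_lt_or_eq.1 hi with h4 | rfl
    · exact ih (by omega) i h4
    · exact hn

lemma lexNum_lt {ι : F → ℕ} (hlt : ∀ a, ι a < Fintype.card F) (h0 : ι 0 = 0) {L : F[X]} {n : ℕ}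
    (hL : L ∈ V F n) : lexNum ι L < Fintype.card F ^ n := by
  rw [lexNum_eq_sum h0 hL]
  exact sum_digits_lt _ (fun i => hlt _) n

lemma lexNum_injective {ι : F → ℕ} (hinj : Function.Injective ι)
    (hlt : ∀ a, ι a < Fintype.card F) (h0 : ι 0 = 0) : Function.Injective (lexNum ι) := by
  intro L M h
  obtain ⟨k, hk⟩ := exists_mem_V_ge L
  obtain ⟨l, hl⟩ := exists_mem_V_ge M
  have hL := hk (max k l) (le_max_left _ _)
  have hM := hl (max k l) (le_max_right _ _)
  rw [lexNum_eq_sum h0 hL, lexNum_eq_sum h0 hM] at h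
  ext i
  by_cases hi : i < max k l
  · exact hinj (digits_unique (fun i => hlt (L.coeff i)) (fun i => hlt (M.coeff i)) h i hi)
  · rw [mem_V_iff_coeff.1 hL i (by omega), mem_V_iff_coeff.1 hM i (by omega)]

lemma lexNum_add {ι : F → ℕ} (h0 : ι 0 = 0) {H M : F[X]} {k : ℕ} (hH : X ^ k ∣ H)
    (hM : M ∈ V F k) : lexNum ι (M + H) = lexNum ι M + lexNum ι H := by
  obtain ⟨l, hl⟩ := exists_mem_V_ge H
  have hH' := hl (max k l) (le_max_right _ _)
  have hM' := V_mono (le_max_left k l) hM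
  rw [lexNum_eq_sum h0 hH', lexNum_eq_sum h0 hM', lexNum_eq_sum h0 (add_mem_V hM' hH'),
    ← Finset.sum_add_distrib]
  refine Finset.sum_congr rfl fun i _ => ?_
  rw [coeff_add, ← add_mul]
  congr 1
  by_cases hi : i < k
  · rw [X_pow_dvd_iff.1 hH i hi, h0, add_zero, add_zero]
  · rw [mem_V_iff_coeff.1 hM i (by omega), h0, zero_add, zero_add]

lemma C_mul_X_pow_mem_V (u : F) {j n : ℕ} (hj : j < n) : C u * X ^ j ∈ V F n := by
  rw [mem_V_iff_coeff]
  intro i hi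
  rw [coeff_C_mul_X_pow, if_neg (by omega)]

lemma lexNum_C_mul_X_pow {ι : F → ℕ} (h0 : ι 0 = 0) (u : F) (j : ℕ) :
    lexNum ι (C u * X ^ j) = ι u * Fintype.card F ^ j := by
  rw [lexNum_eq_sum h0 (C_mul_X_pow_mem_V u j.lt_succ_self), Finset.sum_range_succ,
    Finset.sum_eq_zero, zero_add, coeff_C_mul_X_pow, if_pos rfl]
  intro i hi
  rw [coeff_C_mul_X_pow, if_neg (by have := Finset.mem_range.1 hi; omega), h0, zero_mul]

lemma exists_lexNum_eq {ι : F → ℕ} (hinj : Function.Injective ι)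
    (hlt : ∀ a, ι a < Fintype.card F) (h0 : ι 0 = 0) {n k : ℕ} (hk : k < Fintype.card F ^ n) :
    ∃ L ∈ V F n, lexNum ι L = k := by
  have himg : (V F n).image (lexNum ι) = Finset.range (Fintype.card F ^ n) := by
    refine Finset.eq_of_subset_of_card_le (fun M hM => ?_) ?_
    · obtain ⟨N, hN, rfl⟩ := Finset.mem_image.1 hM
      exact Finset.mem_range.2 (lexNum_lt hlt h0 hN)
    · rw [Finset.card_image_of_injective _ (lexNum_injective hinj hlt h0), Finset.card_range, card_V]
  have h1 := Finset.mem_range.2 hk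
  rw [← himg] at h1
  simpa using h1

/-- The initial segment of polynomials of degree less than `n` in the lexicographic order. -/
def lexSeg (ι : F → ℕ) (n w : ℕ) : Finset F[X] := (V F n).filter fun L => lexNum ι L < w

lemma lexSeg_subset (ι : F → ℕ) (n w : ℕ) : lexSeg ι n w ⊆ V F n := Finset.filter_subset _ _

/-- Increasing one vanishing digit adds exactly one polynomial for each choice of the lower
digits. -/
lemma sum_lexSeg_increment {ι : F → ℕ} (hinj : Function.Injective ι)
    (hlt : ∀ a, ι a < Fintype.card F) (h0 : ι 0 = 0) {u : F} (hu : ι u = 1) {n j : ℕ} (hj : j < n)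
    {W H : F[X]} (hW : W ∈ V F j) (hH : H ∈ V F n) (hXH : X ^ (j + 1) ∣ H) (g : F[X] → ℂ) :
    ∑ L ∈ lexSeg ι n (lexNum ι (W + C u * X ^ j + H)), g L =
      ∑ L ∈ lexSeg ι n (lexNum ι (W + H)), g L +
        ∑ M ∈ V F j, g (M + (if lexNum ι M < lexNum ι W then C u * X ^ j else 0) + H) := by
  have hu1 : lexNum ι (C u * X ^ j) = Fintype.card F ^ j := by
    rw [lexNum_C_mul_X_pow h0, hu, one_mul]
  have hadd : ∀ M ∈ V F j, lexNum ι (M + C u * X ^ j + H) = lexNum ι M + Fintype.card F ^ j + lexNum ι H :=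
    fun M hM => by
      rw [lexNum_add h0 hXH (add_mem_V (V_mono j.le_succ hM) (C_mul_X_pow_mem_V u j.lt_succ_self)),
        lexNum_add h0 (dvd_mul_left _ _) hM, hu1]
  have hadd' : ∀ M ∈ V F j, lexNum ι (M + H) = lexNum ι M + lexNum ι H := fun M hM =>
    lexNum_add h0 hXH (V_mono j.le_succ hM)
  set φ : F[X] → F[X] := fun M => M + (if lexNum ι M < lexNum ι W then C u * X ^ j else 0) + H with hφ
  have hφn : ∀ M ∈ V F j, lexNum ι (φ M) = if lexNum ι M < lexNum ι W then
      lexNum ι M + Fintype.card F ^ j + lexNum ι H else lexNum ι M + lexNum ι H := fun M hM => by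
    simp only [hφ]
    split_ifs
    · exact hadd M hM
    · rw [add_zero]; exact hadd' M hM
  have hlW := lexNum_lt hlt h0 hW
  have hφinj : Set.InjOn φ (V F j) := fun M hM N hN h => by
    have h1 := congrArg (lexNum ι) h
    rw [hφn M hM, hφn N hN] at h1
    have h2 := lexNum_lt hlt h0 hM
    have h3 := lexNum_lt hlt h0 hN
    refine lexNum_injective hinj hlt h0 ?_
    split_ifs at h1 <;> omega
  set I := (V F n).filter fun L => lexNum ι (W + H) ≤ lexNum ι L ∧
    lexNum ι L < lexNum ι (W + C u * X ^ j + H) with hI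
  have himg : (V F j).image φ = I := by
    refine Finset.eq_of_subset_of_card_le (fun L hL => ?_) ?_
    · obtain ⟨M, hM, rfl⟩ := Finset.mem_image.1 hL
      have h2 := lexNum_lt hlt h0 hM
      rw [hI, Finset.mem_filter]
      refine ⟨add_mem_V (add_mem_V (V_mono hj.le hM) ?_) hH, ?_⟩
      · split_ifs
        · exact C_mul_X_pow_mem_V u hj
        · exact zero_mem_V n
      · rw [hφn M hM, hadd W hW, hadd' W hW]
        split_ifs <;> omega
    · rw [Finset.card_image_of_injOn hφinj, card_V]
      have h4 : I.card ≤ (Finset.Ico (lexNum ι (W + H)) (lexNum ι (W + C u * X ^ j + H))).card :=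
        Finset.card_le_card_of_injOn (lexNum ι) (fun L hL => by
          have := (Finset.mem_filter.1 hL).2
          exact Finset.mem_coe.2 (Finset.mem_Ico.2 this))
          (lexNum_injective hinj hlt h0).injOn
      rw [Nat.card_Ico, hadd W hW, hadd' W hW] at h4
      omega
  have hdisj : Disjoint (lexSeg ι n (lexNum ι (W + H))) I := by
    rw [Finset.disjoint_left]
    intro L hL hL'
    have h1 := (Finset.mem_filter.1 hL).2
    have h2 := (Finset.mem_filter.1 hL').2
    omega
  have hun : lexSeg ι n (lexNum ι (W + C u * X ^ j + H)) = lexSeg ι n (lexNum ι (W + H)) ∪ I := by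
    ext L
    have h1 := hadd W hW
    have h2 := hadd' W hW
    simp only [lexSeg, hI, Finset.mem_union, Finset.mem_filter]
    constructor
    · rintro ⟨h3, h4⟩
      by_cases h5 : lexNum ι L < lexNum ι (W + H)
      · exact Or.inl ⟨h3, h5⟩
      · exact Or.inr ⟨h3, by omega, h4⟩
    · rintro (⟨h3, h4⟩ | ⟨h3, h4, h5⟩)
      · exact ⟨h3, by omega⟩
      · exact ⟨h3, h5⟩
  rw [hun, Finset.sum_union hdisj, ← himg, Finset.sum_image hφinj]

open Classical in
/-- Restriction of a function to the monic polynomials, extended by zero. -/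
def monicPart (f : F[X] → ℂ) (G : F[X]) : ℂ := if G.Monic then f G else 0

lemma mem_V_of_lexNum_lt {ι : F → ℕ} (hinj : Function.Injective ι)
    (hlt : ∀ a, ι a < Fintype.card F) (h0 : ι 0 = 0) {n : ℕ} {G : F[X]}
    (h : lexNum ι G < Fintype.card F ^ n) : G ∈ V F n := by
  obtain ⟨L, hL, hLk⟩ := exists_lexNum_eq hinj hlt h0 h
  rwa [lexNum_injective hinj hlt h0 hLk] at hL

lemma finsum_lexNum_le {ι : F → ℕ} (hinj : Function.Injective ι)
    (hlt : ∀ a, ι a < Fintype.card F) (h0 : ι 0 = 0) (f : F[X] → ℂ) {N d : ℕ}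
    (hN : N < Fintype.card F ^ d) :
    ∑ᶠ G ∈ {G : F[X] | G.Monic ∧ lexNum ι G ≤ N}, f G = ∑ G ∈ lexSeg ι d (N + 1), monicPart f G := by
  classical
  have hset : {G : F[X] | G.Monic ∧ lexNum ι G ≤ N} =
      ((lexSeg ι d (N + 1)).filter fun G => G.Monic : Finset F[X]) := by
    ext G
    simp only [lexSeg, Set.mem_ofPred_eq, Finset.coe_filter, Finset.mem_filter, Nat.lt_succ_iff]
    constructor
    · rintro ⟨h1, h2⟩
      exact ⟨⟨mem_V_of_lexNum_lt hinj hlt h0 (by omega), h2⟩, h1⟩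
    · rintro ⟨⟨-, h2⟩, h1⟩
      exact ⟨h1, h2⟩
  rw [hset, finsum_mem_coe_finset, Finset.sum_filter]
  rfl

lemma shiftBounded_lexSeg {ι : F → ℕ} (hinj : Function.Injective ι)
    (hlt : ∀ a, ι a < Fintype.card F) (h0 : ι 0 = 0) {f : F[X] → ℂ} {C : ℝ}
    (hC : ∀ N ≥ 1, ‖∑ᶠ G ∈ {G : F[X] | G.Monic ∧ lexNum ι G ≤ N}, f G‖ ≤ C) (n w : ℕ) :
    ShiftBounded (monicPart f) n (2 * C) (lexSeg ι n w) := by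
  intro B hB hn hX
  have hq : 2 ≤ Fintype.card F := Fintype.one_lt_card
  have hC0 : 0 ≤ C := (norm_nonneg _).trans (hC 1 le_rfl)
  have hb : ∀ N d, N ≤ Fintype.card F ^ d → ‖∑ G ∈ lexSeg ι d N, monicPart f G‖ ≤ C := by
    intro N d hN
    rcases N with _ | _ | N
    · simpa [lexSeg] using hC0
    · have h1 : ∑ G ∈ lexSeg ι d 1, monicPart f G = 0 := by
        refine Finset.sum_eq_zero fun G hG => ?_
        have h2 := (Finset.mem_filter.1 hG).2
        have h3 : lexNum ι (0 : F[X]) = 0 := by simp [lexNum, h0]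
        have h4 : G = 0 := lexNum_injective hinj hlt h0 (by rw [h3]; omega)
        rw [monicPart, if_neg]
        rw [h4]
        exact not_monic_zero
      rw [h1, norm_zero]
      exact hC0
    · rw [← finsum_lexNum_le hinj hlt h0 f hN]
      exact hC _ (by omega)
  set b := lexNum ι B with hbdef
  set v := min w (Fintype.card F ^ n) with hv
  have hseg : lexSeg ι n w = lexSeg ι n v := by
    refine Finset.filter_congr fun L hL => ?_
    have := lexNum_lt hlt h0 hL
    omega
  obtain ⟨d, hd⟩ : ∃ d, b + v ≤ Fintype.card F ^ d :=
    ⟨b + v, (Nat.lt_pow_self hq).le⟩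
  have hadd : ∀ L ∈ V F n, lexNum ι (B + L) = b + lexNum ι L := fun L hL => by
    rw [add_comm, lexNum_add h0 hX hL, add_comm]
  have himg : (lexSeg ι n v).image (fun L => B + L) =
      (lexSeg ι d (b + v)).filter fun G => ¬ lexNum ι G < b := by
    ext G
    simp only [Finset.mem_image, Finset.mem_filter, lexSeg]
    constructor
    · rintro ⟨L, ⟨hL, hLv⟩, rfl⟩
      have h1 := hadd L hL
      exact ⟨⟨mem_V_of_lexNum_lt hinj hlt h0 (by omega), by omega⟩, by omega⟩
    · rintro ⟨⟨hG, h1⟩, h2⟩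
      obtain ⟨L, hL, hLk⟩ := exists_lexNum_eq (n := n) hinj hlt h0
        (k := lexNum ι G - b) (by omega)
      refine ⟨L, ⟨hL, by omega⟩, lexNum_injective hinj hlt h0 ?_⟩
      rw [hadd L hL]
      omega
  have hlow : (lexSeg ι d (b + v)).filter (fun G => lexNum ι G < b) = lexSeg ι d b := by
    ext G
    simp only [Finset.mem_filter, lexSeg]
    constructor
    · rintro ⟨⟨h1, h2⟩, h3⟩
      exact ⟨h1, h3⟩
    · rintro ⟨h1, h3⟩
      exact ⟨⟨h1, by omega⟩, h3⟩
  have hsplit := Finset.sum_filter_add_sum_filter_not (lexSeg ι d (b + v))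
    (fun G => lexNum ι G < b) (monicPart f)
  rw [hlow, ← himg, Finset.sum_image (fun _ _ _ _ h => add_left_cancel h)] at hsplit
  rw [hseg, ← add_sub_cancel_left (∑ G ∈ lexSeg ι d b, monicPart f G)
    (∑ L ∈ lexSeg ι n v, monicPart f (B + L)), hsplit]
  refine (norm_sub_le _ _).trans ?_
  have h1 := hb (b + v) d hd
  have h2 := hb b d (by omega)
  linarith

lemma monicPart_umul {f : F[X] → ℂ} (hf : CompMultOnMonic f) (hu : UnimodularOnMonic f) :
    UMul (monicPart f) where
  eq_zero G hG := by rw [monicPart, if_neg hG]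
  norm_eq G hG := by rw [monicPart, if_pos hG]; exact hu G hG
  map_mul D G hD := by
    by_cases hG : G.Monic
    · rw [monicPart, monicPart, monicPart, if_pos (hD.mul hG), if_pos hD, if_pos hG]
      exact hf.2 D G hD hG
    · have h1 : ¬ (D * G).Monic := fun h => hG (hD.of_mul_monic_left h)
      rw [monicPart, monicPart, monicPart, if_neg h1, if_neg hG, mul_zero]

open Classical in
lemma nrm_layer_translate_sq {f : F[X] → ℂ} (hf : UMul f) {P : F[X]} (hP : P.Monic) (Q L : F[X])
    (n a : ℕ) :
    nrm (fun m G => if X ^ n ∣ G then layer f P Q a m (G + L) else 0) ^ 2 =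
      (nm (P ^ a))⁻¹ *
        nrm (fun m G => if X ^ n ∣ P ^ a * G - L then Phi f (P * Q) m G else 0) ^ 2 := by
  have hl := (layer_cb hf P Q a).comp (fun m => m) fun _ G => G + L
  have hPh := Phi_cb hf (P ^ (a + 1) * Q)
  rw [← nrm_translate (hl.ite fun _ G => X ^ n ∣ G) (-L)]
  have h1 : (fun (m : ℕ) (G : F[X]) =>
      if X ^ n ∣ G + -L then layer f P Q a m (G + -L + L) else 0) =
      fun m G => if P ^ a ∣ G then
        (if X ^ n ∣ G - L then Phi f (P ^ (a + 1) * Q) m G else 0) else 0 := by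
    ext m G
    rw [neg_add_cancel_right, ← sub_eq_add_neg]
    simp only [layer]
    split_ifs <;> rfl
  rw [h1, nrm_dvd_sq (hPh.ite fun _ G => X ^ n ∣ G - L) (hP.pow a)]
  have h2 : (fun (m : ℕ) (G : F[X]) => if X ^ n ∣ P ^ a * G - L then
      Phi f (P ^ (a + 1) * Q) m (P ^ a * G) else 0) =
      fun m G => f (P ^ a) * if X ^ n ∣ P ^ a * G - L then Phi f (P * Q) m G else 0 := by
    ext m G
    split_ifs
    · rw [← Phi_dilate hf (hP.pow a)]
      congr 1
      ring
    · simp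
  rw [h2, nrm_const_mul, hf.norm_eq _ (hP.pow a), one_mul]

open Classical in
lemma nrm_layer_translate_ge {f : F[X] → ℂ} (hf : UMul f) {P R : F[X]} (hP : P.Monic)
    (hR : R.Monic) (hPX : IsCoprime X P) (hRX : IsCoprime X R) {n N : ℕ} (hn0 : 1 ≤ n)
    (hn : n ≤ N) {L : F[X]} (hL : ¬ X ∣ L) (a : ℕ) :
    nrm (fun m G => if X ∣ G then 0 else Phi f (X ^ N * (P * R)) m G) ^ 2 ≤
      qr F ^ n * nm (P ^ a) *
        nrm (fun m G => if X ^ n ∣ G then layer f P (X ^ N * R) a m (G + L) else 0) ^ 2 := by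
  have hc : IsCoprime (X ^ n) (P ^ a) := hPX.pow
  obtain ⟨y, hy⟩ : ∃ y, X ^ n ∣ P ^ a * y - L := by
    obtain ⟨u, v, huv⟩ := hc
    exact ⟨v * L, ⟨-(u * L), by linear_combination L * huv⟩⟩
  have hX : (X : F[X]) ∣ X ^ n := dvd_pow_self X (by omega)
  have hxy : ¬ X ∣ y := fun h => hL (by
    have := dvd_sub (h.mul_left (P ^ a)) (hX.trans hy)
    rwa [sub_sub_cancel] at this)
  have h1 : ∀ G, X ^ n ∣ P ^ a * G - L ↔ X ^ n ∣ G - y := fun G => by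
    have h2 : P ^ a * G - L = P ^ a * (G - y) + (P ^ a * y - L) := by ring
    rw [h2, dvd_add_left hy]
    exact ⟨fun h => hc.dvd_of_dvd_mul_left h, fun h => h.mul_left _⟩
  have h3 : P * (X ^ N * R) = X ^ N * (P * R) := by ring
  have hnm : nm (P ^ a) ≠ 0 := (nm_pos _).ne'
  rw [nrm_layer_translate_sq hf hP]
  simp only [h1, h3]
  rw [mul_assoc, mul_inv_cancel_left₀ hnm]
  exact energy_unit_ge hf (hP.mul hR) (hPX.mul_right hRX) hn hxy hn0

lemma norm_sum_sq_of_disjoint {I : Type*} (s : Finset I) (g : I → ℂ)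
    (h : ∀ i ∈ s, ∀ j ∈ s, i ≠ j → g i = 0 ∨ g j = 0) :
    ‖∑ i ∈ s, g i‖ ^ 2 = ∑ i ∈ s, ‖g i‖ ^ 2 := by
  classical
  by_cases h0 : ∃ i ∈ s, g i ≠ 0
  · obtain ⟨i, hi, hgi⟩ := h0
    have h1 : ∀ j ∈ s, j ≠ i → g j = 0 := fun j hj hji =>
      (h j hj i hi hji).resolve_right hgi
    rw [Finset.sum_eq_single_of_mem i hi h1,
      Finset.sum_eq_single_of_mem i hi fun j hj hji => by rw [h1 j hj hji]; simp]
  · push Not at h0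
    rw [Finset.sum_eq_zero h0, Finset.sum_eq_zero fun i hi => by rw [h0 i hi]; simp]
    simp

lemma nrm_sum_sq_of_disjoint {I : Type*} (s : Finset I) {g : I → ℕ → F[X] → ℂ}
    (hg : ∀ i ∈ s, CB (g i))
    (h : ∀ m G, ∀ i ∈ s, ∀ j ∈ s, i ≠ j → g i m G = 0 ∨ g j m G = 0) :
    nrm (fun m G => ∑ i ∈ s, g i m G) ^ 2 = ∑ i ∈ s, nrm (g i) ^ 2 := by
  rw [nrm_sq (CB.sum s hg), Finset.sum_congr rfl fun i hi => nrm_sq (hg i hi), ← E_sum]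
  congr 1
  ext m G
  exact norm_sum_sq_of_disjoint s _ (h m G)

lemma eq_zero_of_dvd_of_mem_V {D G : F[X]} {k : ℕ} (hD : D.Monic) (hk : k ≤ D.natDegree)
    (hG : G ∈ V F k) (h : D ∣ G) : G = 0 := by
  by_contra hne
  have h1 := degree_le_of_dvd h hne
  rw [degree_eq_natDegree hD.ne_zero] at h1
  exact absurd ((mem_V.1 hG).trans_le (by exact_mod_cast hk)) h1.not_gt

open Classical in
lemma count_V_not_X_dvd {j : ℕ} (hj : 1 ≤ j) :
    qr F ^ j ≤ 2 * ((V F j).filter fun M => ¬ X ∣ M).card := by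
  have h1 := count_V_dvd (F := F) (D := X) (R := 1) monic_X isCoprime_one_right 0
    (by rwa [natDegree_X] : (X : F[X]).natDegree ≤ j)
  simp only [zero_add, one_mul] at h1
  rw [Finset.sum_boole, nm_eq, natDegree_X, pow_one] at h1
  have h2 := Finset.card_filter_add_card_filter_not (s := V F j) (fun M => (X : F[X]) ∣ M)
  have h3 : (((V F j).filter fun M => X ∣ M).card : ℝ) +
      ((V F j).filter fun M => ¬ X ∣ M).card = qr F ^ j := by
    rw [← card_V_real, ← h2]
    push_cast
    rfl
  have h4 : (0 : ℝ) ≤ ((V F j).filter fun M => X ∣ M).card := Nat.cast_nonneg _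
  nlinarith [two_le_qr (F := F)]

open Classical in
lemma nrm_layerSum_increment_ge {f : F[X] → ℂ} (hf : UMul f) {P R : F[X]} (hP : P.Monic)
    (hR : R.Monic) (hPX : IsCoprime X P) (hRX : IsCoprime X R) {ι : F → ℕ}
    (hinj : Function.Injective ι) (hlt : ∀ a, ι a < Fintype.card F) (h0 : ι 0 = 0) {u : F}
    (hu : ι u = 1) {n N j a : ℕ} (hj0 : 1 ≤ j) (hj : j < n) (hn : n ≤ N)
    (ha : (P ^ a).natDegree = j + 1) {W H : F[X]} (hW : W ∈ V F j) (hH : H ∈ V F n)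
    (hXH : X ^ (j + 1) ∣ H) :
    nrm (fun m G => if X ∣ G then 0 else Phi f (X ^ N * (P * R)) m G) ^ 2 ≤
      2 * qr F * qr F ^ n * nrm (fun m G =>
        layerSum f P (X ^ N * R) n (lexSeg ι n (lexNum ι (W + C u * X ^ j + H))) a m G -
        layerSum f P (X ^ N * R) n (lexSeg ι n (lexNum ι (W + H))) a m G) ^ 2 := by
  set κ := nrm (fun m G => if X ∣ G then 0 else Phi f (X ^ N * (P * R)) m G) ^ 2
  set T : F[X] → F[X] := fun M => M + (if lexNum ι M < lexNum ι W then C u * X ^ j else 0) + H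
    with hT
  have h1 : (fun m G =>
        layerSum f P (X ^ N * R) n (lexSeg ι n (lexNum ι (W + C u * X ^ j + H))) a m G -
        layerSum f P (X ^ N * R) n (lexSeg ι n (lexNum ι (W + H))) a m G) = fun m G =>
      ∑ M ∈ V F j, if X ^ n ∣ G then layer f P (X ^ N * R) a m (G + T M) else 0 := by
    ext m G
    simp only [layerSum]
    split_ifs with h
    · rw [sum_lexSeg_increment hinj hlt h0 hu hj hW hH hXH, add_sub_cancel_left]
    · simp
  have hXT : ∀ M, X ∣ T M ↔ X ∣ M := fun M => by
    have h2 : X ∣ (if lexNum ι M < lexNum ι W then C u * X ^ j else 0) + H :=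
      dvd_add (by
        split_ifs
        · exact (dvd_pow_self X (by omega)).mul_left _
        · exact dvd_zero _) ((dvd_pow_self X (by omega)).trans hXH)
    simp only [hT, add_assoc]
    exact dvd_add_left h2
  have hinjT : ∀ M ∈ V F j, ∀ M' ∈ V F j, P ^ a ∣ T M - T M' → M = M' := fun M hM M' hM' h => by
    set e : F[X] := (if lexNum ι M < lexNum ι W then C u * X ^ j else 0) -
      (if lexNum ι M' < lexNum ι W then C u * X ^ j else 0) with he
    have h2 : T M - T M' = (M - M') + e := by
      simp only [hT, he]
      ring
    have hXe : X ^ j ∣ e := dvd_sub (by split_ifs <;> simp) (by split_ifs <;> simp)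
    have hev : e ∈ V F (j + 1) := by
      have := C_mul_X_pow_mem_V u j.lt_succ_self
      refine sub_mem_V ?_ ?_ <;> split_ifs <;> first | exact this | exact zero_mem_V _
    have hMM := sub_mem_V hM hM'
    rw [h2] at h
    have h3 := eq_zero_of_dvd_of_mem_V (hP.pow a) ha.ge (add_mem_V (V_mono j.le_succ hMM) hev) h
    have h4 : M - M' = -e := by linear_combination h3
    have h5 := eq_zero_of_dvd_of_mem_V (monic_X_pow j) (natDegree_X_pow j).ge hMM
      (h4 ▸ (dvd_neg.2 hXe))
    exact sub_eq_zero.1 h5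
  have hcb : ∀ M, CB fun m G => if X ^ n ∣ G then layer f P (X ^ N * R) a m (G + T M) else 0 :=
    fun M => ((layer_cb hf P (X ^ N * R) a).comp (fun m => m) fun _ G => G + T M).ite
      fun _ G => X ^ n ∣ G
  rw [h1, nrm_sum_sq_of_disjoint (V F j) fun M _ => hcb M]
  · have h6 : ∀ M ∈ (V F j).filter (fun M => ¬ X ∣ M), κ / (qr F ^ n * qr F ^ (j + 1)) ≤
        nrm (fun m G => if X ^ n ∣ G then layer f P (X ^ N * R) a m (G + T M) else 0) ^ 2 :=
      fun M hM => by
        have hM' : ¬ X ∣ T M := by rw [hXT]; exact (Finset.mem_filter.1 hM).2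
        have := nrm_layer_translate_ge hf hP hR hPX hRX (by omega) hn hM' a
        rw [nm_eq, ha] at this
        rw [div_le_iff₀' (mul_pos (pow_pos qr_pos _) (pow_pos qr_pos _))]
        exact this
    have h7 := Finset.card_nsmul_le_sum _ _ _ h6
    have h8 := h7.trans (Finset.sum_le_sum_of_subset_of_nonneg (Finset.filter_subset _ (V F j))
      fun M _ _ => sq_nonneg _)
    rw [nsmul_eq_mul] at h8
    have h9 := count_V_not_X_dvd (F := F) hj0
    have hq : 0 < qr F := qr_pos
    have hk : 0 ≤ κ := sq_nonneg _
    have h10 : qr F ^ j / 2 * (κ / (qr F ^ n * qr F ^ (j + 1))) ≤ _ :=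
      (mul_le_mul_of_nonneg_right (by linarith) (by positivity)).trans h8
    have h11 : qr F ^ j / 2 * (κ / (qr F ^ n * qr F ^ (j + 1))) = κ / (2 * qr F * qr F ^ n) := by
      rw [pow_succ]
      field_simp
    rw [h11, div_le_iff₀' (by positivity)] at h10
    exact h10
  · intro m G M hM M' hM' hne
    by_contra! hcon
    obtain ⟨hc1, hc2⟩ := hcon
    simp only [layer, ne_eq, ite_eq_right_iff, not_forall] at hc1 hc2
    obtain ⟨-, hd1, -⟩ := hc1
    obtain ⟨-, hd2, -⟩ := hc2
    refine hne (hinjT M hM M' hM' ?_)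
    have := dvd_sub hd1 hd2
    rwa [add_sub_add_left_eq_sub] at this

lemma card_mul_le_of_toggle (s : Finset ℕ) (v : Finset ℕ → ℕ → ℝ) {b δ : ℝ}
    (hb : ∀ S ⊆ s, ∑ a ∈ s, v S a ≤ b)
    (hδ : ∀ a ∈ s, ∀ S ⊆ s.erase a, δ ≤ v S a + v (insert a S) a) : s.card * δ ≤ 2 * b := by
  have h1 : ∑ S ∈ s.powerset, ∑ a ∈ s, v S a ≤ 2 ^ s.card * b := by
    refine (Finset.sum_le_card_nsmul _ _ b fun S hS => hb S (Finset.mem_powerset.1 hS)).trans_eq ?_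
    rw [Finset.card_powerset, nsmul_eq_mul]
    push_cast
    rfl
  have h2 : ∀ a ∈ s, 2 ^ s.card * (δ / 2) ≤ ∑ S ∈ s.powerset, v S a := fun a ha => by
    have h3 : s.powerset = (insert a (s.erase a)).powerset := by rw [Finset.insert_erase ha]
    rw [h3, Finset.sum_powerset_insert (Finset.notMem_erase a s), ← Finset.sum_add_distrib]
    refine le_trans (le_of_eq ?_) (Finset.card_nsmul_le_sum _ _ δ fun S hS =>
      hδ a ha S (Finset.mem_powerset.1 hS))
    rw [Finset.card_powerset, nsmul_eq_mul, ← Finset.card_erase_add_one ha, pow_succ]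
    push_cast
    ring
  have h4 := Finset.card_nsmul_le_sum _ _ _ h2
  rw [Finset.sum_comm, nsmul_eq_mul] at h4
  have h5 : (0 : ℝ) < 2 ^ s.card := by positivity
  have h6 := h4.trans h1
  have h7 : (2 : ℝ) ^ s.card * (s.card * δ) ≤ 2 ^ s.card * (2 * b) := by linarith
  exact le_of_mul_le_mul_left h7 h5

lemma nrm_sub_sq_le {g h : ℕ → F[X] → ℂ} (hg : CB g) (hh : CB h) :
    nrm (fun m G => g m G - h m G) ^ 2 ≤ 2 * (nrm h ^ 2 + nrm g ^ 2) := by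
  have h1 := pow_le_pow_left₀ (nrm_nonneg _) (nrm_sub_le hg hh) 2
  nlinarith [sq_nonneg (nrm g - nrm h)]

lemma sum_mem_V {I : Type*} (s : Finset I) {g : I → F[X]} {n : ℕ} (h : ∀ i ∈ s, g i ∈ V F n) :
    ∑ i ∈ s, g i ∈ V F n :=
  Finset.sum_induction g (· ∈ V F n) (fun _ _ => add_mem_V) (zero_mem_V n) h

/-- Modulus reduction at a prime other than `X`: the local averages of `f` cannot have their
first mass at a modulus containing such a prime. -/
lemma nrm_Phi_mul_eq_zero {f : F[X] → ℂ} (hf : UMul f) {P R : F[X]} {p : ℕ} (hP : P ∈ Irr F p)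
    (hR : R.Monic) (hPX : IsCoprime X P) (hRX : IsCoprime X R) {ι : F → ℕ}
    (hinj : Function.Injective ι) (hlt : ∀ a, ι a < Fintype.card F) (h0 : ι 0 = 0) {u : F}
    (hu : ι u = 1) {C₀ : ℝ} (hC₀ : 0 ≤ C₀)
    (hSB : ∀ n w, ShiftBounded f n C₀ (lexSeg ι n w))
    (hnull : ∀ N, nrm (Phi f (X ^ N * R)) = 0) (s : ℕ) : nrm (Phi f (X ^ s * (P * R))) = 0 := by
  classical
  obtain ⟨hPm, hPd, hPi⟩ := mem_Irr.1 hP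
  have hp : 1 ≤ p := hPd ▸ hPi.natDegree_pos
  have hq := two_le_qr (F := F)
  have key : ∀ K : ℕ, (K : ℝ) * ((1 - (qr F)⁻¹) * nrm (Phi f (X ^ s * (P * R))) ^ 2) ≤
      8 * qr F * C₀ ^ 2 := fun K' => by
    set K := K' + 1 with hK
    set n := K * p with hn
    set N := n + s + 1 with hN
    set κ := nrm (fun m G => if X ∣ G then 0 else Phi f (X ^ N * (P * R)) m G) ^ 2 with hκ
    have hκge : (1 - (qr F)⁻¹) * nrm (Phi f (X ^ s * (P * R))) ^ 2 ≤ κ := by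
      have h1 := nrm_Phi_not_dvd hf monic_X (X ^ (n + s) * (P * R))
      rw [nm_eq, natDegree_X, pow_one] at h1
      have h2 : X * (X ^ (n + s) * (P * R)) = X ^ N * (P * R) := by rw [hN]; ring
      rw [h2] at h1
      refine le_trans (mul_le_mul_of_nonneg_left (pow_le_pow_left₀ (nrm_nonneg _) ?_ 2) ?_) h1
      · have h3 := nrm_Phi_le_mul hf (X ^ s * (P * R)) (monic_X_pow n)
        have h4 : X ^ s * (P * R) * X ^ n = X ^ (n + s) * (P * R) := by ring
        rwa [h4] at h3
      · rw [sub_nonneg]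
        exact inv_le_one_of_one_le₀ (by linarith)
    set W : Finset ℕ → F[X] := fun S => ∑ a ∈ S, C u * X ^ (a * p - 1) with hW
    set y : Finset ℕ → ℕ → ℕ → F[X] → ℂ := fun S a =>
      layerSum f P (X ^ N * R) n (lexSeg ι n (lexNum ι (W S))) a with hy
    have hycb : ∀ S a, CB (y S a) := fun S a => layerSum_cb hf _ _ _ _ _
    have hXQ : X ^ n ∣ X ^ N * R := (pow_dvd_pow X (by omega)).mul_right _
    have hsum : ∀ S ⊆ Finset.Icc 2 K, ∑ a ∈ Finset.Icc 2 K, nrm (y S a) ^ 2 ≤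
        C₀ ^ 2 * (qr F ^ n)⁻¹ := fun S _ => by
      have h1 := nrm_sum_layerSum_le hf hP ((monic_X_pow N).mul hR) (hnull N)
        (hXQ.mul_left (P ^ (K + 1))) (lexSeg_subset ι n (lexNum ι (W S))) (hSB n _) hC₀
      rw [nrm_sum_sq_of_orthogonal (hycb S) fun a b hab =>
        ip_layerSum_eq_zero hf hPm hPd (hnull N) hXQ _ hab] at h1
      refine (Finset.sum_le_sum_of_subset_of_nonneg (fun a ha => ?_) fun _ _ _ => sq_nonneg _).trans
        h1
      rw [Finset.mem_Icc] at ha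
      exact Finset.mem_range.2 (by omega)
    have htog : ∀ a ∈ Finset.Icc 2 K, ∀ S ⊆ (Finset.Icc 2 K).erase a,
        κ / (4 * qr F * qr F ^ n) ≤ nrm (y S a) ^ 2 + nrm (y (insert a S) a) ^ 2 :=
      fun a ha S hS => by
        rw [Finset.mem_Icc] at ha
        have haS : a ∉ S := fun h => Finset.notMem_erase a _ (hS h)
        have hSK : ∀ b ∈ S, b ≤ K := fun b hb =>
          (Finset.mem_Icc.1 (Finset.mem_of_mem_erase (hS hb))).2
        have hap : 2 ≤ a * p := by nlinarith
        have hapn : a * p ≤ n := Nat.mul_le_mul_right p ha.2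
        set W₁ := W (S.filter (· < a)) with hW₁
        set H := W (S.filter fun b => ¬ b < a) with hH
        have hWS : W S = W₁ + H := (Finset.sum_filter_add_sum_filter_not S (· < a) _).symm
        have hWi : W (insert a S) = W₁ + C u * X ^ (a * p - 1) + H := by
          have : W (insert a S) = C u * X ^ (a * p - 1) + W S := Finset.sum_insert haS
          rw [this, hWS]
          ring
        have hW₁V : W₁ ∈ V F (a * p - 1) := sum_mem_V _ fun b hb => by
          have hb' := (Finset.mem_filter.1 hb).2
          refine C_mul_X_pow_mem_V u ?_
          have : (b + 1) * p ≤ a * p := Nat.mul_le_mul_right p hb'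
          rw [add_mul] at this
          omega
        have hHV : H ∈ V F n := sum_mem_V _ fun b hb => by
          refine C_mul_X_pow_mem_V u ?_
          have : b * p ≤ n := Nat.mul_le_mul_right p (hSK b (Finset.mem_filter.1 hb).1)
          omega
        have hXH : X ^ (a * p - 1 + 1) ∣ H := Finset.dvd_sum fun b hb => by
          obtain ⟨hb1, hb2⟩ := Finset.mem_filter.1 hb
          have hba : b ≠ a := fun h => haS (h ▸ hb1)
          refine (pow_dvd_pow X ?_).mul_left _
          have : (a + 1) * p ≤ b * p := Nat.mul_le_mul_right p (by omega)
          rw [add_mul] at this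
          omega
        have h1 := nrm_layerSum_increment_ge hf hPm hR hPX hRX hinj hlt h0 hu (n := n) (N := N)
          (j := a * p - 1) (a := a) (by omega) (by omega) (by omega)
          (by rw [hPm.natDegree_pow, hPd]; omega) hW₁V hHV hXH
        have h2 := nrm_sub_sq_le (hycb (insert a S) a) (hycb S a)
        simp only [hy, hWS, hWi] at h2 ⊢
        rw [div_le_iff₀' (by positivity)]
        have h3 : 0 ≤ 2 * qr F * qr F ^ n := by positivity
        calc κ ≤ _ := h1
          _ ≤ 2 * qr F * qr F ^ n * _ := mul_le_mul_of_nonneg_left h2 h3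
          _ = _ := by ring
    have h5 := card_mul_le_of_toggle (Finset.Icc 2 K) (fun S a => nrm (y S a) ^ 2) hsum htog
    have hcard : (Finset.Icc 2 K).card = K' := by simp [hK]
    rw [hcard, mul_div_assoc', div_le_iff₀ (by positivity)] at h5
    calc (K' : ℝ) * ((1 - (qr F)⁻¹) * nrm (Phi f (X ^ s * (P * R))) ^ 2) ≤ K' * κ :=
          mul_le_mul_of_nonneg_left hκge (Nat.cast_nonneg _)
      _ ≤ _ := h5
      _ = 8 * qr F * C₀ ^ 2 := by
          field_simp
          ring
  have h1 : 0 < 1 - (qr F)⁻¹ := by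
    rw [sub_pos]
    exact inv_lt_one_of_one_lt₀ one_lt_qr
  by_contra hne
  have h2 : 0 < (1 - (qr F)⁻¹) * nrm (Phi f (X ^ s * (P * R))) ^ 2 :=
    mul_pos h1 (by positivity)
  obtain ⟨K, hK⟩ := exists_nat_gt (8 * qr F * C₀ ^ 2 /
    ((1 - (qr F)⁻¹) * nrm (Phi f (X ^ s * (P * R))) ^ 2))
  rw [div_lt_iff₀ h2] at hK
  exact absurd (key K) hK.not_ge

open Classical in
lemma nrm_Phi_class_le {f : F[X] → ℂ} (hf : UMul f) {r l : ℕ} (hrl : r ≤ l) (x : F[X]) :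
    nrm (fun m G => if X ^ r ∣ G - x then Phi f (X ^ r) m G else 0) ^ 2 ≤
      qr F ^ (l - r) * nrm (fun m G => if X ^ l ∣ G - x then Phi f (X ^ r) m G else 0) ^ 2 := by
  have hPh := Phi_cb hf (X ^ r)
  have hcb : ∀ z, CB fun m G => if X ^ l ∣ G - z then Phi f (X ^ r) m G else 0 := fun z =>
    hPh.ite fun _ G => X ^ l ∣ G - z
  have hl : (X : F[X]) ^ l = X ^ r * X ^ (l - r) := by rw [← pow_add]; congr 1; omega
  have hX0 : (X : F[X]) ^ r ≠ 0 := (monic_X_pow r).ne_zero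
  have heq : ∀ c, nrm (fun m G => if X ^ l ∣ G - (x + X ^ r * c) then Phi f (X ^ r) m G else 0) =
      nrm (fun m G => if X ^ l ∣ G - x then Phi f (X ^ r) m G else 0) := fun c => by
    rw [← nrm_translate (hcb _) (X ^ r * c)]
    refine nrm_congr ((hcb _).comp (fun m => m) fun _ G => G + X ^ r * c) (hcb x) ?_
    obtain ⟨k, hk⟩ := exists_mem_V_ge c
    filter_upwards [eventually_ge_atTop k] with m hm
    refine Eventually.of_forall fun G => ?_
    rw [add_sub_add_right_eq_sub, Phi_add_mul f _ (hk m hm)]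
  have h1 : nrm (fun m G => if X ^ r ∣ G - x then Phi f (X ^ r) m G else 0) ≤
      nrm (fun m G => ∑ c ∈ V F (l - r),
        if X ^ l ∣ G - (x + X ^ r * c) then Phi f (X ^ r) m G else 0) := by
    refine nrm_mono (hPh.ite fun _ G => X ^ r ∣ G - x) (CB.sum _ fun c _ => hcb _)
      (Eventually.of_forall fun m => Eventually.of_forall fun G => ?_)
    by_cases h : X ^ r ∣ G - x
    · obtain ⟨y, hy⟩ := h
      have h2 : ∀ c, X ^ l ∣ G - (x + X ^ r * c) ↔ X ^ (l - r) ∣ y - c := fun c => by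
        have : G - (x + X ^ r * c) = X ^ r * (y - c) := by linear_combination hy
        rw [this, hl]
        exact mul_dvd_mul_iff_left hX0
      have hmem := modByMonic_mem_V (monic_X_pow (l - r)) (natDegree_X_pow (R := F) (l - r)) y
      rw [if_pos ⟨y, hy⟩]
      simp only [h2]
      rw [Finset.sum_eq_single_of_mem _ hmem, if_pos (dvd_self_sub_modByMonic y)]
      intro c hc hne
      rw [if_neg]
      intro hd
      have h3 := dvd_sub (dvd_self_sub_modByMonic (S := X ^ (l - r)) y) hd
      rw [sub_sub_sub_cancel_left] at h3
      exact hne (sub_eq_zero.1 (eq_zero_of_dvd_of_mem_V (monic_X_pow (l - r))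
        (natDegree_X_pow _).ge (sub_mem_V hc hmem) h3))
    · rw [if_neg h]
      simp
  have h4 := nrm_sum_sq_of_disjoint (V F (l - r)) (fun c _ => hcb (x + X ^ r * c))
    fun m G c hc c' hc' hne => by
      by_contra! hcon
      obtain ⟨hc1, hc2⟩ := hcon
      simp only [ne_eq, ite_eq_right_iff, not_forall] at hc1 hc2
      obtain ⟨hd1, -⟩ := hc1
      obtain ⟨hd2, -⟩ := hc2
      have h5 := dvd_sub hd2 hd1
      have h6 : G - (x + X ^ r * c') - (G - (x + X ^ r * c)) = X ^ r * (c - c') := by ring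
      rw [h6, hl, mul_dvd_mul_iff_left hX0] at h5
      exact hne (sub_eq_zero.1 (eq_zero_of_dvd_of_mem_V (monic_X_pow (l - r))
        (natDegree_X_pow _).ge (sub_mem_V hc hc') h5))
  simp only [heq] at h4
  rw [Finset.sum_const, nsmul_eq_mul, card_V_real] at h4
  rw [← h4]
  exact pow_le_pow_left₀ (nrm_nonneg _) h1 2

open Classical in
lemma nrm_layer_X_translate_ge {f : F[X] → ℂ} (hf : UMul f) {r j n : ℕ} (hn : j + (r + 1) ≤ n)
    {x : F[X]} (hx : ¬ X ∣ x) :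
    nrm (fun m G => if X ∣ G then 0 else Phi f (X ^ (r + 1)) m G) ^ 2 ≤ qr F ^ n *
      nrm (fun m G => if X ^ n ∣ G then layer f X (X ^ r) j m (G + X ^ j * x) else 0) ^ 2 := by
  rw [nrm_layer_translate_sq hf monic_X]
  have h1 : ∀ G : F[X], X ^ n ∣ X ^ j * G - X ^ j * x ↔ X ^ (n - j) ∣ G - x := fun G => by
    have h2 : (X : F[X]) ^ n = X ^ j * X ^ (n - j) := by rw [← pow_add]; congr 1; omega
    rw [← mul_sub, h2]
    exact mul_dvd_mul_iff_left (monic_X_pow j).ne_zero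
  have h3 : (X : F[X]) * X ^ r = X ^ (r + 1) := by ring
  simp only [h1, h3, nm_X_pow]
  have h4 := energy_unit_ge hf monic_one isCoprime_one_right (le_refl (r + 1)) hx (by omega)
  simp only [mul_one] at h4
  have h5 := nrm_Phi_class_le hf (by omega : r + 1 ≤ n - j) x
  have hq : qr F ^ n = qr F ^ (r + 1) * qr F ^ (n - j - (r + 1)) * qr F ^ j := by
    rw [← pow_add, ← pow_add]
    congr 1
    omega
  have hq0 : qr F ^ j ≠ 0 := (pow_pos qr_pos j).ne'
  rw [hq, mul_assoc _ (qr F ^ j), mul_inv_cancel_left₀ hq0, mul_assoc]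
  exact h4.trans (mul_le_mul_of_nonneg_left h5 (pow_nonneg qr_pos.le _))

/-- Signed indicator of the second coordinate. -/
def signedDelta (c : F) (v : Bool × F) : ℝ := if v.2 = c then (if v.1 then 1 else -1) else 0

lemma sum_signedDelta_mul {A : Type} [CommRing A] [Algebra ℝ A] (c : F) (g : Bool × F → A) :
    ∑ v, algebraMap ℝ A (signedDelta c v) * g v = g (true, c) - g (false, c) := by
  rw [Fintype.sum_prod_type, Fintype.sum_bool]
  simp [signedDelta, apply_ite (algebraMap ℝ A), ite_mul, sub_eq_add_neg]

/-- The point of the cube with value `v` at `k` and values `y` elsewhere. -/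
def glue {k₀ : ℕ} (k : Fin k₀) (v : Bool × F) (y : {i // i ≠ k} → Bool × F) :
    Fin k₀ → Bool × F :=
  (Equiv.funSplitAt k (Bool × F)).symm (v, y)

lemma glue_self {k₀ : ℕ} (k : Fin k₀) (v : Bool × F) (y : {i // i ≠ k} → Bool × F) :
    glue k v y k = v := by simp [glue]

lemma glue_of_ne {k₀ : ℕ} {k : Fin k₀} (v : Bool × F) (y : {i // i ≠ k} → Bool × F) {i : Fin k₀}
    (h : i ≠ k) : glue k v y i = y ⟨i, h⟩ := by simp [glue, h]

lemma sum_cube_eq {A : Type} [AddCommMonoid A] {k₀ : ℕ} (k : Fin k₀)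
    (g : (Fin k₀ → Bool × F) → A) : ∑ x, g x = ∑ y, ∑ v, g (glue k v y) := by
  rw [← Equiv.sum_comp (Equiv.funSplitAt k (Bool × F)).symm g, Fintype.sum_prod_type,
    Finset.sum_comm]
  rfl

lemma card_slice {k₀ : ℕ} (k : Fin k₀) :
    (Fintype.card ({i : Fin k₀ // i ≠ k} → Bool × F) : ℝ) * (2 * qr F) =
      Fintype.card (Fin k₀ → Bool × F) := by
  have h := Fintype.card_congr (Equiv.funSplitAt k (Bool × F))
  rw [h, Fintype.card_prod, Fintype.card_prod, Fintype.card_bool]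
  push_cast
  rw [qr]
  ring

lemma sum_signedDelta_cube {A : Type} [CommRing A] [Algebra ℝ A] {k₀ : ℕ} (k : Fin k₀) (c : F)
    (g : (Fin k₀ → Bool × F) → A) :
    ∑ x, algebraMap ℝ A (signedDelta c (x k)) * g x =
      ∑ y, (g (glue k (true, c) y) - g (glue k (false, c) y)) := by
  rw [sum_cube_eq k]
  refine Finset.sum_congr rfl fun y _ => ?_
  simp only [glue_self]
  exact sum_signedDelta_mul c fun v => g (glue k v y)

lemma signedDelta_orthogonal {k₀ : ℕ} (i j : Fin k₀ × F) :
    ∑ x : Fin k₀ → Bool × F, signedDelta i.2 (x i.1) * signedDelta j.2 (x j.1) =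
      if i = j then 2 * (Fintype.card ({l : Fin k₀ // l ≠ i.1} → Bool × F) : ℝ) else 0 := by
  have h := sum_signedDelta_cube (A := ℝ) i.1 i.2 fun x => signedDelta j.2 (x j.1)
  simp only [Algebra.algebraMap_self, RingHom.id_apply] at h
  rw [h]
  obtain ⟨k, c⟩ := i
  obtain ⟨l, d⟩ := j
  by_cases hkl : l = k
  · subst hkl
    by_cases hcd : c = d
    · subst hcd
      simp [glue_self, signedDelta]
      ring
    · simp [glue_self, signedDelta, hcd]
  · rw [if_neg fun hh => hkl (congrArg Prod.fst hh).symm]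
    simp [glue_of_ne _ _ hkl]

lemma cube_bessel {k₀ : ℕ} {N : ℝ} (hN : 0 < N)
    (hN' : ∀ k : Fin k₀, (Fintype.card ({i : Fin k₀ // i ≠ k} → Bool × F) : ℝ) = N)
    (T : (Fin k₀ → Bool × F) → ℂ) :
    ∑ k : Fin k₀, ∑ c : F, ‖∑ y, (T (glue k (true, c) y) - T (glue k (false, c) y))‖ ^ 2 ≤
      2 * N * ∑ x, ‖T x‖ ^ 2 := by
  have h := bessel (Finset.univ : Finset (Fin k₀ × F)) Finset.univ T
    (fun i x => signedDelta i.2 (x i.1)) (fun _ => 2 * N) (fun _ _ => by positivity)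
    fun i _ j _ => by rw [signedDelta_orthogonal, hN']
  rw [← Finset.mul_sum, inv_mul_le_iff₀ (by positivity), Fintype.sum_prod_type] at h
  refine le_trans (le_of_eq ?_) h
  refine Finset.sum_congr rfl fun k _ => Finset.sum_congr rfl fun c _ => ?_
  rw [← sum_signedDelta_cube (A := ℂ)]
  congr 2
  refine Finset.sum_congr rfl fun x _ => ?_
  rw [mul_comm]
  rfl

lemma sum_nrm_sq_le {I J : Type*} (s : Finset I) (t : Finset J) {g : I → ℕ → F[X] → ℂ}
    {h : J → ℕ → F[X] → ℂ} (hg : ∀ i, CB (g i)) (hh : ∀ j, CB (h j)) {D : ℝ}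
    (H : ∀ m G, ∑ i ∈ s, ‖g i m G‖ ^ 2 ≤ D * ∑ j ∈ t, ‖h j m G‖ ^ 2) :
    ∑ i ∈ s, nrm (g i) ^ 2 ≤ D * ∑ j ∈ t, nrm (h j) ^ 2 := by
  rw [Finset.sum_congr rfl fun i _ => nrm_sq (hg i), Finset.sum_congr rfl fun j _ => nrm_sq (hh j),
    ← E_sum, ← E_sum, ← E_const_mul]
  choose B hB using fun i => (hg i).normSq
  choose B' hB' using fun j => (hh j).normSq
  refine E_mono ⟨∑ i ∈ s, B i, fun m G => ?_⟩ ⟨|D| * ∑ j ∈ t, B' j, fun m G => ?_⟩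
    (Eventually.of_forall fun m => Eventually.of_forall fun G => H m G)
  · exact (Finset.abs_sum_le_sum_abs _ _).trans (Finset.sum_le_sum fun i _ => hB i m G)
  · rw [abs_mul]
    exact mul_le_mul_of_nonneg_left ((Finset.abs_sum_le_sum_abs _ _).trans
      (Finset.sum_le_sum fun j _ => hB' j m G)) (abs_nonneg D)

lemma nrm_cube_bessel {k₀ : ℕ} {N : ℝ} (hN : 0 < N)
    (hN' : ∀ k : Fin k₀, (Fintype.card ({i : Fin k₀ // i ≠ k} → Bool × F) : ℝ) = N)
    {T : (Fin k₀ → Bool × F) → ℕ → F[X] → ℂ} (hT : ∀ x, CB (T x)) :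
    ∑ i : Fin k₀ × F, nrm (fun m G =>
      ∑ y, (T (glue i.1 (true, i.2) y) m G - T (glue i.1 (false, i.2) y) m G)) ^ 2 ≤
      2 * N * ∑ x, nrm (T x) ^ 2 := by
  refine sum_nrm_sq_le Finset.univ Finset.univ
    (fun i => CB.sum _ fun y _ => (hT _).sub (hT _)) hT fun m G => ?_
  rw [Fintype.sum_prod_type]
  exact cube_bessel hN hN' fun x => T x m G

/-- The monomial `c X ^ r`, suppressed when `r = 0`. -/
def extra (r : ℕ) (c : F) : F[X] := if r = 0 then 0 else C c * X ^ r

lemma extra_eq (r : ℕ) (c : F) : extra r c = C (if r = 0 then 0 else c) * X ^ r := by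
  unfold extra
  split_ifs <;> simp

lemma X_dvd_extra (r : ℕ) (c : F) : X ∣ extra r c := by
  unfold extra
  split_ifs with h
  · exact dvd_zero _
  · exact (dvd_pow_self X h).mul_left _

lemma extra_mem_V (r : ℕ) (c : F) : extra r c ∈ V F (r + 1) := by
  rw [extra_eq]
  exact C_mul_X_pow_mem_V _ r.lt_succ_self

lemma not_X_dvd_C_add_extra {u : F} (hu : u ≠ 0) (r : ℕ) (c : F) : ¬ X ∣ C u + extra r c := by
  intro h
  have h1 : X ∣ C u := (dvd_add_left (X_dvd_extra r c)).1 h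
  rw [X_dvd_iff, coeff_C_zero] at h1
  exact hu h1

lemma sum_layer_increment (f : F[X] → ℂ) {ι : F → ℕ} (h0 : ι 0 = 0) {u : F} (hu : u ≠ 0)
    {n j r : ℕ} (hj : j < n) {W H : F[X]} (hW : 0 < lexNum ι W) (hH : X ^ (j + r + 1) ∣ H) (c : F) :
    ∃ k, ∀ m ≥ k, ∀ G : F[X], X ^ n ∣ G →
      ∑ a ∈ Finset.range (n + 1), ∑ M ∈ V F j, layer f X (X ^ r) a m
        (G + (M + (if lexNum ι M < lexNum ι W then C u * X ^ j else 0) +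
          (extra r c * X ^ j + H))) =
      ∑ a ∈ Finset.range j, ∑ M ∈ V F j, layer f X (X ^ r) a m
        (G + (M + (if lexNum ι M < lexNum ι W then C u * X ^ j else 0) + H)) +
      layer f X (X ^ r) j m (G + X ^ j * (C u + extra r c)) := by
  classical
  obtain ⟨N, hN⟩ := hH
  obtain ⟨k, hk⟩ := exists_mem_V_ge N
  have hXj : ∀ M ∈ V F j, X ^ j ∣ M → M = 0 := fun M hM h =>
    eq_zero_of_dvd_of_mem_V (monic_X_pow j) (natDegree_X_pow j).ge hM h
  have hlex0 : lexNum ι (0 : F[X]) = 0 := by simp [lexNum, h0]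
  refine ⟨max k j, fun m hm G hG => ?_⟩
  have hNm : N ∈ V F m := hk m (le_of_max_le_left hm)
  have hXG : X ^ (j + 1) ∣ G := (pow_dvd_pow X hj).trans hG
  have hXH : X ^ (j + 1) ∣ H := hN ▸ (pow_dvd_pow X (by omega)).mul_right N
  have hXE : X ^ (j + 1) ∣ extra r c * X ^ j := by
    rw [pow_succ']
    exact mul_dvd_mul (X_dvd_extra r c) dvd_rfl
  have hXR : ∀ M e : F[X], (X ^ (j + 1) ∣ G + (M + e + (extra r c * X ^ j + H)) ↔
      X ^ (j + 1) ∣ M + e) ∧ (X ^ j ∣ G + (M + e + (extra r c * X ^ j + H)) ↔ X ^ j ∣ M + e) :=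
    fun M e => by
      have h1 : X ^ (j + 1) ∣ G + (extra r c * X ^ j + H) := dvd_add hXG (dvd_add hXE hXH)
      have h2 : G + (M + e + (extra r c * X ^ j + H)) =
          M + e + (G + (extra r c * X ^ j + H)) := by ring
      rw [h2]
      exact ⟨dvd_add_left h1, dvd_add_left ((pow_dvd_pow X j.le_succ).trans h1)⟩
  have hje : ∀ M, X ^ j ∣ if lexNum ι M < lexNum ι W then C u * X ^ j else 0 := fun M => by
    split_ifs <;> simp
  have hM0 : ∀ M ∈ V F j, X ^ j ∣ G + (M + (if lexNum ι M < lexNum ι W then C u * X ^ j else 0) +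
      (extra r c * X ^ j + H)) → M = 0 := fun M hM h =>
    hXj M hM ((dvd_add_left (hje M)).1 ((hXR _ _).2.1 h))
  have hhigh : ∀ a ∈ Finset.range (n + 1), a ∉ Finset.range (j + 1) →
      ∑ M ∈ V F j, layer f X (X ^ r) a m
        (G + (M + (if lexNum ι M < lexNum ι W then C u * X ^ j else 0) +
          (extra r c * X ^ j + H))) = 0 := fun a _ ha => by
    refine Finset.sum_eq_zero fun M hM => ?_
    rw [Finset.mem_range] at ha
    rw [layer, if_neg]
    intro h
    have h1 := (pow_dvd_pow X (by omega : j + 1 ≤ a)).trans h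
    have h2 := hM0 M hM ((pow_dvd_pow X j.le_succ).trans h1)
    subst h2
    have h3 := (hXR _ _).1.1 h1
    rw [hlex0, if_pos hW, zero_add, pow_succ', mul_dvd_mul_iff_right (monic_X_pow j).ne_zero,
      X_dvd_iff, coeff_C_zero] at h3
    exact hu h3
  have hmid : ∑ M ∈ V F j, layer f X (X ^ r) j m
        (G + (M + (if lexNum ι M < lexNum ι W then C u * X ^ j else 0) +
          (extra r c * X ^ j + H))) = layer f X (X ^ r) j m (G + X ^ j * (C u + extra r c)) := by
    rw [Finset.sum_eq_single_of_mem 0 (zero_mem_V j) fun M hM hne => by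
      rw [layer, if_neg fun h => hne (hM0 M hM h)]]
    rw [hlex0, if_pos hW, ← layer_add f X (X ^ r) j hNm (G + X ^ j * (C u + extra r c)), hN]
    congr 1
    ring
  have hlow : ∀ a ∈ Finset.range j, ∀ Y : F[X], layer f X (X ^ r) a m
      (G + (Y + (extra r c * X ^ j + H))) = layer f X (X ^ r) a m (G + (Y + H)) :=
    fun a ha Y => by
      have haj := Finset.mem_range.1 ha
      have hNa : C (if r = 0 then 0 else c) * X ^ (j - a - 1) ∈ V F m :=
        V_mono (le_of_max_le_right hm) (C_mul_X_pow_mem_V _ (by omega))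
      rw [← layer_add f X (X ^ r) a hNa (G + (Y + H)), extra_eq]
      congr 1
      have : j = a + 1 + (j - a - 1) := by omega
      have h2 : (X : F[X]) ^ j = X ^ (a + 1) * X ^ (j - a - 1) := by rw [← pow_add, ← this]
      rw [h2]
      ring
  rw [← Finset.sum_subset (Finset.range_mono (by omega : j + 1 ≤ n + 1)) hhigh,
    Finset.sum_range_succ, hmid]
  congr 1
  exact Finset.sum_congr rfl fun a ha => Finset.sum_congr rfl fun M _ => hlow a ha _

lemma sum_V_one {A : Type} [AddCommMonoid A] (g : F[X] → A) : ∑ c ∈ V F 1, g c = ∑ c : F, g (C c) := by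
  symm
  refine Finset.sum_bij (fun c _ => C c) (fun c _ => ?_) (fun _ _ _ _ h => C_injective h)
    (fun M hM => ?_) fun _ _ => rfl
  · simpa using C_mul_X_pow_mem_V c one_pos
  · have h1 : M.natDegree = 0 := by
      rcases eq_or_ne M 0 with rfl | h
      · exact natDegree_zero
      · exact Nat.lt_one_iff.1 ((natDegree_lt_iff_degree_lt h).2 (mem_V.1 hM))
    exact ⟨M.coeff 0, Finset.mem_univ _, (eq_C_of_natDegree_eq_zero h1).symm⟩

lemma nrm_sum_V_layer_eq_zero {f : F[X] → ℂ} (hf : UMul f) (hnull : nrm (Phi f (X ^ 0)) = 0)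
    {a j : ℕ} (ha : a < j) : nrm (fun m G => ∑ M ∈ V F j, layer f X (X ^ 0) a m (G + M)) = 0 := by
  have hl := layer_cb hf X (X ^ 0) a
  have hcb : ∀ L, CB fun m G => layer f X (X ^ 0) a m (G + L) := fun L =>
    hl.comp (fun m => m) fun _ G => G + L
  have hav : CB fun m G => ∑ c ∈ V F 1, layer f X (X ^ 0) a m (G + X ^ a * X ^ 0 * c) :=
    CB.sum _ fun c _ => hcb _
  have hav' := fun M => hav.comp (fun m => m) fun _ G => G + M
  have h1 : ∀ M ∈ V F j, nrm (fun m G =>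
      ∑ c ∈ V F 1, layer f X (X ^ 0) a m (G + M + X ^ a * X ^ 0 * c)) = 0 := fun M _ =>
    (nrm_translate hav M).trans (nrm_layer_average hf monic_X natDegree_X hnull a)
  refine nrm_null_of_le (CB.sum _ fun M _ => hcb M) (CB.sum _ fun M _ => hav' M)
    (nrm_sum_null _ (fun M _ => hav' M) h1)
    (Eventually.of_forall fun m => Eventually.of_forall fun G => ?_)
  have h2 : ∑ M ∈ V F j, ∑ c ∈ V F 1, layer f X (X ^ 0) a m (G + M + X ^ a * X ^ 0 * c) =
      (qr F : ℂ) * ∑ M ∈ V F j, layer f X (X ^ 0) a m (G + M) := by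
    rw [Finset.sum_comm]
    have h3 : ∀ c ∈ V F 1, ∑ M ∈ V F j, layer f X (X ^ 0) a m (G + M + X ^ a * X ^ 0 * c) =
        ∑ M ∈ V F j, layer f X (X ^ 0) a m (G + M) := fun c hc => by
      have h4 : X ^ a * X ^ 0 * c ∈ V F j := by
        rw [pow_zero, mul_one]
        exact V_mono (by omega : a + 1 ≤ j) (mul_mem_V (monic_X_pow a) (natDegree_X_pow a) hc)
      rw [← sum_V_add h4 fun M => layer f X (X ^ 0) a m (G + M)]
      exact Finset.sum_congr rfl fun M _ => by rw [add_assoc]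
    rw [Finset.sum_congr rfl h3, Finset.sum_const, nsmul_eq_mul, card_V_complex, pow_one]
  rw [h2, norm_mul, norm_real, Real.norm_of_nonneg qr_pos.le]
  exact le_mul_of_one_le_left (norm_nonneg _) one_lt_qr.le

open Classical in
/-- Contribution of the layers below the digit being raised. -/
def lowPart (f : F[X] → ℂ) (ι : F → ℕ) (u : F) (r n j : ℕ) (W H : F[X]) (m : ℕ) (G : F[X]) : ℂ :=
  if X ^ n ∣ G then ∑ a ∈ Finset.range j, ∑ M ∈ V F j, layer f X (X ^ r) a m
    (G + (M + (if lexNum ι M < lexNum ι W then C u * X ^ j else 0) + H)) else 0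

open Classical in
/-- Contribution of the layer of the digit being raised. -/
def midPart (f : F[X] → ℂ) (u : F) (r n j : ℕ) (c : F) (m : ℕ) (G : F[X]) : ℂ :=
  if X ^ n ∣ G then layer f X (X ^ r) j m (G + X ^ j * (C u + extra r c)) else 0

lemma lowPart_cb {f : F[X] → ℂ} (hf : UMul f) (ι : F → ℕ) (u : F) (r n j : ℕ) (W H : F[X]) :
    CB (lowPart f ι u r n j W H) := by
  classical
  exact (CB.sum _ fun a _ => CB.sum _ fun M _ => (layer_cb hf X (X ^ r) a).comp (fun m => m)
    fun _ G => G + (M + (if lexNum ι M < lexNum ι W then C u * X ^ j else 0) + H)).ite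
    fun _ G => X ^ n ∣ G

lemma midPart_cb {f : F[X] → ℂ} (hf : UMul f) (u : F) (r n j : ℕ) (c : F) :
    CB (midPart f u r n j c) := by
  classical
  exact ((layer_cb hf X (X ^ r) j).comp (fun m => m)
    fun _ G => G + X ^ j * (C u + extra r c)).ite fun _ G => X ^ n ∣ G

lemma nrm_lowPart_zero {f : F[X] → ℂ} (hf : UMul f) (hnull : nrm (Phi f (X ^ 0)) = 0)
    (ι : F → ℕ) (u : F) (n j : ℕ) (W : F[X]) {H : F[X]} (hH : X ^ (j + 1) ∣ H) :
    nrm (lowPart f ι u 0 n j W H) = 0 := by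
  have hcb : ∀ a, CB fun m G => ∑ M ∈ V F j, layer f X (X ^ 0) a m (G + M) := fun a =>
    CB.sum _ fun M _ => (layer_cb hf X (X ^ 0) a).comp (fun m => m) fun _ G => G + M
  refine nrm_null_of_le (lowPart_cb hf ι u 0 n j W H)
    (CB.sum (Finset.range j) fun a _ => hcb a) (nrm_sum_null _ (fun a _ => hcb a) fun a ha =>
      nrm_sum_V_layer_eq_zero hf hnull (Finset.mem_range.1 ha)) ?_
  obtain ⟨N, hN⟩ := hH
  obtain ⟨k, hk⟩ := exists_mem_V_ge N
  filter_upwards [eventually_ge_atTop (k + j)] with m hm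
  refine Eventually.of_forall fun G => ?_
  rw [lowPart]
  split_ifs with hG
  · refine le_of_eq (congrArg _ (Finset.sum_congr rfl fun a ha => Finset.sum_congr rfl fun M _ => ?_))
    have haj := Finset.mem_range.1 ha
    have hX : (X : F[X]) ^ j = X ^ (a + 1) * X ^ (j - a - 1) := by
      rw [← pow_add]
      congr 1
      omega
    have hl : ∀ v : F, layer f X (X ^ 0) a m (G + (M + C v * X ^ j + H)) =
        layer f X (X ^ 0) a m (G + M) := fun v => by
      have h1 : C v * X ^ (j - a - 1) ∈ V F m :=
        V_mono (by omega) (C_mul_X_pow_mem_V v (by omega : j - a - 1 < j))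
      have h2 : X ^ (j - a) * N ∈ V F m := V_mono (by omega : j - a + k ≤ m)
        (mul_mem_V (monic_X_pow _) (natDegree_X_pow _) (hk k le_rfl))
      have h3 : (X : F[X]) ^ (j + 1) = X ^ (a + 1) * X ^ (j - a) := by
        rw [← pow_add]
        congr 1
        omega
      rw [← layer_add f X (X ^ 0) a (add_mem_V h1 h2) (G + M), hN, hX, h3]
      congr 1
      ring
    split_ifs
    · exact hl u
    · simpa using hl 0
  · rw [norm_zero]
    exact norm_nonneg _

lemma nrm_sum_midPart {f : F[X] → ℂ} (hf : UMul f) {r : ℕ} (hr : r ≠ 0)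
    (hnull : nrm (Phi f (X ^ r)) = 0) (u : F) (n j : ℕ) :
    nrm (fun m G => ∑ c : F, midPart f u r n j c m G) = 0 := by
  classical
  have hcb : CB fun m G => ∑ c ∈ V F 1, layer f X (X ^ r) j m (G + X ^ j * X ^ r * c) :=
    CB.sum _ fun c _ => (layer_cb hf X (X ^ r) j).comp (fun m => m)
      fun _ G => G + X ^ j * X ^ r * c
  refine nrm_null_of_le (CB.sum _ fun c _ => midPart_cb hf u r n j c)
    (hcb.comp (fun m => m) fun _ G => G + X ^ j * C u)
    ((nrm_translate hcb (X ^ j * C u)).trans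
      (nrm_layer_average hf monic_X natDegree_X hnull j))
    (Eventually.of_forall fun m => Eventually.of_forall fun G => ?_)
  rw [sum_V_one]
  simp only [midPart]
  split_ifs with hG
  · refine le_of_eq (congrArg _ (Finset.sum_congr rfl fun c _ => ?_))
    rw [extra, if_neg hr]
    congr 1
    ring
  · simp

lemma sum_nrm_sq_le_sum_nrm_add_sq {I : Type*} (t : Finset I) {g : I → ℕ → F[X] → ℂ}
    (hg : ∀ i, CB (g i)) {h : ℕ → F[X] → ℂ} (hh : CB h)
    (H : nrm (fun m G => ∑ i ∈ t, g i m G) = 0 ∨ nrm h = 0) :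
    ∑ i ∈ t, nrm (g i) ^ 2 ≤ ∑ i ∈ t, nrm (fun m G => g i m G + h m G) ^ 2 := by
  have h1 : ∑ i ∈ t, ip h (g i) = 0 := by
    rcases H with H | H
    · rw [← ip_sum_right]
      exact ip_eq_zero_of_null hh (CB.sum _ fun i _ => hg i) H
    · exact Finset.sum_eq_zero fun i _ => by rw [ip_comm]; exact ip_eq_zero_of_null (hg i) hh H
  rw [Finset.sum_congr rfl fun i _ => nrm_add_sq (hg i) hh, Finset.sum_add_distrib,
    Finset.sum_add_distrib, ← Finset.mul_sum, Finset.sum_congr rfl fun i _ => ip_comm (g i) h, h1]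
  have h2 : 0 ≤ ∑ i ∈ t, nrm h ^ 2 := Finset.sum_nonneg fun _ _ => sq_nonneg _
  linarith

lemma sum_layerSum_increment (f : F[X] → ℂ) {ι : F → ℕ} (hinj : Function.Injective ι)
    (hlt : ∀ a, ι a < Fintype.card F) (h0 : ι 0 = 0) {u : F} (hu : ι u = 1) {n j r : ℕ}
    (hj : j + (r + 1) ≤ n) {W H : F[X]} (hW : W ∈ V F j) (hW0 : W ≠ 0) (hHV : H ∈ V F n)
    (hH : X ^ (j + r + 1) ∣ H) (c : F) :
    ∃ k, ∀ m ≥ k, ∀ G : F[X],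
      ∑ a ∈ Finset.range (n + 1), layerSum f X (X ^ r) n
        (lexSeg ι n (lexNum ι (W + C u * X ^ j + (extra r c * X ^ j + H)))) a m G -
      ∑ a ∈ Finset.range (n + 1), layerSum f X (X ^ r) n
        (lexSeg ι n (lexNum ι (W + (extra r c * X ^ j + H)))) a m G =
      midPart f u r n j c m G + lowPart f ι u r n j W H m G := by
  have hu0 : u ≠ 0 := fun h => by rw [h, h0] at hu; omega
  have hlex : 0 < lexNum ι W := by
    rw [Nat.pos_iff_ne_zero]
    intro h
    refine hW0 (lexNum_injective hinj hlt h0 ?_)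
    rw [h]
    simp [lexNum, h0]
  obtain ⟨k, hk⟩ := sum_layer_increment f h0 hu0 (by omega : j < n) hlex hH c
  refine ⟨k, fun m hm G => ?_⟩
  have hEV : extra r c * X ^ j + H ∈ V F n := by
    refine add_mem_V (V_mono hj ?_) hHV
    rw [mul_comm]
    exact mul_mem_V (monic_X_pow j) (natDegree_X_pow j) (extra_mem_V r c)
  have hEX : X ^ (j + 1) ∣ extra r c * X ^ j + H := by
    refine dvd_add ?_ ((pow_dvd_pow X (by omega)).trans hH)
    rw [pow_succ']
    exact mul_dvd_mul (X_dvd_extra r c) dvd_rfl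
  simp only [layerSum, midPart, lowPart]
  split_ifs with hG
  · rw [← Finset.sum_sub_distrib]
    simp only [sum_lexSeg_increment hinj hlt h0 hu (by omega : j < n) hW hEV hEX,
      add_sub_cancel_left]
    rw [hk m hm G hG, add_comm]
  · simp

/-- The digit block attached to a point of the cube. -/
def block (r : ℕ) (u : F) (v : Bool × F) : F[X] := (if v.1 then C u else 0) + extra r v.2

lemma block_mem_V (r : ℕ) (u : F) (v : Bool × F) : block r u v ∈ V F (r + 1) := by
  refine add_mem_V ?_ (extra_mem_V r v.2)
  split_ifs
  · simpa using C_mul_X_pow_mem_V u r.succ_pos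
  · exact zero_mem_V _

/-- The blocks with index in `s`, put in disjoint digit ranges. -/
def blockSum (r : ℕ) (u : F) {k₀ : ℕ} (x : Fin k₀ → Bool × F) (s : Finset (Fin k₀)) : F[X] :=
  ∑ k ∈ s, X ^ ((r + 1) * (k + 1)) * block r u (x k)

lemma blockSum_mem_V (r : ℕ) (u : F) {k₀ : ℕ} (x : Fin k₀ → Bool × F) {s : Finset (Fin k₀)} {l : ℕ}
    (h : ∀ k ∈ s, (k : ℕ) < l) : blockSum r u x s ∈ V F ((r + 1) * (l + 1)) :=
  sum_mem_V _ fun k hk => by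
    refine V_mono ?_ (mul_mem_V (monic_X_pow _) (natDegree_X_pow _) (block_mem_V r u (x k)))
    rw [← Nat.mul_succ]
    exact Nat.mul_le_mul_left _ (by have := h k hk; omega)

lemma dvd_blockSum (r : ℕ) (u : F) {k₀ : ℕ} (x : Fin k₀ → Bool × F) {s : Finset (Fin k₀)} {l : ℕ}
    (h : ∀ k ∈ s, l ≤ (k : ℕ)) : X ^ ((r + 1) * (l + 1)) ∣ blockSum r u x s :=
  Finset.dvd_sum fun k hk => (pow_dvd_pow X (Nat.mul_le_mul_left _ (by
    have := h k hk; omega))).mul_right _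

lemma blockSum_glue (r : ℕ) (u : F) {k₀ : ℕ} {k : Fin k₀} (v w : Bool × F)
    (y : {i // i ≠ k} → Bool × F) {s : Finset (Fin k₀)} (hs : k ∉ s) :
    blockSum r u (glue k v y) s = blockSum r u (glue k w y) s :=
  Finset.sum_congr rfl fun i hi => by
    have hik : i ≠ k := fun h => hs (h ▸ hi)
    rw [glue_of_ne v y hik, glue_of_ne w y hik]

lemma blockSum_univ (r : ℕ) (u : F) {k₀ : ℕ} (x : Fin k₀ → Bool × F) (k : Fin k₀) :
    blockSum r u x Finset.univ = blockSum r u x (Finset.univ.filter (· < k)) +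
      X ^ ((r + 1) * (k + 1)) * block r u (x k) +
      blockSum r u x (Finset.univ.filter (k < ·)) := by
  simp only [blockSum]
  rw [← Finset.sum_filter_add_sum_filter_not Finset.univ (· < k), add_assoc]
  congr 1
  have h1 : Finset.univ.filter (fun i => ¬ i < k) = insert k (Finset.univ.filter (k < ·)) := by
    ext i
    simp [le_iff_eq_or_lt, eq_comm]
  rw [h1, Finset.sum_insert (by simp)]

/-- The polynomial whose digits encode a point of the cube. -/
def cubeWord (r : ℕ) (u : F) {k₀ : ℕ} (x : Fin k₀ → Bool × F) : F[X] :=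
  C u + blockSum r u x Finset.univ

lemma exists_cubeWord_glue (r : ℕ) {u : F} (hu : u ≠ 0) {k₀ : ℕ} (k : Fin k₀)
    (y : {i // i ≠ k} → Bool × F) :
    ∃ W ∈ V F ((r + 1) * (k + 1)), W ≠ 0 ∧ ∃ H ∈ V F ((r + 1) * (k₀ + 1)),
      X ^ ((r + 1) * (k + 1) + r + 1) ∣ H ∧ ∀ c : F,
        cubeWord r u (glue k (true, c) y) = W + C u * X ^ ((r + 1) * ((k : ℕ) + 1)) +
          (extra r c * X ^ ((r + 1) * ((k : ℕ) + 1)) + H) ∧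
        cubeWord r u (glue k (false, c) y) = W + (extra r c * X ^ ((r + 1) * ((k : ℕ) + 1)) + H) := by
  set x := glue k (false, (0 : F)) y with hx
  have hpos : 0 < (r + 1) * ((k : ℕ) + 1) := by positivity
  refine ⟨C u + blockSum r u x (Finset.univ.filter (· < k)), add_mem_V ?_ ?_, ?_,
    blockSum r u x (Finset.univ.filter (k < ·)), blockSum_mem_V r u x fun i _ => i.2, ?_,
    fun c => ?_⟩
  · simpa using C_mul_X_pow_mem_V u hpos
  · exact blockSum_mem_V r u x fun i hi => by simpa using hi
  · intro h
    have h1 : (X : F[X]) ∣ blockSum r u x (Finset.univ.filter (· < k)) :=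
      (dvd_pow_self X (by positivity)).trans (dvd_blockSum r u x (l := 0) fun i _ => i.1.zero_le)
    have h2 : (X : F[X]) ∣ C u := by
      rw [eq_neg_of_add_eq_zero_left h]
      exact h1.neg_right
    rw [X_dvd_iff, coeff_C_zero] at h2
    exact hu h2
  · have h1 : (r + 1) * ((k : ℕ) + 1) + r + 1 = (r + 1) * ((k : ℕ) + 1 + 1) := by ring
    rw [h1]
    exact dvd_blockSum r u x fun i hi => by
      have : k < i := by simpa using hi
      exact this
  · have h1 : ∀ b : Bool, cubeWord r u (glue k (b, c) y) =
        C u + (blockSum r u x (Finset.univ.filter (· < k)) +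
        X ^ ((r + 1) * ((k : ℕ) + 1)) * block r u (b, c) +
        blockSum r u x (Finset.univ.filter (k < ·))) := fun b => by
      rw [cubeWord, blockSum_univ r u _ k, glue_self, blockSum_glue r u (b, c) (false, 0) y (by simp),
        blockSum_glue r u (b, c) (false, 0) y (by simp), hx]
    constructor
    · rw [h1]
      simp only [block, if_true]
      ring
    · rw [h1]
      simp only [block, Bool.false_eq_true, if_false]
      ring

/-- The total layer sum over the initial segment bounded by a point of the cube. -/
def cubeSum (f : F[X] → ℂ) (ι : F → ℕ) (u : F) (r : ℕ) {k₀ : ℕ} (x : Fin k₀ → Bool × F) (m : ℕ)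
    (G : F[X]) : ℂ :=
  ∑ a ∈ Finset.range ((r + 1) * (k₀ + 1) + 1), layerSum f X (X ^ r) ((r + 1) * (k₀ + 1))
    (lexSeg ι ((r + 1) * (k₀ + 1)) (lexNum ι (cubeWord r u x))) a m G

lemma cubeSum_cb {f : F[X] → ℂ} (hf : UMul f) (ι : F → ℕ) (u : F) (r : ℕ) {k₀ : ℕ}
    (x : Fin k₀ → Bool × F) : CB (cubeSum f ι u r x) :=
  CB.sum _ fun a _ => layerSum_cb hf X (X ^ r) _ _ a

lemma nrm_cubeSum_sq_le {f : F[X] → ℂ} (hf : UMul f) {ι : F → ℕ} {C₀ : ℝ} (hC₀ : 0 ≤ C₀)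
    (hSB : ∀ n w, ShiftBounded f n C₀ (lexSeg ι n w)) (u : F) {r : ℕ}
    (hnull : nrm (Phi f (X ^ r)) = 0) {k₀ : ℕ} (x : Fin k₀ → Bool × F) :
    nrm (cubeSum f ι u r x) ^ 2 ≤ C₀ ^ 2 * (qr F ^ ((r + 1) * (k₀ + 1)))⁻¹ :=
  nrm_sum_layerSum_le hf (mem_Irr.2 ⟨monic_X, natDegree_X, irreducible_X⟩) (monic_X_pow r) hnull
    ((pow_dvd_pow X (Nat.le_succ _)).mul_right _) (lexSeg_subset ι _ _) (hSB _ _) hC₀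

open Classical in
lemma sum_nrm_cubeSum_increment_ge {f : F[X] → ℂ} (hf : UMul f) {ι : F → ℕ}
    (hinj : Function.Injective ι) (hlt : ∀ a, ι a < Fintype.card F) (h0 : ι 0 = 0) {u : F}
    (hu : ι u = 1) {r : ℕ} (hnull : nrm (Phi f (X ^ r)) = 0) {k₀ : ℕ} (k : Fin k₀) :
    (Fintype.card ({i : Fin k₀ // i ≠ k} → Bool × F) : ℝ) ^ 2 * qr F *
        nrm (fun m G => if X ∣ G then 0 else Phi f (X ^ (r + 1)) m G) ^ 2 ≤
      qr F ^ ((r + 1) * (k₀ + 1)) * ∑ c : F, nrm (fun m G => ∑ y, (cubeSum f ι u r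
        (glue k (true, c) y) m G - cubeSum f ι u r (glue k (false, c) y) m G)) ^ 2 := by
  have hu0 : u ≠ 0 := fun h => by rw [h, h0] at hu; omega
  set n := (r + 1) * (k₀ + 1) with hn
  set j := (r + 1) * ((k : ℕ) + 1) with hj
  have hjn : j + (r + 1) ≤ n := by
    rw [hj, hn, ← Nat.mul_succ]
    exact Nat.mul_le_mul_left _ (by have := k.2; omega)
  choose W hWV hW0 H hHV hH hword using fun y => exists_cubeWord_glue r hu0 k y
  set N := Fintype.card ({i : Fin k₀ // i ≠ k} → Bool × F) with hN
  have hmid := fun c => midPart_cb hf u r n j c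
  have hlow := fun y => lowPart_cb hf ι u r n j (W y) (H y)
  have hlows := CB.sum Finset.univ fun y _ => hlow y
  have hNmid : ∀ c, CB fun m G => (N : ℂ) * midPart f u r n j c m G :=
    fun c => (hmid c).const_mul _
  have heq : ∀ c : F, nrm (fun m G => ∑ y, (cubeSum f ι u r (glue k (true, c) y) m G -
      cubeSum f ι u r (glue k (false, c) y) m G)) = nrm fun m G =>
      (N : ℂ) * midPart f u r n j c m G + ∑ y, lowPart f ι u r n j (W y) (H y) m G := fun c => by
    refine nrm_congr (CB.sum _ fun y _ => (cubeSum_cb hf ι u r _).sub (cubeSum_cb hf ι u r _))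
      ((hNmid c).add hlows) ?_
    have h1 : ∀ y, ∃ k', ∀ m ≥ k', ∀ G, cubeSum f ι u r (glue k (true, c) y) m G -
        cubeSum f ι u r (glue k (false, c) y) m G =
        midPart f u r n j c m G + lowPart f ι u r n j (W y) (H y) m G := fun y => by
      obtain ⟨k', hk'⟩ := sum_layerSum_increment f hinj hlt h0 hu hjn (hWV y) (hW0 y) (hHV y) (hH y) c
      refine ⟨k', fun m hm G => ?_⟩
      rw [← hk' m hm G, cubeSum, cubeSum, (hword y c).1, (hword y c).2]
    have h2 : ∀ᶠ m in atTop, ∀ y, ∀ G, cubeSum f ι u r (glue k (true, c) y) m G -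
        cubeSum f ι u r (glue k (false, c) y) m G =
        midPart f u r n j c m G + lowPart f ι u r n j (W y) (H y) m G :=
      eventually_all.2 fun y => eventually_atTop.2 (h1 y)
    filter_upwards [h2] with m hm
    refine Eventually.of_forall fun G => ?_
    rw [Finset.sum_congr rfl fun y _ => hm y G, Finset.sum_add_distrib, Finset.sum_const,
      Finset.card_univ, nsmul_eq_mul]
  have hmain := sum_nrm_sq_le_sum_nrm_add_sq (Finset.univ : Finset F) hNmid hlows (by
    rcases eq_or_ne r 0 with hr | hr
    · right
      refine nrm_sum_null _ (fun y _ => hlow y) fun y _ => ?_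
      have hd : X ^ (j + 1) ∣ H y := (pow_dvd_pow X (by omega)).trans (hH y)
      clear_value n j
      subst hr
      exact nrm_lowPart_zero hf hnull ι u n j (W y) hd
    · left
      simp only [← Finset.mul_sum]
      rw [nrm_const_mul, nrm_sum_midPart hf hr hnull, mul_zero])
  simp only [heq]
  refine le_trans ?_ (mul_le_mul_of_nonneg_left hmain (pow_pos qr_pos n).le)
  have hsum : (N : ℝ) ^ 2 * qr F * nrm (fun m G => if X ∣ G then 0 else Phi f (X ^ (r + 1)) m G) ^ 2 =
      ∑ _c : F, (N : ℝ) ^ 2 * nrm (fun m G => if X ∣ G then 0 else Phi f (X ^ (r + 1)) m G) ^ 2 := by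
    rw [Finset.sum_const, Finset.card_univ, nsmul_eq_mul, qr]
    ring
  rw [hsum, Finset.mul_sum]
  refine Finset.sum_le_sum fun c _ => ?_
  rw [nrm_const_mul, Complex.norm_natCast, mul_pow, mul_left_comm]
  exact mul_le_mul_of_nonneg_left
    (nrm_layer_X_translate_ge hf hjn (not_X_dvd_C_add_extra hu0 r c)) (sq_nonneg _)

open Classical in
lemma nrm_Phi_X_pow_succ_eq_zero {f : F[X] → ℂ} (hf : UMul f) {ι : F → ℕ}
    (hinj : Function.Injective ι) (hlt : ∀ a, ι a < Fintype.card F) (h0 : ι 0 = 0) {u : F}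
    (hu : ι u = 1) {C₀ : ℝ} (hC₀ : 0 ≤ C₀) (hSB : ∀ n w, ShiftBounded f n C₀ (lexSeg ι n w)) {r : ℕ}
    (hnull : nrm (Phi f (X ^ r)) = 0) : nrm (Phi f (X ^ (r + 1))) = 0 := by
  set κ := nrm (fun m G => if X ∣ G then 0 else Phi f (X ^ (r + 1)) m G) ^ 2 with hκ
  have hκ0 : 0 ≤ κ := sq_nonneg _
  have hq := qr_pos (F := F)
  have hbound : ∀ k₀ : ℕ, (k₀ : ℝ) * κ ≤ 4 * C₀ ^ 2 := fun k₀ => by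
    obtain ⟨M, hM⟩ : ∃ M : ℝ, M = (Fintype.card (Fin k₀ → Bool × F) : ℝ) := ⟨_, rfl⟩
    set N : ℝ := M / (2 * qr F) with hN
    set n := (r + 1) * (k₀ + 1) with hn
    have hqn : 0 < qr F ^ n := pow_pos hq n
    have hM0 : 0 < M := by rw [hM]; exact_mod_cast Fintype.card_pos
    have hN0 : 0 < N := by positivity
    have hMN : M = 2 * qr F * N := by rw [hN]; field_simp
    have hN' : ∀ k : Fin k₀, (Fintype.card ({i : Fin k₀ // i ≠ k} → Bool × F) : ℝ) = N := fun k => by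
      rw [hN, eq_div_iff (by positivity)]
      rw [hM]
      exact card_slice k
    have hB := nrm_cube_bessel hN0 hN' fun x => cubeSum_cb hf ι u r x
    have hup : ∑ x : Fin k₀ → Bool × F, nrm (cubeSum f ι u r x) ^ 2 ≤ M * (C₀ ^ 2 * (qr F ^ n)⁻¹) := by
      refine (Finset.sum_le_card_nsmul _ _ _ fun x _ =>
        nrm_cubeSum_sq_le hf hC₀ hSB u hnull x).trans_eq ?_
      rw [nsmul_eq_mul, Finset.card_univ, hM]
    rw [Fintype.sum_prod_type] at hB
    have hlo : ∑ _k : Fin k₀, N ^ 2 * qr F * κ ≤ qr F ^ n * ∑ k : Fin k₀, ∑ c : F,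
        nrm (fun m G => ∑ y, (cubeSum f ι u r (glue k (true, c) y) m G -
          cubeSum f ι u r (glue k (false, c) y) m G)) ^ 2 := by
      rw [Finset.mul_sum]
      refine Finset.sum_le_sum fun k _ => ?_
      have := sum_nrm_cubeSum_increment_ge hf hinj hlt h0 hu hnull k
      rwa [hN' k] at this
    rw [Finset.sum_const, Finset.card_univ, Fintype.card_fin, nsmul_eq_mul] at hlo
    have h1 := hlo.trans (mul_le_mul_of_nonneg_left (hB.trans
      (mul_le_mul_of_nonneg_left hup (by positivity))) hqn.le)
    have h2 : qr F ^ n * (2 * N * (M * (C₀ ^ 2 * (qr F ^ n)⁻¹))) = N ^ 2 * qr F * (4 * C₀ ^ 2) := by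
      rw [hMN]
      field_simp
      ring
    rw [h2] at h1
    refine le_of_mul_le_mul_left (le_trans (le_of_eq ?_) h1) (by positivity : 0 < N ^ 2 * qr F)
    ring
  have hκz : κ = 0 := by
    by_contra h
    have hp : 0 < κ := lt_of_le_of_ne hκ0 (Ne.symm h)
    obtain ⟨k₀, hk₀⟩ := exists_nat_gt (4 * C₀ ^ 2 / κ)
    rw [div_lt_iff₀ hp] at hk₀
    exact absurd (hbound k₀) (not_le.2 hk₀)
  have hsplit := nrm_sq_split (Phi_cb hf (X ^ (r + 1))) fun _ G => X ∣ G
  have hd := nrm_Phi_dvd_sq hf (monic_X (R := F)) (X ^ r)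
  rw [← pow_succ', hnull] at hd
  rw [hd, ← hκ, hκz] at hsplit
  simpa using hsplit

lemma norm_sum_V_add_le {f : F[X] → ℂ} {ι : F → ℕ} (hlt : ∀ a, ι a < Fintype.card F)
    (h0 : ι 0 = 0) {C₀ : ℝ} (hSB : ∀ n w, ShiftBounded f n C₀ (lexSeg ι n w)) {H : ℕ} {G : F[X]}
    (hG : G.Monic) (hd : H ≤ G.natDegree) : ‖∑ L ∈ V F H, f (G + L)‖ ≤ C₀ := by
  have hmod : G %ₘ X ^ H ∈ V F H := by
    rw [mem_V]
    have := degree_modByMonic_lt G (monic_X_pow (R := F) H)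
    rwa [degree_X_pow] at this
  have hX : X ^ H ∣ G - G %ₘ X ^ H :=
    ⟨G /ₘ X ^ H, by rw [sub_eq_iff_eq_add, add_comm, modByMonic_add_div]⟩
  have hm : (G - G %ₘ X ^ H).Monic := by
    refine hG.sub_of_left ((mem_V.1 hmod).trans_le ?_)
    rw [degree_eq_natDegree hG.ne_zero]
    exact_mod_cast hd
  have hseg : lexSeg ι H (Fintype.card F ^ H) = V F H :=
    Finset.filter_true_of_mem fun L hL => lexNum_lt hlt h0 hL
  have h := hSB H (Fintype.card F ^ H) _ hm (by simpa using natDegree_le_of_dvd hX hm.ne_zero) hX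
  rw [hseg, ← sum_V_add hmod] at h
  refine le_of_eq_of_le (congrArg _ (Finset.sum_congr rfl fun L _ => congrArg f ?_)) h
  ring

lemma nrm_Phi_one_eq_zero {f : F[X] → ℂ} (hf : UMul f) {C₀ : ℝ}
    (hC : ∀ H : ℕ, ∀ᶠ G in big F, ‖∑ L ∈ V F H, f (G + L)‖ ≤ C₀) : nrm (Phi f 1) = 0 := by
  have hlim : Tendsto (fun k : ℕ => (qr F ^ k)⁻¹ * C₀) atTop (nhds 0) := by
    have := (tendsto_inv_atTop_zero.comp (tendsto_pow_atTop_atTop_of_one_lt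
      (one_lt_qr (F := F)))).mul_const C₀
    simpa using this
  refine le_antisymm (ge_of_tendsto' hlim fun k => ?_) (nrm_nonneg _)
  have hq : 0 < qr F ^ k := pow_pos qr_pos k
  have hC0 : 0 ≤ C₀ := by
    obtain ⟨n, hn⟩ := eventually_big.1 (hC 0)
    exact (norm_nonneg _).trans (hn (X ^ n) (monic_X_pow n) (natDegree_X_pow n).ge)
  have hb : ‖(((qr F ^ k)⁻¹ * C₀ : ℝ) : ℂ)‖ = (qr F ^ k)⁻¹ * C₀ := by
    rw [Complex.norm_real, Real.norm_eq_abs, abs_of_nonneg (by positivity)]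
  rw [← hb, ← nrm_const (F := F)]
  refine nrm_mono (Phi_cb hf 1) (CB.const _) ?_
  filter_upwards [eventually_ge_atTop k] with m hm
  filter_upwards [hC m] with G hG
  rw [hb, Phi, norm_mul, norm_inv, norm_qrC_pow]
  simp only [one_mul]
  refine mul_le_mul ?_ hG (norm_nonneg _) (by positivity)
  exact inv_anti₀ hq (pow_le_pow_right₀ one_lt_qr.le hm)

lemma nrm_Phi_eq_zero {f : F[X] → ℂ} (hf : UMul f) {ι : F → ℕ} (hinj : Function.Injective ι)
    (hlt : ∀ a, ι a < Fintype.card F) (h0 : ι 0 = 0) {u : F} (hu : ι u = 1) {C₀ : ℝ} (hC₀ : 0 ≤ C₀)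
    (hSB : ∀ n w, ShiftBounded f n C₀ (lexSeg ι n w)) {Q : F[X]} (hQ : Q.Monic) :
    nrm (Phi f Q) = 0 := by
  have hpow : ∀ s : ℕ, nrm (Phi f (X ^ s)) = 0 := fun s => by
    induction s with
    | zero =>
      rw [pow_zero]
      exact nrm_Phi_one_eq_zero hf fun H => (eventually_big_degree H).mono fun G hG =>
        norm_sum_V_add_le hlt h0 hSB hG.1 hG.2
    | succ s ih => exact nrm_Phi_X_pow_succ_eq_zero hf hinj hlt h0 hu hC₀ hSB ih
  have hcop : ∀ d : ℕ, ∀ R : F[X], R.Monic → ¬ X ∣ R → R.natDegree = d →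
      ∀ s, nrm (Phi f (X ^ s * R)) = 0 := by
    intro d
    induction d using Nat.strong_induction_on with
    | _ d ih =>
      intro R hR hRX hd s
      by_cases hunit : IsUnit R
      · rw [hR.eq_one_of_isUnit hunit, mul_one]
        exact hpow s
      · obtain ⟨P, hPm, hPi, T, hT⟩ := exists_monic_irreducible_factor R hunit
        have hTm : T.Monic := hPm.of_mul_monic_left (hT ▸ hR)
        have hPX : ¬ X ∣ P := fun h => hRX (hT ▸ h.mul_right T)
        have hTX : ¬ X ∣ T := fun h => hRX (hT ▸ h.mul_left P)
        have hdeg : T.natDegree < d := by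
          have := hPi.natDegree_pos
          rw [← hd, hT, hPm.natDegree_mul hTm]
          omega
        rw [hT]
        exact nrm_Phi_mul_eq_zero hf (mem_Irr.2 ⟨hPm, rfl, hPi⟩) hTm (X_isCoprime_iff.2 hPX).symm
          (X_isCoprime_iff.2 hTX).symm hinj hlt h0 hu hC₀ hSB (ih _ hdeg T hTm hTX rfl) s
  obtain ⟨R, hR, hRX⟩ := exists_eq_pow_rootMultiplicity_mul_and_not_dvd Q hQ.ne_zero (0 : F)
  rw [map_zero, sub_zero] at hR hRX
  have hRm : R.Monic := (monic_X_pow _).of_mul_monic_left (hR ▸ hQ)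
  rw [hR]
  exact hcop _ R hRm hRX rfl _

/-- For every completely multiplicative `f : 𝓜 → S¹` and every
lexicographic ordering `⟨·⟩` with `⟨0⟩ = 0`, the lexicographic discrepancy is
infinite: `sup_{N ≥ 1} |∑_{G ∈ 𝓜, ⟨G⟩ ≤ N} f(G)| = ∞`. -/
theorem lexicographic_discrepancy_infinite (f : F[X] → ℂ)
    (hf : CompMultOnMonic f) (hu : UnimodularOnMonic f)
    (ι : F → ℕ) (hινj : Function.Injective ι)
    (hιlt : ∀ a : F, ι a < Fintype.card F) (hι0 : ι 0 = 0) :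
    ∀ C : ℝ, ∃ N : ℕ, 1 ≤ N ∧
      C < ‖∑ᶠ G ∈ {G : F[X] | G.Monic ∧ lexNum ι G ≤ N}, f G‖ := by
  intro C
  by_contra! hC
  have hC₀ : 0 ≤ 2 * C := by linarith [(norm_nonneg _).trans (hC 1 le_rfl)]
  have hf₀ := monicPart_umul hf hu
  have hSB := shiftBounded_lexSeg hινj hιlt hι0 hC
  obtain ⟨u, hu1⟩ : ∃ u : F, ι u = 1 := by
    have hbij : Function.Bijective fun a : F => (⟨ι a, hιlt a⟩ : Fin (Fintype.card F)) :=
      (Fintype.bijective_iff_injective_and_card _).2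
        ⟨fun a b h => hινj (Fin.mk.inj_iff.1 h), (Fintype.card_fin _).symm⟩
    obtain ⟨u, hu⟩ := hbij.2 ⟨1, Fintype.one_lt_card⟩
    exact ⟨u, Fin.mk.inj_iff.1 hu⟩
  refine not_unbiased hf₀ (fun H => (eventually_big_degree H).mono fun G hG =>
    norm_sum_V_add_le hιlt hι0 hSB hG.1 hG.2) fun Q hQ ε hε => ?_
  by_contra! hbias
  have hnull := nrm_Phi_eq_zero hf₀ hινj hιlt hι0 hu1 hC₀ hSB hQ
  have hcb := Phi_cb hf₀ Q
  have hle : ε ≤ nrm (Phi (monicPart f) Q) ^ 2 := by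
    rw [nrm_sq hcb, ← E_const (F := F) ε]
    refine E_mono_mean ⟨|ε|, fun _ _ => le_rfl⟩ hcb.normSq (Eventually.of_forall fun m => ?_)
    rw [mean_const]
    exact hbias m
  rw [hnull] at hle
  linarith [hle]

end FFEDP

end
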